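/- Theorem 0.4 (multi-parameter case): There exist constants 0 < c ≤ C < ∞ depending only on N₁,…,Nₙ such that for every f ∈ L¹(X): f belongs to H¹(X₁×…×Xₙ) if and only if ∫_X [E_ω(|S_{D(ω)} f(x)|²)]^{1/2} dx < ∞, where S_{D(ω)} is the multi-parameter random dyadic square function; moreover, for f ∈ H¹(X₁×…×Xₙ), c‖f‖_{H¹(X)} ≤ ∫_X [E_ω(|S_{D(ω)} f(x)|²)]^{1/2} dx ≤ C‖f‖_{H¹(X)}. -/

import Mathlib

open MeasureTheory Filter Topology
open scoped ENNReal

noncomputable section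

namespace Treil

/-- The cube of sidelength `2^k` of the dyadic lattice `t + 𝒟₀` that contains `x`. -/
def dcube {N : ℕ} (t : Fin N → ℝ) (k : ℤ) (x : Fin N → ℝ) : Set (Fin N → ℝ) :=
  {y | ∀ i, ⌊(y i - t i) / (2 : ℝ) ^ k⌋ = ⌊(x i - t i) / (2 : ℝ) ^ k⌋}

/-- The averaging operator `E_k` over the cubes of sidelength `2^k` of the (generalized)
dyadic lattice whose layer at scale `2^k` has offset `c k`. -/
def avg {N : ℕ} (c : ℤ → Fin N → ℝ) (k : ℤ) (f : (Fin N → ℝ) → ℝ) (x : Fin N → ℝ) : ℝ :=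
  (∫ y in dcube (c k) k x, f y) / ((2 : ℝ) ^ k) ^ (N : ℕ)

/-- The martingale difference `Δ_k = E_{k-1} - E_k`. -/
def mdiff {N : ℕ} (c : ℤ → Fin N → ℝ) (k : ℤ) (f : (Fin N → ℝ) → ℝ) (x : Fin N → ℝ) : ℝ :=
  avg c (k - 1) f x - avg c k f x

/-- The square of the dyadic square function, `|S_𝒟 f (x)|² = ∑_k |Δ_k f (x)|²`,
with values in `[0,∞]`. -/
def Ssq {N : ℕ} (c : ℤ → Fin N → ℝ) (f : (Fin N → ℝ) → ℝ) (x : Fin N → ℝ) : ℝ≥0∞ :=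
  ∑' k : ℤ, ENNReal.ofReal ((mdiff c k f x) ^ 2)

/-- The offset (at scale `2^k`) of the random dyadic lattice on `ℝ` built from the uniform
shift `u ∈ [0,1)` and the fair signs `ξ_j`, `j ≥ 1`, encoded as the binary digits of
`v ∈ [0,1)` (`ξ_j = -1` iff `⌊v 2^j⌋` is odd); the interval `I_0 = [u-1, u)` belongs to the
lattice, and `I_k` is obtained from `I_{k-1}` by adjoining the right neighbour if `ξ_k = +1`
and the left neighbour if `ξ_k = -1`. -/
def randOffset1 (u v : ℝ) (k : ℤ) : ℝ :=
  u - 1 - ∑ j ∈ Finset.range k.toNat, (if ⌊v * 2 ^ (j + 1)⌋ % 2 = 1 then (2 : ℝ) ^ j else 0)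

/-- The sample space for the random dyadic lattice in `ℝ^N`: each of the `N` independent
coordinate lattices is driven by a pair (uniform shift, digit-encoded fair signs). -/
abbrev RSpace (N : ℕ) := Fin N → ℝ × ℝ

/-- The probability measure of the random dyadic lattice in `ℝ^N`. -/
def randMeasure (N : ℕ) : Measure (RSpace N) :=
  Measure.pi fun _ =>
    (volume.restrict (Set.Ico (0 : ℝ) 1)).prod (volume.restrict (Set.Ico (0 : ℝ) 1))

/-- The per-scale offsets of the random dyadic lattice `𝒟(ω)` in `ℝ^N`. -/
def randOffset {N : ℕ} (ω : RSpace N) (k : ℤ) : Fin N → ℝ :=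
  fun i => randOffset1 (ω i).1 (ω i).2 k

/-- An (axis-parallel, half-open) cube in `ℝ^N`. -/
def IsPCube {N : ℕ} (Q : Set (Fin N → ℝ)) : Prop :=
  ∃ (a : Fin N → ℝ) (l : ℝ), 0 < l ∧ Q = Set.univ.pi fun i => Set.Ico (a i) (a i + l)

/-- An `H¹`-atom: supported in a cube `Q`, bounded by `|Q|⁻¹`, with zero mean. -/
def IsAtom {N : ℕ} (a : (Fin N → ℝ) → ℝ) : Prop :=
  ∃ Q : Set (Fin N → ℝ), IsPCube Q ∧ (∀ x, x ∉ Q → a x = 0) ∧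
    (∀ x, |a x| ≤ ((volume Q).toReal)⁻¹) ∧ (∫ x, a x) = 0

/-- The atomic `H¹(ℝ^N)` norm: the infimum of `∑ |λ_j|` over all decompositions
`f = ∑ λ_j a_j` converging in `L¹`, with atoms `a_j`. -/
def H1norm {N : ℕ} (f : (Fin N → ℝ) → ℝ) : ℝ≥0∞ :=
  ⨅ (lam : ℕ → ℝ) (a : ℕ → (Fin N → ℝ) → ℝ) (_ : ∀ j, IsAtom (a j))
    (_ : Tendsto (fun m => ∫ x, |f x - ∑ j ∈ Finset.range m, lam j * a j x|) atTop (𝓝 0)),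
    ∑' j, ENNReal.ofReal |lam j|
/-! ### Multi-parameter setting: `X = X₁ × ⋯ × Xₙ`, `X_j = ℝ^{N_j}` -/

variable (n : ℕ) (Nd : Fin n → ℕ)

/-- The product space `X = X₁ × X₂ × ⋯ × Xₙ`, `X_j = ℝ^{N_j}`. -/
abbrev X := Π j : Fin n, (Fin (Nd j) → ℝ)

/-- The averaging operator `E_𝐤 = E¹_{k₁} ⋯ Eⁿ_{kₙ}` over the "rectangles"
`R = Q₁ × ⋯ × Qₙ` of the product lattice with per-variable, per-scale offsets `c`. -/
def ravg (c : Π j : Fin n, ℤ → Fin (Nd j) → ℝ) (k : Fin n → ℤ) (f : X n Nd → ℝ)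
    (x : X n Nd) : ℝ :=
  (∫ y in Set.univ.pi fun j => dcube (c j (k j)) (k j) (x j), f y) /
    ∏ j, ((2 : ℝ) ^ (k j)) ^ (Nd j : ℕ)

/-- The multi-parameter martingale difference
`Δ_𝐤 = Δ¹_{k₁} ⋯ Δⁿ_{kₙ} = ∏_j (E^j_{k_j - 1} - E^j_{k_j})`, expanded by multilinearity. -/
def rmdiff (c : Π j : Fin n, ℤ → Fin (Nd j) → ℝ) (k : Fin n → ℤ) (f : X n Nd → ℝ)
    (x : X n Nd) : ℝ :=
  ∑ ε : Fin n → Bool,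
    (-1 : ℝ) ^ (Finset.univ.filter fun j => ε j = false).card *
      ravg n Nd c (fun j => k j - if ε j then 1 else 0) f x

/-- The square of the multi-parameter dyadic square function,
`|S_𝒟 f (x)|² = ∑_{R ∋ x} |Δ_R f (x)|² = ∑_{𝐤 ∈ ℤⁿ} |Δ_𝐤 f (x)|²`. -/
def rSsq (c : Π j : Fin n, ℤ → Fin (Nd j) → ℝ) (f : X n Nd → ℝ) (x : X n Nd) : ℝ≥0∞ :=
  ∑' k : Fin n → ℤ, ENNReal.ofReal ((rmdiff n Nd c k f x) ^ 2)

/-- The sample space of the random product dyadic lattice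
`𝒟(ω) = 𝒟₁(ω) × ⋯ × 𝒟ₙ(ω)`. -/
abbrev PSpace := Π j : Fin n, RSpace (Nd j)

instance randMeasure.instSigmaFinite (M : ℕ) : SigmaFinite (randMeasure M) := by
  unfold randMeasure; infer_instance

/-- The probability measure of the random product dyadic lattice (the `n` factors are
independent). -/
def prodRandMeasure : Measure (PSpace n Nd) := Measure.pi fun j => randMeasure (Nd j)

/-- The quantity `∫_X [𝔼_ω |S_{𝒟(ω)} f (x)|²]^{1/2} dx` for the multi-parameter random
dyadic square function. -/
def randProdSNorm (f : X n Nd → ℝ) : ℝ≥0∞ :=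
  ∫⁻ x, (∫⁻ ω, rSsq n Nd (fun j => randOffset (ω j)) f x ∂prodRandMeasure n Nd) ^ (1 / 2 : ℝ)

/-! ### The product (Chang–Fefferman) Hardy space `H¹(X₁ × ⋯ × Xₙ)` -/

/-- The upper half-space variables `((y₁,t₁),…,(yₙ,tₙ))`. -/
abbrev W := Π j : Fin n, ((Fin (Nd j) → ℝ) × ℝ)

/-- The Poisson kernel of the upper half-space `ℝ^{M+1}_+`. -/
def pk (M : ℕ) (y : Fin M → ℝ) (t : ℝ) : ℝ :=
  (Real.Gamma (((M : ℝ) + 1) / 2) / Real.pi ^ (((M : ℝ) + 1) / 2)) * t /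
    ((∑ i, y i ^ 2) + t ^ 2) ^ (((M : ℝ) + 1) / 2)

/-- The extension of `f` to `ℝ^{N₁+1}_+ × ⋯ × ℝ^{Nₙ+1}_+` obtained by applying the Poisson
(harmonic) extension in each variable. -/
def prodPoisson (f : X n Nd → ℝ) (p : W n Nd) : ℝ :=
  ∫ z, f z * ∏ j, pk (Nd j) ((p j).1 - z j) (p j).2

/-- The coordinate direction `i` in the `j`-th half-space factor (`i = N_j` is the
`t_j`-direction). -/
def dirW (j : Fin n) (i : Fin (Nd j + 1)) : W n Nd :=
  Pi.single j (if h : (i : ℕ) < Nd j then (Pi.single (⟨i, h⟩ : Fin (Nd j)) 1, 0) else (0, 1))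

/-- `|∇₁ ∇₂ ⋯ ∇ₙ u (p)|²`: the sum over all choices of one coordinate direction in each
half-space factor of the square of the corresponding mixed partial derivative. -/
def mixedGradSq (u : W n Nd → ℝ) (p : W n Nd) : ℝ :=
  ∑ d : Π j : Fin n, Fin (Nd j + 1),
    (iteratedFDeriv ℝ n u p fun j => dirW n Nd j (d j)) ^ 2

/-- The product cone `Γ_{x₁} × ⋯ × Γ_{xₙ}`, `Γ_{x_j} = {(y,t) : |y - x_j| < t}`. -/
def prodCone (x : X n Nd) : Set (W n Nd) :=
  {p | ∀ j, Real.sqrt (∑ i, ((p j).1 i - x j i) ^ 2) < (p j).2}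

/-- The square of the product Lusin square function `S⃗^L f`. -/
def lusinSq (f : X n Nd → ℝ) (x : X n Nd) : ℝ≥0∞ :=
  ∫⁻ p in prodCone n Nd x,
    ENNReal.ofReal (mixedGradSq n Nd (prodPoisson n Nd f) p *
      ∏ j, (p j).2 ^ (1 - (Nd j : ℝ)))

/-- The norm of the multi-parameter (product) Hardy space `H¹(X₁ × ⋯ × Xₙ)` of
Chang–Fefferman: `‖f‖ = ‖S⃗^L f‖_{L¹(X)}`. -/
def H1prodNorm (f : X n Nd → ℝ) : ℝ≥0∞ :=
  ∫⁻ x, (lusinSq n Nd f x) ^ (1 / 2 : ℝ)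

set_option linter.unusedSectionVars false

open scoped NNReal

/-- If the averages of `β` over the cells of a partition into cells of equal measure are at most
`M`, then so is the average of `β` against every weight which is constant on the cells. -/
lemma lintegral_mul_le_of_cell_average_le {α : Type*} [MeasurableSpace α] {μ : Measure α}
    [SFinite μ] {Q : α → Set α} (hQ : MeasurableSet {p : α × α | p.2 ∈ Q p.1})
    (hsymm : ∀ x y, y ∈ Q x → x ∈ Q y) {v : ℝ≥0∞} (hv0 : v ≠ 0) (hvt : v ≠ ⊤)
    (hvol : ∀ x, μ (Q x) = v) {g β : α → ℝ≥0∞} (hg : Measurable g) (hβ : Measurable β)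
    (hgc : ∀ x y, y ∈ Q x → g y = g x) {M : ℝ≥0∞}
    (hM : ∀ x, ∫⁻ y in Q x, β y ∂μ ≤ M * v) :
    ∫⁻ x, g x * β x ∂μ ≤ M * ∫⁻ x, g x ∂μ := by
  have hQx : ∀ x, MeasurableSet (Q x) := fun x => measurable_prodMk_left hQ
  have hF : Measurable fun p : α × α =>
      ({p : α × α | p.2 ∈ Q p.1}).indicator (fun p => g p.1 * β p.1) p :=
    Measurable.indicator (by fun_prop) hQ
  have key : v * ∫⁻ x, g x * β x ∂μ ≤ v * (M * ∫⁻ x, g x ∂μ) := by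
    calc v * ∫⁻ x, g x * β x ∂μ = ∫⁻ x, ∫⁻ y, ({p : α × α | p.2 ∈ Q p.1}).indicator
            (fun p => g p.1 * β p.1) (x, y) ∂μ ∂μ := by
          rw [← lintegral_const_mul _ (by fun_prop)]
          congr 1; ext x
          have : ∀ y, ({p : α × α | p.2 ∈ Q p.1}).indicator
            (fun p => g p.1 * β p.1) (x, y) = (Q x).indicator (fun _ => g x * β x) y := by
            intro y; simp [Set.indicator]
          simp_rw [this]
          rw [lintegral_indicator (hQx x), setLIntegral_const, hvol, mul_comm]
      _ = ∫⁻ y, ∫⁻ x, ({p : α × α | p.2 ∈ Q p.1}).indicator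
            (fun p => g p.1 * β p.1) (x, y) ∂μ ∂μ := lintegral_lintegral_swap hF.aemeasurable
      _ = ∫⁻ y, g y * ∫⁻ x in Q y, β x ∂μ ∂μ := by
          congr 1; ext y
          rw [← lintegral_const_mul _ hβ, ← lintegral_indicator (hQx y)]
          congr 1; ext x
          by_cases h : y ∈ Q x
          · simp [Set.indicator, h, hsymm _ _ h, hgc _ _ h]
          · have : x ∉ Q y := fun h' => h (hsymm _ _ h')
            simp [Set.indicator, h, this]
      _ ≤ ∫⁻ y, g y * (M * v) ∂μ := lintegral_mono fun y => by gcongr; exact hM y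
      _ = v * (M * ∫⁻ x, g x ∂μ) := by
          rw [lintegral_mul_const _ hg]; ring
  exact (ENNReal.mul_le_mul_iff_right hv0 hvt).1 key

/-- The pointwise inequality behind Garsia's proof of the `H¹`-`BMO` duality. -/
lemma two_mul_mul_le_increment (s : ℝ≥0) (a : ℝ≥0) (b : ℝ≥0∞) :
    2 * ((a : ℝ≥0∞) * b) ≤ 2 * ((NNReal.sqrt (s + a ^ 2) - NNReal.sqrt s : ℝ≥0) : ℝ≥0∞) +
      (NNReal.sqrt (s + a ^ 2) : ℝ≥0∞) * b ^ 2 := by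
  rcases eq_or_ne a 0 with rfl | ha
  · simp
  have hpos : 0 < NNReal.sqrt (s + a ^ 2) := by
    rw [NNReal.sqrt_pos]; positivity
  rcases eq_or_ne b ⊤ with rfl | hb
  · rw [ENNReal.top_pow (by norm_num), ENNReal.mul_top (ENNReal.coe_ne_zero.2 hpos.ne')]
    simp
  lift b to ℝ≥0 using hb
  norm_cast
  have hle : NNReal.sqrt s ≤ NNReal.sqrt (s + a ^ 2) := NNReal.sqrt_le_sqrt.2 (by simp)
  rw [← NNReal.coe_le_coe]
  push_cast [NNReal.coe_sub hle]
  set S := √((s : ℝ) + (a : ℝ) ^ 2) with hS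
  set T := √(s : ℝ) with hT
  have h1 : S ^ 2 = s + (a : ℝ) ^ 2 := Real.sq_sqrt (by positivity)
  have h2 : T ^ 2 = s := Real.sq_sqrt (by positivity)
  have hT0 : 0 ≤ T := Real.sqrt_nonneg _
  have hTS : T ≤ S := by
    apply Real.sqrt_le_sqrt; nlinarith [sq_nonneg (a : ℝ)]
  have hSpos : 0 < S := by
    apply Real.sqrt_pos.2; positivity
  have h3 : (a : ℝ) ^ 2 ≤ 2 * (S - T) * S := by nlinarith
  have : 0 ≤ ((a : ℝ) - S * b) ^ 2 := sq_nonneg _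
  have h4 : 2 * ((a : ℝ) * b) * S ≤ (2 * (S - T) + S * (b : ℝ) ^ 2) * S := by nlinarith
  exact le_of_mul_le_mul_right h4 hSpos

/-- Garsia's inequality: the duality between a square function and a Carleson sequence over a
nested sequence of partitions into cells of equal measure. -/
lemma garsia {α : Type*} [MeasurableSpace α] {μ : Measure α} [SFinite μ] (n : ℕ)
    {Q : ℕ → α → Set α} (hQ : ∀ i, MeasurableSet {p : α × α | p.2 ∈ Q i p.1})
    (hsymm : ∀ i x y, y ∈ Q i x → x ∈ Q i y) {v : ℕ → ℝ≥0∞} (hv0 : ∀ i, v i ≠ 0)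
    (hvt : ∀ i, v i ≠ ⊤) (hvol : ∀ i x, μ (Q i x) = v i)
    {a : ℕ → α → ℝ≥0} (ha : ∀ i, Measurable (a i))
    (hac : ∀ i j x y, j ≤ i → y ∈ Q i x → a j y = a j x)
    {b : ℕ → α → ℝ≥0∞} (hb : ∀ i, Measurable (b i)) {M : ℝ≥0∞}
    (hM : ∀ i < n, ∀ x, ∫⁻ y in Q i x, ∑ j ∈ Finset.Ico i n, b j y ^ 2 ∂μ ≤ M * v i) :
    ∑ i ∈ Finset.range n, ∫⁻ x, a i x * b i x ∂μ ≤
      (1 + M) * ∫⁻ x, (NNReal.sqrt (∑ i ∈ Finset.range n, a i x ^ 2) : ℝ≥0∞) ∂μ := by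
  set S : ℕ → α → ℝ≥0 := fun i x => NNReal.sqrt (∑ j ∈ Finset.range i, a j x ^ 2) with hS
  set d : ℕ → α → ℝ≥0 := fun i x => S (i + 1) x - S i x with hd
  have hSm : ∀ i, Measurable (S i) := fun i =>
    NNReal.continuous_sqrt.measurable.comp
      (Finset.measurable_sum _ fun j _ => (ha j).pow_const 2)
  have hdm : ∀ i, Measurable (d i) := fun i => (hSm _).sub (hSm _)
  have hmono : ∀ i x, S i x ≤ S (i + 1) x := fun i x => by
    apply NNReal.sqrt_le_sqrt.2
    rw [Finset.sum_range_succ]; simp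
  have hsum : ∀ i x, ∑ j ∈ Finset.range i, d j x = S i x := fun i x => by
    induction i with
    | zero => simp [hS]
    | succ i ih => rw [Finset.sum_range_succ, ih]; exact add_tsub_cancel_of_le (hmono i x)
  have hpt : ∀ i x, 2 * ((a i x : ℝ≥0∞) * b i x) ≤ 2 * (d i x : ℝ≥0∞) +
      (S (i + 1) x : ℝ≥0∞) * b i x ^ 2 := fun i x => by
    have := two_mul_mul_le_increment (∑ j ∈ Finset.range i, a j x ^ 2) (a i x) (b i x)
    simp only [hd, hS, Finset.sum_range_succ]
    exact this
  have hdc : ∀ i x y, y ∈ Q i x → d i y = d i x := fun i x y h => by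
    have h1 : ∀ l ≤ i + 1, S l y = S l x := fun l hl => by
      simp only [hS]
      congr 1
      refine Finset.sum_congr rfl fun j hj => ?_
      rw [hac i j x y (by have := Finset.mem_range.1 hj; omega) h]
    simp only [hd, h1 i (by omega), h1 (i + 1) le_rfl]
  have hsumE : ∀ i x, ∑ j ∈ Finset.range i, (d j x : ℝ≥0∞) = (S i x : ℝ≥0∞) := fun i x => by
    rw [← hsum i x]; push_cast; rfl
  have h2 : ∑ i ∈ Finset.range n, ∫⁻ x, (S (i + 1) x : ℝ≥0∞) * b i x ^ 2 ∂μ ≤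
      M * ∫⁻ x, (S n x : ℝ≥0∞) ∂μ := by
    calc ∑ i ∈ Finset.range n, ∫⁻ x, (S (i + 1) x : ℝ≥0∞) * b i x ^ 2 ∂μ
        = ∫⁻ x, ∑ i ∈ Finset.range n, (S (i + 1) x : ℝ≥0∞) * b i x ^ 2 ∂μ := by
          rw [lintegral_finsetSum]
          intro i _; exact (hSm _).coe_nnreal_ennreal.mul ((hb i).pow_const 2)
      _ = ∫⁻ x, ∑ j ∈ Finset.range n, (d j x : ℝ≥0∞) *
            ∑ i ∈ Finset.Ico j n, b i x ^ 2 ∂μ := by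
          congr 1; ext x
          simp_rw [← hsumE, Finset.sum_mul, Finset.mul_sum]
          rw [Finset.sum_comm' (t' := Finset.range n) (s' := fun j => Finset.Ico j n)]
          intro i j
          simp only [Finset.mem_range, Finset.mem_Ico]
          omega
      _ = ∑ j ∈ Finset.range n, ∫⁻ x, (d j x : ℝ≥0∞) *
            ∑ i ∈ Finset.Ico j n, b i x ^ 2 ∂μ := by
          rw [lintegral_finsetSum]
          intro i _
          exact (hdm _).coe_nnreal_ennreal.mul
            (Finset.measurable_sum _ fun j _ => (hb j).pow_const 2)
      _ ≤ ∑ j ∈ Finset.range n, M * ∫⁻ x, (d j x : ℝ≥0∞) ∂μ := by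
          refine Finset.sum_le_sum fun j hj => ?_
          exact lintegral_mul_le_of_cell_average_le (hQ j) (hsymm j) (hv0 j) (hvt j) (hvol j)
            (hdm _).coe_nnreal_ennreal
            (Finset.measurable_sum _ fun j _ => (hb j).pow_const 2)
            (fun x y h => by rw [hdc j x y h]) (hM j (Finset.mem_range.1 hj))
      _ = M * ∫⁻ x, (S n x : ℝ≥0∞) ∂μ := by
          rw [← Finset.mul_sum, ← lintegral_finsetSum]
          · simp_rw [hsumE]
          · intro i _; exact (hdm _).coe_nnreal_ennreal
  have h1 : 2 * ∑ i ∈ Finset.range n, ∫⁻ x, (a i x : ℝ≥0∞) * b i x ∂μ ≤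
      2 * ((1 + M) * ∫⁻ x, (S n x : ℝ≥0∞) ∂μ) := by
    calc 2 * ∑ i ∈ Finset.range n, ∫⁻ x, (a i x : ℝ≥0∞) * b i x ∂μ
        = ∑ i ∈ Finset.range n, ∫⁻ x, 2 * ((a i x : ℝ≥0∞) * b i x) ∂μ := by
          rw [Finset.mul_sum]
          refine Finset.sum_congr rfl fun i _ => ?_
          rw [lintegral_const_mul]
          exact (ha i).coe_nnreal_ennreal.mul (hb i)
      _ ≤ ∑ i ∈ Finset.range n, ∫⁻ x, (2 * (d i x : ℝ≥0∞) +
            (S (i + 1) x : ℝ≥0∞) * b i x ^ 2) ∂μ :=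
          Finset.sum_le_sum fun i _ => lintegral_mono fun x => hpt i x
      _ = 2 * ∫⁻ x, (S n x : ℝ≥0∞) ∂μ +
            ∑ i ∈ Finset.range n, ∫⁻ x, (S (i + 1) x : ℝ≥0∞) * b i x ^ 2 ∂μ := by
          simp_rw [← hsumE n]
          rw [lintegral_finsetSum _ fun i _ => (hdm i).coe_nnreal_ennreal, Finset.mul_sum,
            ← Finset.sum_add_distrib]
          refine Finset.sum_congr rfl fun i _ => ?_
          rw [lintegral_add_left ((hdm i).coe_nnreal_ennreal.const_mul 2),
            lintegral_const_mul _ (hdm i).coe_nnreal_ennreal]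
      _ ≤ 2 * ∫⁻ x, (S n x : ℝ≥0∞) ∂μ + M * ∫⁻ x, (S n x : ℝ≥0∞) ∂μ := by gcongr
      _ ≤ 2 * ((1 + M) * ∫⁻ x, (S n x : ℝ≥0∞) ∂μ) := by
          rw [← add_mul, ← mul_assoc]
          gcongr
          rw [mul_add, mul_one]
          gcongr
          exact le_mul_of_one_le_left' (by norm_num)
  exact (ENNReal.mul_le_mul_iff_right (by norm_num) (by norm_num)).1 h1

/-! ### Dyadic cubes -/

section Cubes

variable {N : ℕ}

lemma mem_dcube {t : Fin N → ℝ} {k : ℤ} {x y : Fin N → ℝ} :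
    y ∈ dcube t k x ↔ ∀ i, ⌊(y i - t i) / (2 : ℝ) ^ k⌋ = ⌊(x i - t i) / (2 : ℝ) ^ k⌋ := Iff.rfl

lemma mem_dcube_symm {t : Fin N → ℝ} {k : ℤ} {x y : Fin N → ℝ} (h : y ∈ dcube t k x) :
    x ∈ dcube t k y := fun i => (h i).symm

lemma dcube_eq_of_mem {t : Fin N → ℝ} {k : ℤ} {x y : Fin N → ℝ} (h : y ∈ dcube t k x) :
    dcube t k y = dcube t k x := by
  ext z
  exact ⟨fun hz i => (hz i).trans (h i), fun hz i => (hz i).trans (h i).symm⟩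

lemma dcube_eq_pi (t : Fin N → ℝ) (k : ℤ) (x : Fin N → ℝ) :
    dcube t k x = Set.univ.pi fun i =>
      Set.Ico (t i + ⌊(x i - t i) / (2 : ℝ) ^ k⌋ * (2 : ℝ) ^ k)
        (t i + ⌊(x i - t i) / (2 : ℝ) ^ k⌋ * (2 : ℝ) ^ k + (2 : ℝ) ^ k) := by
  ext y
  have hk : (0 : ℝ) < 2 ^ k := by positivity
  simp only [mem_dcube, Set.mem_univ_pi, Set.mem_Ico]
  refine forall_congr' fun i => ?_
  rw [Int.floor_eq_iff, le_div_iff₀ hk, div_lt_iff₀ hk]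
  constructor
  · rintro ⟨h1, h2⟩; constructor <;> linarith
  · rintro ⟨h1, h2⟩; constructor <;> linarith

lemma volume_dcube (t : Fin N → ℝ) (k : ℤ) (x : Fin N → ℝ) :
    volume (dcube t k x) = ENNReal.ofReal (((2 : ℝ) ^ k) ^ N) := by
  rw [dcube_eq_pi, Real.volume_pi_Ico]
  simp only [add_sub_cancel_left, Finset.prod_const, Finset.card_univ, Fintype.card_fin]
  rw [ENNReal.ofReal_pow (by positivity)]

lemma measurableSet_dcube (t : Fin N → ℝ) (k : ℤ) (x : Fin N → ℝ) :
    MeasurableSet (dcube t k x) := by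
  rw [dcube_eq_pi]
  exact MeasurableSet.univ_pi fun i => measurableSet_Ico

lemma measurableSet_mem_dcube {β : Type*} [MeasurableSpace β] (k : ℤ) {t x y : β → Fin N → ℝ}
    (ht : Measurable t) (hx : Measurable x) (hy : Measurable y) :
    MeasurableSet {p | y p ∈ dcube (t p) k (x p)} := by
  simp only [mem_dcube, Set.ofPred_forall]
  exact MeasurableSet.iInter fun i => measurableSet_eq_fun
    (Int.measurable_floor.comp (by fun_prop)) (Int.measurable_floor.comp (by fun_prop))

lemma abs_sub_lt_of_mem_dcube {t : Fin N → ℝ} {k : ℤ} {x y : Fin N → ℝ}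
    (h : y ∈ dcube t k x) (i : Fin N) : |y i - x i| < (2 : ℝ) ^ k := by
  have hk : (0 : ℝ) < 2 ^ k := by positivity
  have h1 := Int.abs_sub_lt_one_of_floor_eq_floor (h i)
  rw [← sub_div, abs_div, abs_of_pos hk, div_lt_one hk] at h1
  simpa using h1

lemma norm_sub_le_of_mem_dcube {t : Fin N → ℝ} {k : ℤ} {x y : Fin N → ℝ}
    (h : y ∈ dcube t k x) : ‖y - x‖ ≤ (2 : ℝ) ^ k :=
  (pi_norm_le_iff_of_nonneg (by positivity)).2 fun i => (abs_sub_lt_of_mem_dcube h i).le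

/-- The partitions of a (generalized) dyadic lattice with offsets `c` are nested. -/
def Nested (c : ℤ → Fin N → ℝ) : Prop :=
  ∀ k x y, y ∈ dcube (c k) k x → y ∈ dcube (c (k + 1)) (k + 1) x

lemma Nested.mem_of_le {c : ℤ → Fin N → ℝ} (hc : Nested c) {j k : ℤ} (hjk : j ≤ k)
    {x y : Fin N → ℝ} (h : y ∈ dcube (c j) j x) : y ∈ dcube (c k) k x := by
  induction k, hjk using Int.leInduction with
  | base => exact h
  | succ k _ ih => exact hc k x y ih

lemma nested_of_sub_eq (c : ℤ → Fin N → ℝ)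
    (h : ∀ k i, ∃ m : ℤ, c (k + 1) i = c k i + m * (2 : ℝ) ^ k) : Nested c := by
  intro k x y hxy i
  obtain ⟨m, hm⟩ := h k i
  have hk : (2 : ℝ) ^ k ≠ 0 := by positivity
  have key : ∀ z : ℝ, ⌊(z - c (k + 1) i) / (2 : ℝ) ^ (k + 1)⌋ =
      (⌊(z - c k i) / (2 : ℝ) ^ k⌋ - m) / 2 := by
    intro z
    have : (z - c (k + 1) i) / (2 : ℝ) ^ (k + 1) =
        ((z - c k i) / (2 : ℝ) ^ k - m) / ((2 : ℕ) : ℝ) := by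
      rw [hm, zpow_add_one₀ two_ne_zero]; push_cast; field_simp; ring
    rw [this, Int.floor_div_natCast, Int.floor_sub_intCast]
    rfl
  rw [key, key, hxy i]

end Cubes

/-! ### The distribution of the random dyadic lattice -/

lemma indicator_one_congr {α β : Type*} {s : Set α} {t : Set β} {a : α} {b : β}
    (h : a ∈ s ↔ b ∈ t) : s.indicator (1 : α → ℝ≥0∞) a = t.indicator (1 : β → ℝ≥0∞) b := by
  by_cases hb : b ∈ t
  · rw [Set.indicator_of_mem hb, Set.indicator_of_mem (h.2 hb)]; rfl
  · rw [Set.indicator_of_notMem hb, Set.indicator_of_notMem (fun ha => hb (h.1 ha))]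

lemma lintegral_Ico_halves {ψ : ℝ → ℝ≥0∞} (hψ : Measurable ψ) :
    ∫⁻ v in Set.Ico (0 : ℝ) 1, ψ v =
      2⁻¹ * ((∫⁻ v in Set.Ico (0 : ℝ) 1, ψ (v / 2)) +
        ∫⁻ v in Set.Ico (0 : ℝ) 1, ψ ((v + 1) / 2)) := by
  have key : ∀ d : ℝ, ∫⁻ v in Set.Ico (0 : ℝ) 1, ψ ((v + d) / 2) =
      2 * ∫⁻ v in Set.Ico (d / 2) ((d + 1) / 2), ψ v := by
    intro d
    rw [← lintegral_indicator measurableSet_Ico, ← lintegral_indicator measurableSet_Ico]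
    have h1 : ∀ v, (Set.Ico (0 : ℝ) 1).indicator (fun v => ψ ((v + d) / 2)) v =
        (Set.Ico (d / 2) ((d + 1) / 2)).indicator ψ ((1 / 2 : ℝ) * v + d / 2) := by
      intro v
      simp only [Set.indicator, Set.mem_Ico]
      have : (0 ≤ v ∧ v < 1) ↔ (d / 2 ≤ 1 / 2 * v + d / 2 ∧ 1 / 2 * v + d / 2 < (d + 1) / 2) := by
        constructor <;> rintro ⟨h1, h2⟩ <;> constructor <;> linarith
      rw [show (v + d) / 2 = 1 / 2 * v + d / 2 by ring]
      split_ifs <;> tauto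
    simp_rw [h1]
    have hm : Measurable fun v => (Set.Ico (d / 2) ((d + 1) / 2)).indicator ψ (v + d / 2) :=
      (hψ.indicator measurableSet_Ico).comp (by fun_prop)
    have h2 := lintegral_map (μ := volume) hm (measurable_const_mul (1 / 2 : ℝ))
    rw [Real.map_volume_mul_left (by norm_num), lintegral_smul_measure,
      lintegral_add_right_eq_self
      (fun v => (Set.Ico (d / 2) ((d + 1) / 2)).indicator ψ v)] at h2
    rw [← h2]
    norm_num
  have h0 := key 0
  have h1 := key 1
  norm_num at h0 h1
  rw [h0, h1, ← mul_add, ← lintegral_union measurableSet_Ico, ← mul_assoc,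
    ENNReal.inv_mul_cancel (by norm_num) (by norm_num), one_mul,
    Set.Ico_union_Ico_eq_Ico (by norm_num) (by norm_num)]
  rw [Set.disjoint_left]
  rintro x ⟨_, h⟩ ⟨h', _⟩
  linarith

/-- The nonnegative integer by which the lattice is shifted up to scale `2^k`. -/
def digitShift (v : ℝ) (k : ℕ) : ℝ :=
  ∑ j ∈ Finset.range k, (if ⌊v * 2 ^ (j + 1)⌋ % 2 = 1 then (2 : ℝ) ^ j else 0)

@[fun_prop]
lemma measurable_digitShift (k : ℕ) : Measurable fun v => digitShift v k := by
  unfold digitShift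
  refine Finset.measurable_sum _ fun j _ => ?_
  refine Measurable.ite ?_ measurable_const measurable_const
  have : Measurable fun v : ℝ => ⌊v * 2 ^ (j + 1)⌋ % 2 :=
    (measurable_of_countable (fun m : ℤ => m % 2)).comp
      (Int.measurable_floor.comp (by fun_prop))
  exact this (measurableSet_singleton 1)

lemma digitShift_half (d : ℤ) (hd : d = 0 ∨ d = 1) {v : ℝ} (hv : v ∈ Set.Ico (0 : ℝ) 1) (k : ℕ) :
    digitShift ((v + d) / 2) (k + 1) = d + 2 * digitShift v k := by
  unfold digitShift
  rw [Finset.sum_range_succ', Finset.mul_sum, add_comm]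
  congr 1
  · have : ⌊(v + d) / 2 * 2 ^ (0 + 1)⌋ = d := by
      rw [Int.floor_eq_iff]
      norm_num
      exact ⟨hv.1, by linarith [hv.2]⟩
    rw [this]
    rcases hd with rfl | rfl <;> simp
  · refine Finset.sum_congr rfl fun j _ => ?_
    have : (v + d) / 2 * 2 ^ (j + 1 + 1) = v * 2 ^ (j + 1) + ((d * 2 ^ (j + 1) : ℤ) : ℝ) := by
      push_cast; ring
    rw [this, Int.floor_add_intCast, pow_succ (2 : ℤ), ← mul_assoc, Int.add_mul_emod_self_right]
    split_ifs <;> ring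

lemma randOffset1_eq (u v : ℝ) (k : ℤ) : randOffset1 u v k = u - 1 - digitShift v k.toNat := rfl

lemma lintegral_randOffset1_natCast (k : ℕ) : ∀ {φ : ℝ → ℝ≥0∞}, Measurable φ →
    ∫⁻ u in Set.Ico (0 : ℝ) 1, ∫⁻ v in Set.Ico (0 : ℝ) 1, φ (1 - u + digitShift v k) =
      ∫⁻ u in Set.Ico (0 : ℝ) 1, φ (2 ^ k * (1 - u)) := by
  induction k with
  | zero => intro φ _; simp [digitShift]
  | succ k ih =>
    intro φ hφ
    have hm : ∀ g : ℝ × ℝ → ℝ, Measurable g → AEMeasurable (fun p => φ (g p))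
        ((volume.restrict (Set.Ico (0 : ℝ) 1)).prod (volume.restrict (Set.Ico (0 : ℝ) 1))) :=
      fun g hg => (hφ.comp hg).aemeasurable
    have e1 : ∀ u, ∫⁻ v in Set.Ico (0 : ℝ) 1, φ (1 - u + digitShift v (k + 1)) =
        2⁻¹ * ((∫⁻ v in Set.Ico (0 : ℝ) 1, φ (1 - u + 2 * digitShift v k)) +
          ∫⁻ v in Set.Ico (0 : ℝ) 1, φ (1 - u + 1 + 2 * digitShift v k)) := by
      intro u
      rw [lintegral_Ico_halves (by fun_prop)]
      congr 2
      · refine setLIntegral_congr_fun measurableSet_Ico fun v hv => ?_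
        have := digitShift_half 0 (Or.inl rfl) hv k
        simp only [Int.cast_zero, add_zero, zero_add] at this
        simp only [this]
      · refine setLIntegral_congr_fun measurableSet_Ico fun v hv => ?_
        have := digitShift_half 1 (Or.inr rfl) hv k
        simp only [Int.cast_one] at this
        simp only [this, ← add_assoc]
    have e2 : ∀ v, ∫⁻ u in Set.Ico (0 : ℝ) 1, φ (2 * (1 - u + digitShift v k)) =
        2⁻¹ * ((∫⁻ u in Set.Ico (0 : ℝ) 1, φ (1 - u + 1 + 2 * digitShift v k)) +
          ∫⁻ u in Set.Ico (0 : ℝ) 1, φ (1 - u + 2 * digitShift v k)) := by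
      intro v
      rw [lintegral_Ico_halves (by fun_prop)]
      congr 3
      · ext u; congr 1; ring
      · ext u; congr 1; ring
    have e3 := ih (φ := fun s => φ (2 * s)) (by fun_prop)
    simp_rw [e1]
    rw [lintegral_const_mul _ (by fun_prop), lintegral_add_left (by fun_prop)]
    calc _ = ∫⁻ v in Set.Ico (0 : ℝ) 1, ∫⁻ u in Set.Ico (0 : ℝ) 1,
          φ (2 * (1 - u + digitShift v k)) := by
          simp_rw [e2]
          rw [lintegral_const_mul _ (by fun_prop), lintegral_add_left (by fun_prop), add_comm]
          congr 2
          · exact lintegral_lintegral_swap (hm (fun p => 1 - p.1 + 1 + 2 * digitShift p.2 k)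
              (by fun_prop))
          · exact lintegral_lintegral_swap (hm (fun p => 1 - p.1 + 2 * digitShift p.2 k)
              (by fun_prop))
      _ = _ := by
          rw [← lintegral_lintegral_swap (hm (fun p => 2 * (1 - p.1 + digitShift p.2 k))
              (by fun_prop)), e3]
          congr 1; ext u; congr 1; ring

lemma volume_floor_sub_ne_le (y z : ℝ) :
    volume ({u : ℝ | ⌊y - u⌋ ≠ ⌊z - u⌋} ∩ Set.Ico 0 1) ≤ ENNReal.ofReal |y - z| := by
  wlog hyz : y ≤ z generalizing y z with H
  · rw [abs_sub_comm]
    convert H z y (le_of_not_ge hyz) using 4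
    ext u
    exact ne_comm
  rcases le_or_gt 1 (z - y) with h1 | h1
  · refine (measure_mono Set.inter_subset_right).trans ?_
    rw [Real.volume_Ico]
    apply ENNReal.ofReal_le_ofReal
    rw [abs_sub_comm, abs_of_nonneg (by linarith)]; linarith
  set r := Int.fract y with hr
  have hr0 : 0 ≤ r := Int.fract_nonneg y
  have hr1 : r < 1 := Int.fract_lt_one y
  set δ := z - y with hδ
  have hsub : {u : ℝ | ⌊y - u⌋ ≠ ⌊z - u⌋} ∩ Set.Ico 0 1 ⊆
      Set.Ico r (min (r + δ) 1) ∪ {min (r + δ) 1} ∪ Set.Icc 0 (r + δ - 1) := by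
    rintro u ⟨hu, hu0, hu1⟩
    by_contra hcon
    simp only [Set.mem_union, Set.mem_Ico, Set.mem_singleton_iff, Set.mem_Icc, not_or, not_and,
      not_lt, not_le] at hcon
    obtain ⟨⟨ha, hb⟩, hc⟩ := hcon
    have hc := hc hu0
    apply hu
    have ey : y = ⌊y⌋ + r := (Int.floor_add_fract y).symm
    rcases lt_or_ge u r with h | h
    · have h2 : ⌊y - u⌋ = ⌊y⌋ := by
        rw [Int.floor_eq_iff]; constructor <;> linarith
      have h3 : ⌊z - u⌋ = ⌊y⌋ := by
        rw [Int.floor_eq_iff]; constructor <;> linarith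
      rw [h2, h3]
    · have h4 : r + δ < u := by
        have := lt_of_le_of_ne (ha h) (Ne.symm hb)
        rcases min_lt_iff.1 this with h | h
        · exact h
        · linarith
      have h2 : ⌊y - u⌋ = ⌊y⌋ - 1 := by
        rw [Int.floor_eq_iff]; push_cast; constructor <;> linarith
      have h3 : ⌊z - u⌋ = ⌊y⌋ - 1 := by
        rw [Int.floor_eq_iff]; push_cast; constructor <;> linarith
      rw [h2, h3]
  refine (measure_mono hsub).trans ((measure_union_le _ _).trans ?_)
  refine (add_le_add_left (measure_union_le _ _) _).trans ?_
  rw [Real.volume_Ico, Real.volume_singleton, add_zero, Real.volume_Icc,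
    abs_sub_comm, abs_of_nonneg (by linarith)]
  rcases le_total (r + δ) 1 with h | h
  · rw [min_eq_left h, ENNReal.ofReal_of_nonpos (p := r + δ - 1 - 0) (by linarith), add_zero]
    apply ENNReal.ofReal_le_ofReal; linarith
  · rw [min_eq_right h, ← ENNReal.ofReal_add (by linarith) (by linarith)]
    apply ENNReal.ofReal_le_ofReal; linarith

lemma measurable_floor_ne_indicator {β : Type*} [MeasurableSpace β] {f g : β → ℝ}
    (hf : Measurable f) (hg : Measurable g) :
    Measurable ({b | ⌊f b⌋ ≠ ⌊g b⌋}.indicator (1 : β → ℝ≥0∞)) :=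
  measurable_one.indicator (measurableSet_eq_fun (Int.measurable_floor.comp hf)
    (Int.measurable_floor.comp hg)).compl

lemma lintegral_floor_sub_two_pow_mul_ne_le (p : ℕ) : ∀ y z : ℝ,
    ∫⁻ u in Set.Ico (0 : ℝ) 1, {u : ℝ | ⌊y - 2 ^ p * u⌋ ≠ ⌊z - 2 ^ p * u⌋}.indicator 1 u ≤
      ENNReal.ofReal |y - z| := by
  induction p with
  | zero =>
    intro y z
    refine le_trans (le_of_eq ?_) (volume_floor_sub_ne_le y z)
    rw [lintegral_indicator_one, Measure.restrict_apply] <;> simp only [pow_zero, one_mul]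
    all_goals exact (measurableSet_eq_fun (Int.measurable_floor.comp (by fun_prop))
      (Int.measurable_floor.comp (by fun_prop))).compl
  | succ p ih =>
    intro y z
    rw [lintegral_Ico_halves (measurable_floor_ne_indicator (by fun_prop) (by fun_prop))]
    have h1 : ∀ u : ℝ, {u : ℝ | ⌊y - 2 ^ (p + 1) * u⌋ ≠ ⌊z - 2 ^ (p + 1) * u⌋}.indicator
        (1 : ℝ → ℝ≥0∞) (u / 2) =
        {u : ℝ | ⌊y - 2 ^ p * u⌋ ≠ ⌊z - 2 ^ p * u⌋}.indicator 1 u := by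
      intro u
      simp only [Set.indicator, Set.mem_ofPred_eq, Pi.one_apply]
      rw [show (2 : ℝ) ^ (p + 1) * (u / 2) = 2 ^ p * u by ring]
    have h2 : ∀ u : ℝ, {u : ℝ | ⌊y - 2 ^ (p + 1) * u⌋ ≠ ⌊z - 2 ^ (p + 1) * u⌋}.indicator
        (1 : ℝ → ℝ≥0∞) ((u + 1) / 2) =
        {u : ℝ | ⌊y - 2 ^ p * u⌋ ≠ ⌊z - 2 ^ p * u⌋}.indicator 1 u := by
      intro u
      apply indicator_one_congr
      simp only [Set.mem_ofPred_eq]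
      have : ∀ s : ℝ, s - (2 : ℝ) ^ (p + 1) * ((u + 1) / 2) = s - 2 ^ p * u - ((2 ^ p : ℤ) : ℝ) :=
        fun s => by push_cast; ring
      rw [this, this, Int.floor_sub_intCast, Int.floor_sub_intCast, Ne, sub_left_inj]
    rw [lintegral_congr h1, lintegral_congr h2]
    calc _ ≤ 2⁻¹ * (ENNReal.ofReal |y - z| + ENNReal.ofReal |y - z|) := by
          gcongr <;> exact ih y z
      _ = _ := by
          rw [← two_mul, ← mul_assoc, ENNReal.inv_mul_cancel (by norm_num) (by norm_num), one_mul]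

/-- The probability that the random interval partition at scale `2^k` separates two points is at
most the distance of the points divided by `2^k`. -/
lemma lintegral_randOffset1_separates_le (k : ℤ) (x y : ℝ) :
    ∫⁻ u in Set.Ico (0 : ℝ) 1, ∫⁻ v in Set.Ico (0 : ℝ) 1,
      {s : ℝ | ⌊(x + s) / 2 ^ k⌋ ≠ ⌊(y + s) / 2 ^ k⌋}.indicator 1 (1 - u + digitShift v k.toNat) ≤
      ENNReal.ofReal (|x - y| / 2 ^ k) := by
  rw [lintegral_randOffset1_natCast _
    (measurable_floor_ne_indicator (by fun_prop) (by fun_prop))]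
  have hk : (0 : ℝ) < 2 ^ k := by positivity
  obtain ⟨p, hp⟩ : ∃ p : ℕ, (2 : ℝ) ^ k.toNat / 2 ^ k = 2 ^ p := by
    rcases le_total 0 k with h | h
    · lift k to ℕ using h
      exact ⟨0, by simp⟩
    · refine ⟨(-k).toNat, ?_⟩
      rw [Int.toNat_of_nonpos h, pow_zero, ← zpow_natCast, Int.toNat_of_nonneg (by omega)]
      simp
  have := lintegral_floor_sub_two_pow_mul_ne_le p ((x + 2 ^ k.toNat) / 2 ^ k)
    ((y + 2 ^ k.toNat) / 2 ^ k)
  rw [← sub_div, add_sub_add_right_eq_sub, abs_div, abs_of_pos hk] at this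
  refine le_trans (le_of_eq ?_) this
  congr 1; ext u
  simp only [Set.indicator, Set.mem_ofPred_eq, Pi.one_apply]
  have e : ∀ s : ℝ, (s + 2 ^ k.toNat * (1 - u)) / 2 ^ k =
      (s + 2 ^ k.toNat) / 2 ^ k - 2 ^ p * u := fun s => by
    rw [← hp]; field_simp; ring
  rw [e, e]

section RandomLattice

variable {N : ℕ}

instance isProbabilityMeasure_randMeasure : IsProbabilityMeasure (randMeasure N) := by
  have : IsProbabilityMeasure (volume.restrict (Set.Ico (0 : ℝ) 1)) := ⟨by simp⟩
  unfold randMeasure; infer_instance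

lemma measurable_randOffset (k : ℤ) : Measurable fun ω : RSpace N => randOffset ω k := by
  refine measurable_pi_lambda _ fun i => ?_
  simp only [randOffset, randOffset1_eq]
  fun_prop

lemma nested_randOffset (ω : RSpace N) : Nested (randOffset ω) := by
  apply nested_of_sub_eq
  intro k i
  simp only [randOffset, randOffset1_eq, digitShift]
  rcases le_or_gt 0 k with h | h
  · lift k to ℕ using h
    have : ((k : ℤ) + 1).toNat = k + 1 := by omega
    rw [this, Int.toNat_natCast, Finset.sum_range_succ]
    split_ifs
    · exact ⟨-1, by push_cast; rw [zpow_natCast]; ring⟩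
    · exact ⟨0, by simp⟩
  · refine ⟨0, ?_⟩
    rw [Int.toNat_of_nonpos (by omega), Int.toNat_of_nonpos (by omega)]
    simp

lemma randMeasure_notMem_dcube_le (k : ℤ) (x y : Fin N → ℝ) :
    randMeasure N {ω | y ∉ dcube (randOffset ω k) k x} ≤
      ENNReal.ofReal (N * (‖y - x‖ / 2 ^ k)) := by
  have hP : IsProbabilityMeasure (volume.restrict (Set.Ico (0 : ℝ) 1)) := ⟨by simp⟩
  have hk : (0 : ℝ) < 2 ^ k := by positivity
  have hsub : {ω : RSpace N | y ∉ dcube (randOffset ω k) k x} ⊆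
      ⋃ i, (fun ω : RSpace N => ω i) ⁻¹' {q : ℝ × ℝ | ⌊(y i - randOffset1 q.1 q.2 k) / 2 ^ k⌋ ≠
        ⌊(x i - randOffset1 q.1 q.2 k) / 2 ^ k⌋} := by
    intro ω hω
    simpa [mem_dcube, randOffset] using hω
  refine (measure_mono hsub).trans ((measure_iUnion_le _).trans ?_)
  rw [tsum_fintype]
  have hi : ∀ i, randMeasure N ((fun ω : RSpace N => ω i) ⁻¹'
      {q : ℝ × ℝ | ⌊(y i - randOffset1 q.1 q.2 k) / 2 ^ k⌋ ≠
        ⌊(x i - randOffset1 q.1 q.2 k) / 2 ^ k⌋}) ≤ ENNReal.ofReal (‖y - x‖ / 2 ^ k) := by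
    intro i
    have hms : MeasurableSet {q : ℝ × ℝ | ⌊(y i - randOffset1 q.1 q.2 k) / 2 ^ k⌋ ≠
        ⌊(x i - randOffset1 q.1 q.2 k) / 2 ^ k⌋} := by
      simp only [randOffset1_eq]
      exact (measurableSet_eq_fun (Int.measurable_floor.comp (by fun_prop))
        (Int.measurable_floor.comp (by fun_prop))).compl
    have h1 := (measurePreserving_eval (fun _ : Fin N => (volume.restrict (Set.Ico (0 : ℝ) 1)).prod
      (volume.restrict (Set.Ico (0 : ℝ) 1))) i).measure_preimage hms.nullMeasurableSet
    unfold randMeasure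
    refine (le_of_eq h1).trans ?_
    rw [← lintegral_indicator_one hms, lintegral_prod _ (measurable_one.indicator hms).aemeasurable]
    refine le_trans (le_of_eq ?_) ((lintegral_randOffset1_separates_le k (y i) (x i)).trans ?_)
    · congr 1; ext u; congr 1; ext v
      apply indicator_one_congr
      simp only [Set.mem_ofPred_eq, randOffset1_eq]
      have e : ∀ s : ℝ, s - (u - 1 - digitShift v k.toNat) = s + (1 - u + digitShift v k.toNat) :=
        fun s => by ring
      rw [e, e]
    · gcongr
      exact norm_le_pi_norm (y - x) i
  calc _ ≤ ∑ _i : Fin N, ENNReal.ofReal (‖y - x‖ / 2 ^ k) := Finset.sum_le_sum fun i _ => hi i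
    _ = _ := by
      rw [Finset.sum_const, Finset.card_univ, Fintype.card_fin, nsmul_eq_mul,
        ENNReal.ofReal_mul (by positivity), ENNReal.ofReal_natCast]

end RandomLattice

/-! ### Hilbert space valued dyadic martingales -/

section Martingale

variable {N : ℕ} {H : Type*} [NormedAddCommGroup H] [InnerProductSpace ℝ H] [CompleteSpace H]

/-- The integral kernel of the averaging operator over the cubes of sidelength `2^k` of the
lattice with offset `t`. -/
def dker (t : Fin N → ℝ) (k : ℤ) (x z : Fin N → ℝ) : ℝ :=
  (dcube t k x).indicator (fun _ => (((2 : ℝ) ^ k) ^ N)⁻¹) z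

lemma dker_nonneg (t : Fin N → ℝ) (k : ℤ) (x z : Fin N → ℝ) : 0 ≤ dker t k x z :=
  Set.indicator_nonneg (fun _ _ => by positivity) _

lemma dker_le (t : Fin N → ℝ) (k : ℤ) (x z : Fin N → ℝ) : dker t k x z ≤ (((2 : ℝ) ^ k) ^ N)⁻¹ :=
  Set.indicator_le_self' (fun _ _ => by positivity) _

lemma dker_comm (t : Fin N → ℝ) (k : ℤ) (x z : Fin N → ℝ) : dker t k x z = dker t k z x := by
  unfold dker
  by_cases h : z ∈ dcube t k x
  · rw [Set.indicator_of_mem h, Set.indicator_of_mem (mem_dcube_symm h)]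
  · rw [Set.indicator_of_notMem h, Set.indicator_of_notMem fun h' => h (mem_dcube_symm h')]

lemma dker_eq_of_mem {t : Fin N → ℝ} {k : ℤ} {x y : Fin N → ℝ} (h : y ∈ dcube t k x)
    (z : Fin N → ℝ) : dker t k y z = dker t k x z := by
  unfold dker; rw [dcube_eq_of_mem h]

lemma measurable_dker {β : Type*} [MeasurableSpace β] (k : ℤ) {t x z : β → Fin N → ℝ}
    (ht : Measurable t) (hx : Measurable x) (hz : Measurable z) :
    Measurable fun p => dker (t p) k (x p) (z p) := by
  have : (fun p => dker (t p) k (x p) (z p)) =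
      {p | z p ∈ dcube (t p) k (x p)}.indicator fun _ => (((2 : ℝ) ^ k) ^ N)⁻¹ := by
    ext p; rfl
  rw [this]
  exact measurable_const.indicator (measurableSet_mem_dcube k ht hx hz)

lemma integrable_dker (t : Fin N → ℝ) (k : ℤ) (x : Fin N → ℝ) : Integrable (dker t k x) := by
  refine (integrable_indicator_iff (measurableSet_dcube t k x)).2 ?_
  refine integrableOn_const ?_
  rw [volume_dcube]; exact ENNReal.ofReal_ne_top

lemma integral_dker (t : Fin N → ℝ) (k : ℤ) (x : Fin N → ℝ) : ∫ z, dker t k x z = 1 := by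
  unfold dker
  rw [integral_indicator (measurableSet_dcube t k x), setIntegral_const, Measure.real,
    volume_dcube, ENNReal.toReal_ofReal (by positivity), smul_eq_mul]
  exact mul_inv_cancel₀ (by positivity)

/-- The average of `F` over the cube of sidelength `2^k` containing `x`. -/
def havg (t : Fin N → ℝ) (k : ℤ) (F : (Fin N → ℝ) → H) (x : Fin N → ℝ) : H :=
  ∫ z, dker t k x z • F z

lemma norm_dker (t : Fin N → ℝ) (k : ℤ) (x z : Fin N → ℝ) : ‖dker t k x z‖ = dker t k x z :=
  Real.norm_of_nonneg (dker_nonneg _ _ _ _)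

lemma integrable_dker_smul {F : (Fin N → ℝ) → H} (hF : Integrable F) (t : Fin N → ℝ) (k : ℤ)
    (x : Fin N → ℝ) : Integrable fun z => dker t k x z • F z :=
  hF.bdd_smul _ (measurable_dker k measurable_const measurable_const
    measurable_id).aestronglyMeasurable (ae_of_all _ fun z => by
      rw [norm_dker]; exact dker_le t k x z)

lemma stronglyMeasurable_dker (t : Fin N → ℝ) (k : ℤ) :
    StronglyMeasurable fun p : (Fin N → ℝ) × (Fin N → ℝ) => dker t k p.1 p.2 :=
  (measurable_dker k measurable_const measurable_fst measurable_snd).stronglyMeasurable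

lemma stronglyMeasurable_havg {F : (Fin N → ℝ) → H} (hF : StronglyMeasurable F) (t : Fin N → ℝ)
    (k : ℤ) : StronglyMeasurable (havg t k F) := by
  unfold havg
  exact StronglyMeasurable.integral_prod_right
    ((stronglyMeasurable_dker t k).smul (hF.comp_measurable measurable_snd))

lemma havg_eq_of_mem {t : Fin N → ℝ} {k : ℤ} {x y : Fin N → ℝ} (h : y ∈ dcube t k x)
    (F : (Fin N → ℝ) → H) : havg t k F y = havg t k F x := by
  simp only [havg, dker_eq_of_mem h]

lemma norm_havg_le_norm_lintegral {F : (Fin N → ℝ) → H} (hF : Integrable F) (t : Fin N → ℝ)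
    (k : ℤ) (x : Fin N → ℝ) : ‖havg t k F x‖ ≤ (((2 : ℝ) ^ k) ^ N)⁻¹ * ∫ z, ‖F z‖ := by
  refine (norm_integral_le_integral_norm _).trans ?_
  rw [← integral_const_mul]
  refine integral_mono (integrable_dker_smul hF t k x).norm (hF.norm.const_mul _) fun z => ?_
  simp only [norm_smul, norm_dker]
  gcongr
  exact dker_le t k x z

lemma norm_havg_le {F : (Fin N → ℝ) → H} {B : ℝ} (hB : ∀ x, ‖F x‖ ≤ B) (t : Fin N → ℝ)
    (k : ℤ) (x : Fin N → ℝ) : ‖havg t k F x‖ ≤ B := by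
  calc _ ≤ ∫ z, dker t k x z * B := norm_integral_le_of_norm_le
          ((integrable_dker t k x).mul_const B) (ae_of_all _ fun z => by
            rw [norm_smul, norm_dker]; gcongr
            exacts [dker_nonneg _ _ _ _, hB z])
    _ = B := by rw [integral_mul_const, integral_dker, one_mul]

lemma integrable_prod_dker_mul {F : (Fin N → ℝ) → ℝ} (hF : Integrable F) (t : Fin N → ℝ) (k : ℤ) :
    Integrable fun p : (Fin N → ℝ) × (Fin N → ℝ) => dker t k p.1 p.2 * F p.1 := by
  have hm : AEStronglyMeasurable (fun p : (Fin N → ℝ) × (Fin N → ℝ) => dker t k p.1 p.2 * F p.1)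
      (volume.prod volume) :=
    (stronglyMeasurable_dker t k).aestronglyMeasurable.mul hF.aestronglyMeasurable.comp_fst
  refine (integrable_prod_iff hm).2 ⟨ae_of_all _ fun x =>
    (integrable_dker t k x).mul_const (F x), ?_⟩
  simp only [norm_mul, norm_dker, integral_mul_const, integral_dker, one_mul]
  exact hF.norm

lemma integrable_havg {F : (Fin N → ℝ) → H} (hF : Integrable F) (hFm : StronglyMeasurable F)
    (t : Fin N → ℝ) (k : ℤ) : Integrable (havg t k F) := by
  have h := integrable_prod_dker_mul hF.norm t k
  have h2 := h.swap.integral_prod_left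
  refine h2.mono (stronglyMeasurable_havg hFm t k).aestronglyMeasurable (ae_of_all _ fun x => ?_)
  refine (norm_integral_le_integral_norm _).trans ((le_of_eq ?_).trans (le_abs_self _))
  refine integral_congr_ae (ae_of_all _ fun z => ?_)
  simp only [norm_smul, norm_dker, dker_comm t k x z, Function.comp, Prod.swap]

lemma integral_inner_havg {F φ : (Fin N → ℝ) → H} (hF : Integrable F) (hFm : StronglyMeasurable F)
    (hφ : StronglyMeasurable φ) {B : ℝ} (hB : ∀ x, ‖φ x‖ ≤ B) (hφi : Integrable φ)
    (t : Fin N → ℝ) (k : ℤ) :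
    ∫ x, inner ℝ (F x) (havg t k φ x) = ∫ x, inner ℝ (havg t k F x) (φ x) := by
  have h1 : ∀ x, inner ℝ (F x) (havg t k φ x) = ∫ z, dker t k x z * inner ℝ (F x) (φ z) := by
    intro x
    rw [havg, ← integral_inner (integrable_dker_smul hφi t k x)]
    simp only [inner_smul_right]
  have h2 : ∀ z, inner ℝ (havg t k F z) (φ z) = ∫ x, dker t k x z * inner ℝ (F x) (φ z) := by
    intro z
    rw [real_inner_comm, havg, ← integral_inner (integrable_dker_smul hF t k z)]
    simp only [inner_smul_right, dker_comm t k z, real_inner_comm (φ z)]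
  simp_rw [h1, h2]
  refine integral_integral_swap ?_
  refine ((integrable_prod_dker_mul hF.norm t k).mul_const B).mono
    ((stronglyMeasurable_dker t k).mul ((hFm.comp_measurable measurable_fst).inner
      (hφ.comp_measurable measurable_snd))).aestronglyMeasurable (ae_of_all _ fun p => ?_)
  have hB0 : 0 ≤ B := (norm_nonneg _).trans (hB 0)
  simp only [Function.uncurry, norm_mul, norm_dker, norm_norm, Real.norm_of_nonneg hB0, mul_assoc]
  have := dker_nonneg t k p.1 p.2
  gcongr
  exact (norm_inner_le_norm _ _).trans (by gcongr; exact hB _)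

lemma havg_congr_on {F G : (Fin N → ℝ) → H} {t : Fin N → ℝ} {k : ℤ} {x : Fin N → ℝ}
    (h : ∀ z ∈ dcube t k x, F z = G z) : havg t k F x = havg t k G x := by
  unfold havg
  congr 1; ext z
  by_cases hz : z ∈ dcube t k x
  · rw [h z hz]
  · simp [dker, Set.indicator_of_notMem hz]

lemma havg_const (a : H) (t : Fin N → ℝ) (k : ℤ) (x : Fin N → ℝ) :
    havg t k (fun _ => a) x = a := by
  rw [havg, integral_smul_const, integral_dker, one_smul]

lemma havg_sub {F G : (Fin N → ℝ) → H} (hF : Integrable F) (hG : Integrable G) (t : Fin N → ℝ)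
    (k : ℤ) (x : Fin N → ℝ) :
    havg t k (fun z => F z - G z) x = havg t k F x - havg t k G x := by
  simp only [havg, smul_sub]
  exact integral_sub (integrable_dker_smul hF t k x) (integrable_dker_smul hG t k x)

/-- Averaging at a coarse scale is unaffected by a previous averaging at a finer scale. -/
lemma havg_havg_of_le {c : ℤ → Fin N → ℝ} (hc : Nested c) {F : (Fin N → ℝ) → H}
    (hF : Integrable F) (hFm : StronglyMeasurable F) {j k : ℤ} (hjk : j ≤ k) (x : Fin N → ℝ) :
    havg (c k) k (havg (c j) j F) x = havg (c k) k F x := by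
  have e : ∀ y z, dker (c k) k x y * dker (c j) j y z = dker (c j) j y z * dker (c k) k x z := by
    intro y z
    by_cases hz : z ∈ dcube (c j) j y
    · have h1 := hc.mem_of_le hjk hz
      rw [mul_comm, dker_comm _ _ x, dker_comm _ _ x, dker_eq_of_mem h1]
    · simp [dker, Set.indicator_of_notMem hz]
  have e' : ∀ y, dker (c k) k x y • havg (c j) j F y =
      ∫ z, (dker (c j) j y z * dker (c k) k x z) • F z := by
    intro y
    rw [havg, ← integral_smul]
    simp only [smul_smul, e]
  conv_lhs => rw [havg]
  simp_rw [e']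
  rw [integral_integral_swap]
  · unfold havg
    congr 1; ext z
    simp_rw [mul_smul]
    rw [integral_smul_const]
    simp_rw [dker_comm (c j) j _ z]
    rw [integral_dker, one_smul]
  · have h0 := (integrable_prod_dker_mul (F := fun z => dker (c k) k x z * ‖F z‖)
      (by simpa only [norm_smul, norm_dker] using
          (integrable_dker_smul hF (c k) k x).norm) (c j) j).swap
    refine h0.mono ((StronglyMeasurable.smul ?_ (hFm.comp_measurable
      measurable_snd)).aestronglyMeasurable) (ae_of_all _ fun p => ?_)
    · exact (stronglyMeasurable_dker _ _).mul (measurable_dker k measurable_const measurable_const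
        measurable_snd).stronglyMeasurable
    · simp only [Function.uncurry, norm_smul, norm_mul, norm_dker, norm_norm, Function.comp,
        Prod.fst_swap, Prod.snd_swap, dker_comm (c j) j p.1, mul_assoc, le_refl]

/-- Averaging at a fine scale does not change averages at a coarser scale. -/
lemma havg_havg_of_ge {c : ℤ → Fin N → ℝ} (hc : Nested c) {F : (Fin N → ℝ) → H}
    {j k : ℤ} (hjk : j ≤ k) (x : Fin N → ℝ) :
    havg (c j) j (havg (c k) k F) x = havg (c k) k F x := by
  rw [havg_congr_on (G := fun _ => havg (c k) k F x) fun z hz =>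
    havg_eq_of_mem (hc.mem_of_le hjk hz) F, havg_const]

/-- The martingale difference `E_{k-1} - E_k`. -/
def hdiff (c : ℤ → Fin N → ℝ) (k : ℤ) (F : (Fin N → ℝ) → H) (x : Fin N → ℝ) : H :=
  havg (c (k - 1)) (k - 1) F x - havg (c k) k F x

lemma integrable_hdiff {F : (Fin N → ℝ) → H} (hF : Integrable F) (hFm : StronglyMeasurable F)
    (c : ℤ → Fin N → ℝ) (k : ℤ) : Integrable (hdiff c k F) :=
  (integrable_havg hF hFm _ _).sub (integrable_havg hF hFm _ _)

lemma stronglyMeasurable_hdiff {F : (Fin N → ℝ) → H} (hFm : StronglyMeasurable F)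
    (c : ℤ → Fin N → ℝ) (k : ℤ) : StronglyMeasurable (hdiff c k F) :=
  (stronglyMeasurable_havg hFm _ _).sub (stronglyMeasurable_havg hFm _ _)

lemma norm_hdiff_le {F : (Fin N → ℝ) → H} {B : ℝ} (hB : ∀ x, ‖F x‖ ≤ B) (c : ℤ → Fin N → ℝ)
    (k : ℤ) (x : Fin N → ℝ) : ‖hdiff c k F x‖ ≤ B + B :=
  (norm_sub_le _ _).trans (add_le_add (norm_havg_le hB _ _ _) (norm_havg_le hB _ _ _))

lemma hdiff_eq_of_mem {c : ℤ → Fin N → ℝ} (hc : Nested c) {k : ℤ} {x y : Fin N → ℝ}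
    (h : y ∈ dcube (c (k - 1)) (k - 1) x) (F : (Fin N → ℝ) → H) :
    hdiff c k F y = hdiff c k F x := by
  unfold hdiff
  rw [havg_eq_of_mem h, havg_eq_of_mem (hc.mem_of_le (by omega) h)]

lemma integrable_inner_of_bdd {F φ : (Fin N → ℝ) → H} (hF : Integrable F)
    (hφ : StronglyMeasurable φ) {B : ℝ} (hB : ∀ x, ‖φ x‖ ≤ B) :
    Integrable fun x => inner ℝ (F x) (φ x) :=
  (hF.norm.mul_const B).mono' (hF.aestronglyMeasurable.inner hφ.aestronglyMeasurable)
    (ae_of_all _ fun x => (norm_inner_le_norm _ _).trans (by gcongr; exact hB x))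

lemma integral_inner_hdiff {F φ : (Fin N → ℝ) → H} (hF : Integrable F) (hFm : StronglyMeasurable F)
    (hφ : StronglyMeasurable φ) {B : ℝ} (hB : ∀ x, ‖φ x‖ ≤ B) (hφi : Integrable φ)
    (c : ℤ → Fin N → ℝ) (k : ℤ) :
    ∫ x, inner ℝ (F x) (hdiff c k φ x) = ∫ x, inner ℝ (hdiff c k F x) (φ x) := by
  simp only [hdiff, inner_sub_right, inner_sub_left]
  rw [integral_sub, integral_sub, integral_inner_havg hF hFm hφ hB hφi,
    integral_inner_havg hF hFm hφ hB hφi]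
  · exact integrable_inner_of_bdd (integrable_havg hF hFm _ _) hφ hB
  · exact integrable_inner_of_bdd (integrable_havg hF hFm _ _) hφ hB
  · exact integrable_inner_of_bdd hF (stronglyMeasurable_havg hφ _ _) (norm_havg_le hB _ _)
  · exact integrable_inner_of_bdd hF (stronglyMeasurable_havg hφ _ _) (norm_havg_le hB _ _)

lemma hdiff_hdiff {c : ℤ → Fin N → ℝ} (hc : Nested c) {F : (Fin N → ℝ) → H}
    (hF : Integrable F) (hFm : StronglyMeasurable F) (k : ℤ) (x : Fin N → ℝ) :
    hdiff c k (hdiff c k F) x = hdiff c k F x := by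
  have hi := fun k => integrable_havg hF hFm (c k) k
  conv_lhs => unfold hdiff
  rw [havg_sub (hi _) (hi _), havg_sub (hi _) (hi _), havg_havg_of_le hc hF hFm le_rfl,
    havg_havg_of_ge hc (by omega), havg_havg_of_le hc hF hFm (by omega),
    havg_havg_of_le hc hF hFm le_rfl, sub_self, sub_zero]
  rfl

lemma integral_inner_hdiff_hdiff {c : ℤ → Fin N → ℝ} (hc : Nested c) {F φ : (Fin N → ℝ) → H}
    (hF : Integrable F) (hFm : StronglyMeasurable F)
    (hφ : StronglyMeasurable φ) {B : ℝ} (hB : ∀ x, ‖φ x‖ ≤ B) (hφi : Integrable φ) (k : ℤ) :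
    ∫ x, inner ℝ (F x) (hdiff c k φ x) = ∫ x, inner ℝ (hdiff c k F x) (hdiff c k φ x) := by
  rw [← integral_inner_hdiff hF hFm (stronglyMeasurable_hdiff hφ c k) (norm_hdiff_le hB c k)
    (integrable_hdiff hφi hφ c k)]
  simp only [hdiff_hdiff hc hφi hφ]

lemma sum_hdiff (c : ℤ → Fin N → ℝ) (K : ℤ) (n : ℕ) (F : (Fin N → ℝ) → H) (x : Fin N → ℝ) :
    ∑ i ∈ Finset.range n, hdiff c (K - i) F x =
      havg (c (K - n)) (K - n) F x - havg (c K) K F x := by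
  induction n with
  | zero => simp
  | succ n ih =>
    rw [Finset.sum_range_succ, ih, hdiff]
    push_cast
    rw [show K - (n : ℤ) - 1 = K - (n + 1) by ring]
    abel

/-- The sum of the squares of martingale differences is bounded on `L²`. -/
lemma sum_lintegral_hdiff_sq_le {c : ℤ → Fin N → ℝ} (hc : Nested c) {φ : (Fin N → ℝ) → H}
    (hφ : StronglyMeasurable φ) {B : ℝ} (hB : ∀ x, ‖φ x‖ ≤ B) (hφi : Integrable φ) (K : ℤ)
    (n : ℕ) :
    ∑ i ∈ Finset.range n, ∫⁻ x, ‖hdiff c (K - i) φ x‖ₑ ^ 2 ≤ ∫⁻ x, ‖φ x‖ₑ ^ 2 := by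
  have conv : ∀ {ψ : (Fin N → ℝ) → H}, Integrable ψ → StronglyMeasurable ψ → ∀ {B : ℝ},
      (∀ x, ‖ψ x‖ ≤ B) → ∫⁻ x, ‖ψ x‖ₑ ^ 2 = ENNReal.ofReal (∫ x, inner ℝ (ψ x) (ψ x)) := by
    intro ψ hi hm B hB
    rw [ofReal_integral_eq_lintegral_ofReal (integrable_inner_of_bdd hi hm hB)
      (ae_of_all _ fun x => real_inner_self_nonneg)]
    congr 1; ext x
    rw [real_inner_self_eq_norm_sq, ENNReal.ofReal_pow (norm_nonneg _), ofReal_norm]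
  rw [conv hφi hφ hB]
  simp_rw [fun i : ℕ => conv (integrable_hdiff hφi hφ c (K - i)) (stronglyMeasurable_hdiff hφ c _)
    (norm_hdiff_le hB c _)]
  rw [← ENNReal.ofReal_sum_of_nonneg fun i _ => integral_nonneg fun x => real_inner_self_nonneg]
  apply ENNReal.ofReal_le_ofReal
  have hA := fun k => integrable_inner_of_bdd hφi (stronglyMeasurable_havg hφ (c k) k)
    (norm_havg_le hB (c k) k)
  have hAA : ∀ k, ∫ x, inner ℝ (φ x) (havg (c k) k φ x) =
      ∫ x, inner ℝ (havg (c k) k φ x) (havg (c k) k φ x) := by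
    intro k
    rw [← integral_inner_havg hφi hφ (stronglyMeasurable_havg hφ _ _) (norm_havg_le hB _ _)
      (integrable_havg hφi hφ _ _)]
    simp only [havg_havg_of_le hc hφi hφ le_rfl]
  calc ∑ i ∈ Finset.range n, ∫ x, inner ℝ (hdiff c (K - i) φ x) (hdiff c (K - i) φ x)
      = ∑ i ∈ Finset.range n, ∫ x, inner ℝ (φ x) (hdiff c (K - i) φ x) := by
        refine Finset.sum_congr rfl fun i _ => ?_
        rw [integral_inner_hdiff_hdiff hc hφi hφ hφ hB hφi]
    _ = (∫ x, inner ℝ (φ x) (havg (c (K - n)) (K - n) φ x)) -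
          ∫ x, inner ℝ (φ x) (havg (c K) K φ x) := by
        rw [← integral_finsetSum _ fun i _ => integrable_inner_of_bdd hφi
          (stronglyMeasurable_hdiff hφ c _) (norm_hdiff_le hB c _)]
        simp only [← inner_sum, sum_hdiff, inner_sub_right]
        exact integral_sub (hA _) (hA _)
    _ ≤ ∫ x, inner ℝ (φ x) (havg (c (K - n)) (K - n) φ x) := by
        rw [hAA K]
        exact sub_le_self _ (integral_nonneg fun x =>
            real_inner_self_nonneg (x := havg (c K) K φ x))
    _ ≤ ∫ x, inner ℝ (φ x) (φ x) := by
        set E := havg (c (K - n)) (K - n) φ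
        have hEE : Integrable fun x => inner ℝ (E x) (E x) :=
          integrable_inner_of_bdd (integrable_havg hφi hφ _ _) (stronglyMeasurable_havg hφ _ _)
            (norm_havg_le hB _ _)
        have h0 : 0 ≤ ∫ x, (inner ℝ (φ x) (φ x) - (inner ℝ (φ x) (E x) + inner ℝ (φ x) (E x)) +
            inner ℝ (E x) (E x)) := by
          refine integral_nonneg fun x => ?_
          have := real_inner_self_nonneg (x := φ x - E x)
          rw [inner_sub_sub_self, real_inner_comm (φ x) (E x)] at this
          simpa [sub_sub] using this
        have hE : Integrable fun x => inner ℝ (φ x) (E x) := hA _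
        have hS : Integrable fun x => inner ℝ (φ x) (E x) + inner ℝ (φ x) (E x) := hE.add hE
        have hD : Integrable fun x => inner ℝ (φ x) (φ x) -
            (inner ℝ (φ x) (E x) + inner ℝ (φ x) (E x)) :=
          (integrable_inner_of_bdd hφi hφ hB).sub hS
        rw [integral_add hD hEE, integral_sub (integrable_inner_of_bdd hφi hφ hB) hS,
          integral_add hE hE, ← hAA] at h0
        linarith

end Martingale

section DyadicDuality

variable {N : ℕ} {H : Type*} [NormedAddCommGroup H] [InnerProductSpace ℝ H] [CompleteSpace H]

/-- The mean square oscillation of `b` over balls is at most `M` (up to normalization). -/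
def BMOBound (b : (Fin N → ℝ) → H) (M : NNReal) : Prop :=
  ∀ z₀ : Fin N → ℝ, ∀ l : ℝ, 0 < l →
    ∃ a : H, ∫⁻ z in Metric.closedBall z₀ l, ‖b z - a‖ₑ ^ 2 ≤ M * ENNReal.ofReal (l ^ N)

lemma dcube_subset_closedBall (t : Fin N → ℝ) (k : ℤ) (x : Fin N → ℝ) :
    dcube t k x ⊆ Metric.closedBall x ((2 : ℝ) ^ k) := fun y hy => by
  rw [Metric.mem_closedBall, dist_eq_norm]
  exact norm_sub_le_of_mem_dcube hy

lemma tendsto_havg_of_continuous (c : ℤ → Fin N → ℝ) {b : (Fin N → ℝ) → H} (hb : Continuous b)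
    (hbi : Integrable b) (x : Fin N → ℝ) :
    Tendsto (fun m : ℕ => havg (c (-m)) (-m) b x) atTop (𝓝 (b x)) := by
  rw [Metric.tendsto_atTop]
  intro ε hε
  obtain ⟨δ, hδ, h⟩ := Metric.continuous_iff.1 hb x (ε / 2) (by positivity)
  obtain ⟨m₀, hm₀⟩ := exists_pow_lt_of_lt_one hδ (by norm_num : (1 / 2 : ℝ) < 1)
  refine ⟨m₀, fun m hm => ?_⟩
  set t := c (-m)
  have hsm : (2 : ℝ) ^ (-(m : ℤ)) < δ := by
    rw [zpow_neg, zpow_natCast, ← inv_pow]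
    refine lt_of_le_of_lt ?_ hm₀
    rw [one_div]
    exact pow_le_pow_of_le_one (by norm_num) (by norm_num) hm
  have e : havg t (-m) b x - b x = ∫ z, dker t (-m) x z • (b z - b x) := by
    simp only [smul_sub]
    rw [integral_sub (integrable_dker_smul hbi t _ x) ((integrable_dker t _ x).smul_const _),
      integral_smul_const, integral_dker, one_smul]
    rfl
  rw [dist_eq_norm, e]
  calc _ ≤ ∫ z, dker t (-m) x z * (ε / 2) := norm_integral_le_of_norm_le
          ((integrable_dker t (-m) x).mul_const _) (ae_of_all _ fun z => by
            rw [norm_smul, norm_dker]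
            by_cases hz : z ∈ dcube t (-m) x
            · have := dker_nonneg t (-m) x z
              gcongr
              rw [← dist_eq_norm]
              refine (h z ?_).le
              rw [dist_eq_norm]
              exact (norm_sub_le_of_mem_dcube hz).trans_lt hsm
            · simp [dker, Set.indicator_of_notMem hz])
    _ = ε / 2 := by rw [integral_mul_const, integral_dker, one_mul]
    _ < ε := by linarith

lemma tendsto_havg_zero (hN : 0 < N) (c : ℤ → Fin N → ℝ) {b : (Fin N → ℝ) → H}
    (hbi : Integrable b) (x : Fin N → ℝ) :
    Tendsto (fun m : ℕ => havg (c m) m b x) atTop (𝓝 0) := by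
  refine squeeze_zero_norm (fun m => norm_havg_le_norm_lintegral hbi (c m) m x) ?_
  rw [← zero_mul (∫ z, ‖b z‖)]
  refine Tendsto.mul_const _ ?_
  simp only [zpow_natCast, ← pow_mul]
  refine tendsto_inv_atTop_zero.comp ?_
  refine (tendsto_pow_atTop_atTop_of_one_lt (by norm_num)).comp ?_
  exact tendsto_id.atTop_mul_const' hN

lemma lintegral_dcube_hdiff_sq_le {c : ℤ → Fin N → ℝ} (hc : Nested c) {b : (Fin N → ℝ) → H}
    (hb : StronglyMeasurable b) {B : ℝ} (hB : ∀ x, ‖b x‖ ≤ B) (hbi : Integrable b) {M : NNReal}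
    (hM : BMOBound b M) (K : ℤ) (n : ℕ) (x : Fin N → ℝ) :
    ∫⁻ y in dcube (c K) K x, ∑ i ∈ Finset.range n, ‖hdiff c (K - i) b y‖ₑ ^ 2 ≤
      M * ENNReal.ofReal (((2 : ℝ) ^ K) ^ N) := by
  obtain ⟨a, ha⟩ := hM x (2 ^ K) (by positivity)
  set Q := dcube (c K) K x with hQ
  have hQm : MeasurableSet Q := measurableSet_dcube _ _ _
  have hQv : volume Q ≠ ⊤ := by rw [hQ, volume_dcube]; exact ENNReal.ofReal_ne_top
  have i1 : Integrable (Q.indicator b) := hbi.indicator hQm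
  have i2 : Integrable (Q.indicator fun _ => a) :=
    (integrable_indicator_iff hQm).2 (integrableOn_const hQv)
  set φ := fun z => Q.indicator b z - Q.indicator (fun _ => a) z with hφ
  have hφm : StronglyMeasurable φ :=
    (hb.indicator hQm).sub (stronglyMeasurable_const.indicator hQm)
  have hφB : ∀ z, ‖φ z‖ ≤ B + ‖a‖ := fun z => (norm_sub_le _ _).trans (add_le_add
    ((norm_indicator_le_norm_self _ _).trans (hB z)) (norm_indicator_le_norm_self _ _))
  have hav : ∀ k ≤ K, ∀ y ∈ Q, havg (c k) k φ y = havg (c k) k b y - a := by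
    intro k hk y hy
    have hsub : ∀ z ∈ dcube (c k) k y, z ∈ Q := fun z hz =>
      (dcube_eq_of_mem hy).subset (hc.mem_of_le hk hz)
    rw [hφ, havg_sub i1 i2, havg_congr_on (F := Q.indicator b) (G := b)
      fun z hz => Set.indicator_of_mem (hsub z hz) _,
      havg_congr_on (F := Q.indicator fun _ => a) (G := fun _ => a)
          fun z hz => Set.indicator_of_mem (hsub z hz) _, havg_const]
  calc _ = ∫⁻ y in Q, ∑ i ∈ Finset.range n, ‖hdiff c (K - i) φ y‖ₑ ^ 2 := by
        refine setLIntegral_congr_fun hQm fun y hy => Finset.sum_congr rfl fun i _ => ?_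
        simp only [hdiff]
        rw [hav _ (by omega) y hy, hav _ (by omega) y hy]
        abel_nf
    _ ≤ ∫⁻ y, ∑ i ∈ Finset.range n, ‖hdiff c (K - i) φ y‖ₑ ^ 2 := setLIntegral_le_lintegral _ _
    _ = ∑ i ∈ Finset.range n, ∫⁻ y, ‖hdiff c (K - i) φ y‖ₑ ^ 2 :=
        lintegral_finsetSum _ fun i _ => (stronglyMeasurable_hdiff hφm c _).enorm.pow_const 2
    _ ≤ ∫⁻ y, ‖φ y‖ₑ ^ 2 := sum_lintegral_hdiff_sq_le hc hφm hφB (i1.sub i2) K n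
    _ = ∫⁻ y in Q, ‖b y - a‖ₑ ^ 2 := by
        rw [← lintegral_indicator hQm]
        congr 1; ext y
        by_cases hy : y ∈ Q <;> simp [hφ, hy]
    _ ≤ _ := (lintegral_mono_set (dcube_subset_closedBall _ _ _)).trans ha

lemma ofReal_integral_inner_le_lintegral {α : Type*} [MeasurableSpace α] {μ : Measure α}
    (f g : α → H) :
    ENNReal.ofReal (∫ x, inner ℝ (f x) (g x) ∂μ) ≤ ∫⁻ x, ‖f x‖ₑ * ‖g x‖ₑ ∂μ := by
  refine (ENNReal.ofReal_le_ofReal (le_abs_self _)).trans ?_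
  rw [← Real.norm_eq_abs, ofReal_norm]
  refine (enorm_integral_le_lintegral_enorm _).trans (lintegral_mono fun x => ?_)
  rw [← enorm_norm (f x), ← enorm_norm (g x), ← enorm_mul]
  rw [enorm_le_iff_norm_le, norm_mul, norm_norm, norm_norm]
  exact norm_inner_le_norm _ _

lemma lintegral_dcube_pred_hdiff_sq_le {c : ℤ → Fin N → ℝ} (hc : Nested c)
    {b : (Fin N → ℝ) → H} (hb : StronglyMeasurable b) {B : ℝ} (hB : ∀ x, ‖b x‖ ≤ B)
    (hbi : Integrable b) {M : NNReal} (hM : BMOBound b M) (K : ℤ) {i n : ℕ}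
    (x : Fin N → ℝ) :
    ∫⁻ y in dcube (c (K - i - 1)) (K - i - 1) x,
      ∑ j ∈ Finset.Ico i n, ‖hdiff c (K - j) b y‖ₑ ^ 2 ≤
      (2 ^ N * M : NNReal) * ENNReal.ofReal (((2 : ℝ) ^ (K - i - 1)) ^ N) := by
  have hsub : dcube (c (K - i - 1)) (K - i - 1) x ⊆ dcube (c (K - i)) (K - i) x :=
    fun y hy => hc.mem_of_le (by omega) hy
  refine (lintegral_mono_set hsub).trans ?_
  have h1 := lintegral_dcube_hdiff_sq_le hc hb hB hbi hM (K - i) (n - i) x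
  simp only [Finset.sum_Ico_eq_sum_range]
  simp only [sub_sub] at h1
  push_cast
  refine h1.trans (le_of_eq ?_)
  have e : ((2 : ℝ) ^ (K - i)) ^ N = 2 ^ N * ((2 : ℝ) ^ (K - i - 1)) ^ N := by
    rw [← mul_pow, zpow_sub_one₀ two_ne_zero]; congr 1; ring
  rw [e, ENNReal.ofReal_mul (by positivity), ENNReal.ofReal_pow (by norm_num)]
  simp only [ENNReal.ofReal_ofNat]
  ring

/-- Garsia's inequality for a sequence of partitions into dyadic cubes. -/
lemma garsia_dcube (t : ℕ → Fin N → ℝ) (s : ℕ → ℤ) (n : ℕ) {a : ℕ → (Fin N → ℝ) → NNReal}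
    (ha : ∀ i, Measurable (a i))
    (hac : ∀ i j x y, j ≤ i → y ∈ dcube (t i) (s i) x → a j y = a j x)
    {b : ℕ → (Fin N → ℝ) → ℝ≥0∞} (hb : ∀ i, Measurable (b i)) {M : ℝ≥0∞}
    (hM : ∀ i < n, ∀ x, ∫⁻ y in dcube (t i) (s i) x, ∑ j ∈ Finset.Ico i n, b j y ^ 2 ≤
      M * ENNReal.ofReal (((2 : ℝ) ^ s i) ^ N)) :
    ∑ i ∈ Finset.range n, ∫⁻ x, a i x * b i x ≤
      (1 + M) * ∫⁻ x, (NNReal.sqrt (∑ i ∈ Finset.range n, a i x ^ 2) : ℝ≥0∞) := by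
  refine garsia (μ := (volume : Measure (Fin N → ℝ))) n (Q := fun i x => dcube (t i) (s i) x)
    (fun i => measurableSet_mem_dcube _ measurable_const measurable_fst measurable_snd)
    (fun i x y h => mem_dcube_symm h) (v := fun i => ENNReal.ofReal (((2 : ℝ) ^ s i) ^ N))
    (fun i => ?_) (fun i => ENNReal.ofReal_ne_top) (fun i x => volume_dcube _ _ _) ha hac hb hM
  rw [Ne, ENNReal.ofReal_eq_zero, not_le]
  positivity

lemma ofReal_integral_inner_havg_sub_le {c : ℤ → Fin N → ℝ} (hc : Nested c)
    {F b : (Fin N → ℝ) → H} (hF : Integrable F) (hFm : StronglyMeasurable F)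
    (hb : StronglyMeasurable b) {B : ℝ} (hB : ∀ x, ‖b x‖ ≤ B) (hbi : Integrable b) {M : NNReal}
    (hM : BMOBound b M) (K : ℤ) (n : ℕ) :
    ENNReal.ofReal (∫ x, inner ℝ (F x) (havg (c (K - n)) (K - n) b x - havg (c K) K b x)) ≤
      (1 + 2 ^ N * M) * ∫⁻ x, (∑' k, ‖hdiff c k F x‖ₑ ^ 2) ^ (1 / 2 : ℝ) := by
  have hm : ∀ k (G : (Fin N → ℝ) → H), StronglyMeasurable G →
      Measurable fun x => ‖hdiff c k G x‖₊ := fun k G hG =>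
    (stronglyMeasurable_hdiff hG c k).nnnorm.measurable
  have hcon : ∀ (i j : ℕ) (x y : Fin N → ℝ), j ≤ i → y ∈ dcube (c (K - i - 1)) (K - i - 1) x →
      ‖hdiff c (K - j) F y‖₊ = ‖hdiff c (K - j) F x‖₊ := fun i j x y hij h => by
    have h1 : K - (i : ℤ) - 1 ≤ K - j - 1 := by omega
    rw [hdiff_eq_of_mem hc (hc.mem_of_le h1 h) F]
  have hcar := fun i (_ : i < n) x =>
    lintegral_dcube_pred_hdiff_sq_le hc hb hB hbi hM K (i := i) (n := n) x
  have hG := garsia_dcube (fun i : ℕ => c (K - i - 1)) (fun i : ℕ => K - i - 1) n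
    (a := fun i x => ‖hdiff c (K - i) F x‖₊) (fun i => hm _ F hFm) hcon
    (b := fun i x => ‖hdiff c (K - i) b x‖ₑ)
    (fun i => (stronglyMeasurable_hdiff hb c _).enorm) (M := (2 ^ N * M : NNReal)) hcar
  refine (le_of_eq ?_).trans (((Finset.le_sum_of_subadditive _ ENNReal.ofReal_zero.le
    (fun _ _ => ENNReal.ofReal_add_le) _ _).trans (Finset.sum_le_sum fun i _ =>
    ofReal_integral_inner_le_lintegral _ _)).trans (hG.trans ?_))
  · congr 1
    simp_rw [← sum_hdiff, inner_sum]
    rw [integral_finsetSum _ fun i _ => integrable_inner_of_bdd hF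
      (stronglyMeasurable_hdiff hb c _) (norm_hdiff_le hB c _)]
    exact Finset.sum_congr rfl fun i _ => integral_inner_hdiff_hdiff hc hF hFm hb hB hbi _
  push_cast
  gcongr with x
  rw [NNReal.sqrt_eq_rpow, ENNReal.coe_rpow_of_nonneg _ (by norm_num)]
  gcongr
  push_cast
  have := ENNReal.sum_le_tsum (f := fun k => ‖hdiff c k F x‖ₑ ^ 2)
    ((Finset.range n).map ⟨fun i : ℕ => K - (i : ℤ), fun i j h => by simpa using h⟩)
  rw [Finset.sum_map] at this
  exact this

/-- Duality between the dyadic Hardy space and functions of bounded mean oscillation. -/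
lemma ofReal_integral_inner_le_of_bmo (hN : 0 < N) {c : ℤ → Fin N → ℝ} (hc : Nested c)
    {F b : (Fin N → ℝ) → H} (hF : Integrable F) (hFm : StronglyMeasurable F)
    (hb : StronglyMeasurable b) (hbc : Continuous b) {B : ℝ} (hB : ∀ x, ‖b x‖ ≤ B)
    (hbi : Integrable b) {M : NNReal} (hM : BMOBound b M) :
    ENNReal.ofReal (∫ x, inner ℝ (F x) (b x)) ≤
      (1 + 2 ^ N * M) * ∫⁻ x, (∑' k, ‖hdiff c k F x‖ₑ ^ 2) ^ (1 / 2 : ℝ) := by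
  have hlim : Tendsto (fun m : ℕ => ENNReal.ofReal
      (∫ x, inner ℝ (F x) (havg (c (-m)) (-m) b x - havg (c m) m b x))) atTop
      (𝓝 (ENNReal.ofReal (∫ x, inner ℝ (F x) (b x)))) := by
    refine ENNReal.tendsto_ofReal (tendsto_integral_of_dominated_convergence
      (fun x => ‖F x‖ * (B + B)) (fun m => ?_) (hF.norm.mul_const _) (fun m => ae_of_all _ fun x =>
        (norm_inner_le_norm _ _).trans ?_) (ae_of_all _ fun x => ?_))
    · exact hFm.aestronglyMeasurable.inner ((stronglyMeasurable_havg hb _ _).sub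
        (stronglyMeasurable_havg hb _ _)).aestronglyMeasurable
    · gcongr
      exact (norm_sub_le _ _).trans (add_le_add (norm_havg_le hB _ _ _) (norm_havg_le hB _ _ _))
    · have h := (tendsto_havg_of_continuous c hbc hbi x).sub (tendsto_havg_zero hN c hbi x)
      rw [sub_zero] at h
      exact tendsto_const_nhds.inner h
  refine le_of_tendsto' hlim fun m => ?_
  have := ofReal_integral_inner_havg_sub_le hc hF hFm hb hB hbi hM m (2 * m)
  rw [show (m : ℤ) - ((2 * m : ℕ) : ℤ) = -m by push_cast; ring] at this
  exact this

end DyadicDuality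

section CalderonZygmund

variable {N : ℕ} {H : Type*} [NormedAddCommGroup H] [InnerProductSpace ℝ H] [CompleteSpace H]
variable {Θ : Type*} [MeasurableSpace Θ]

lemma lintegral_mul_le_sqrt {α : Type*} [MeasurableSpace α] {μ : Measure α} {f g : α → ℝ≥0∞}
    (hf : AEMeasurable f μ) (hg : AEMeasurable g μ) :
    ∫⁻ x, f x * g x ∂μ ≤ (∫⁻ x, f x ^ 2 ∂μ) ^ (1 / 2 : ℝ) * (∫⁻ x, g x ^ 2 ∂μ) ^ (1 / 2 : ℝ) := by
  have := ENNReal.lintegral_mul_le_Lp_mul_Lq μ Real.HolderConjugate.two_two hf hg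
  simpa using this

/-- Applying an `x`-dependent family `θ ↦ K x θ` of kernels to a function. -/
def kerApply (K : (Fin N → ℝ) → Θ → (Fin N → ℝ) → ℝ) (F : (Fin N → ℝ) → H) (x : Fin N → ℝ)
    (θ : Θ) : H := ∫ z, K x θ z • F z

lemma enorm_integral_smul_le {σ : Measure (Fin N → ℝ)} {τ : Measure Θ} [SFinite σ] [SFinite τ]
    {G : (Fin N → ℝ) × Θ → H} (hGm : StronglyMeasurable G)
    (hG : ∀ x, ∫⁻ θ, ‖G (x, θ)‖ₑ ^ 2 ∂τ ≤ 1) {f : (Fin N → ℝ) × Θ → ℝ} (hf : Measurable f) :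
    ‖∫ p, f p • G p ∂(σ.prod τ)‖ₑ ≤ ∫⁻ x, (∫⁻ θ, ‖f (x, θ)‖ₑ ^ 2 ∂τ) ^ (1 / 2 : ℝ) ∂σ := by
  refine (enorm_integral_le_lintegral_enorm _).trans ?_
  have hm : AEMeasurable (fun p => ‖f p • G p‖ₑ) (σ.prod τ) :=
    (hf.stronglyMeasurable.smul hGm).enorm.aemeasurable
  rw [lintegral_prod _ hm]
  refine lintegral_mono fun x => ?_
  simp only [enorm_smul]
  refine (lintegral_mul_le_sqrt (hf.comp measurable_prodMk_left).enorm.aemeasurable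
    (hGm.comp_measurable measurable_prodMk_left).enorm.aemeasurable).trans ?_
  refine (mul_le_mul_right (ENNReal.rpow_le_rpow (hG x) (by norm_num)) _).trans ?_
  rw [ENNReal.one_rpow, mul_one]
  exact le_rfl

/-- The quantitative hypotheses under which the truncated kernel is harmless. -/
structure TruncBound (K : (Fin N → ℝ) → Θ → (Fin N → ℝ) → ℝ) (ν : Measure Θ) (R : ℝ)
    (A : Set Θ) (B : ℝ) : Prop where
  measurableSet : MeasurableSet A
  measure_lt_top : ν A < ⊤
  bound : ∀ x, ∀ θ ∈ A, ∀ z, |K x θ z| ≤ B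
  decay : ∀ x, ‖x‖ ≤ R → ∀ θ ∈ A, ∀ z, |K x θ z| ≤ B * (1 + ‖z‖) ^ (-((N : ℝ) + 1))
  cont : ∀ x z z', ∫⁻ θ in A, ‖K x θ z - K x θ z'‖ₑ ^ 2 ∂ν ≤ ENNReal.ofReal (B * ‖z - z'‖)

/-- Uniform `L²` boundedness of the family of operators with kernels `K`. -/
def L2Bound (H : Type*) [NormedAddCommGroup H] [InnerProductSpace ℝ H]
    (K : (Fin N → ℝ) → Θ → (Fin N → ℝ) → ℝ) (ν : Measure Θ) (C : NNReal) : Prop :=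
  ∀ φ : (Fin N → ℝ) → H, StronglyMeasurable φ → (∃ B, ∀ x, ‖φ x‖ ≤ B) → Integrable φ →
    ∫⁻ x, ∫⁻ θ, ‖kerApply K φ x θ‖ₑ ^ 2 ∂ν ≤ C * ∫⁻ x, ‖φ x‖ₑ ^ 2

/-- A Hörmander type condition for the family of kernels `K`. -/
def HorBound (K : (Fin N → ℝ) → Θ → (Fin N → ℝ) → ℝ) (ν : Measure Θ) (C : NNReal) : Prop :=
  ∀ z₀ z : Fin N → ℝ, ∀ l : ℝ, 0 < l → ‖z - z₀‖ ≤ l →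
    ∫⁻ x in (Metric.closedBall z₀ (4 * l))ᶜ,
      (∫⁻ θ, ‖K x θ z - K x θ z₀‖ₑ ^ 2 ∂ν) ^ (1 / 2 : ℝ) ≤ C

section Dual

variable {K : (Fin N → ℝ) → Θ → (Fin N → ℝ) → ℝ} {ν : Measure Θ} [SFinite ν] {R B : ℝ}
  {A : Set Θ} {G : (Fin N → ℝ) × Θ → H}

/-- The adjoint of the truncation of `kerApply K`. -/
def kerDual (K : (Fin N → ℝ) → Θ → (Fin N → ℝ) → ℝ) (ν : Measure Θ) (R : ℝ) (A : Set Θ)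
    (G : (Fin N → ℝ) × Θ → H) (z : Fin N → ℝ) : H :=
  ∫ p, K p.1 p.2 z • G p ∂((volume.restrict (Metric.closedBall 0 R)).prod (ν.restrict A))

lemma measurable_ker_left (hK : Measurable fun p : ((Fin N → ℝ) × Θ) × (Fin N → ℝ) =>
    K p.1.1 p.1.2 p.2) (z : Fin N → ℝ) : Measurable fun p : (Fin N → ℝ) × Θ => K p.1 p.2 z :=
  hK.comp (measurable_id.prodMk measurable_const)

lemma TruncBound.isFiniteMeasure (hT : TruncBound K ν R A B) :
    IsFiniteMeasure (ν.restrict A) := ⟨by simpa using hT.measure_lt_top⟩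

lemma TruncBound.lintegral_le (hT : TruncBound K ν R A B) (hGm : StronglyMeasurable G)
    (hG : ∀ x, ∫⁻ θ in A, ‖G (x, θ)‖ₑ ^ 2 ∂ν ≤ 1) :
    Integrable G ((volume.restrict (Metric.closedBall 0 R)).prod (ν.restrict A)) := by
  have := hT.isFiniteMeasure
  refine ⟨hGm.aestronglyMeasurable, ?_⟩
  rw [hasFiniteIntegral_iff_enorm, lintegral_prod _ hGm.enorm.aemeasurable]
  calc _ ≤ ∫⁻ x in Metric.closedBall (0 : Fin N → ℝ) R, (ν A) ^ (1 / 2 : ℝ) := by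
        refine lintegral_mono fun x => ?_
        have := lintegral_mul_le_sqrt (μ := ν.restrict A) (f := fun _ => 1) aemeasurable_const
          (hGm.comp_measurable (measurable_prodMk_left (x := x))).enorm.aemeasurable
        simp only [one_mul, one_pow, lintegral_one, Measure.restrict_apply_univ] at this
        refine this.trans ?_
        refine (mul_le_mul_right (ENNReal.rpow_le_rpow (hG x) (by norm_num)) _).trans ?_
        rw [ENNReal.one_rpow, mul_one]
    _ < ⊤ := by
        rw [lintegral_const, Measure.restrict_apply_univ]
        exact ENNReal.mul_lt_top (ENNReal.rpow_lt_top_of_nonneg (by norm_num)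
          hT.measure_lt_top.ne) measure_closedBall_lt_top

lemma TruncBound.ae_mem (hT : TruncBound K ν R A B) :
    ∀ᵐ p ∂((volume.restrict (Metric.closedBall (0 : Fin N → ℝ) R)).prod (ν.restrict A)),
      ‖p.1‖ ≤ R ∧ p.2 ∈ A := by
  rw [Measure.prod_restrict]
  filter_upwards [ae_restrict_mem (measurableSet_closedBall.prod hT.measurableSet)] with p hp
  exact ⟨by simpa using hp.1, hp.2⟩

lemma TruncBound.integrable_smul (hT : TruncBound K ν R A B)
    (hK : Measurable fun p : ((Fin N → ℝ) × Θ) × (Fin N → ℝ) => K p.1.1 p.1.2 p.2)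
    (hGm : StronglyMeasurable G) (hG : ∀ x, ∫⁻ θ in A, ‖G (x, θ)‖ₑ ^ 2 ∂ν ≤ 1) (z : Fin N → ℝ) :
    Integrable (fun p => K p.1 p.2 z • G p)
      ((volume.restrict (Metric.closedBall 0 R)).prod (ν.restrict A)) :=
  (hT.lintegral_le hGm hG).bdd_smul B (measurable_ker_left hK z).aestronglyMeasurable
    (hT.ae_mem.mono fun _ hp => hT.bound _ _ hp.2 _)

lemma stronglyMeasurable_kerDual [IsFiniteMeasure (ν.restrict A)]
    (hK : Measurable fun p : ((Fin N → ℝ) × Θ) × (Fin N → ℝ) => K p.1.1 p.1.2 p.2)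
    (hGm : StronglyMeasurable G) : StronglyMeasurable (kerDual K ν R A G) := by
  unfold kerDual
  exact StronglyMeasurable.integral_prod_right (f := fun z (p : (Fin N → ℝ) × Θ) =>
    K p.1 p.2 z • G p) ((hK.comp measurable_swap).stronglyMeasurable.smul
    (hGm.comp_measurable measurable_snd))

lemma TruncBound.norm_kerDual_le (hT : TruncBound K ν R A B) (hGm : StronglyMeasurable G)
    (hG : ∀ x, ∫⁻ θ in A, ‖G (x, θ)‖ₑ ^ 2 ∂ν ≤ 1) :
    ∃ J : ℝ, 0 ≤ J ∧ ∀ z, ‖kerDual K ν R A G z‖ ≤ B * (1 + ‖z‖) ^ (-((N : ℝ) + 1)) * J := by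
  refine ⟨∫ p, ‖G p‖ ∂((volume.restrict (Metric.closedBall 0 R)).prod (ν.restrict A)),
    integral_nonneg fun _ => norm_nonneg _, fun z => ?_⟩
  rw [← integral_const_mul]
  refine norm_integral_le_of_norm_le ((hT.lintegral_le hGm hG).norm.const_mul _)
    (hT.ae_mem.mono fun p hp => ?_)
  rw [norm_smul]
  gcongr
  exact hT.decay _ hp.1 _ hp.2 _

lemma integrable_one_add_norm_rpow :
    Integrable fun z : Fin N → ℝ => (1 + ‖z‖) ^ (-((N : ℝ) + 1)) :=
  integrable_one_add_norm (by simp)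

lemma TruncBound.integrable_kerDual (hT : TruncBound K ν R A B)
    (hK : Measurable fun p : ((Fin N → ℝ) × Θ) × (Fin N → ℝ) => K p.1.1 p.1.2 p.2)
    (hGm : StronglyMeasurable G) (hG : ∀ x, ∫⁻ θ in A, ‖G (x, θ)‖ₑ ^ 2 ∂ν ≤ 1) :
    Integrable (kerDual K ν R A G) := by
  have := hT.isFiniteMeasure
  obtain ⟨J, hJ, h⟩ := hT.norm_kerDual_le hGm hG
  exact ((integrable_one_add_norm_rpow.const_mul B).mul_const J).mono'
    (stronglyMeasurable_kerDual hK hGm).aestronglyMeasurable (ae_of_all _ h)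

lemma TruncBound.bounded_kerDual (hT : TruncBound K ν R A B) (hB : 0 ≤ B)
    (hGm : StronglyMeasurable G) (hG : ∀ x, ∫⁻ θ in A, ‖G (x, θ)‖ₑ ^ 2 ∂ν ≤ 1) :
    ∃ J : ℝ, ∀ z, ‖kerDual K ν R A G z‖ ≤ J := by
  obtain ⟨J, hJ, h⟩ := hT.norm_kerDual_le hGm hG
  refine ⟨B * J, fun z => (h z).trans ?_⟩
  gcongr
  refine mul_le_of_le_one_right hB (Real.rpow_le_one_of_one_le_of_nonpos ?_ ?_)
  · linarith [norm_nonneg z]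
  · have : (0 : ℝ) ≤ N := Nat.cast_nonneg N
    linarith

lemma TruncBound.kerDual_sub (hT : TruncBound K ν R A B)
    (hK : Measurable fun p : ((Fin N → ℝ) × Θ) × (Fin N → ℝ) => K p.1.1 p.1.2 p.2)
    (hGm : StronglyMeasurable G) (hG : ∀ x, ∫⁻ θ in A, ‖G (x, θ)‖ₑ ^ 2 ∂ν ≤ 1)
    (z z' : Fin N → ℝ) :
    kerDual K ν R A G z - kerDual K ν R A G z' =
      ∫ p, (K p.1 p.2 z - K p.1 p.2 z') • G p
        ∂((volume.restrict (Metric.closedBall 0 R)).prod (ν.restrict A)) := by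
  simp only [sub_smul]
  exact (integral_sub (hT.integrable_smul hK hGm hG z) (hT.integrable_smul hK hGm hG z')).symm

lemma TruncBound.continuous_kerDual (hT : TruncBound K ν R A B)
    (hK : Measurable fun p : ((Fin N → ℝ) × Θ) × (Fin N → ℝ) => K p.1.1 p.1.2 p.2)
    (hGm : StronglyMeasurable G) (hG : ∀ x, ∫⁻ θ in A, ‖G (x, θ)‖ₑ ^ 2 ∂ν ≤ 1) :
    Continuous (kerDual K ν R A G) := by
  have := hT.isFiniteMeasure
  have key : ∀ z z', ‖kerDual K ν R A G z - kerDual K ν R A G z'‖ₑ ≤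
      ENNReal.ofReal (B * ‖z - z'‖) ^ (1 / 2 : ℝ) *
        volume (Metric.closedBall (0 : Fin N → ℝ) R) := by
    intro z z'
    rw [hT.kerDual_sub hK hGm hG]
    refine (enorm_integral_smul_le hGm hG
      ((measurable_ker_left hK z).sub (measurable_ker_left hK z'))).trans ?_
    calc _ ≤ ∫⁻ x in Metric.closedBall (0 : Fin N → ℝ) R,
          ENNReal.ofReal (B * ‖z - z'‖) ^ (1 / 2 : ℝ) :=
          lintegral_mono fun x => ENNReal.rpow_le_rpow (hT.cont x z z') (by norm_num)
      _ = _ := by rw [lintegral_const, Measure.restrict_apply_univ]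
  rw [continuous_iff_continuousAt]
  intro z'
  rw [ContinuousAt, tendsto_iff_edist_tendsto_0]
  have hlim : Tendsto (fun z => ENNReal.ofReal (B * ‖z - z'‖) ^ (1 / 2 : ℝ) *
        volume (Metric.closedBall (0 : Fin N → ℝ) R)) (𝓝 z') (𝓝 0) := by
    rw [← zero_mul (volume (Metric.closedBall (0 : Fin N → ℝ) R))]
    refine ENNReal.Tendsto.mul_const ?_ (Or.inr measure_closedBall_lt_top.ne)
    have h1 : Tendsto (fun z => ENNReal.ofReal (B * ‖z - z'‖)) (𝓝 z') (𝓝 0) := by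
      have : Continuous fun z => ENNReal.ofReal (B * ‖z - z'‖) :=
        ENNReal.continuous_ofReal.comp (by fun_prop)
      simpa using this.tendsto z'
    have h2 := h1.ennrpow_const (1 / 2)
    simpa using h2
  refine tendsto_of_tendsto_of_tendsto_of_le_of_le tendsto_const_nhds hlim
    (fun _ => zero_le) fun z => ?_
  rw [edist_eq_enorm_sub]
  exact key z z'

/-- The adjoint identity. -/
lemma TruncBound.integral_inner_kerDual (hT : TruncBound K ν R A B)
    (hK : Measurable fun p : ((Fin N → ℝ) × Θ) × (Fin N → ℝ) => K p.1.1 p.1.2 p.2)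
    (hGm : StronglyMeasurable G) (hG : ∀ x, ∫⁻ θ in A, ‖G (x, θ)‖ₑ ^ 2 ∂ν ≤ 1)
    {F : (Fin N → ℝ) → H} (hF : Integrable F) :
    ∫ z, inner ℝ (F z) (kerDual K ν R A G z) =
      ∫ p, inner ℝ (kerApply K F p.1 p.2) (G p)
        ∂((volume.restrict (Metric.closedBall 0 R)).prod (ν.restrict A)) := by
  have := hT.isFiniteMeasure
  set π := (volume.restrict (Metric.closedBall (0 : Fin N → ℝ) R)).prod (ν.restrict A)
  have hGi := hT.lintegral_le hGm hG
  have h1 : ∀ z, inner ℝ (F z) (kerDual K ν R A G z) =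
      ∫ p, K p.1 p.2 z * inner ℝ (F z) (G p) ∂π := by
    intro z
    rw [kerDual, ← integral_inner (hT.integrable_smul hK hGm hG z)]
    simp only [inner_smul_right]
    rfl
  have h2 : ∀ᵐ p ∂π, inner ℝ (kerApply K F p.1 p.2) (G p) =
      ∫ z, K p.1 p.2 z * inner ℝ (F z) (G p) := by
    filter_upwards [hT.ae_mem] with p hp
    have hi : Integrable fun z => K p.1 p.2 z • F z :=
      hF.bdd_smul B (hK.comp (measurable_const.prodMk measurable_id)).aestronglyMeasurable
        (ae_of_all _ fun z => hT.bound _ _ hp.2 _)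
    rw [real_inner_comm, kerApply, ← integral_inner hi]
    simp only [inner_smul_right, real_inner_comm (G p)]
  rw [integral_congr_ae h2]
  simp_rw [h1]
  refine integral_integral_swap ?_
  have hb : Integrable (fun q : (Fin N → ℝ) × ((Fin N → ℝ) × Θ) => B * (‖F q.1‖ * ‖G q.2‖))
      (volume.prod π) := (hF.norm.mul_prod hGi.norm).const_mul B
  have hae : ∀ᵐ q ∂((volume : Measure (Fin N → ℝ)).prod π), q.2.2 ∈ A :=
    Measure.quasiMeasurePreserving_snd.ae (hT.ae_mem.mono fun p hp => hp.2)
  refine hb.mono' ?_ (hae.mono fun q hq => ?_)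
  · exact (hK.comp measurable_swap).aestronglyMeasurable.mul
      (hF.aestronglyMeasurable.comp_fst.inner (hGm.comp_measurable
        measurable_snd).aestronglyMeasurable)
  · simp only [Function.uncurry, norm_mul]
    exact mul_le_mul (hT.bound _ _ hq _) (norm_inner_le_norm _ _) (norm_nonneg _)
      ((abs_nonneg _).trans (hT.bound q.2.1 _ hq q.1))

end Dual

end CalderonZygmund

lemma enorm_add_sq_le {H : Type*} [NormedAddCommGroup H] (a b : H) :
    ‖a + b‖ₑ ^ 2 ≤ 2 * (‖a‖ₑ ^ 2 + ‖b‖ₑ ^ 2) := by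
  refine (pow_le_pow_left' (enorm_add_le a b) 2).trans ?_
  have := ENNReal.rpow_add_le_mul_rpow_add_rpow ‖a‖ₑ ‖b‖ₑ (p := 2) (by norm_num)
  norm_num at this
  exact_mod_cast this

lemma lintegral_eq_iSup_restrict {α : Type*} [MeasurableSpace α] {μ : Measure α} {f : α → ℝ≥0∞}
    (hf : Measurable f) {A : ℕ → Set α} (hA : ∀ m, MeasurableSet (A m)) (hmono : Monotone A)
    (huniv : ⋃ m, A m = Set.univ) : ∫⁻ x, f x ∂μ = ⨆ m, ∫⁻ x in A m, f x ∂μ := by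
  have h1 : ∀ m, ∫⁻ x in A m, f x ∂μ = ∫⁻ x, (A m).indicator f x ∂μ := fun m =>
    (lintegral_indicator (hA m) f).symm
  simp_rw [h1]
  rw [← lintegral_iSup (fun m => hf.indicator (hA m))
    fun m m' h x => Set.indicator_le_indicator_of_subset (hmono h) (fun _ => zero_le) x]
  congr 1 with x
  obtain ⟨m, hm⟩ := Set.mem_iUnion.1 (huniv ▸ Set.mem_univ x : x ∈ ⋃ m, A m)
  refine le_antisymm ?_ (iSup_le fun m => Set.indicator_le_self _ _ _)
  exact (Set.indicator_of_mem hm f).symm.le.trans (le_iSup (fun m => (A m).indicator f x) m)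

lemma lintegral_sqrt_le_of_exhaustion {α Θ : Type*} [MeasurableSpace α] [MeasurableSpace Θ]
    {μ : Measure α} {ν : Measure Θ} [SFinite ν] {g : α → Θ → ℝ≥0∞}
    (hg : Measurable (Function.uncurry g)) {S : ℕ → Set α} {A : ℕ → Set Θ}
    (hS : ∀ m, MeasurableSet (S m)) (hSm : Monotone S) (hSu : ⋃ m, S m = Set.univ)
    (hA : ∀ m, MeasurableSet (A m)) (hAm : Monotone A) (hAu : ⋃ m, A m = Set.univ) {R : ℝ≥0∞}
    (h : ∀ m, ∫⁻ x in S m, (∫⁻ θ in A m, g x θ ∂ν) ^ (1 / 2 : ℝ) ∂μ ≤ R) :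
    ∫⁻ x, (∫⁻ θ, g x θ ∂ν) ^ (1 / 2 : ℝ) ∂μ ≤ R := by
  have h1 : ∀ x, (∫⁻ θ, g x θ ∂ν) ^ (1 / 2 : ℝ) = ⨆ m, (∫⁻ θ in A m, g x θ ∂ν) ^ (1 / 2 : ℝ) := by
    intro x
    rw [lintegral_eq_iSup_restrict (f := g x) (hg.comp measurable_prodMk_left) hA hAm hAu]
    exact (ENNReal.orderIsoRpow (1 / 2) (by norm_num)).map_iSup _
  simp_rw [h1]
  have hgm : ∀ m, Measurable fun x => (∫⁻ θ in A m, g x θ ∂ν) ^ (1 / 2 : ℝ) := fun m =>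
    (Measurable.lintegral_prod_right' hg).pow_const _
  rw [lintegral_iSup hgm
    fun m m' hm x => ENNReal.rpow_le_rpow (lintegral_mono_set (hAm hm)) (by norm_num)]
  refine iSup_le fun m => ?_
  rw [lintegral_eq_iSup_restrict (hgm m) hS hSm hSu]
  refine iSup_le fun m' => ?_
  refine le_trans ?_ (h (max m m'))
  refine (lintegral_mono_set (hSm (le_max_right m m'))).trans (lintegral_mono fun x =>
    ENNReal.rpow_le_rpow (lintegral_mono_set (hAm (le_max_left m m'))) (by norm_num))

lemma le_mul_of_le_sqrt_mul_sqrt {x c v : ℝ≥0∞} (hx : x ≠ ⊤)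
    (h : x ≤ (c * x) ^ (1 / 2 : ℝ) * v ^ (1 / 2 : ℝ)) : x ≤ c * v := by
  by_cases h0 : x = 0
  · simp [h0]
  have h2 := ENNReal.rpow_le_rpow h (by norm_num : (0 : ℝ) ≤ 2)
  rw [← ENNReal.mul_rpow_of_nonneg _ _ (by norm_num), ← ENNReal.rpow_mul] at h2
  norm_num at h2
  rw [sq, mul_right_comm] at h2
  exact (ENNReal.mul_le_mul_iff_left h0 hx).1 h2

section CalderonZygmund

variable {N : ℕ} {H : Type*} [NormedAddCommGroup H] [InnerProductSpace ℝ H] [CompleteSpace H]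
variable {Θ : Type*} [MeasurableSpace Θ]
variable {K : (Fin N → ℝ) → Θ → (Fin N → ℝ) → ℝ} {ν : Measure Θ} [SFinite ν]

lemma stronglyMeasurable_kerApply
    (hK : Measurable fun p : ((Fin N → ℝ) × Θ) × (Fin N → ℝ) => K p.1.1 p.1.2 p.2)
    {F : (Fin N → ℝ) → H} (hF : StronglyMeasurable F) :
    StronglyMeasurable fun p : (Fin N → ℝ) × Θ => kerApply K F p.1 p.2 := by
  unfold kerApply
  exact StronglyMeasurable.integral_prod_right (f := fun (p : (Fin N → ℝ) × Θ) z =>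
    K p.1 p.2 z • F z) (hK.stronglyMeasurable.smul (hF.comp_measurable measurable_snd))

section Dual

variable {R B : ℝ} {A : Set Θ} {G : (Fin N → ℝ) × Θ → H}

lemma lintegral_indicator_enorm_sq_le (hG : ∀ x, ∫⁻ θ in A, ‖G (x, θ)‖ₑ ^ 2 ∂ν ≤ 1)
    (S : Set (Fin N → ℝ)) (x : Fin N → ℝ) :
    ∫⁻ θ in A, ‖(Prod.fst ⁻¹' S).indicator G (x, θ)‖ₑ ^ 2 ∂ν ≤ 1 := by
  refine (lintegral_mono fun θ => ?_).trans (hG x)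
  gcongr
  simp only [Set.indicator]
  split_ifs <;> simp

lemma TruncBound.lintegral_closedBall_kerDual_near_le (hT : TruncBound K ν R A B) (hB : 0 ≤ B)
    (hK : Measurable fun p : ((Fin N → ℝ) × Θ) × (Fin N → ℝ) => K p.1.1 p.1.2 p.2)
    (hGm : StronglyMeasurable G) (hG : ∀ x, ∫⁻ θ in A, ‖G (x, θ)‖ₑ ^ 2 ∂ν ≤ 1) {C : NNReal}
    (hC : L2Bound H K ν C) (z₀ : Fin N → ℝ) (l r : ℝ) :
    ∫⁻ z in Metric.closedBall z₀ l,
      ‖kerDual K ν R A ((Prod.fst ⁻¹' Metric.closedBall z₀ r).indicator G) z‖ₑ ^ 2 ≤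
        C * volume (Metric.closedBall z₀ r) := by
  have := hT.isFiniteMeasure
  set S : Set ((Fin N → ℝ) × Θ) := Prod.fst ⁻¹' Metric.closedBall z₀ r with hS
  have hSm : MeasurableSet S := measurable_fst measurableSet_closedBall
  have hnm : StronglyMeasurable (S.indicator G) := hGm.indicator hSm
  have hn := lintegral_indicator_enorm_sq_le hG (Metric.closedBall z₀ r)
  rw [← hS] at hn
  set D := kerDual K ν R A (S.indicator G) with hD
  have hDm : StronglyMeasurable D := stronglyMeasurable_kerDual hK hnm
  obtain ⟨J, hJ⟩ := hT.bounded_kerDual hB hnm hn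
  set φ := (Metric.closedBall z₀ l).indicator D with hφ
  have hφm : StronglyMeasurable φ := hDm.indicator measurableSet_closedBall
  have hφJ : ∀ x, ‖φ x‖ ≤ J := fun x => (norm_indicator_le_norm_self _ _).trans (hJ x)
  have hφi : Integrable φ := (hT.integrable_kerDual hK hnm hn).indicator measurableSet_closedBall
  have e1 : ∫⁻ z in Metric.closedBall z₀ l, ‖D z‖ₑ ^ 2 = ∫⁻ z, ‖φ z‖ₑ ^ 2 := by
    rw [← lintegral_indicator measurableSet_closedBall]
    congr 1 with z
    simp only [hφ, Set.indicator]
    split_ifs <;> simp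
  have hfin : ∫⁻ z, ‖φ z‖ₑ ^ 2 ≠ ⊤ := by
    rw [← e1]
    refine ((lintegral_mono fun z => pow_le_pow_left' (enorm_le_iff_norm_le.2
      ((hJ z).trans (Real.le_norm_self J)) : ‖D z‖ₑ ≤ ‖J‖ₑ) 2).trans_lt ?_).ne
    rw [lintegral_const]
    exact ENNReal.mul_lt_top (by simp) (by simpa using measure_closedBall_lt_top)
  have e2 : ∫⁻ z, ‖φ z‖ₑ ^ 2 = ENNReal.ofReal (∫ z, inner ℝ (φ z) (D z)) := by
    have : ∀ z, inner ℝ (φ z) (D z) = ‖φ z‖ ^ 2 := fun z => by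
      rw [← real_inner_self_eq_norm_sq]
      simp only [hφ, Set.indicator]
      split_ifs <;> simp
    simp_rw [this]
    rw [ofReal_integral_eq_lintegral_ofReal _ (ae_of_all _ fun z => by positivity)]
    · simp_rw [ENNReal.ofReal_pow (norm_nonneg _), ofReal_norm]
    · simp_rw [sq]
      exact (hφi.norm.bdd_smul J hφm.norm.aestronglyMeasurable
        (ae_of_all _ fun z => by simpa using hφJ z))
  rw [e1]
  refine le_mul_of_le_sqrt_mul_sqrt hfin ?_
  conv_lhs => rw [e2, hT.integral_inner_kerDual hK hnm hn hφi]
  refine (ofReal_integral_inner_le_lintegral _ _).trans ?_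
  have hTm := stronglyMeasurable_kerApply hK hφm
  refine (lintegral_mul_le_sqrt hTm.enorm.aemeasurable hnm.enorm.aemeasurable).trans ?_
  gcongr
  · rw [lintegral_prod _ (hTm.enorm.pow_const 2).aemeasurable]
    refine le_trans ?_ (hC φ hφm ⟨J, hφJ⟩ hφi)
    exact lintegral_mono' Measure.restrict_le_self fun x =>
      lintegral_mono' Measure.restrict_le_self le_rfl
  · rw [lintegral_prod _ (hnm.enorm.pow_const 2).aemeasurable]
    calc _ ≤ ∫⁻ x, (Metric.closedBall z₀ r).indicator 1 x := by
          refine lintegral_mono' Measure.restrict_le_self fun x => ?_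
          by_cases hx : x ∈ Metric.closedBall z₀ r
          · rw [Set.indicator_of_mem hx]
            exact hn x
          · rw [Set.indicator_of_notMem hx]
            refine (lintegral_eq_zero_of_ae_eq_zero (ae_of_all _ fun θ => ?_)).le
            have : (x, θ) ∉ S := hx
            simp [Set.indicator_of_notMem this]
      _ = _ := by rw [lintegral_indicator_one measurableSet_closedBall]

lemma TruncBound.enorm_kerDual_far_sub_le (hT : TruncBound K ν R A B)
    (hK : Measurable fun p : ((Fin N → ℝ) × Θ) × (Fin N → ℝ) => K p.1.1 p.1.2 p.2)
    (hGm : StronglyMeasurable G) (hG : ∀ x, ∫⁻ θ in A, ‖G (x, θ)‖ₑ ^ 2 ∂ν ≤ 1) {C : NNReal}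
    (hC : HorBound K ν C) {z₀ z : Fin N → ℝ} {l : ℝ} (hl : 0 < l) (hz : ‖z - z₀‖ ≤ l) :
    ‖kerDual K ν R A ((Prod.fst ⁻¹' (Metric.closedBall z₀ (4 * l))ᶜ).indicator G) z -
      kerDual K ν R A ((Prod.fst ⁻¹' (Metric.closedBall z₀ (4 * l))ᶜ).indicator G) z₀‖ₑ ≤ C := by
  have := hT.isFiniteMeasure
  set E := (Metric.closedBall z₀ (4 * l))ᶜ with hE
  have hEm : MeasurableSet E := measurableSet_closedBall.compl
  have hSm : MeasurableSet (Prod.fst ⁻¹' E : Set ((Fin N → ℝ) × Θ)) := measurable_fst hEm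
  rw [hT.kerDual_sub hK (hGm.indicator hSm) (lintegral_indicator_enorm_sq_le hG E)]
  have e : ∀ p : (Fin N → ℝ) × Θ, (K p.1 p.2 z - K p.1 p.2 z₀) • (Prod.fst ⁻¹' E).indicator G p =
      ((Prod.fst ⁻¹' E).indicator (fun p => K p.1 p.2 z - K p.1 p.2 z₀) p) • G p := fun p => by
    simp only [Set.indicator]
    split_ifs <;> simp
  simp_rw [e]
  refine (enorm_integral_smul_le hGm hG (((measurable_ker_left hK z).sub
    (measurable_ker_left hK z₀)).indicator hSm)).trans ?_
  refine le_trans ?_ (hC z₀ z l hl hz)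
  rw [← lintegral_indicator (μ := volume) hEm]
  refine lintegral_mono' Measure.restrict_le_self fun x => ?_
  by_cases hx : x ∈ E
  · rw [Set.indicator_of_mem hx]
    refine ENNReal.rpow_le_rpow (lintegral_mono' Measure.restrict_le_self fun θ => ?_)
      (by norm_num)
    simp [Set.indicator, hx]
  · rw [Set.indicator_of_notMem hx]
    simp [Set.indicator, hx]

lemma TruncBound.bmoBound_kerDual (hT : TruncBound K ν R A B) (hB : 0 ≤ B)
    (hK : Measurable fun p : ((Fin N → ℝ) × Θ) × (Fin N → ℝ) => K p.1.1 p.1.2 p.2)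
    (hGm : StronglyMeasurable G) (hG : ∀ x, ∫⁻ θ in A, ‖G (x, θ)‖ₑ ^ 2 ∂ν ≤ 1)
    {C₁ C₂ : NNReal} (h2 : L2Bound H K ν C₁) (hH : HorBound K ν C₂) :
    BMOBound (kerDual K ν R A G) (2 * (C₁ * 8 ^ N + C₂ ^ 2 * 2 ^ N)) := by
  have := hT.isFiniteMeasure
  intro z₀ l hl
  set S : Set ((Fin N → ℝ) × Θ) := Prod.fst ⁻¹' (Metric.closedBall z₀ (4 * l)) with hS
  have hSm : MeasurableSet S := measurable_fst measurableSet_closedBall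
  have hnear := hT.lintegral_closedBall_kerDual_near_le hB hK hGm hG h2 z₀ l (4 * l)
  have hfar := fun z (hz : ‖z - z₀‖ ≤ l) => hT.enorm_kerDual_far_sub_le hK hGm hG hH hl hz
  rw [Set.preimage_compl] at hfar
  rw [← hS] at hnear hfar
  refine ⟨kerDual K ν R A (Sᶜ.indicator G) z₀, ?_⟩
  have hsplit : ∀ z, kerDual K ν R A G z =
      kerDual K ν R A (S.indicator G) z + kerDual K ν R A (Sᶜ.indicator G) z := by
    intro z
    unfold kerDual
    rw [← integral_add (hT.integrable_smul hK (hGm.indicator hSm)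
      (lintegral_indicator_enorm_sq_le hG _) z) (hT.integrable_smul hK
      (hGm.indicator hSm.compl)
      (lintegral_indicator_enorm_sq_le hG (Metric.closedBall z₀ (4 * l))ᶜ) z)]
    simp only [← smul_add]
    simp only [Set.indicator_self_add_compl_apply]
  have hmn : Measurable fun z => ‖kerDual K ν R A (S.indicator G) z‖ₑ ^ 2 :=
    (stronglyMeasurable_kerDual hK (hGm.indicator hSm)).enorm.pow_const 2
  calc _ ≤ ∫⁻ z in Metric.closedBall z₀ l,
        (2 * ‖kerDual K ν R A (S.indicator G) z‖ₑ ^ 2 + 2 * (C₂ : ℝ≥0∞) ^ 2) := by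
        refine setLIntegral_mono ((hmn.const_mul 2).add_const _) fun z hz => ?_
        rw [hsplit, add_sub_assoc, ← mul_add]
        refine (enorm_add_sq_le _ _).trans ?_
        gcongr
        exact hfar z (by simpa [dist_eq_norm] using hz)
    _ = 2 * (∫⁻ z in Metric.closedBall z₀ l, ‖kerDual K ν R A (S.indicator G) z‖ₑ ^ 2) +
        2 * (C₂ : ℝ≥0∞) ^ 2 * volume (Metric.closedBall z₀ l) := by
        rw [lintegral_add_right _ measurable_const, lintegral_const_mul _ hmn, lintegral_const,
          Measure.restrict_apply_univ]
    _ ≤ 2 * (C₁ * volume (Metric.closedBall z₀ (4 * l))) +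
        2 * (C₂ : ℝ≥0∞) ^ 2 * volume (Metric.closedBall z₀ l) := by gcongr
    _ = _ := by
        rw [Real.volume_pi_closedBall _ (by positivity), Real.volume_pi_closedBall _ hl.le]
        simp only [Fintype.card_fin]
        rw [show 2 * (4 * l) = 8 * l by ring, mul_pow, mul_pow, ENNReal.ofReal_mul (by positivity),
          ENNReal.ofReal_mul (by positivity)]
        push_cast
        rw [ENNReal.ofReal_pow (by positivity), ENNReal.ofReal_pow (by positivity)]
        norm_num
        ring

end Dual

/-- Calderón–Zygmund duality: to bound the mixed norm of `kerApply K F` it suffices to bound the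
pairings of `F` with nice functions of bounded mean oscillation. -/
lemma lintegral_kerApply_le_of_bmo {A : ℕ → Set Θ} {B : ℕ → ℝ} (hB : ∀ m, 0 ≤ B m)
    (hT : ∀ m : ℕ, TruncBound K ν m (A m) (B m)) (hAm : Monotone A) (hAu : ⋃ m, A m = Set.univ)
    (hK : Measurable fun p : ((Fin N → ℝ) × Θ) × (Fin N → ℝ) => K p.1.1 p.1.2 p.2)
    {C₁ C₂ : NNReal} (h2 : L2Bound H K ν C₁) (hH : HorBound K ν C₂)
    {F : (Fin N → ℝ) → H} (hF : Integrable F) (hFm : StronglyMeasurable F) {R : ℝ≥0∞}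
    (hR : ∀ b : (Fin N → ℝ) → H, StronglyMeasurable b → Continuous b → (∃ J, ∀ x, ‖b x‖ ≤ J) →
      Integrable b → BMOBound b (2 * (C₁ * 8 ^ N + C₂ ^ 2 * 2 ^ N)) →
      ENNReal.ofReal (∫ x, inner ℝ (F x) (b x)) ≤ R) :
    ∫⁻ x, (∫⁻ θ, ‖kerApply K F x θ‖ₑ ^ 2 ∂ν) ^ (1 / 2 : ℝ) ≤ R := by
  have hum := stronglyMeasurable_kerApply hK hFm
  refine lintegral_sqrt_le_of_exhaustion (hum.enorm.pow_const 2)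
    (S := fun m : ℕ => Metric.closedBall 0 m) (fun _ => measurableSet_closedBall)
    (fun m m' h => Metric.closedBall_subset_closedBall (by exact_mod_cast h))
    (Metric.iUnion_closedBall_nat 0) (fun m => (hT m).measurableSet) hAm hAu fun m => ?_
  have := (hT m).isFiniteMeasure
  set s : (Fin N → ℝ) → ℝ≥0∞ := fun x => (∫⁻ θ in A m, ‖kerApply K F x θ‖ₑ ^ 2 ∂ν) with hs
  have hsm : Measurable s := Measurable.lintegral_prod_right' (hum.enorm.pow_const 2)
  set q : (Fin N → ℝ) → ℝ := fun x => ((s x) ^ (1 / 2 : ℝ)).toReal⁻¹ with hq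
  have hqm : Measurable q := (hsm.pow_const _).ennreal_toReal.inv
  have hub : ∀ x, ∀ θ ∈ A m, ‖kerApply K F x θ‖ ≤ B m * ∫ z, ‖F z‖ := fun x θ hθ => by
    rw [← integral_const_mul]
    refine norm_integral_le_of_norm_le (hF.norm.const_mul _) (ae_of_all _ fun z => ?_)
    rw [norm_smul]
    gcongr
    exact (hT m).bound x θ hθ z
  have hsfin : ∀ x, s x ≠ ⊤ := fun x => by
    refine ((setLIntegral_mono measurable_const fun θ hθ => pow_le_pow_left'
      (enorm_le_iff_norm_le.2 ((hub x θ hθ).trans (Real.le_norm_self _)) :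
        ‖kerApply K F x θ‖ₑ ≤ ‖B m * ∫ z, ‖F z‖‖ₑ) 2).trans_lt ?_).ne
    rw [lintegral_const]
    exact ENNReal.mul_lt_top (ENNReal.pow_lt_top enorm_lt_top)
      (by simpa using (hT m).measure_lt_top)
  set G : (Fin N → ℝ) × Θ → H := fun p => q p.1 • kerApply K F p.1 p.2 with hGdef
  have hGm : StronglyMeasurable G :=
    (hqm.comp measurable_fst).stronglyMeasurable.smul hum
  have hGs : ∀ x, ∫⁻ θ in A m, ‖G (x, θ)‖ₑ ^ 2 ∂ν = ‖q x‖ₑ ^ 2 * s x := fun x => by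
    simp only [hGdef, enorm_smul, mul_pow]
    rw [lintegral_const_mul]
    exact (hum.comp_measurable measurable_prodMk_left).enorm.pow_const 2
  have hqs : ∀ x, s x ≠ 0 → ‖q x‖ₑ = (s x ^ (1 / 2 : ℝ))⁻¹ := fun x h0 => by
    rw [hq, Real.enorm_eq_ofReal (by positivity), ENNReal.ofReal_inv_of_pos, ENNReal.ofReal_toReal]
    · exact ENNReal.rpow_ne_top_of_nonneg (by norm_num) (hsfin x)
    · exact ENNReal.toReal_pos (by simp [h0])
        (ENNReal.rpow_ne_top_of_nonneg (by norm_num) (hsfin x))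
  have hss : ∀ x, s x = s x ^ (1 / 2 : ℝ) * s x ^ (1 / 2 : ℝ) := fun x => by
    rw [← ENNReal.rpow_add_of_nonneg _ _ (by norm_num) (by norm_num)]
    norm_num
  have hG : ∀ x, ∫⁻ θ in A m, ‖G (x, θ)‖ₑ ^ 2 ∂ν ≤ 1 := fun x => by
    rw [hGs]
    by_cases h0 : s x = 0
    · simp [h0]
    rw [hqs x h0]
    have hx := hss x
    generalize s x ^ (1 / 2 : ℝ) = a at hx ⊢
    rw [hx, ← sq, ← mul_pow]
    exact pow_le_one' (ENNReal.inv_mul_le_one a) 2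
  refine le_trans (le_of_eq ?_) (hR (kerDual K ν m (A m) G) (stronglyMeasurable_kerDual hK hGm)
    ((hT m).continuous_kerDual hK hGm hG) ((hT m).bounded_kerDual (hB m) hGm hG)
    ((hT m).integrable_kerDual hK hGm hG) ((hT m).bmoBound_kerDual (hB m) hK hGm hG h2 hH))
  rw [(hT m).integral_inner_kerDual hK hGm hG hF]
  have hin : ∀ p : (Fin N → ℝ) × Θ, inner ℝ (kerApply K F p.1 p.2) (G p) =
      q p.1 * ‖kerApply K F p.1 p.2‖ ^ 2 := fun p => by
    rw [hGdef, inner_smul_right, real_inner_self_eq_norm_sq]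
  rw [ofReal_integral_eq_lintegral_ofReal]
  · have hm2 : Measurable fun p : (Fin N → ℝ) × Θ =>
        ‖q p.1‖ₑ * ‖kerApply K F p.1 p.2‖ₑ ^ 2 :=
      (hqm.comp measurable_fst).enorm.mul (hum.enorm.pow_const 2)
    have e : ∀ p : (Fin N → ℝ) × Θ, ENNReal.ofReal (inner ℝ (kerApply K F p.1 p.2) (G p)) =
        ‖q p.1‖ₑ * ‖kerApply K F p.1 p.2‖ₑ ^ 2 := fun p => by
      rw [hin, ENNReal.ofReal_mul (by rw [hq]; positivity), ENNReal.ofReal_pow (norm_nonneg _),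
        ofReal_norm, Real.enorm_eq_ofReal (by rw [hq]; positivity)]
    simp_rw [e]
    rw [lintegral_prod _ hm2.aemeasurable]
    refine lintegral_congr fun x => ?_
    have hm3 : Measurable fun θ => ‖kerApply K F x θ‖ₑ ^ 2 :=
      (hum.comp_measurable measurable_prodMk_left).enorm.pow_const 2
    simp only
    rw [lintegral_const_mul _ hm3]
    change s x ^ (1 / 2 : ℝ) = ‖q x‖ₑ * s x
    by_cases h0 : s x = 0
    · simp [h0]
    rw [hqs x h0]
    have hx := hss x
    have ha0 : s x ^ (1 / 2 : ℝ) ≠ 0 := by simp [h0]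
    have ha1 : s x ^ (1 / 2 : ℝ) ≠ ⊤ := ENNReal.rpow_ne_top_of_nonneg (by norm_num) (hsfin x)
    generalize s x ^ (1 / 2 : ℝ) = a at hx ha0 ha1 ⊢
    rw [hx, ← mul_assoc, ENNReal.inv_mul_cancel ha0 ha1, one_mul]
  · refine ((hT m).lintegral_le hGm hG).norm.const_mul (B m * ∫ z, ‖F z‖) |>.mono'
      (hum.inner hGm).aestronglyMeasurable ((hT m).ae_mem.mono fun p hp => ?_)
    refine (norm_inner_le_norm _ _).trans ?_
    gcongr
    exact hub _ _ hp.2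
  · refine ae_of_all _ fun p => ?_
    simp only [hin, hq, Pi.zero_apply]
    positivity

end CalderonZygmund

section HormanderScale

variable {N : ℕ} {Θ : Type*} [MeasurableSpace Θ]

lemma lintegral_scale_eq {β : ℝ} (hβ : 0 < β) (z₀ : Fin N → ℝ) {l : ℝ} (hl : 0 < l) :
    ∫⁻ x : Fin N → ℝ, ENNReal.ofReal (l ^ β * (l + ‖x - z₀‖) ^ (-((N : ℝ) + β))) =
      ENNReal.ofReal (∫ x : Fin N → ℝ, (1 + ‖x‖) ^ (-((N : ℝ) + β))) := by
  have hi : Integrable fun x : Fin N → ℝ => (1 + ‖x‖) ^ (-((N : ℝ) + β)) :=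
    integrable_one_add_norm (by simpa using hβ)
  have h1 := lintegral_sub_right_eq_self (μ := (volume : Measure (Fin N → ℝ)))
    (fun x => ENNReal.ofReal (l ^ β * (l + ‖x‖) ^ (-((N : ℝ) + β)))) z₀
  rw [h1]
  have e : ∀ x : Fin N → ℝ, l ^ β * (l + ‖x‖) ^ (-((N : ℝ) + β)) =
      (l ^ N)⁻¹ * (1 + ‖l⁻¹ • x‖) ^ (-((N : ℝ) + β)) := fun x => by
    rw [norm_smul, norm_inv, Real.norm_of_nonneg hl.le,
      show l + ‖x‖ = l * (1 + l⁻¹ * ‖x‖) by field_simp,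
      Real.mul_rpow hl.le (by positivity), ← mul_assoc, ← Real.rpow_add hl,
      show β + -((N : ℝ) + β) = -(N : ℝ) by ring, Real.rpow_neg hl.le, Real.rpow_natCast]
  simp_rw [e]
  rw [← ofReal_integral_eq_lintegral_ofReal ((hi.comp_smul (inv_ne_zero hl.ne')).const_mul _)
    (ae_of_all _ fun x => by positivity), integral_const_mul,
    Measure.integral_comp_inv_smul_of_nonneg volume
      (fun x : Fin N → ℝ => (1 + ‖x‖) ^ (-((N : ℝ) + β))) hl.le]
  rw [smul_eq_mul, Module.finrank_fin_fun, ← mul_assoc, inv_mul_cancel₀ (by positivity), one_mul]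

/-- Pointwise smoothness of the family of kernels implies the Hörmander condition. -/
lemma exists_horBound {K : (Fin N → ℝ) → Θ → (Fin N → ℝ) → ℝ} {ν : Measure Θ} {p : ℕ}
    (hp : 0 < p) {D : ℝ} (hD : 0 ≤ D)
    (h : ∀ z₀ z x : Fin N → ℝ, ∀ l : ℝ, 0 < l → ‖z - z₀‖ ≤ l → 4 * l < ‖x - z₀‖ →
      ∫⁻ θ, ‖K x θ z - K x θ z₀‖ₑ ^ 2 ∂ν ≤
        ENNReal.ofReal (D * (l ^ p / (l + ‖x - z₀‖) ^ (2 * N + p)))) :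
    ∃ C : NNReal, HorBound K ν C := by
  refine ⟨(Real.sqrt D).toNNReal *
    (∫ x : Fin N → ℝ, (1 + ‖x‖) ^ (-((N : ℝ) + p / 2))).toNNReal, fun z₀ z l hl hz => ?_⟩
  calc _ ≤ ∫⁻ x in (Metric.closedBall z₀ (4 * l))ᶜ, ENNReal.ofReal (Real.sqrt D) *
          ENNReal.ofReal (l ^ ((p : ℝ) / 2) * (l + ‖x - z₀‖) ^ (-((N : ℝ) + p / 2))) := by
        refine setLIntegral_mono (by fun_prop) fun x hx => ?_
        have hx' : 4 * l < ‖x - z₀‖ := by simpa [dist_eq_norm] using hx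
        refine (ENNReal.rpow_le_rpow (h z₀ z x l hl hz hx') (by norm_num)).trans ?_
        have hd : 0 < l + ‖x - z₀‖ := by positivity
        rw [ENNReal.ofReal_rpow_of_nonneg (by positivity) (by norm_num),
          ← ENNReal.ofReal_mul (by positivity)]
        refine ENNReal.ofReal_le_ofReal (le_of_eq ?_)
        rw [Real.mul_rpow hD (by positivity), Real.div_rpow (by positivity) (by positivity),
          Real.sqrt_eq_rpow, ← Real.rpow_natCast l, ← Real.rpow_natCast, ← Real.rpow_mul hl.le,
          ← Real.rpow_mul hd.le, Real.rpow_neg hd.le]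
        push_cast
        rw [show (2 * (N : ℝ) + p) * (1 / 2) = N + p / 2 by ring,
          show (p : ℝ) * (1 / 2) = p / 2 by ring, div_eq_mul_inv _ (_ ^ ((N : ℝ) + p / 2))]
    _ ≤ ∫⁻ x, ENNReal.ofReal (Real.sqrt D) *
          ENNReal.ofReal (l ^ ((p : ℝ) / 2) * (l + ‖x - z₀‖) ^ (-((N : ℝ) + p / 2))) :=
        lintegral_mono' Measure.restrict_le_self le_rfl
    _ = _ := by
        rw [lintegral_const_mul _ (by fun_prop), lintegral_scale_eq (by positivity) z₀ hl]
        push_cast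
        rfl

end HormanderScale

section DyadicKernel

variable {N : ℕ} {H : Type*} [NormedAddCommGroup H] [InnerProductSpace ℝ H] [CompleteSpace H]

/-- The parameter space of the random dyadic martingale differences. -/
abbrev DPar (N : ℕ) := ℤ × RSpace N

/-- Counting measure over the scales times the probability measure of the random lattice. -/
def dparMeasure (N : ℕ) : Measure (DPar N) := Measure.count.prod (randMeasure N)

instance sFinite_dparMeasure : SFinite (dparMeasure N) := by
  unfold dparMeasure; infer_instance

/-- The kernels of the random dyadic martingale differences. -/
def diffKer (x : Fin N → ℝ) (θ : DPar N) (z : Fin N → ℝ) : ℝ :=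
  dker (randOffset θ.2 (θ.1 - 1)) (θ.1 - 1) x z - dker (randOffset θ.2 θ.1) θ.1 x z

lemma measurable_dker_randOffset (k : ℤ) :
    Measurable fun q : (Fin N → ℝ) × RSpace N × (Fin N → ℝ) =>
      dker (randOffset q.2.1 k) k q.1 q.2.2 :=
  measurable_dker k ((measurable_randOffset k).comp (measurable_fst.comp measurable_snd))
    measurable_fst (measurable_snd.comp measurable_snd)

lemma measurable_diffKer : Measurable fun p : ((Fin N → ℝ) × DPar N) × (Fin N → ℝ) =>
    diffKer p.1.1 p.1.2 p.2 := by
  have h : Measurable (Function.uncurry fun (q : (Fin N → ℝ) × RSpace N × (Fin N → ℝ)) (k : ℤ) =>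
      diffKer q.1 (k, q.2.1) q.2.2) := by
    refine measurable_from_prod_countable_left fun k => ?_
    simp only [Function.uncurry, diffKer]
    exact (measurable_dker_randOffset (k - 1)).sub (measurable_dker_randOffset k)
  have h2 : Measurable fun p : ((Fin N → ℝ) × DPar N) × (Fin N → ℝ) =>
      (((p.1.1, p.1.2.2, p.2), p.1.2.1) : ((Fin N → ℝ) × RSpace N × (Fin N → ℝ)) × ℤ) := by
    fun_prop
  have h3 := h.comp h2
  simpa only [Function.comp_def, Function.uncurry, Prod.mk.eta] using h3

lemma kerApply_diffKer {F : (Fin N → ℝ) → H} (hF : Integrable F) (x : Fin N → ℝ) (θ : DPar N) :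
    kerApply diffKer F x θ = hdiff (randOffset θ.2) θ.1 F x := by
  simp only [kerApply, diffKer, sub_smul]
  exact integral_sub (integrable_dker_smul hF _ _ _) (integrable_dker_smul hF _ _ _)

lemma lintegral_dparMeasure {g : DPar N → ℝ≥0∞} (hg : Measurable g) :
    ∫⁻ θ, g θ ∂dparMeasure N = ∑' k : ℤ, ∫⁻ ω, g (k, ω) ∂randMeasure N := by
  rw [dparMeasure, lintegral_prod _ hg.aemeasurable, lintegral_count]

lemma lintegral_dker_sub_sq_le (k : ℤ) (x z z' : Fin N → ℝ) :
    ∫⁻ ω, ‖dker (randOffset ω k) k x z - dker (randOffset ω k) k x z'‖ₑ ^ 2 ∂randMeasure N ≤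
      ENNReal.ofReal (N * ‖z - z'‖ / (2 ^ k) ^ (2 * N + 1)) := by
  set S := {ω : RSpace N | z ∉ dcube (randOffset ω k) k z'} with hS
  have hSm : MeasurableSet S :=
    (measurableSet_mem_dcube k (measurable_randOffset k) measurable_const measurable_const).compl
  have hk : (0 : ℝ) < 2 ^ k := by positivity
  calc _ ≤ ∫⁻ ω, S.indicator (fun _ => ENNReal.ofReal ((((2 : ℝ) ^ k) ^ N)⁻¹) ^ 2) ω
          ∂randMeasure N := by
        refine lintegral_mono fun ω => ?_
        by_cases hω : ω ∈ S
        · rw [Set.indicator_of_mem hω]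
          gcongr
          rw [Real.enorm_eq_ofReal_abs]
          refine ENNReal.ofReal_le_ofReal (abs_sub_le_iff.2 ⟨?_, ?_⟩) <;>
          linarith [dker_nonneg (randOffset ω k) k x z, dker_le (randOffset ω k) k x z,
            dker_nonneg (randOffset ω k) k x z', dker_le (randOffset ω k) k x z']
        · have hm : z ∈ dcube (randOffset ω k) k z' := by simpa [hS] using hω
          rw [dker_comm _ _ x z, dker_eq_of_mem hm, dker_comm _ _ z' x]
          simp
    _ = ENNReal.ofReal ((((2 : ℝ) ^ k) ^ N)⁻¹) ^ 2 * randMeasure N S := by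
        rw [lintegral_indicator_const hSm]
    _ ≤ ENNReal.ofReal ((((2 : ℝ) ^ k) ^ N)⁻¹) ^ 2 * ENNReal.ofReal (N * (‖z - z'‖ / 2 ^ k)) := by
        gcongr
        exact randMeasure_notMem_dcube_le k z' z
    _ = _ := by
        rw [← ENNReal.ofReal_pow (by positivity), ← ENNReal.ofReal_mul (by positivity)]
        congr 1
        field_simp
        ring

lemma lintegral_diffKer_sub_sq_le (k : ℤ) (x z z' : Fin N → ℝ) :
    ∫⁻ ω, ‖diffKer x (k, ω) z - diffKer x (k, ω) z'‖ₑ ^ 2 ∂randMeasure N ≤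
      ENNReal.ofReal (4 * N * ‖z - z'‖ * 2 ^ (2 * N + 1) / (2 ^ k) ^ (2 * N + 1)) := by
  have hm : ∀ k : ℤ, Measurable fun ω : RSpace N =>
      ‖dker (randOffset ω k) k x z - dker (randOffset ω k) k x z'‖ₑ ^ 2 := fun k =>
    ((measurable_dker k (measurable_randOffset k) measurable_const measurable_const).sub
      (measurable_dker k (measurable_randOffset k) measurable_const
        measurable_const)).enorm.pow_const 2
  calc _ ≤ ∫⁻ ω, (2 * ‖dker (randOffset ω (k - 1)) (k - 1) x z -
            dker (randOffset ω (k - 1)) (k - 1) x z'‖ₑ ^ 2 +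
          2 * ‖dker (randOffset ω k) k x z - dker (randOffset ω k) k x z'‖ₑ ^ 2)
            ∂randMeasure N := by
        refine lintegral_mono fun ω => ?_
        have := enorm_add_sq_le (dker (randOffset ω (k - 1)) (k - 1) x z -
            dker (randOffset ω (k - 1)) (k - 1) x z')
          (-(dker (randOffset ω k) k x z - dker (randOffset ω k) k x z'))
        rw [enorm_neg, mul_add] at this
        refine le_trans (le_of_eq ?_) this
        simp only [diffKer]
        congr 2
        ring
    _ ≤ 2 * ENNReal.ofReal (N * ‖z - z'‖ / (2 ^ (k - 1)) ^ (2 * N + 1)) +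
        2 * ENNReal.ofReal (N * ‖z - z'‖ / (2 ^ k) ^ (2 * N + 1)) := by
        rw [lintegral_add_left ((hm _).const_mul 2), lintegral_const_mul _ (hm _),
          lintegral_const_mul _ (hm _)]
        gcongr <;> exact lintegral_dker_sub_sq_le _ _ _ _
    _ ≤ 2 * ENNReal.ofReal (N * ‖z - z'‖ / (2 ^ (k - 1)) ^ (2 * N + 1)) +
        2 * ENNReal.ofReal (N * ‖z - z'‖ / (2 ^ (k - 1)) ^ (2 * N + 1)) := by
        gcongr
        · norm_num
        · omega
    _ = _ := by
        rw [← two_mul, ← mul_assoc, zpow_sub_one₀ (by norm_num)]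
        rw [show (2 : ℝ≥0∞) * 2 = ENNReal.ofReal 4 by norm_num, ← ENNReal.ofReal_mul (by norm_num)]
        congr 1
        rw [mul_pow, inv_pow]
        field_simp

end DyadicKernel

section DiffKer

variable {N : ℕ} {H : Type*} [NormedAddCommGroup H] [InnerProductSpace ℝ H]
  [CompleteSpace H]

lemma tsum_zpow_inv_le {s : ℝ} (hs : 0 < s) {p : ℕ} (hp : 0 < p) :
    ∑' k : ℤ, (if s ≤ (2 : ℝ) ^ k then ENNReal.ofReal (((2 ^ k) ^ p)⁻¹) else 0) ≤
      ENNReal.ofReal (2 / s ^ p) := by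
  set k₀ := Int.clog 2 s with hk₀
  have hiff : ∀ k : ℤ, s ≤ (2 : ℝ) ^ k ↔ k₀ ≤ k := fun k => by
    have := Int.le_zpow_iff_clog_le (R := ℝ) (b := 2) (by norm_num) (x := k) hs
    simpa using this
  have hinj : Function.Injective fun i : ℕ => k₀ + (i : ℤ) := fun a b h => by
    simpa using h
  have hsupp : Function.support (fun k : ℤ => if s ≤ (2 : ℝ) ^ k then
      ENNReal.ofReal (((2 ^ k) ^ p)⁻¹) else 0) ⊆ Set.range fun i : ℕ => k₀ + (i : ℤ) := by
    intro k hk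
    have : k₀ ≤ k := by
      by_contra h
      exact hk (if_neg (fun h' => h ((hiff k).1 h')))
    exact ⟨(k - k₀).toNat, by simp only; omega⟩
  rw [← hinj.tsum_eq hsupp]
  calc _ ≤ ∑' i : ℕ, ENNReal.ofReal ((s ^ p)⁻¹) * (2⁻¹ : ℝ≥0∞) ^ i := by
        refine ENNReal.tsum_le_tsum fun i => ?_
        have hle : s ≤ (2 : ℝ) ^ k₀ := (hiff k₀).2 le_rfl
        rw [if_pos ((hiff _).2 (by omega))]
        have h2 : (2⁻¹ : ℝ≥0∞) ^ i = ENNReal.ofReal (((2 : ℝ) ^ i)⁻¹) := by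
          rw [ENNReal.ofReal_inv_of_pos (by positivity), ENNReal.ofReal_pow (by norm_num),
            ENNReal.inv_pow]
          simp
        rw [h2, ← ENNReal.ofReal_mul (by positivity), ← mul_inv]
        refine ENNReal.ofReal_le_ofReal (inv_anti₀ (by positivity) ?_)
        rw [zpow_add₀ (by norm_num), mul_pow, zpow_natCast]
        have h1 : (1 : ℝ) ≤ 2 ^ i := one_le_pow₀ (by norm_num)
        have h3 : (2 : ℝ) ^ i ≤ (2 ^ i) ^ p := le_self_pow₀ h1 hp.ne'
        gcongr
    _ = ENNReal.ofReal (2 / s ^ p) := by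
        rw [ENNReal.tsum_mul_left, ENNReal.tsum_geometric, div_eq_mul_inv, mul_comm (2 : ℝ),
          ENNReal.ofReal_mul (by positivity)]
        congr 1
        simp

lemma abs_diffKer_le (x : Fin N → ℝ) (k : ℤ) (ω : RSpace N) (z : Fin N → ℝ) :
    |diffKer x (k, ω) z| ≤ (((2 : ℝ) ^ (k - 1)) ^ N)⁻¹ := by
  have h1 : (((2 : ℝ) ^ k) ^ N)⁻¹ ≤ (((2 : ℝ) ^ (k - 1)) ^ N)⁻¹ := by
    gcongr
    · norm_num
    · omega
  simp only [diffKer]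
  refine abs_sub_le_iff.2 ⟨?_, ?_⟩ <;>
  linarith [dker_nonneg (randOffset ω k) k x z, dker_le (randOffset ω k) k x z,
    dker_nonneg (randOffset ω (k - 1)) (k - 1) x z, dker_le (randOffset ω (k - 1)) (k - 1) x z]

lemma dker_eq_zero {t : Fin N → ℝ} {k : ℤ} {x z : Fin N → ℝ} (h : (2 : ℝ) ^ k < ‖x - z‖) :
    dker t k x z = 0 :=
  Set.indicator_of_notMem (fun h' => h.not_ge (by
    rw [norm_sub_rev]; exact norm_sub_le_of_mem_dcube h')) _

lemma diffKer_eq_zero {x z : Fin N → ℝ} {k : ℤ} (ω : RSpace N) (h : (2 : ℝ) ^ k < ‖x - z‖) :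
    diffKer x (k, ω) z = 0 := by
  have h1 : (2 : ℝ) ^ (k - 1) ≤ 2 ^ k := zpow_le_zpow_right₀ (by norm_num) (by omega)
  simp only [diffKer]
  rw [dker_eq_zero h, dker_eq_zero (h1.trans_lt h), sub_zero]

lemma measurable_ker_middle {Θ : Type*} [MeasurableSpace Θ]
    {K : (Fin N → ℝ) → Θ → (Fin N → ℝ) → ℝ}
    (hK : Measurable fun p : ((Fin N → ℝ) × Θ) × (Fin N → ℝ) => K p.1.1 p.1.2 p.2)
    (x z : Fin N → ℝ) : Measurable fun θ => K x θ z :=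
  hK.comp ((measurable_const.prodMk measurable_id).prodMk measurable_const)

lemma measurable_diffKer_sub (x z z' : Fin N → ℝ) :
    Measurable fun θ : DPar N => ‖diffKer x θ z - diffKer x θ z'‖ₑ ^ 2 :=
  ((measurable_ker_middle measurable_diffKer x z).sub
    (measurable_ker_middle measurable_diffKer x z')).enorm.pow_const 2

lemma TruncBound.of_separate {Θ : Type*} [MeasurableSpace Θ]
    {K : (Fin N → ℝ) → Θ → (Fin N → ℝ) → ℝ} {ν : Measure Θ} {R : ℝ} {A : Set Θ} {B₁ B₂ B₃ : ℝ}
    (hA : MeasurableSet A) (hν : ν A < ⊤) (h₁ : ∀ x, ∀ θ ∈ A, ∀ z, |K x θ z| ≤ B₁)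
    (h₂ : ∀ x, ‖x‖ ≤ R → ∀ θ ∈ A, ∀ z, |K x θ z| ≤ B₂ * (1 + ‖z‖) ^ (-((N : ℝ) + 1)))
    (h₃ : ∀ x z z', ∫⁻ θ in A, ‖K x θ z - K x θ z'‖ₑ ^ 2 ∂ν ≤ ENNReal.ofReal (B₃ * ‖z - z'‖)) :
    ∃ B, 0 ≤ B ∧ TruncBound K ν R A B := by
  refine ⟨max 0 (max B₁ (max B₂ B₃)), le_max_left _ _, hA, hν, fun x θ hθ z => ?_,
    fun x hx θ hθ z => ?_, fun x z z' => ?_⟩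
  · exact (h₁ x θ hθ z).trans ((le_max_left _ _).trans (le_max_right _ _))
  · refine (h₂ x hx θ hθ z).trans ?_
    gcongr
    exact (le_max_left _ _).trans ((le_max_right _ _).trans (le_max_right _ _))
  · refine (h₃ x z z').trans (ENNReal.ofReal_le_ofReal ?_)
    gcongr
    exact (le_max_right _ _).trans ((le_max_right _ _).trans (le_max_right _ _))

/-- The truncation of the parameter space of `diffKer` to scales between `2^(-m)` and `2^m`. -/
def dparTrunc (N : ℕ) (m : ℕ) : Set (DPar N) := Set.Icc (-(m : ℤ)) m ×ˢ Set.univ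

lemma monotone_dparTrunc : Monotone (dparTrunc N) := fun a b hab θ hθ => by
  simp only [dparTrunc, Set.mem_prod, Set.mem_Icc, Set.mem_univ, and_true] at hθ ⊢
  omega

lemma iUnion_dparTrunc : ⋃ m, dparTrunc N m = Set.univ := by
  refine Set.eq_univ_of_forall fun θ => Set.mem_iUnion.2 ⟨θ.1.natAbs, ?_⟩
  simp only [dparTrunc, Set.mem_prod, Set.mem_Icc, Set.mem_univ, and_true]
  omega

lemma count_Icc_lt_top (m : ℕ) : Measure.count (Set.Icc (-(m : ℤ)) m) < ⊤ :=
  Measure.count_apply_lt_top.2 (Set.finite_Icc _ _)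

lemma exists_truncBound_diffKer (m : ℕ) :
    ∃ B, 0 ≤ B ∧ TruncBound (diffKer (N := N)) (dparMeasure N) m (dparTrunc N m) B := by
  have hscale : ∀ k ∈ Set.Icc (-(m : ℤ)) m, (((2 : ℝ) ^ (k - 1)) ^ N)⁻¹ ≤ (2 ^ (m + 1)) ^ N := by
    intro k hk
    rw [← inv_pow, ← zpow_neg]
    refine pow_le_pow_left₀ (by positivity) ?_ N
    rw [← zpow_natCast]
    exact zpow_le_zpow_right₀ (by norm_num) (by push_cast; linarith [hk.1])
  refine TruncBound.of_separate (B₁ := ((2 : ℝ) ^ (m + 1)) ^ N)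
    (B₂ := ((2 : ℝ) ^ (m + 1)) ^ N * (1 + (m + 2 ^ m)) ^ ((N : ℝ) + 1))
    (B₃ := 4 * N * 2 ^ (2 * N + 1) * (2 ^ m) ^ (2 * N + 1) *
      (Measure.count (Set.Icc (-(m : ℤ)) m)).toReal)
    (measurableSet_Icc.prod MeasurableSet.univ) ?_ ?_ ?_ ?_
  · rw [dparMeasure, dparTrunc, Measure.prod_prod, measure_univ, mul_one]
    exact count_Icc_lt_top m
  · rintro x ⟨k, ω⟩ hθ z
    exact (abs_diffKer_le x k ω z).trans (hscale k hθ.1)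
  · rintro x hx ⟨k, ω⟩ hθ z
    rcases lt_or_ge ((2 : ℝ) ^ k) ‖x - z‖ with h | h
    · rw [diffKer_eq_zero ω h, abs_zero]
      positivity
    · have hk : (2 : ℝ) ^ k ≤ 2 ^ m := by
        rw [← zpow_natCast]
        exact zpow_le_zpow_right₀ (by norm_num) hθ.1.2
      have hz : ‖z‖ ≤ m + 2 ^ m := by
        have := norm_sub_le x (x - z)
        rw [sub_sub_cancel] at this
        linarith
      refine ((abs_diffKer_le x k ω z).trans (hscale k hθ.1)).trans ?_
      rw [mul_assoc]
      refine le_mul_of_one_le_right (by positivity) ?_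
      rw [Real.rpow_neg (by positivity), ← div_eq_mul_inv, one_le_div (by positivity)]
      gcongr
  · intro x z z'
    rw [dparMeasure, dparTrunc, ← Measure.prod_restrict, Measure.restrict_univ,
      lintegral_prod _ (measurable_diffKer_sub x z z').aemeasurable]
    calc _ ≤ ∫⁻ k in Set.Icc (-(m : ℤ)) m, ENNReal.ofReal
          (4 * N * 2 ^ (2 * N + 1) * (2 ^ m) ^ (2 * N + 1) * ‖z - z'‖) ∂Measure.count := by
          refine setLIntegral_mono measurable_const fun k hk => ?_
          refine (lintegral_diffKer_sub_sq_le k x z z').trans (ENNReal.ofReal_le_ofReal ?_)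
          have h1 : (((2 : ℝ) ^ k) ^ (2 * N + 1))⁻¹ ≤ (2 ^ m) ^ (2 * N + 1) := by
            rw [← inv_pow, ← zpow_neg]
            refine pow_le_pow_left₀ (by positivity) ?_ _
            rw [← zpow_natCast]
            exact zpow_le_zpow_right₀ (by norm_num) (by linarith [hk.1])
          calc _ = (4 * N * 2 ^ (2 * N + 1) * ‖z - z'‖) * (((2 : ℝ) ^ k) ^ (2 * N + 1))⁻¹ := by
                ring
            _ ≤ (4 * N * 2 ^ (2 * N + 1) * ‖z - z'‖) * (2 ^ m) ^ (2 * N + 1) := by gcongr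
            _ = _ := by ring
      _ = _ := by
          rw [setLIntegral_const]
          nth_rw 1 [← ENNReal.ofReal_toReal (count_Icc_lt_top m).ne]
          rw [← ENNReal.ofReal_mul (by positivity)]
          congr 1
          ring

lemma exists_horBound_diffKer :
    ∃ C : NNReal, HorBound (diffKer (N := N)) (dparMeasure N) C := by
  refine exists_horBound (p := 1) one_pos (D := 8 * N * 2 ^ (2 * N + 1) * 2 ^ (2 * N + 1))
    (by positivity) fun z₀ z x l hl hz hx => ?_
  set d := ‖x - z₀‖ with hd
  rw [lintegral_dparMeasure (measurable_diffKer_sub x z z₀)]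
  have hs : 0 < (l + d) / 2 := by linarith
  have hxz : (l + d) / 2 < ‖x - z‖ := by
    have := norm_sub_le_norm_sub_add_norm_sub x z z₀
    linarith
  calc _ ≤ ∑' k : ℤ, ENNReal.ofReal (4 * N * l * 2 ^ (2 * N + 1)) *
          (if (l + d) / 2 ≤ (2 : ℝ) ^ k then
            ENNReal.ofReal (((2 ^ k) ^ (2 * N + 1))⁻¹) else 0) := by
        refine ENNReal.tsum_le_tsum fun k => ?_
        split_ifs with h
        · refine (lintegral_diffKer_sub_sq_le k x z z₀).trans ?_
          rw [← ENNReal.ofReal_mul (by positivity), div_eq_mul_inv]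
          gcongr
        · push Not at h
          refine le_of_eq ?_
          have h1 : ∀ ω, diffKer x (k, ω) z = 0 := fun ω => diffKer_eq_zero ω (h.trans hxz)
          have h2 : ∀ ω, diffKer x (k, ω) z₀ = 0 := fun ω => diffKer_eq_zero ω (by linarith)
          simp [h1, h2]
    _ ≤ ENNReal.ofReal (4 * N * l * 2 ^ (2 * N + 1)) *
          ENNReal.ofReal (2 / ((l + d) / 2) ^ (2 * N + 1)) := by
        rw [ENNReal.tsum_mul_left]
        gcongr
        exact tsum_zpow_inv_le hs (by omega)
    _ = _ := by
        rw [← ENNReal.ofReal_mul (by positivity)]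
        congr 1
        rw [div_pow]
        have : (l + d) ^ (2 * N + 1) ≠ 0 := by positivity
        field_simp
        ring

lemma tsum_lintegral_hdiff_sq_le {c : ℤ → Fin N → ℝ} (hc : Nested c) {φ : (Fin N → ℝ) → H}
    (hφ : StronglyMeasurable φ) {B : ℝ} (hB : ∀ x, ‖φ x‖ ≤ B) (hφi : Integrable φ) :
    ∑' k : ℤ, ∫⁻ x, ‖hdiff c k φ x‖ₑ ^ 2 ≤ ∫⁻ x, ‖φ x‖ₑ ^ 2 := by
  rw [ENNReal.tsum_eq_iSup_sum]
  refine iSup_le fun s => ?_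
  obtain ⟨M, hM⟩ : ∃ M : ℕ, ∀ k ∈ s, k.natAbs ≤ M :=
    ⟨s.sup Int.natAbs, fun k hk => Finset.le_sup (f := Int.natAbs) hk⟩
  have hsub : s ⊆ (Finset.range (2 * M + 1)).image fun i : ℕ => (M : ℤ) - i := by
    intro k hk
    have := hM k hk
    exact Finset.mem_image.2 ⟨((M : ℤ) - k).toNat, by simp only [Finset.mem_range]; omega,
      by omega⟩
  refine (Finset.sum_le_sum_of_subset hsub).trans ?_
  rw [Finset.sum_image (fun a _ b _ h => by simpa using h)]
  exact sum_lintegral_hdiff_sq_le hc hφ hB hφi M _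

lemma measurable_enorm_kerApply {Θ : Type*} [MeasurableSpace Θ]
    {K : (Fin N → ℝ) → Θ → (Fin N → ℝ) → ℝ}
    (hK : Measurable fun p : ((Fin N → ℝ) × Θ) × (Fin N → ℝ) => K p.1.1 p.1.2 p.2)
    {φ : (Fin N → ℝ) → H} (hφ : StronglyMeasurable φ) :
    Measurable fun p : (Fin N → ℝ) × Θ => ‖kerApply K φ p.1 p.2‖ₑ ^ 2 :=
  (stronglyMeasurable_kerApply hK hφ).enorm.pow_const 2

lemma lintegral_lintegral_dparMeasure {g : (Fin N → ℝ) → DPar N → ℝ≥0∞}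
    (hm : Measurable fun p : (Fin N → ℝ) × DPar N => g p.1 p.2) :
    ∫⁻ x, ∫⁻ θ, g x θ ∂dparMeasure N = ∫⁻ ω, ∑' k : ℤ, ∫⁻ x, g x (k, ω) ∂volume ∂randMeasure N := by
  have hm2 : ∀ k : ℤ, Measurable fun p : (Fin N → ℝ) × RSpace N => g p.1 (k, p.2) := fun k =>
    hm.comp (measurable_fst.prodMk (measurable_const.prodMk measurable_snd))
  have h1 : ∀ x, ∫⁻ θ, g x θ ∂dparMeasure N = ∑' k : ℤ, ∫⁻ ω, g x (k, ω) ∂randMeasure N :=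
    fun x => lintegral_dparMeasure (hm.comp measurable_prodMk_left)
  simp only [h1]
  rw [lintegral_tsum fun k => ((hm2 k).lintegral_prod_right').aemeasurable]
  have h2 : ∀ k : ℤ, ∫⁻ x, ∫⁻ ω, g x (k, ω) ∂randMeasure N =
      ∫⁻ ω, ∫⁻ x, g x (k, ω) ∂volume ∂randMeasure N := fun k =>
    lintegral_lintegral_swap (hm2 k).aemeasurable
  simp only [h2]
  rw [← lintegral_tsum fun k => ((hm2 k).lintegral_prod_left').aemeasurable]

lemma l2Bound_diffKer : L2Bound H (diffKer (N := N)) (dparMeasure N) 1 := by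
  rintro φ hφ ⟨B, hB⟩ hφi
  rw [lintegral_lintegral_dparMeasure
    (measurable_enorm_kerApply (measurable_diffKer (N := N)) hφ)]
  calc _ ≤ ∫⁻ ω, ∫⁻ x, ‖φ x‖ₑ ^ 2 ∂volume ∂randMeasure N := by
        refine lintegral_mono fun ω => ?_
        simp only [kerApply_diffKer hφi]
        exact tsum_lintegral_hdiff_sq_le (nested_randOffset ω) hφ hB hφi
    _ = _ := by simp

end DiffKer

section HomSmooth

variable {N : ℕ} {E F : Type*} [NormedAddCommGroup E] [NormedSpace ℝ E] [NormedAddCommGroup F]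
  [NormedSpace ℝ F]

/-- Smooth functions away from the origin that are positively homogeneous of degree `-a`. -/
structure HomSmooth (a : ℕ) (g : E → F) : Prop where
  contDiffAt : ∀ p, p ≠ 0 → ContDiffAt ℝ (⊤ : ℕ∞) g p
  hom : ∀ r : ℝ, 0 < r → ∀ p, g (r • p) = (r ^ a)⁻¹ • g p

lemma HomSmooth.differentiableAt {a : ℕ} {g : E → F} (hg : HomSmooth a g) {p : E} (hp : p ≠ 0) :
    DifferentiableAt ℝ g p :=
  (hg.contDiffAt p hp).differentiableAt (by simp)

lemma HomSmooth.fderiv {a : ℕ} {g : E → F} (hg : HomSmooth a g) :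
    HomSmooth (a + 1) (fderiv ℝ g) := by
  refine ⟨fun p hp => (hg.contDiffAt p hp).fderiv_right (m := (⊤ : ℕ∞)) (by simp), ?_⟩
  intro r hr p
  have h1 : _root_.fderiv ℝ (fun x => g (r • x)) p = r • _root_.fderiv ℝ g (r • p) :=
    fderiv_comp_smul r
  have h2 : (fun x => g (r • x)) = fun x => (r ^ a)⁻¹ • g x := funext (hg.hom r hr)
  rw [h2] at h1
  have h3 : _root_.fderiv ℝ (fun x => (r ^ a)⁻¹ • g x) p = (r ^ a)⁻¹ • _root_.fderiv ℝ g p :=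
    congrFun (fderiv_const_smul_field (𝕜 := ℝ) ((r ^ a)⁻¹)) p
  rw [h3] at h1
  rw [pow_succ, mul_inv, mul_comm, mul_smul, h1, smul_smul, inv_mul_cancel₀ hr.ne', one_smul]

lemma HomSmooth.clm_apply {a : ℕ} {g : E → E →L[ℝ] F} (hg : HomSmooth a g) (v : E) :
    HomSmooth a fun p => g p v :=
  ⟨fun p hp => (hg.contDiffAt p hp).clm_apply contDiffAt_const, fun r hr p => by
    rw [hg.hom r hr]; rfl⟩

lemma HomSmooth.exists_bound [FiniteDimensional ℝ E] {a : ℕ} {g : E → F} (hg : HomSmooth a g) :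
    ∃ C : ℝ, 0 ≤ C ∧ ∀ p, p ≠ 0 → ‖g p‖ ≤ C / ‖p‖ ^ a := by
  have hc : ContinuousOn g (Metric.sphere 0 1) := fun p hp =>
    (hg.contDiffAt p (by rintro rfl; simp at hp)).continuousAt.continuousWithinAt
  have : ProperSpace E := FiniteDimensional.proper ℝ E
  obtain ⟨C, hC⟩ := (isCompact_sphere (0 : E) 1).exists_bound_of_continuousOn hc
  refine ⟨max C 0, le_max_right _ _, fun p hp => ?_⟩
  have hn : 0 < ‖p‖ := norm_pos_iff.2 hp
  have h1 := hC (‖p‖⁻¹ • p) (by simp [norm_smul, hn.ne'])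
  rw [hg.hom _ (inv_pos.2 hn), norm_smul, norm_inv, norm_pow, norm_inv, norm_norm, inv_pow,
    inv_inv] at h1
  rw [le_div_iff₀ (by positivity), mul_comm]
  exact h1.trans (le_max_left _ _)

/-- The coordinate directions in `ℝ^N × ℝ`; the last one is the direction of the last factor. -/
def pdir (N : ℕ) (i : Fin (N + 1)) : (Fin N → ℝ) × ℝ :=
  if h : (i : ℕ) < N then (Pi.single (⟨i, h⟩ : Fin N) 1, 0) else (0, 1)

/-- Partial derivatives in `ℝ^N × ℝ`. -/
def pd (i : Fin (N + 1)) (g : (Fin N → ℝ) × ℝ → ℝ) (p : (Fin N → ℝ) × ℝ) : ℝ :=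
  fderiv ℝ g p (pdir N i)

lemma HomSmooth.pd {a : ℕ} {g : (Fin N → ℝ) × ℝ → ℝ} (hg : HomSmooth a g) (i : Fin (N + 1)) :
    HomSmooth (a + 1) (pd i g) := hg.fderiv.clm_apply _

/-- The Poisson kernel as a function on `ℝ^N × ℝ`. -/
def pker (N : ℕ) (p : (Fin N → ℝ) × ℝ) : ℝ := pk N p.1 p.2

/-- The square of the Euclidean norm on `ℝ^N × ℝ`. -/
def rhoSq (p : (Fin N → ℝ) × ℝ) : ℝ := (∑ i, p.1 i ^ 2) + p.2 ^ 2

lemma rhoSq_nonneg (p : (Fin N → ℝ) × ℝ) : 0 ≤ rhoSq p :=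
  add_nonneg (Finset.sum_nonneg fun _ _ => sq_nonneg _) (sq_nonneg _)

lemma sq_norm_le_rhoSq (p : (Fin N → ℝ) × ℝ) : ‖p‖ ^ 2 ≤ rhoSq p := by
  have h : ‖p‖ ≤ Real.sqrt (rhoSq p) := by
    rw [Prod.norm_def]
    refine max_le ((pi_norm_le_iff_of_nonneg (Real.sqrt_nonneg _)).2 fun i => ?_) ?_
    · refine Real.abs_le_sqrt ?_
      have := Finset.single_le_sum (f := fun i => p.1 i ^ 2) (fun _ _ => sq_nonneg _)
        (Finset.mem_univ i)
      simp only [rhoSq]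
      nlinarith [sq_nonneg p.2]
    · refine Real.abs_le_sqrt ?_
      simp only [rhoSq]
      linarith [Finset.sum_nonneg (s := Finset.univ) (f := fun i => p.1 i ^ 2)
        fun _ _ => sq_nonneg _]
  calc ‖p‖ ^ 2 ≤ Real.sqrt (rhoSq p) ^ 2 := by gcongr
    _ = rhoSq p := Real.sq_sqrt (rhoSq_nonneg p)

lemma rhoSq_pos {p : (Fin N → ℝ) × ℝ} (hp : p ≠ 0) : 0 < rhoSq p :=
  lt_of_lt_of_le (by have := norm_pos_iff.2 hp; positivity) (sq_norm_le_rhoSq p)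

lemma contDiff_rhoSq : ContDiff ℝ (⊤ : ℕ∞) (rhoSq (N := N)) := by
  unfold rhoSq
  refine ContDiff.add (ContDiff.sum fun i _ => ?_) (by fun_prop)
  have : ContDiff ℝ (⊤ : ℕ∞) fun p : (Fin N → ℝ) × ℝ => p.1 i :=
    (contDiff_apply ℝ ℝ i).comp contDiff_fst
  exact this.pow 2

/-- The normalizing constant of the Poisson kernel. -/
def pconst (N : ℕ) : ℝ := Real.Gamma (((N : ℝ) + 1) / 2) / Real.pi ^ (((N : ℝ) + 1) / 2)

lemma pconst_pos (N : ℕ) : 0 < pconst N :=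
  div_pos (Real.Gamma_pos_of_pos (by positivity)) (Real.rpow_pos_of_pos Real.pi_pos _)

lemma pker_eq (p : (Fin N → ℝ) × ℝ) :
    pker N p = pconst N * (p.2 * rhoSq p ^ (-(((N : ℝ) + 1) / 2))) := by
  rw [pker, pk, Real.rpow_neg (rhoSq_nonneg p), rhoSq, pconst, div_eq_mul_inv, mul_assoc]

lemma contDiffAt_rhoSq_rpow {p : (Fin N → ℝ) × ℝ} (hp : p ≠ 0) (β : ℝ) :
    ContDiffAt ℝ (⊤ : ℕ∞) (fun p => rhoSq p ^ β) p :=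
  contDiff_rhoSq.contDiffAt.rpow_const_of_ne (rhoSq_pos hp).ne'

lemma rhoSq_smul (r : ℝ) (p : (Fin N → ℝ) × ℝ) : rhoSq (r • p) = r ^ 2 * rhoSq p := by
  simp only [rhoSq, Prod.smul_fst, Prod.smul_snd, Pi.smul_apply, smul_eq_mul, mul_pow, mul_add,
    Finset.mul_sum]

lemma homSmooth_pker (N : ℕ) : HomSmooth N (pker N) := by
  refine ⟨fun p hp => ?_, fun r hr p => ?_⟩
  · have : pker N = fun p => pconst N * (p.2 * rhoSq p ^ (-(((N : ℝ) + 1) / 2))) :=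
      funext pker_eq
    rw [this]
    exact contDiffAt_const.mul (contDiffAt_snd.mul (contDiffAt_rhoSq_rpow hp _))
  · rw [pker_eq, pker_eq, rhoSq_smul, Real.mul_rpow (by positivity) (rhoSq_nonneg p),
      ← Real.rpow_natCast r 2, ← Real.rpow_mul hr.le, Prod.smul_snd]
    have : r ^ (((2 : ℕ) : ℝ) * -(((N : ℝ) + 1) / 2)) = (r ^ (N + 1))⁻¹ := by
      rw [← Real.rpow_natCast, ← Real.rpow_neg hr.le]
      congr 1
      push_cast
      ring
    rw [this, smul_eq_mul, smul_eq_mul, pow_succ]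
    field_simp

lemma pker_pos {p : (Fin N → ℝ) × ℝ} (hp : 0 < p.2) : 0 < pker N p := by
  have : 0 < rhoSq p := rhoSq_pos (by rintro rfl; simp at hp)
  rw [pker_eq]
  have := pconst_pos N
  positivity

lemma pker_le {p : (Fin N → ℝ) × ℝ} (hp : 0 < p.2) :
    pker N p ≤ pconst N * (p.2 / ‖p‖ ^ (N + 1)) := by
  have h0 : p ≠ 0 := by rintro rfl; simp at hp
  have hn : 0 < ‖p‖ := norm_pos_iff.2 h0
  rw [pker_eq, div_eq_mul_inv p.2]
  have hc := pconst_pos N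
  refine mul_le_mul_of_nonneg_left (mul_le_mul_of_nonneg_left ?_ hp.le) hc.le
  have h1 : rhoSq p ^ (-(((N : ℝ) + 1) / 2)) ≤ (‖p‖ ^ 2) ^ (-(((N : ℝ) + 1) / 2)) :=
    Real.rpow_le_rpow_of_nonpos (by positivity) (sq_norm_le_rhoSq p)
      (by have : (0 : ℝ) ≤ N := Nat.cast_nonneg N
          linarith)
  refine h1.trans (le_of_eq ?_)
  rw [← Real.rpow_natCast, ← Real.rpow_mul hn.le, ← Real.rpow_natCast, ← Real.rpow_neg hn.le]
  congr 1
  push_cast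
  ring

/-- The coordinate functions of `ℝ^N × ℝ`. -/
def pcoord (i : Fin (N + 1)) (p : (Fin N → ℝ) × ℝ) : ℝ :=
  if h : (i : ℕ) < N then p.1 ⟨i, h⟩ else p.2

lemma sum_pcoord_mul (p q : (Fin N → ℝ) × ℝ) :
    ∑ i, pcoord i p * pcoord i q = (∑ i, p.1 i * q.1 i) + p.2 * q.2 := by
  rw [Fin.sum_univ_castSucc]
  simp [pcoord]

lemma sum_pcoord_sq (p : (Fin N → ℝ) × ℝ) : ∑ i, pcoord i p ^ 2 = rhoSq p := by
  simp only [sq, sum_pcoord_mul, rhoSq]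

lemma pcoord_pdir_self (i : Fin (N + 1)) : pcoord i (pdir N i) = 1 := by
  unfold pcoord pdir
  split_ifs <;> simp

lemma fderiv_pcoord (i : Fin (N + 1)) (p v : (Fin N → ℝ) × ℝ) :
    DifferentiableAt ℝ (pcoord i) p ∧ fderiv ℝ (pcoord i) p v = pcoord i v := by
  let L : ((Fin N → ℝ) × ℝ) →L[ℝ] ℝ :=
    if h : (i : ℕ) < N then (ContinuousLinearMap.proj (R := ℝ) (φ := fun _ : Fin N => ℝ)
      (⟨i, h⟩ : Fin N)).comp (ContinuousLinearMap.fst ℝ _ _)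
    else ContinuousLinearMap.snd ℝ _ _
  have hL : pcoord i = L := by
    ext p
    simp only [pcoord, L]
    split_ifs <;> simp
  rw [hL]
  exact ⟨L.differentiableAt, by rw [L.fderiv]⟩

lemma pdir_snd_eq (i : Fin (N + 1)) : (pdir N i).2 = if i = Fin.last N then 1 else 0 := by
  unfold pdir
  split_ifs with h h' h'
  · simp [h'] at h
  · rfl
  · rfl
  · exact absurd (Fin.ext (by simp; omega)) h'

lemma fderiv_rhoSq (p v : (Fin N → ℝ) × ℝ) :
    fderiv ℝ rhoSq p v = 2 * ((∑ i, p.1 i * v.1 i) + p.2 * v.2) := by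
  have h : (rhoSq : (Fin N → ℝ) × ℝ → ℝ) = fun p => ∑ i, pcoord i p ^ 2 :=
    funext fun p => (sum_pcoord_sq p).symm
  rw [h, fderiv_fun_sum fun i _ => ((fderiv_pcoord i p v).1.fun_pow 2), ← sum_pcoord_mul,
    sum_apply, Finset.mul_sum]
  refine Finset.sum_congr rfl fun i _ => ?_
  rw [fderiv_fun_pow _ (fderiv_pcoord i p v).1]
  simp [(fderiv_pcoord i p v).2]
  ring

lemma pd_rhoSq (i : Fin (N + 1)) (p : (Fin N → ℝ) × ℝ) :
    fderiv ℝ rhoSq p (pdir N i) = 2 * pcoord i p := by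
  rw [fderiv_rhoSq]
  congr 1
  unfold pdir pcoord
  split_ifs <;> simp [Pi.single_apply]

lemma pd_rhoSq_rpow (i : Fin (N + 1)) {p : (Fin N → ℝ) × ℝ} (hp : p ≠ 0) (β : ℝ) :
    pd i (fun p => rhoSq p ^ β) p = 2 * β * pcoord i p * rhoSq p ^ (β - 1) := by
  have h : HasFDerivAt (fun p => rhoSq p ^ β) _ p :=
    ((contDiff_rhoSq (N := N)).differentiable (by simp) p).hasFDerivAt.rpow_const
      (Or.inl (rhoSq_pos hp).ne') (p := β)
  rw [pd, h.fderiv, smul_apply, pd_rhoSq, smul_eq_mul]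
  ring

lemma pd_mul {i : Fin (N + 1)} {g h : (Fin N → ℝ) × ℝ → ℝ} {p : (Fin N → ℝ) × ℝ}
    (hg : DifferentiableAt ℝ g p) (hh : DifferentiableAt ℝ h p) :
    pd i (fun p => g p * h p) p = g p * pd i h p + h p * pd i g p := by
  rw [pd, fderiv_fun_mul hg hh]
  simp [pd]

lemma pd_snd (i : Fin (N + 1)) (p : (Fin N → ℝ) × ℝ) :
    pd i (fun p => p.2) p = (pdir N i).2 := by
  rw [pd, fderiv_snd]
  rfl

lemma pd_pcoord (i : Fin (N + 1)) (p : (Fin N → ℝ) × ℝ) : pd i (pcoord i) p = 1 := by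
  rw [pd, (fderiv_pcoord i p _).2, pcoord_pdir_self]

lemma pd_pker (i : Fin (N + 1)) {p : (Fin N → ℝ) × ℝ} (hp : p ≠ 0) :
    pd i (pker N) p = pconst N * ((pdir N i).2 * rhoSq p ^ (-(((N : ℝ) + 1) / 2)) -
      ((N : ℝ) + 1) * (p.2 * (pcoord i p * rhoSq p ^ (-(((N : ℝ) + 1) / 2) - 1)))) := by
  have : pker N = fun p => pconst N * (p.2 * rhoSq p ^ (-(((N : ℝ) + 1) / 2))) := funext pker_eq
  have hd := (contDiffAt_rhoSq_rpow hp (-(((N : ℝ) + 1) / 2))).differentiableAt (by simp)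
  rw [this, pd_mul (differentiableAt_const _) (differentiableAt_snd.fun_mul hd),
    pd_mul differentiableAt_snd hd, pd_rhoSq_rpow i hp, pd_snd]
  have h0 : pd i (fun _ => pconst N) p = 0 := by simp [pd]
  rw [h0]
  ring

lemma pd_pd_pker (i : Fin (N + 1)) {p : (Fin N → ℝ) × ℝ} (hp : p ≠ 0) :
    pd i (pd i (pker N)) p = pconst N * (((N : ℝ) + 1) * (
      -(2 * (pdir N i).2 * pcoord i p + p.2) * rhoSq p ^ (-(((N : ℝ) + 1) / 2) - 1) +
      ((N : ℝ) + 3) * (p.2 * pcoord i p ^ 2 * rhoSq p ^ (-(((N : ℝ) + 1) / 2) - 2)))) := by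
  have hev : pd i (pker N) =ᶠ[𝓝 p] fun p => pconst N *
      ((pdir N i).2 * rhoSq p ^ (-(((N : ℝ) + 1) / 2)) -
      ((N : ℝ) + 1) * (p.2 * (pcoord i p * rhoSq p ^ (-(((N : ℝ) + 1) / 2) - 1)))) := by
    filter_upwards [isOpen_ne.mem_nhds hp] with q hq
    exact pd_pker i hq
  have hd := fun β => (contDiffAt_rhoSq_rpow hp β).differentiableAt (by simp)
  have hc := (fderiv_pcoord i p 0).1
  have h0 : ∀ c : ℝ, pd i (fun _ => c) p = 0 := fun c => by simp [pd]
  have hsub : ∀ {g h : (Fin N → ℝ) × ℝ → ℝ}, DifferentiableAt ℝ g p → DifferentiableAt ℝ h p →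
      pd i (fun p => g p - h p) p = pd i g p - pd i h p := fun hg hh => by
    rw [pd, fderiv_fun_sub hg hh]; rfl
  have h1 : DifferentiableAt ℝ (fun p : (Fin N → ℝ) × ℝ => pcoord i p *
      rhoSq p ^ (-(((N : ℝ) + 1) / 2) - 1)) p := hc.fun_mul (hd _)
  have h2 : DifferentiableAt ℝ (fun p : (Fin N → ℝ) × ℝ => p.2 * (pcoord i p *
      rhoSq p ^ (-(((N : ℝ) + 1) / 2) - 1))) p := differentiableAt_snd.fun_mul h1
  have h3 := (differentiableAt_const (𝕜 := ℝ) (x := p) ((pdir N i).2)).fun_mul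
    (hd (-(((N : ℝ) + 1) / 2)))
  have h4 := (differentiableAt_const (𝕜 := ℝ) (x := p) ((N : ℝ) + 1)).fun_mul h2
  rw [pd, hev.fderiv_eq, ← pd, pd_mul (differentiableAt_const _) (h3.fun_sub h4), hsub h3 h4,
    pd_mul (differentiableAt_const _) (hd _), pd_mul (differentiableAt_const _) h2,
    pd_mul differentiableAt_snd h1, pd_mul hc (hd _), pd_rhoSq_rpow i hp, pd_rhoSq_rpow i hp,
    pd_snd, pd_pcoord, h0, h0, h0]
  have e : -(((N : ℝ) + 1) / 2) - 1 - 1 = -(((N : ℝ) + 1) / 2) - 2 := by ring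
  rw [e]
  ring

/-- The Poisson kernel is harmonic. -/
lemma sum_pd_pd_pker {p : (Fin N → ℝ) × ℝ} (hp : p ≠ 0) :
    ∑ i, pd i (pd i (pker N)) p = 0 := by
  simp only [pd_pd_pker _ hp]
  rw [← Finset.mul_sum, ← Finset.mul_sum, Finset.sum_add_distrib, ← Finset.sum_mul,
    ← Finset.mul_sum, ← Finset.sum_mul, ← Finset.mul_sum, sum_pcoord_sq, Finset.sum_neg_distrib,
    Finset.sum_add_distrib]
  have h1 : ∑ i, 2 * (pdir N i).2 * pcoord i p = 2 * p.2 := by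
    simp only [pdir_snd_eq, mul_ite, ite_mul, mul_one, mul_zero, zero_mul, Finset.sum_ite_eq',
      Finset.mem_univ, if_true]
    simp [pcoord]
  have h2 : rhoSq p ^ (-(((N : ℝ) + 1) / 2) - 1) =
      rhoSq p * rhoSq p ^ (-(((N : ℝ) + 1) / 2) - 2) := by
    rw [← Real.rpow_one_add' (rhoSq_nonneg p)]
    · congr 1
      ring
    · have : (0 : ℝ) ≤ N := Nat.cast_nonneg N
      intro h
      linarith
  rw [h1, h2]
  simp only [Finset.sum_const, Finset.card_univ, Fintype.card_fin, nsmul_eq_mul]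
  push_cast
  ring

end HomSmooth

section PKer

variable {N : ℕ}

/-- Kernels of the size and homogeneity of the Poisson kernel. -/
structure PKer (g : (Fin N → ℝ) × ℝ → ℝ) : Prop where
  hom : HomSmooth N g
  bound : ∃ C, 0 ≤ C ∧ ∀ p : (Fin N → ℝ) × ℝ, 0 < p.2 → |g p| ≤ C * (p.2 / ‖p‖ ^ (N + 1))

/-- The scale invariant partial derivative `t ∂_i`. -/
def tpd (i : Fin (N + 1)) (g : (Fin N → ℝ) × ℝ → ℝ) (p : (Fin N → ℝ) × ℝ) : ℝ := p.2 * pd i g p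

lemma ne_zero_of_snd_pos {p : (Fin N → ℝ) × ℝ} (hp : 0 < p.2) : p ≠ 0 := by
  rintro rfl; simp at hp

lemma snd_le_norm (p : (Fin N → ℝ) × ℝ) : p.2 ≤ ‖p‖ := (le_abs_self _).trans (norm_snd_le p)

lemma homSmooth_snd_mul {a : ℕ} {g : (Fin N → ℝ) × ℝ → ℝ} (hg : HomSmooth (a + 1) g) :
    HomSmooth a fun p => p.2 * g p := by
  refine ⟨fun p hp => contDiffAt_snd.mul (hg.contDiffAt p hp), fun r hr p => ?_⟩
  rw [hg.hom r hr p, Prod.smul_snd, smul_eq_mul, smul_eq_mul, smul_eq_mul, pow_succ]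
  field_simp

lemma pKer_pker : PKer (pker N) :=
  ⟨homSmooth_pker N, pconst N, (pconst_pos N).le, fun p hp => by
    rw [abs_of_pos (pker_pos hp)]; exact pker_le hp⟩

lemma PKer.tpd {g : (Fin N → ℝ) × ℝ → ℝ} (hg : PKer g) (i : Fin (N + 1)) : PKer (tpd i g) := by
  refine ⟨homSmooth_snd_mul (hg.hom.pd i), ?_⟩
  obtain ⟨C, hC, h⟩ := (hg.hom.pd i).exists_bound
  refine ⟨C, hC, fun p hp => ?_⟩
  rw [Treil.tpd, abs_mul, abs_of_pos hp]
  calc p.2 * |Treil.pd i g p| ≤ p.2 * (C / ‖p‖ ^ (N + 1)) := by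
        gcongr
        exact h p (ne_zero_of_snd_pos hp)
    _ = _ := by ring

lemma PKer.measurable {g : (Fin N → ℝ) × ℝ → ℝ} (hg : PKer g) : Measurable g := by
  refine measurable_of_continuousOn_compl_singleton 0 fun p hp => ?_
  exact (hg.hom.contDiffAt p hp).continuousAt.continuousWithinAt

lemma PKer.exists_bound {g : (Fin N → ℝ) × ℝ → ℝ} (hg : PKer g) :
    ∃ C, 0 ≤ C ∧ ∀ y : Fin N → ℝ, ∀ t : ℝ, 0 < t → |g (y, t)| ≤ C / t ^ N := by
  obtain ⟨C, hC, h⟩ := hg.bound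
  refine ⟨C, hC, fun y t ht => (h (y, t) ht).trans ?_⟩
  rw [div_eq_mul_inv C]
  refine mul_le_mul_of_nonneg_left ?_ hC
  have h1 : t ≤ ‖((y, t) : (Fin N → ℝ) × ℝ)‖ := snd_le_norm (y, t)
  calc t / ‖((y, t) : (Fin N → ℝ) × ℝ)‖ ^ (N + 1) ≤ t / t ^ (N + 1) := by gcongr
    _ = (t ^ N)⁻¹ := by
        rw [pow_succ]
        field_simp

lemma PKer.exists_decay {g : (Fin N → ℝ) × ℝ → ℝ} (hg : PKer g) {s r : ℝ} (hs : 0 < s) :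
    ∃ D, 0 ≤ D ∧ ∀ t ∈ Set.Icc s r, ∀ y : Fin N → ℝ,
      |g (y, t)| ≤ D * (1 + ‖y‖) ^ (-((N : ℝ) + 1)) := by
  obtain ⟨C, hC, h⟩ := hg.bound
  set m := min s 1 / 2 with hm
  have hm0 : 0 < m := by have := lt_min hs one_pos; positivity
  refine ⟨C * (max r 0 / m ^ (N + 1)), by positivity, fun t ht y => ?_⟩
  have ht0 : 0 < t := hs.trans_le ht.1
  refine (h (y, t) ht0).trans ?_
  have hn : m * (1 + ‖y‖) ≤ ‖((y, t) : (Fin N → ℝ) × ℝ)‖ := by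
    have h1 : t ≤ ‖((y, t) : (Fin N → ℝ) × ℝ)‖ := snd_le_norm (y, t)
    have h2 : ‖y‖ ≤ ‖((y, t) : (Fin N → ℝ) × ℝ)‖ := norm_fst_le (y, t)
    have h3 := min_le_left s 1
    have h4 := min_le_right s 1
    have h5 := norm_nonneg y
    have h6 := ht.1
    nlinarith
  rw [Real.rpow_neg (by positivity), mul_assoc]
  gcongr
  have e : (1 + ‖y‖) ^ ((N : ℝ) + 1) = (1 + ‖y‖) ^ (N + 1) := by
    rw [← Real.rpow_natCast]; push_cast; rfl
  rw [e, div_mul_eq_mul_div, div_eq_mul_inv, div_eq_mul_inv, mul_assoc, ← mul_inv, ← mul_pow,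
    mul_comm (1 + ‖y‖)]
  gcongr
  exact ht.2.trans (le_max_left _ _)

lemma PKer.measurable_slice {g : (Fin N → ℝ) × ℝ → ℝ} (hg : PKer g) (t : ℝ) :
    Measurable fun y => g (y, t) := hg.measurable.comp (measurable_id.prodMk measurable_const)

lemma PKer.integrable_slice {g : (Fin N → ℝ) × ℝ → ℝ} (hg : PKer g) {t : ℝ} (ht : 0 < t) :
    Integrable fun y => g (y, t) := by
  obtain ⟨D, hD, h⟩ := hg.exists_decay (s := t) (r := t) ht
  exact (integrable_one_add_norm_rpow.const_mul D).mono'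
    (hg.measurable_slice t).aestronglyMeasurable
    (ae_of_all _ fun y => h t ⟨le_rfl, le_rfl⟩ y)

lemma PKer.eq_scale {g : (Fin N → ℝ) × ℝ → ℝ} (hg : PKer g) {t : ℝ} (ht : 0 < t)
    (y : Fin N → ℝ) : g (y, t) = (t ^ N)⁻¹ * g (t⁻¹ • y, 1) := by
  rw [← smul_eq_mul, ← hg.hom.hom t ht]
  congr 1
  simp [Prod.smul_mk, smul_smul, ht.ne']

lemma PKer.integral_slice {g : (Fin N → ℝ) × ℝ → ℝ} (hg : PKer g) {t : ℝ} (ht : 0 < t) :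
    ∫ y, g (y, t) = ∫ y, g (y, 1) := by
  simp only [hg.eq_scale ht]
  rw [integral_const_mul, Measure.integral_comp_inv_smul_of_nonneg volume (fun y => g (y, 1)) ht.le]
  simp only [Module.finrank_fintype_fun_eq_card, Fintype.card_fin, smul_eq_mul]
  rw [← mul_assoc, inv_mul_cancel₀ (by positivity), one_mul]

lemma PKer.hasDerivAt {g : (Fin N → ℝ) × ℝ → ℝ} (hg : PKer g) (y : Fin N → ℝ) {t : ℝ}
    (ht : 0 < t) : HasDerivAt (fun t => g (y, t)) (t⁻¹ * Treil.tpd (Fin.last N) g (y, t)) t := by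
  have h1 := (hg.hom.differentiableAt (p := (y, t)) (ne_zero_of_snd_pos ht)).hasFDerivAt
  have h2 : HasDerivAt (fun t : ℝ => ((y, t) : (Fin N → ℝ) × ℝ)) (0, 1) t :=
    (hasDerivAt_const t y).prodMk (hasDerivAt_id t)
  have h3 := h1.comp_hasDerivAt t h2
  have e : t⁻¹ * Treil.tpd (Fin.last N) g (y, t) = fderiv ℝ g (y, t) (0, 1) := by
    simp only [Treil.tpd, Treil.pd]
    rw [← mul_assoc, inv_mul_cancel₀ ht.ne', one_mul]
    simp [pdir]
  rw [e]
  exact h3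

lemma PKer.hasLineDerivAt {g : (Fin N → ℝ) × ℝ → ℝ} (hg : PKer g) (i : Fin N) (y : Fin N → ℝ)
    {t : ℝ} (ht : 0 < t) : HasLineDerivAt ℝ (fun y => g (y, t))
      (t⁻¹ * Treil.tpd i.castSucc g (y, t)) y (Pi.single i 1) := by
  have h1 := (hg.hom.differentiableAt (p := (y, t)) (ne_zero_of_snd_pos ht)).hasFDerivAt
  have h2 : HasFDerivAt (fun y : Fin N → ℝ => ((y, t) : (Fin N → ℝ) × ℝ))
      ((ContinuousLinearMap.id ℝ _).prod 0) y :=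
    (hasFDerivAt_id y).prodMk (hasFDerivAt_const t y)
  have h3 := (h1.comp y h2).hasLineDerivAt (Pi.single i 1)
  have e : t⁻¹ * Treil.tpd i.castSucc g (y, t) = fderiv ℝ g (y, t) (Pi.single i 1, 0) := by
    simp only [Treil.tpd, Treil.pd]
    rw [← mul_assoc, inv_mul_cancel₀ ht.ne', one_mul]
    simp [pdir]
  rw [e]
  simp only [ContinuousLinearMap.comp_apply, ContinuousLinearMap.prod_apply,
    ContinuousLinearMap.id_apply, zero_apply] at h3
  exact h3

lemma PKer.integral_tpd_castSucc {g : (Fin N → ℝ) × ℝ → ℝ} (hg : PKer g) (i : Fin N) {t : ℝ}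
    (ht : 0 < t) : ∫ y, Treil.tpd i.castSucc g (y, t) = 0 := by
  have h := integral_bilinear_hasLineDerivAt_right_eq_neg_left_of_integrable
    (μ := (volume : Measure (Fin N → ℝ)))
    (f := fun _ : Fin N → ℝ => (1 : ℝ)) (f' := fun _ => 0) (g := fun y => g (y, t))
    (g' := fun y => t⁻¹ * Treil.tpd i.castSucc g (y, t)) (v := Pi.single i 1)
    (B := ContinuousLinearMap.mul ℝ ℝ)
    (by simp) (by simpa using (hg.tpd i.castSucc).integrable_slice ht |>.const_mul t⁻¹)
    (by simpa using hg.integrable_slice ht)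
    (fun x _ => (hasFDerivAt_const (1 : ℝ) x).hasLineDerivAt _)
    (fun x _ => hg.hasLineDerivAt i x ht)
  simp only [ContinuousLinearMap.mul_apply', one_mul, zero_mul, integral_zero, neg_zero,
    integral_const_mul] at h
  exact (mul_eq_zero.1 h).resolve_left (inv_ne_zero ht.ne')

/-- Differentiation under the integral sign for kernels of Poisson type. -/
lemma PKer.hasDerivAt_integral_mul {a b : (Fin N → ℝ) × ℝ → ℝ} (ha : PKer a) (hb : PKer b)
    (w : Fin N → ℝ) {t : ℝ} (ht : 0 < t) :
    HasDerivAt (fun t => ∫ y, a (y, t) * b (y - w, t))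
      (∫ y, t⁻¹ * (Treil.tpd (Fin.last N) a (y, t) * b (y - w, t) +
        a (y, t) * Treil.tpd (Fin.last N) b (y - w, t))) t := by
  obtain ⟨D₁, hD₁, h₁⟩ := ha.exists_decay (s := t / 2) (r := 2 * t) (by positivity)
  obtain ⟨D₂, hD₂, h₂⟩ := (ha.tpd (Fin.last N)).exists_decay (s := t / 2) (r := 2 * t)
    (by positivity)
  obtain ⟨C₁, hC₁, k₁⟩ := hb.exists_bound
  obtain ⟨C₂, hC₂, k₂⟩ := (hb.tpd (Fin.last N)).exists_bound
  have hmeas : ∀ {a b : (Fin N → ℝ) × ℝ → ℝ}, PKer a → PKer b → ∀ t,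
      Measurable fun y => a (y, t) * b (y - w, t) := fun ha hb t =>
    (ha.measurable_slice t).mul ((hb.measurable_slice t).comp (measurable_id.sub_const w))
  have hs : Set.Icc (t / 2) (2 * t) ∈ 𝓝 t := Icc_mem_nhds (by linarith) (by linarith)
  refine (hasDerivAt_integral_of_dominated_loc_of_deriv_le (s := Set.Icc (t / 2) (2 * t))
    (F := fun t y => a (y, t) * b (y - w, t))
    (F' := fun t y => t⁻¹ * (Treil.tpd (Fin.last N) a (y, t) * b (y - w, t) +
        a (y, t) * Treil.tpd (Fin.last N) b (y - w, t)))
    (bound := fun y => (t / 2)⁻¹ * (D₂ * (C₁ / (t / 2) ^ N) + D₁ * (C₂ / (t / 2) ^ N)) *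
      (1 + ‖y‖) ^ (-((N : ℝ) + 1))) hs
    (Eventually.of_forall fun t => (hmeas ha hb t).aestronglyMeasurable) ?_ ?_
    (ae_of_all _ fun y s hs => ?_) (integrable_one_add_norm_rpow.const_mul _)
    (ae_of_all _ fun y s hs => ?_)).2
  · refine (integrable_one_add_norm_rpow.const_mul (D₁ * (C₁ / t ^ N))).mono'
      (hmeas ha hb t).aestronglyMeasurable (ae_of_all _ fun y => ?_)
    rw [norm_mul, mul_right_comm]
    exact mul_le_mul (h₁ t (mem_of_mem_nhds hs) y) (k₁ _ t ht) (norm_nonneg _) (by positivity)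
  · exact (((hmeas (ha.tpd _) hb t).add (hmeas ha (hb.tpd _) t)).const_mul _).aestronglyMeasurable
  · have hs0 : 0 < s := lt_of_lt_of_le (by positivity) hs.1
    have hb1 : |b (y - w, s)| ≤ C₁ / (t / 2) ^ N := (k₁ _ s hs0).trans (by gcongr; exact hs.1)
    have hb2 : |Treil.tpd (Fin.last N) b (y - w, s)| ≤ C₂ / (t / 2) ^ N :=
      (k₂ _ s hs0).trans (by gcongr; exact hs.1)
    rw [norm_mul, norm_inv, Real.norm_of_nonneg hs0.le, mul_assoc]
    have hst : s⁻¹ ≤ (t / 2)⁻¹ := inv_anti₀ (by positivity) hs.1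
    refine mul_le_mul hst ?_ (norm_nonneg _) (by positivity)
    refine (norm_add_le _ _).trans ?_
    rw [norm_mul, norm_mul, add_mul, mul_right_comm, mul_right_comm D₁]
    exact add_le_add (mul_le_mul (h₂ s hs y) hb1 (abs_nonneg _) (by positivity))
      (mul_le_mul (h₁ s hs y) hb2 (abs_nonneg _) (by positivity))
  · have hs0 : 0 < s := lt_of_lt_of_le (by positivity) hs.1
    exact ((ha.hasDerivAt y hs0).mul (hb.hasDerivAt (y - w) hs0)).congr_deriv (by ring)

/-- The correlation of two kernels at height `t`. -/
def corr (a b : (Fin N → ℝ) × ℝ → ℝ) (w : Fin N → ℝ) (t : ℝ) : ℝ :=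
  ∫ y, a (y, t) * b (y - w, t)

lemma PKer.integrable_mul {a b : (Fin N → ℝ) × ℝ → ℝ} (ha : PKer a) (hb : PKer b)
    (w : Fin N → ℝ) {t : ℝ} (ht : 0 < t) : Integrable fun y => a (y, t) * b (y - w, t) := by
  obtain ⟨C, hC, k⟩ := hb.exists_bound
  refine ((ha.integrable_slice ht).abs.mul_const (C / t ^ N)).mono'
    ((ha.measurable_slice t).mul
      ((hb.measurable_slice t).comp (measurable_id.sub_const w))).aestronglyMeasurable
    (ae_of_all _ fun y => ?_)
  rw [norm_mul]
  exact mul_le_mul_of_nonneg_left (k _ t ht) (abs_nonneg _)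

lemma PKer.hasDerivAt_corr {a b : (Fin N → ℝ) × ℝ → ℝ} (ha : PKer a) (hb : PKer b)
    (w : Fin N → ℝ) {t : ℝ} (ht : 0 < t) :
    HasDerivAt (corr a b w) (t⁻¹ * (corr (Treil.tpd (Fin.last N) a) b w t +
      corr a (Treil.tpd (Fin.last N) b) w t)) t := by
  refine (ha.hasDerivAt_integral_mul hb w ht).congr_deriv ?_
  rw [integral_const_mul, integral_add ((ha.tpd _).integrable_mul hb w ht)
    (ha.integrable_mul (hb.tpd _) w ht)]
  rfl

lemma PKer.corr_tpd_castSucc {a b : (Fin N → ℝ) × ℝ → ℝ} (ha : PKer a) (hb : PKer b)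
    (i : Fin N) (w : Fin N → ℝ) {t : ℝ} (ht : 0 < t) :
    corr (Treil.tpd i.castSucc a) b w t = -corr a (Treil.tpd i.castSucc b) w t := by
  have hline : ∀ y, HasLineDerivAt ℝ (fun y => b (y - w, t))
      (t⁻¹ * Treil.tpd i.castSucc b (y - w, t)) y (Pi.single i 1) := fun y => by
    have := hb.hasLineDerivAt i (y - w) ht
    unfold HasLineDerivAt at this ⊢
    simpa only [sub_add_eq_add_sub] using this
  have h := integral_bilinear_hasLineDerivAt_right_eq_neg_left_of_integrable
    (μ := (volume : Measure (Fin N → ℝ)))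
    (f := fun y => a (y, t)) (f' := fun y => t⁻¹ * Treil.tpd i.castSucc a (y, t))
    (g := fun y => b (y - w, t))
    (g' := fun y => t⁻¹ * Treil.tpd i.castSucc b (y - w, t)) (v := Pi.single i 1)
    (B := ContinuousLinearMap.mul ℝ ℝ)
    (by simpa [mul_assoc] using ((ha.tpd i.castSucc).integrable_mul hb w ht).const_mul t⁻¹)
    (by simpa [mul_left_comm] using (ha.integrable_mul (hb.tpd i.castSucc) w ht).const_mul t⁻¹)
    (by simpa using ha.integrable_mul hb w ht)
    (fun x _ => ha.hasLineDerivAt i x ht) (fun x _ => hline x)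
  simp only [ContinuousLinearMap.mul_apply', mul_assoc, mul_left_comm _ t⁻¹,
    integral_const_mul] at h
  have ht' := ht.ne'
  unfold corr
  field_simp at h
  linarith

lemma PKer.corr_scale {a b : (Fin N → ℝ) × ℝ → ℝ} (ha : PKer a) (hb : PKer b)
    (w : Fin N → ℝ) {t : ℝ} (ht : 0 < t) : corr a b w t = (t ^ N)⁻¹ * corr a b (t⁻¹ • w) 1 := by
  unfold corr
  simp only [ha.eq_scale ht, hb.eq_scale ht, smul_sub]
  have := Measure.integral_comp_inv_smul_of_nonneg (volume : Measure (Fin N → ℝ))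
    (fun y => (t ^ N)⁻¹ * a (y, 1) * ((t ^ N)⁻¹ * b (y - t⁻¹ • w, 1))) ht.le
  simp only [Module.finrank_fintype_fun_eq_card, Fintype.card_fin, smul_eq_mul] at this
  rw [this, ← integral_const_mul, ← integral_const_mul]
  congr 1
  ext y
  field_simp

lemma corr_eq_convolution (a b : (Fin N → ℝ) × ℝ → ℝ) (t : ℝ) :
    (fun w => corr a b w t) = MeasureTheory.convolution (fun y => a (y, t)) (fun y => b (-y, t))
      (ContinuousLinearMap.mul ℝ ℝ) volume := by
  ext w
  simp [corr, MeasureTheory.convolution]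

lemma PKer.integrable_corr {a b : (Fin N → ℝ) × ℝ → ℝ} (ha : PKer a) (hb : PKer b) {t : ℝ}
    (ht : 0 < t) : Integrable fun w => corr a b w t := by
  rw [corr_eq_convolution]
  exact (ha.integrable_slice ht).integrable_convolution (ContinuousLinearMap.mul ℝ ℝ)
    (hb.integrable_slice ht).comp_neg

lemma PKer.integral_corr {a b : (Fin N → ℝ) × ℝ → ℝ} (ha : PKer a) (hb : PKer b) {t : ℝ}
    (ht : 0 < t) : ∫ w, corr a b w t = (∫ y, a (y, t)) * ∫ y, b (y, t) := by
  rw [corr_eq_convolution]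
  rw [integral_convolution (𝕜 := ℝ) (ContinuousLinearMap.mul ℝ ℝ) (ha.integrable_slice ht)
    (hb.integrable_slice ht).comp_neg]
  simp only [ContinuousLinearMap.mul_apply']
  rw [integral_neg_eq_self (fun y => b (y, t)) volume]

lemma PKer.exists_bound_corr {a b : (Fin N → ℝ) × ℝ → ℝ} (ha : PKer a) (hb : PKer b) :
    ∃ C, 0 ≤ C ∧ ∀ w, |corr a b w 1| ≤ C := by
  obtain ⟨C, hC, k⟩ := hb.exists_bound
  refine ⟨∫ y, |a (y, 1)| * C, integral_nonneg fun y => by positivity, fun w => ?_⟩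
  refine norm_integral_le_of_norm_le (G := ℝ) ((ha.integrable_slice one_pos).abs.mul_const C)
    (ae_of_all _ fun y => ?_)
  rw [norm_mul]
  refine mul_le_mul_of_nonneg_left ?_ (abs_nonneg _)
  simpa using k (y - w) 1 one_pos

lemma PKer.measurable_corr {a b : (Fin N → ℝ) × ℝ → ℝ} (ha : PKer a) (hb : PKer b) :
    Measurable fun p : (Fin N → ℝ) × ℝ => corr a b p.1 p.2 := by
  have h : Measurable fun q : ((Fin N → ℝ) × ℝ) × (Fin N → ℝ) =>
      a (q.2, q.1.2) * b (q.2 - q.1.1, q.1.2) :=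
    (ha.measurable.comp (by fun_prop)).mul (hb.measurable.comp (by fun_prop))
  exact h.stronglyMeasurable.integral_prod_right'.measurable

end PKer

section Eta

variable {N : ℕ}

lemma tpd_tpd (i : Fin (N + 1)) {p : (Fin N → ℝ) × ℝ} (hp : 0 < p.2) :
    tpd i (tpd i (pker N)) p = (if i = Fin.last N then tpd i (pker N) p else 0) +
      p.2 ^ 2 * pd i (pd i (pker N)) p := by
  have h : pd i (tpd i (pker N)) p =
      p.2 * pd i (pd i (pker N)) p + pd i (pker N) p * pd i Prod.snd p :=
    pd_mul differentiableAt_snd (((homSmooth_pker N).pd i).differentiableAt (ne_zero_of_snd_pos hp))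
  rw [tpd, h, pd_snd, pdir_snd_eq]
  split_ifs with h
  · subst h; simp only [tpd]; ring
  · ring

lemma tpd_last_tpd_last {p : (Fin N → ℝ) × ℝ} (hp : 0 < p.2) :
    tpd (Fin.last N) (tpd (Fin.last N) (pker N)) p = tpd (Fin.last N) (pker N) p -
      ∑ i : Fin N, tpd i.castSucc (tpd i.castSucc (pker N)) p := by
  have h := sum_pd_pd_pker (ne_zero_of_snd_pos hp)
  rw [Fin.sum_univ_castSucc] at h
  simp only [tpd_tpd _ hp, if_true, (Fin.castSucc_lt_last _).ne, if_false, zero_add]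
  rw [← Finset.mul_sum, eq_neg_of_add_eq_zero_left h]
  ring

lemma corr_tpd_last_tpd_last_left {b : (Fin N → ℝ) × ℝ → ℝ} (hb : PKer b) (w : Fin N → ℝ) {t : ℝ}
    (ht : 0 < t) : corr (tpd (Fin.last N) (tpd (Fin.last N) (pker N))) b w t =
      corr (tpd (Fin.last N) (pker N)) b w t +
        ∑ i : Fin N, corr (tpd i.castSucc (pker N)) (tpd i.castSucc b) w t := by
  have hP := pKer_pker (N := N)
  have h : ∀ i : Fin N, corr (tpd i.castSucc (pker N)) (tpd i.castSucc b) w t =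
      -corr (tpd i.castSucc (tpd i.castSucc (pker N))) b w t := fun i => by
    rw [(hP.tpd _).corr_tpd_castSucc hb i w ht, neg_neg]
  simp only [h]
  rw [Finset.sum_neg_distrib, ← sub_eq_add_neg]
  unfold corr
  rw [← integral_finsetSum _ fun i _ => ((hP.tpd _).tpd _).integrable_mul hb w ht,
    ← integral_sub ((hP.tpd _).integrable_mul hb w ht)
      (integrable_finsetSum _ fun i _ => ((hP.tpd _).tpd _).integrable_mul hb w ht)]
  refine integral_congr_ae (ae_of_all _ fun y => ?_)
  simp only
  rw [tpd_last_tpd_last (p := (y, t)) ht, sub_mul, Finset.sum_mul]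

lemma corr_tpd_last_tpd_last_right {a : (Fin N → ℝ) × ℝ → ℝ} (ha : PKer a) (w : Fin N → ℝ) {t : ℝ}
    (ht : 0 < t) : corr a (tpd (Fin.last N) (tpd (Fin.last N) (pker N))) w t =
      corr a (tpd (Fin.last N) (pker N)) w t +
        ∑ i : Fin N, corr (tpd i.castSucc a) (tpd i.castSucc (pker N)) w t := by
  have hP := pKer_pker (N := N)
  simp only [fun i => ha.corr_tpd_castSucc (hP.tpd (i.castSucc)) i w ht]
  rw [Finset.sum_neg_distrib, ← sub_eq_add_neg]
  unfold corr
  rw [← integral_finsetSum _ fun i _ => ha.integrable_mul ((hP.tpd _).tpd _) w ht,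
    ← integral_sub (ha.integrable_mul (hP.tpd _) w ht)
      (integrable_finsetSum _ fun i _ => ha.integrable_mul ((hP.tpd _).tpd _) w ht)]
  refine integral_congr_ae (ae_of_all _ fun y => ?_)
  simp only
  rw [tpd_last_tpd_last (p := (y - w, t)) ht, mul_sub, Finset.mul_sum]

/-- A primitive of the Poisson gradient correlation. -/
def eta (w : Fin N → ℝ) (t : ℝ) : ℝ :=
  corr (pker N) (pker N) w t - corr (tpd (Fin.last N) (pker N)) (pker N) w t -
    corr (pker N) (tpd (Fin.last N) (pker N)) w t

/-- The correlation of the scale invariant Poisson gradient with itself. -/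
def gradCorr (w : Fin N → ℝ) (t : ℝ) : ℝ :=
  ∑ i : Fin (N + 1), corr (tpd i (pker N)) (tpd i (pker N)) w t

lemma hasDerivAt_eta (w : Fin N → ℝ) {t : ℝ} (ht : 0 < t) :
    HasDerivAt (eta w) (-(2 * t⁻¹ * gradCorr w t)) t := by
  have hP := pKer_pker (N := N)
  have h := ((hP.hasDerivAt_corr hP w ht).sub ((hP.tpd (Fin.last N)).hasDerivAt_corr hP w ht)).sub
    (hP.hasDerivAt_corr (hP.tpd (Fin.last N)) w ht)
  refine h.congr_deriv ?_
  rw [corr_tpd_last_tpd_last_left hP w ht, corr_tpd_last_tpd_last_right hP w ht, gradCorr,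
    Fin.sum_univ_castSucc]
  ring

lemma continuousOn_gradCorr (w : Fin N → ℝ) : ContinuousOn (gradCorr w) (Set.Ioi 0) := by
  have hP := pKer_pker (N := N)
  refine continuousOn_finsetSum _ fun i _ t ht => ?_
  exact ((hP.tpd i).hasDerivAt_corr (hP.tpd i) w ht).continuousAt.continuousWithinAt

lemma integral_gradCorr (w : Fin N → ℝ) {s r : ℝ} (hs : 0 < s) (hr : s ≤ r) :
    ∫ t in s..r, 2 * t⁻¹ * gradCorr w t = eta w s - eta w r := by
  have hsub : Set.uIcc s r ⊆ Set.Ioi 0 := by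
    rw [Set.uIcc_of_le hr]
    exact fun t ht => hs.trans_le ht.1
  have hc : ContinuousOn (fun t => -(2 * t⁻¹ * gradCorr w t)) (Set.uIcc s r) :=
    ((continuousOn_const.mul (continuousOn_id.inv₀ fun t ht => (hsub ht).ne')).mul
      ((continuousOn_gradCorr w).mono hsub)).neg
  have h := intervalIntegral.integral_eq_sub_of_hasDerivAt
    (fun t ht => hasDerivAt_eta w (hsub ht)) hc.intervalIntegrable
  rw [intervalIntegral.integral_neg] at h
  linarith

lemma measurable_eta : Measurable fun p : (Fin N → ℝ) × ℝ => eta p.1 p.2 := by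
  have hP := pKer_pker (N := N)
  exact ((hP.measurable_corr hP).sub ((hP.tpd _).measurable_corr hP)).sub
    (hP.measurable_corr (hP.tpd _))

lemma eta_scale (w : Fin N → ℝ) {t : ℝ} (ht : 0 < t) :
    eta w t = (t ^ N)⁻¹ * eta (t⁻¹ • w) 1 := by
  have hP := pKer_pker (N := N)
  unfold eta
  rw [hP.corr_scale hP w ht, (hP.tpd _).corr_scale hP w ht, hP.corr_scale (hP.tpd _) w ht]
  ring

lemma integrable_eta {t : ℝ} (ht : 0 < t) : Integrable fun w : Fin N → ℝ => eta w t := by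
  have hP := pKer_pker (N := N)
  exact ((hP.integrable_corr hP ht).sub ((hP.tpd _).integrable_corr hP ht)).sub
    (hP.integrable_corr (hP.tpd _) ht)

lemma exists_bound_eta : ∃ C, 0 ≤ C ∧ ∀ (w : Fin N → ℝ) t, 0 < t → |eta w t| ≤ C / t ^ N := by
  have hP := pKer_pker (N := N)
  obtain ⟨C₁, h₁, k₁⟩ := hP.exists_bound_corr hP
  obtain ⟨C₂, h₂, k₂⟩ := (hP.tpd (Fin.last N)).exists_bound_corr hP
  obtain ⟨C₃, h₃, k₃⟩ := hP.exists_bound_corr (hP.tpd (Fin.last N))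
  refine ⟨C₁ + C₂ + C₃, by positivity, fun w t ht => ?_⟩
  rw [eta_scale w ht, abs_mul, abs_inv, abs_of_pos (by positivity : (0 : ℝ) < t ^ N),
    inv_mul_eq_div]
  gcongr
  exact (abs_sub _ _).trans (add_le_add ((abs_sub _ _).trans (add_le_add (k₁ _) (k₂ _))) (k₃ _))

lemma integral_abs_eta {t : ℝ} (ht : 0 < t) :
    ∫ w : Fin N → ℝ, |eta w t| = ∫ w : Fin N → ℝ, |eta w 1| := by
  simp only [eta_scale _ ht, abs_mul, abs_inv, abs_of_pos (by positivity : (0 : ℝ) < t ^ N)]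
  rw [integral_const_mul,
    Measure.integral_comp_inv_smul_of_nonneg volume (fun y => |eta y 1|) ht.le]
  simp only [Module.finrank_fintype_fun_eq_card, Fintype.card_fin, smul_eq_mul]
  rw [← mul_assoc, inv_mul_cancel₀ (by positivity), one_mul]

lemma integral_tpd_last {g : (Fin N → ℝ) × ℝ → ℝ} (hg : PKer g) {t : ℝ} (ht : 0 < t) :
    ∫ y, tpd (Fin.last N) g (y, t) = 0 := by
  obtain ⟨D, hD, h⟩ := (hg.tpd (Fin.last N)).exists_decay (s := t / 2) (r := 2 * t) (by positivity)
  have hs : Set.Icc (t / 2) (2 * t) ∈ 𝓝 t := Icc_mem_nhds (by linarith) (by linarith)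
  have h1 := (hasDerivAt_integral_of_dominated_loc_of_deriv_le (s := Set.Icc (t / 2) (2 * t))
    (μ := (volume : Measure (Fin N → ℝ)))
    (F := fun t y => g (y, t)) (F' := fun t y => t⁻¹ * tpd (Fin.last N) g (y, t))
    (bound := fun y => (t / 2)⁻¹ * (D * (1 + ‖y‖) ^ (-((N : ℝ) + 1)))) hs
    (Eventually.of_forall fun t => (hg.measurable_slice t).aestronglyMeasurable)
    (hg.integrable_slice ht)
    (((hg.tpd _).measurable_slice t).const_mul _).aestronglyMeasurable
    (ae_of_all _ fun y s hs => ?_) ((integrable_one_add_norm_rpow.const_mul _).const_mul _)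
    (ae_of_all _ fun y s hs => hg.hasDerivAt y (lt_of_lt_of_le (by positivity) hs.1))).2
  · have h2 : HasDerivAt (fun t => ∫ y, g (y, t)) 0 t := by
      refine (hasDerivAt_const t (∫ y, g (y, 1))).congr_of_eventuallyEq ?_
      filter_upwards [lt_mem_nhds ht] with s hs using hg.integral_slice hs
    have h3 := h1.unique h2
    rw [integral_const_mul] at h3
    exact (mul_eq_zero.1 h3).resolve_left (inv_ne_zero ht.ne')
  · have hs0 : 0 < s := lt_of_lt_of_le (by positivity) hs.1
    rw [norm_mul, norm_inv, Real.norm_of_nonneg hs0.le]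
    exact mul_le_mul (inv_anti₀ (by positivity) hs.1) (h s hs y) (norm_nonneg _) (by positivity)

lemma integral_tpd {g : (Fin N → ℝ) × ℝ → ℝ} (hg : PKer g) (i : Fin (N + 1)) {t : ℝ}
    (ht : 0 < t) : ∫ y, tpd i g (y, t) = 0 := by
  induction i using Fin.lastCases with
  | last => exact integral_tpd_last hg ht
  | cast i => exact hg.integral_tpd_castSucc i ht

/-- The square of the integral of the Poisson kernel. -/
def kappa (N : ℕ) : ℝ := (∫ y, pker N (y, 1)) ^ 2

lemma kappa_pos : 0 < kappa N := by
  have hP := pKer_pker (N := N)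
  refine pow_pos ?_ 2
  rw [integral_pos_iff_support_of_nonneg (fun y => (pker_pos one_pos).le)
    (hP.integrable_slice one_pos)]
  have : Function.support (fun y => pker N (y, 1)) = Set.univ :=
    Set.eq_univ_of_forall fun y => (pker_pos (p := (y, 1)) one_pos).ne'
  rw [this]
  exact Measure.measure_univ_pos.2 (NeZero.ne _)

lemma integral_eta {t : ℝ} (ht : 0 < t) : ∫ w : Fin N → ℝ, eta w t = kappa N := by
  have hP := pKer_pker (N := N)
  have h₁ := hP.integrable_corr hP ht
  have h₂ := (hP.tpd (Fin.last N)).integrable_corr hP ht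
  have h₃ := hP.integrable_corr (hP.tpd (Fin.last N)) ht
  unfold eta
  rw [integral_sub (f := fun w => corr (pker N) (pker N) w t -
    corr (tpd (Fin.last N) (pker N)) (pker N) w t) (h₁.sub h₂) h₃,
    integral_sub h₁ h₂, hP.integral_corr hP ht, (hP.tpd _).integral_corr hP ht,
    hP.integral_corr (hP.tpd _) ht, integral_tpd_last hP ht, hP.integral_slice ht]
  simp [kappa, sq]

end Eta

section Reproducing

variable {N : ℕ} {H : Type*} [NormedAddCommGroup H] [InnerProductSpace ℝ H] [CompleteSpace H]

/-- The extension of `F` to the upper half-space with kernel `g`. -/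
def pconv (g : (Fin N → ℝ) × ℝ → ℝ) (F : (Fin N → ℝ) → H) (q : (Fin N → ℝ) × ℝ) : H :=
  ∫ z, g (q.1 - z, q.2) • F z

lemma PKer.integrable_smul {g : (Fin N → ℝ) × ℝ → ℝ} (hg : PKer g) {F : (Fin N → ℝ) → H}
    (hF : Integrable F) (y : Fin N → ℝ) {t : ℝ} (ht : 0 < t) :
    Integrable fun z => g (y - z, t) • F z := by
  obtain ⟨C, hC, k⟩ := hg.exists_bound
  refine (hF.norm.const_mul (C / t ^ N)).mono' (((hg.measurable_slice t).comp
    (measurable_const.sub measurable_id)).aestronglyMeasurable.smul hF.1) (ae_of_all _ fun z => ?_)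
  rw [norm_smul]
  exact mul_le_mul_of_nonneg_right (k _ t ht) (norm_nonneg _)

lemma PKer.stronglyMeasurable_pconv {g : (Fin N → ℝ) × ℝ → ℝ} (hg : PKer g) {F : (Fin N → ℝ) → H}
    (hF : StronglyMeasurable F) : StronglyMeasurable (pconv g F) := by
  have h : StronglyMeasurable fun p : ((Fin N → ℝ) × ℝ) × (Fin N → ℝ) =>
      g (p.1.1 - p.2, p.1.2) • F p.2 :=
    (hg.measurable.comp (by fun_prop)).stronglyMeasurable.smul (hF.comp_measurable measurable_snd)
  exact h.integral_prod_right'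

lemma integral_inner_prod {α β : Type*} [MeasurableSpace α] [MeasurableSpace β] {μ : Measure α}
    {ν : Measure β} [SFinite μ] [SFinite ν] {f : α → H} {g : β → H} (hf : Integrable f μ)
    (hg : Integrable g ν) :
    ∫ p : α × β, inner ℝ (f p.1) (g p.2) ∂(μ.prod ν) = inner ℝ (∫ x, f x ∂μ) (∫ y, g y ∂ν) := by
  have hi : Integrable (fun p : α × β => inner ℝ (f p.1) (g p.2)) (μ.prod ν) := by
    refine (hf.norm.mul_prod hg.norm).mono' (hf.1.comp_fst.inner hg.1.comp_snd)
      (ae_of_all _ fun p => norm_inner_le_norm _ _)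
  rw [integral_prod _ hi]
  simp only [integral_inner hg]
  simp only [real_inner_comm (∫ y, g y ∂ν)]
  rw [integral_inner hf]

/-- The measure on the slab of height between `s` and `r` of the upper half-space. -/
def slab (N : ℕ) (s r : ℝ) : Measure ((Fin N → ℝ) × ℝ) :=
  (volume : Measure (Fin N → ℝ)).prod (volume.restrict (Set.Ioc s r))

instance (s r : ℝ) : SFinite (slab N s r) := by unfold slab; infer_instance

lemma ae_slab (s r : ℝ) : ∀ᵐ q ∂slab N s r, q.2 ∈ Set.Ioc s r := by
  have h : ∀ᵐ t ∂volume.restrict (Set.Ioc s r), t ∈ Set.Ioc s r := ae_restrict_mem measurableSet_Ioc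
  exact Measure.quasiMeasurePreserving_snd.ae h

/-- The integrand in the polarised square function identity. -/
def polar (g : (Fin N → ℝ) × ℝ → ℝ) (F b : (Fin N → ℝ) → H) (q : (Fin N → ℝ) × ℝ)
    (z : (Fin N → ℝ) × (Fin N → ℝ)) : ℝ :=
  2 * q.2⁻¹ * (g (q.1 - z.1, q.2) * g (q.1 - z.2, q.2)) * inner ℝ (F z.1) (b z.2)

lemma PKer.integrable_polar {g : (Fin N → ℝ) × ℝ → ℝ} (hg : PKer g) {F b : (Fin N → ℝ) → H}
    (hF : Integrable F) (hb : Integrable b) (hFm : StronglyMeasurable F)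
    (hbm : StronglyMeasurable b) {s r : ℝ} (hs : 0 < s) :
    Integrable (fun p : ((Fin N → ℝ) × ℝ) × ((Fin N → ℝ) × (Fin N → ℝ)) => polar g F b p.1 p.2)
      ((slab N s r).prod (volume.prod volume)) := by
  have hm : StronglyMeasurable
      fun p : ((Fin N → ℝ) × ℝ) × ((Fin N → ℝ) × (Fin N → ℝ)) => polar g F b p.1 p.2 := by
    have h1 : Measurable fun p : ((Fin N → ℝ) × ℝ) × ((Fin N → ℝ) × (Fin N → ℝ)) =>
        2 * p.1.2⁻¹ * (g (p.1.1 - p.2.1, p.1.2) * g (p.1.1 - p.2.2, p.1.2)) :=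
      (by fun_prop : Measurable _).mul
        ((hg.measurable.comp (by fun_prop)).mul (hg.measurable.comp (by fun_prop)))
    exact h1.stronglyMeasurable.mul ((hFm.comp_measurable (by fun_prop)).inner
      (hbm.comp_measurable (by fun_prop)))
  refine ⟨hm.aestronglyMeasurable, ?_⟩
  obtain ⟨D, hD, h⟩ := hg.exists_decay (s := s) (r := r) hs
  obtain ⟨C, hC, k⟩ := hg.exists_bound
  rw [hasFiniteIntegral_iff_enorm, lintegral_prod_symm _ hm.enorm.aemeasurable]
  set c : ℝ := 2 * s⁻¹ * D * (C / s ^ N) with hc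
  set φ : (Fin N → ℝ) → ℝ := fun y => c * (1 + ‖y‖) ^ (-((N : ℝ) + 1)) with hφ
  have hc0 : 0 ≤ c := by positivity
  have hφi : Integrable φ := integrable_one_add_norm_rpow.const_mul c
  have key : ∀ z : (Fin N → ℝ) × (Fin N → ℝ), ∫⁻ q, ‖polar g F b q z‖ₑ ∂slab N s r ≤
      ((∫⁻ y, ‖φ y‖ₑ) * ENNReal.ofReal (r - s)) * (‖F z.1‖ₑ * ‖b z.2‖ₑ) := fun z => by
    calc _ ≤ ∫⁻ q, ‖φ (q.1 - z.1)‖ₑ * (‖F z.1‖ₑ * ‖b z.2‖ₑ) ∂slab N s r := by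
          refine lintegral_mono_ae ?_
          filter_upwards [ae_slab s r] with q hq
          have hq0 : 0 < q.2 := hs.trans hq.1
          have e1 : ‖polar g F b q z‖ ≤ ‖φ (q.1 - z.1)‖ * (‖F z.1‖ * ‖b z.2‖) := by
            rw [polar, norm_mul, norm_mul, norm_mul _ (g (q.1 - z.2, q.2)), norm_mul, norm_inv,
              Real.norm_of_nonneg hq0.le, Real.norm_of_nonneg (by positivity : 0 ≤ φ (q.1 - z.1)),
              hφ]
            refine mul_le_mul ?_ (norm_inner_le_norm _ _) (norm_nonneg _) (by positivity)
            have a1 := h q.2 ⟨hq.1.le, hq.2⟩ (q.1 - z.1)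
            have a2 : |g (q.1 - z.2, q.2)| ≤ C / s ^ N :=
              (k (q.1 - z.2) q.2 hq0).trans (by gcongr; exact hq.1.le)
            have a3 : q.2⁻¹ ≤ s⁻¹ := inv_anti₀ hs hq.1.le
            rw [Real.norm_of_nonneg (by norm_num : (0 : ℝ) ≤ 2), Real.norm_eq_abs,
              Real.norm_eq_abs]
            calc _ ≤ 2 * s⁻¹ * (D * (1 + ‖q.1 - z.1‖) ^ (-((N : ℝ) + 1)) * (C / s ^ N)) := by
                  gcongr
              _ = _ := by rw [hc]; ring
          simpa only [enorm_mul, ← ofReal_norm, ENNReal.ofReal_mul (norm_nonneg _)] using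
            ENNReal.ofReal_le_ofReal e1
      _ = _ := by
          have hme : Measurable fun q : (Fin N → ℝ) × ℝ => ‖φ (q.1 - z.1)‖ₑ := by
            rw [hφ]; fun_prop
          rw [lintegral_mul_const _ hme, slab, lintegral_prod _ hme.aemeasurable]
          simp only [lintegral_const, Measure.restrict_apply_univ, Real.volume_Ioc]
          rw [lintegral_mul_const _ (by rw [hφ]; fun_prop),
            lintegral_sub_right_eq_self (fun y => ‖φ y‖ₑ) z.1]
  refine (lintegral_mono key).trans_lt ?_
  have e2 : ∫⁻ z : (Fin N → ℝ) × (Fin N → ℝ), ‖F z.1‖ₑ * ‖b z.2‖ₑ ∂(volume.prod volume) =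
      (∫⁻ z, ‖F z‖ₑ) * ∫⁻ z, ‖b z‖ₑ :=
    lintegral_prod_mul hFm.enorm.aemeasurable hbm.enorm.aemeasurable
  have e3 : Measurable fun z : (Fin N → ℝ) × (Fin N → ℝ) => ‖F z.1‖ₑ * ‖b z.2‖ₑ :=
    (hFm.enorm.comp measurable_fst).mul (hbm.enorm.comp measurable_snd)
  rw [lintegral_const_mul _ e3, e2]
  exact ENNReal.mul_lt_top (ENNReal.mul_lt_top hφi.2 ENNReal.ofReal_lt_top)
    (ENNReal.mul_lt_top hF.2 hb.2)

lemma PKer.integral_polar_right {g : (Fin N → ℝ) × ℝ → ℝ} (hg : PKer g) {F b : (Fin N → ℝ) → H}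
    (hF : Integrable F) (hb : Integrable b) {q : (Fin N → ℝ) × ℝ} (hq : 0 < q.2) :
    ∫ z, polar g F b q z ∂(volume.prod volume) =
      2 * q.2⁻¹ * inner ℝ (pconv g F q) (pconv g b q) := by
  have h := integral_inner_prod (hg.integrable_smul hF q.1 hq) (hg.integrable_smul hb q.1 hq)
  simp only [pconv]
  rw [← h, ← integral_const_mul]
  refine integral_congr_ae (ae_of_all _ fun z => ?_)
  simp only [polar, real_inner_smul_left, real_inner_smul_right]
  ring

/-- The reproducing formula of Poisson type. -/
lemma integral_inner_pconv {F b : (Fin N → ℝ) → H}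
    (hF : Integrable F) (hb : Integrable b) (hFm : StronglyMeasurable F)
    (hbm : StronglyMeasurable b) {s r : ℝ} (hs : 0 < s) (hsr : s ≤ r) :
    Integrable (fun q => ∑ i, 2 * q.2⁻¹ *
        inner ℝ (pconv (tpd i (pker N)) F q) (pconv (tpd i (pker N)) b q)) (slab N s r) ∧
    ∫ q, ∑ i, 2 * q.2⁻¹ *
        inner ℝ (pconv (tpd i (pker N)) F q) (pconv (tpd i (pker N)) b q) ∂slab N s r =
      ∫ z : (Fin N → ℝ) × (Fin N → ℝ), inner ℝ (F z.1) (b z.2) *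
        (eta (z.2 - z.1) s - eta (z.2 - z.1) r) ∂(volume.prod volume) := by
  have hG : ∀ i, PKer (tpd i (pker N)) := fun i => pKer_pker.tpd i
  have hi : Integrable (fun p : ((Fin N → ℝ) × ℝ) × ((Fin N → ℝ) × (Fin N → ℝ)) =>
      ∑ i, polar (tpd i (pker N)) F b p.1 p.2) ((slab N s r).prod (volume.prod volume)) :=
    integrable_finsetSum _ fun i _ => (hG i).integrable_polar hF hb hFm hbm hs
  have hleft : (fun q => ∫ z, ∑ i, polar (tpd i (pker N)) F b q z ∂(volume.prod volume))
      =ᵐ[slab N s r] fun q => ∑ i, 2 * q.2⁻¹ *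
        inner ℝ (pconv (tpd i (pker N)) F q) (pconv (tpd i (pker N)) b q) := by
    have hae : ∀ᵐ q ∂slab N s r, ∀ i, Integrable (fun z => polar (tpd i (pker N)) F b q z)
        (volume.prod volume) := ae_all_iff.2 fun i =>
      ((hG i).integrable_polar hF hb hFm hbm hs).prod_right_ae
    filter_upwards [ae_slab s r, hae] with q hq hae
    rw [integral_finsetSum _ fun i _ => hae i]
    exact Finset.sum_congr rfl fun i _ => (hG i).integral_polar_right hF hb (hs.trans hq.1)
  refine ⟨hi.integral_prod_left.congr hleft, ?_⟩
  rw [← integral_congr_ae hleft, integral_integral_swap hi]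
  refine integral_congr_ae ?_
  filter_upwards [hi.prod_left_ae] with z hz
  rw [slab, integral_prod_symm _ hz, ← integral_gradCorr _ hs hsr,
    intervalIntegral.integral_of_le hsr, ← integral_const_mul]
  refine setIntegral_congr_fun measurableSet_Ioc fun t ht => ?_
  have ht0 : 0 < t := hs.trans ht.1
  simp only [polar, gradCorr]
  have e : ∀ i, ∫ y, tpd i (pker N) (y - z.1, t) * tpd i (pker N) (y - z.2, t) =
      corr (tpd i (pker N)) (tpd i (pker N)) (z.2 - z.1) t := fun i => by
    unfold corr
    rw [← integral_sub_right_eq_self (fun y => tpd i (pker N) (y, t) *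
      tpd i (pker N) (y - (z.2 - z.1), t)) z.1]
    simp only [sub_sub, add_sub_cancel]
  have hi' : ∀ i, Integrable fun y =>
      tpd i (pker N) (y - z.1, t) * tpd i (pker N) (y - z.2, t) := by
    intro i
    have := ((hG i).integrable_mul (hG i) (z.2 - z.1) ht0).comp_sub_right z.1
    simpa only [sub_sub, add_sub_cancel] using this
  rw [integral_finsetSum _ fun i _ => ((hi' i).const_mul _).mul_const _]
  simp only [integral_mul_const, integral_const_mul, e]
  rw [← Finset.sum_mul, ← Finset.mul_sum]
  ring

end Reproducing

section PoissonL2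

variable {N : ℕ} {H : Type*} [NormedAddCommGroup H] [InnerProductSpace ℝ H] [CompleteSpace H]

/-- The squared norm of the scale invariant gradient of the Poisson extension. -/
def gradSq (F : (Fin N → ℝ) → H) (q : (Fin N → ℝ) × ℝ) : ℝ :=
  ∑ i, ‖pconv (tpd i (pker N)) F q‖ ^ 2

lemma gradSq_nonneg (F : (Fin N → ℝ) → H) (q : (Fin N → ℝ) × ℝ) : 0 ≤ gradSq F q :=
  Finset.sum_nonneg fun _ _ => by positivity

lemma measurable_gradSq {F : (Fin N → ℝ) → H} (hF : StronglyMeasurable F) :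
    Measurable (gradSq F) :=
  Finset.measurable_fun_sum _ fun i _ =>
    ((pKer_pker.tpd i).stronglyMeasurable_pconv hF).norm.measurable.pow_const 2

/-- The `L¹` norm of `eta` at unit height. -/
def etaNorm (N : ℕ) : ℝ := ∫ w : Fin N → ℝ, |eta w 1|

lemma etaNorm_nonneg : 0 ≤ etaNorm N := integral_nonneg fun _ => abs_nonneg _

lemma lintegral_enorm_eta {t : ℝ} (ht : 0 < t) :
    ∫⁻ w : Fin N → ℝ, ‖eta w t‖ₑ = ENNReal.ofReal (etaNorm N) := by
  rw [etaNorm, ← integral_abs_eta ht, ← ofReal_integral_norm_eq_lintegral_enorm (integrable_eta ht)]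
  rfl

lemma lintegral_schur {φ : (Fin N → ℝ) → H} (hφ : StronglyMeasurable φ) {k : (Fin N → ℝ) → ℝ}
    (hk : Measurable k) :
    ∫⁻ z : (Fin N → ℝ) × (Fin N → ℝ), ‖inner ℝ (φ z.1) (φ z.2) * k (z.2 - z.1)‖ₑ
      ∂(volume.prod volume) ≤ (∫⁻ w, ‖k w‖ₑ) * ∫⁻ z, ‖φ z‖ₑ ^ 2 := by
  have hm : Measurable fun z : (Fin N → ℝ) × (Fin N → ℝ) => ‖k (z.2 - z.1)‖ₑ :=
    (hk.comp (by fun_prop)).enorm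
  have hφ1 : Measurable fun z : (Fin N → ℝ) × (Fin N → ℝ) => ‖φ z.1‖ₑ ^ 2 :=
    (hφ.enorm.comp measurable_fst).pow_const 2
  have hφ2 : Measurable fun z : (Fin N → ℝ) × (Fin N → ℝ) => ‖φ z.2‖ₑ ^ 2 :=
    (hφ.enorm.comp measurable_snd).pow_const 2
  have hp1 : Measurable fun z : (Fin N → ℝ) × (Fin N → ℝ) => ‖φ z.1‖ₑ ^ 2 * ‖k (z.2 - z.1)‖ₑ :=
    hφ1.mul hm
  have hp2 : Measurable fun z : (Fin N → ℝ) × (Fin N → ℝ) => ‖φ z.2‖ₑ ^ 2 * ‖k (z.2 - z.1)‖ₑ :=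
    hφ2.mul hm
  have e1 : ∫⁻ z : (Fin N → ℝ) × (Fin N → ℝ), ‖φ z.1‖ₑ ^ 2 * ‖k (z.2 - z.1)‖ₑ
      ∂(volume.prod volume) = (∫⁻ w, ‖k w‖ₑ) * ∫⁻ z, ‖φ z‖ₑ ^ 2 := by
    rw [lintegral_prod _ hp1.aemeasurable]
    have : ∀ x : Fin N → ℝ, ∫⁻ y, ‖φ x‖ₑ ^ 2 * ‖k (y - x)‖ₑ = ‖φ x‖ₑ ^ 2 * ∫⁻ w, ‖k w‖ₑ := by
      intro x
      rw [lintegral_const_mul _ (by fun_prop),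
        lintegral_sub_right_eq_self (fun y => ‖k y‖ₑ) x]
    simp only [this]
    rw [lintegral_mul_const _ (hφ.enorm.pow_const 2), mul_comm]
  have e2 : ∫⁻ z : (Fin N → ℝ) × (Fin N → ℝ), ‖φ z.2‖ₑ ^ 2 * ‖k (z.2 - z.1)‖ₑ
      ∂(volume.prod volume) = (∫⁻ w, ‖k w‖ₑ) * ∫⁻ z, ‖φ z‖ₑ ^ 2 := by
    rw [lintegral_prod_symm _ hp2.aemeasurable]
    have : ∀ y : Fin N → ℝ, ∫⁻ x, ‖φ y‖ₑ ^ 2 * ‖k (y - x)‖ₑ = ‖φ y‖ₑ ^ 2 * ∫⁻ w, ‖k w‖ₑ := by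
      intro y
      rw [lintegral_const_mul _ (by fun_prop),
        lintegral_sub_left_eq_self (fun y => ‖k y‖ₑ) y]
    simp only [this]
    rw [lintegral_mul_const _ (hφ.enorm.pow_const 2), mul_comm]
  have key : ∀ z : (Fin N → ℝ) × (Fin N → ℝ), ‖inner ℝ (φ z.1) (φ z.2) * k (z.2 - z.1)‖ₑ ≤
      2⁻¹ * (‖φ z.1‖ₑ ^ 2 * ‖k (z.2 - z.1)‖ₑ + ‖φ z.2‖ₑ ^ 2 * ‖k (z.2 - z.1)‖ₑ) := fun z => by
    rw [enorm_mul, ← add_mul, ← mul_assoc]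
    refine mul_le_mul_left ?_ _
    have h : ‖inner ℝ (φ z.1) (φ z.2)‖ ≤ 2⁻¹ * (‖φ z.1‖ ^ 2 + ‖φ z.2‖ ^ 2) := by
      refine (norm_inner_le_norm _ _).trans ?_
      nlinarith [sq_nonneg (‖φ z.1‖ - ‖φ z.2‖)]
    have := ENNReal.ofReal_le_ofReal h
    rw [ENNReal.ofReal_mul (by norm_num), ENNReal.ofReal_add (by positivity) (by positivity),
      ENNReal.ofReal_pow (norm_nonneg _), ENNReal.ofReal_pow (norm_nonneg _), ofReal_norm,
      ofReal_norm, ofReal_norm, ENNReal.ofReal_inv_of_pos two_pos] at this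
    simpa using this
  refine (lintegral_mono key).trans ?_
  rw [lintegral_const_mul _ (by fun_prop), lintegral_add_left hp1, e1,
    e2, ← two_mul, ← mul_assoc, ENNReal.inv_mul_cancel two_ne_zero ENNReal.ofNat_ne_top, one_mul]

lemma lintegral_slab_gradSq_le {φ : (Fin N → ℝ) → H} (hφ : StronglyMeasurable φ)
    (hφi : Integrable φ) {s r : ℝ} (hs : 0 < s) (hsr : s ≤ r) :
    ∫⁻ q, ENNReal.ofReal (q.2⁻¹ * gradSq φ q) ∂slab N s r ≤
      ENNReal.ofReal (etaNorm N) * ∫⁻ z, ‖φ z‖ₑ ^ 2 := by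
  obtain ⟨hi, h⟩ := integral_inner_pconv hφi hφi hφ hφ hs hsr
  have hrw : ∀ q : (Fin N → ℝ) × ℝ, ∑ i, 2 * q.2⁻¹ *
      inner ℝ (pconv (tpd i (pker N)) φ q) (pconv (tpd i (pker N)) φ q) =
      2 * (q.2⁻¹ * gradSq φ q) := fun q => by
    simp only [real_inner_self_eq_norm_sq, gradSq, Finset.mul_sum, mul_assoc]
  simp only [hrw] at hi h
  have hnn : 0 ≤ᵐ[slab N s r] fun q => 2 * (q.2⁻¹ * gradSq φ q) := by
    filter_upwards [ae_slab s r] with q hq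
    have := gradSq_nonneg φ q
    have hq0 : 0 < q.2 := hs.trans hq.1
    simp only [Pi.zero_apply]
    positivity
  have hm : Measurable fun q : (Fin N → ℝ) × ℝ => ENNReal.ofReal (q.2⁻¹ * gradSq φ q) :=
    ENNReal.measurable_ofReal.comp (measurable_snd.inv.mul (measurable_gradSq hφ))
  have he : ∀ t, Measurable fun w : Fin N → ℝ => ‖eta w t‖ₑ := fun t =>
    (measurable_eta.comp (measurable_id.prodMk measurable_const)).enorm
  have h2 : 2 * ∫⁻ q, ENNReal.ofReal (q.2⁻¹ * gradSq φ q) ∂slab N s r ≤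
      2 * (ENNReal.ofReal (etaNorm N) * ∫⁻ z, ‖φ z‖ₑ ^ 2) := by
    calc _ = ∫⁻ q, ENNReal.ofReal (2 * (q.2⁻¹ * gradSq φ q)) ∂slab N s r := by
          rw [← lintegral_const_mul _ hm]
          simp only [ENNReal.ofReal_mul zero_le_two, ENNReal.ofReal_ofNat]
      _ = ENNReal.ofReal (∫ q, 2 * (q.2⁻¹ * gradSq φ q) ∂slab N s r) :=
          (ofReal_integral_eq_lintegral_ofReal hi hnn).symm
      _ ≤ ∫⁻ z : (Fin N → ℝ) × (Fin N → ℝ), ‖inner ℝ (φ z.1) (φ z.2) *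
            (eta (z.2 - z.1) s - eta (z.2 - z.1) r)‖ₑ ∂(volume.prod volume) := by
          rw [h]
          refine le_trans ?_ (enorm_integral_le_lintegral_enorm _)
          rw [← ofReal_norm]
          exact ENNReal.ofReal_le_ofReal (Real.le_norm_self _)
      _ ≤ (∫⁻ w : Fin N → ℝ, ‖eta w s - eta w r‖ₑ) * ∫⁻ z, ‖φ z‖ₑ ^ 2 :=
          lintegral_schur hφ (k := fun w => eta w s - eta w r)
            ((measurable_eta.comp (measurable_id.prodMk measurable_const)).sub
              (measurable_eta.comp (measurable_id.prodMk measurable_const)))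
      _ ≤ (∫⁻ w : Fin N → ℝ, ‖eta w s‖ₑ + ‖eta w r‖ₑ) * ∫⁻ z, ‖φ z‖ₑ ^ 2 := by
          gcongr with w
          exact enorm_sub_le
      _ = _ := by
          rw [lintegral_add_left (he s), lintegral_enorm_eta hs,
            lintegral_enorm_eta (hs.trans_le hsr), ← two_mul, mul_assoc]
  exact (ENNReal.mul_le_mul_iff_right two_ne_zero ENNReal.ofNat_ne_top).1 h2

/-- The `L²` bound for the square function of the Poisson extension. -/
lemma lintegral_gradSq_le {φ : (Fin N → ℝ) → H} (hφ : StronglyMeasurable φ)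
    (hφi : Integrable φ) :
    ∫⁻ q, ENNReal.ofReal (q.2⁻¹ * gradSq φ q)
      ∂((volume : Measure (Fin N → ℝ)).prod (volume.restrict (Set.Ioi 0))) ≤
      ENNReal.ofReal (etaNorm N) * ∫⁻ z, ‖φ z‖ₑ ^ 2 := by
  have hm : Measurable fun q : (Fin N → ℝ) × ℝ => ENNReal.ofReal (q.2⁻¹ * gradSq φ q) :=
    ENNReal.measurable_ofReal.comp (measurable_snd.inv.mul (measurable_gradSq hφ))
  have hu : (⋃ m : ℕ, Set.Ioc (1 / ((m : ℝ) + 1)) ((m : ℝ) + 1)) = Set.Ioi 0 := by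
    ext t
    simp only [Set.mem_iUnion, Set.mem_Ioc, Set.mem_Ioi]
    refine ⟨fun ⟨m, h, _⟩ => lt_trans (by positivity) h, fun ht => ?_⟩
    obtain ⟨m₁, h₁⟩ := exists_nat_one_div_lt ht
    obtain ⟨m₂, h₂⟩ := exists_nat_ge t
    refine ⟨max m₁ m₂, lt_of_le_of_lt ?_ h₁, ?_⟩
    · gcongr
      exact le_max_left _ _
    · have : (m₂ : ℝ) ≤ (max m₁ m₂ : ℕ) := by exact_mod_cast le_max_right _ _
      linarith
  have hmono : Monotone fun m : ℕ => Set.Ioc (1 / ((m : ℝ) + 1)) ((m : ℝ) + 1) := fun a b hab => by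
    have : (a : ℝ) ≤ b := by exact_mod_cast hab
    exact Set.Ioc_subset_Ioc (by gcongr) (by linarith)
  rw [lintegral_prod_symm _ hm.aemeasurable, ← hu,
    setLIntegral_iUnion_of_directed _ hmono.directed_le]
  refine iSup_le fun m => ?_
  have := lintegral_slab_gradSq_le hφ hφi (s := 1 / ((m : ℝ) + 1)) (r := (m : ℝ) + 1)
    (by positivity) (by
      have : (0 : ℝ) ≤ m := Nat.cast_nonneg m
      rw [div_le_iff₀ (by positivity)]; nlinarith)
  rwa [slab, lintegral_prod_symm _ hm.aemeasurable] at this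

end PoissonL2

section LusinKer

variable {N : ℕ} {H : Type*} [NormedAddCommGroup H] [InnerProductSpace ℝ H]
  [CompleteSpace H]

/-- The cone with vertex `x`. -/
def lcone (x : Fin N → ℝ) : Set ((Fin N → ℝ) × ℝ) :=
  {q | Real.sqrt (∑ i, (q.1 i - x i) ^ 2) < q.2}

lemma norm_sub_lt_of_mem_lcone {x : Fin N → ℝ} {q : (Fin N → ℝ) × ℝ} (h : q ∈ lcone x) :
    ‖q.1 - x‖ < q.2 := by
  refine lt_of_le_of_lt ((pi_norm_le_iff_of_nonneg (Real.sqrt_nonneg _)).2 fun i => ?_) h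
  refine Real.abs_le_sqrt ?_
  exact Finset.single_le_sum (f := fun i => (q.1 i - x i) ^ 2) (fun _ _ => sq_nonneg _)
    (Finset.mem_univ i)

lemma pos_of_mem_lcone {x : Fin N → ℝ} {q : (Fin N → ℝ) × ℝ} (h : q ∈ lcone x) : 0 < q.2 :=
  lt_of_le_of_lt (Real.sqrt_nonneg _) h

lemma measurableSet_lcone_prod :
    MeasurableSet {p : (Fin N → ℝ) × ((Fin N → ℝ) × ℝ) | p.2 ∈ lcone p.1} := by
  have h : Measurable fun p : (Fin N → ℝ) × ((Fin N → ℝ) × ℝ) =>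
      Real.sqrt (∑ i, (p.2.1 i - p.1 i) ^ 2) := by fun_prop
  exact measurableSet_lt h (by fun_prop)

lemma measurableSet_lcone (x : Fin N → ℝ) : MeasurableSet (lcone x) :=
  (measurable_prodMk_left (x := x)) measurableSet_lcone_prod

/-- The parameter space of the Lusin area function: a point of the half-space together with
the index of a partial derivative. -/
abbrev LPar (N : ℕ) := ((Fin N → ℝ) × ℝ) × Fin (N + 1)

/-- The measure on `LPar N`. -/
def lparMeasure (N : ℕ) : Measure (LPar N) := (volume.prod volume).prod Measure.count

instance sFinite_lparMeasure : SFinite (lparMeasure N) := by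
  unfold lparMeasure; infer_instance

lemma lintegral_lparMeasure {g : LPar N → ℝ≥0∞} (hg : Measurable g) :
    ∫⁻ θ, g θ ∂lparMeasure N = ∫⁻ q, ∑ i, g (q, i) := by
  rw [lparMeasure, lintegral_prod _ hg.aemeasurable]
  refine lintegral_congr fun q => ?_
  rw [lintegral_count, tsum_fintype]

/-- The weight of the area function. -/
def lusW (x : Fin N → ℝ) (q : (Fin N → ℝ) × ℝ) : ℝ :=
  (lcone x).indicator (fun q => Real.sqrt ((q.2 ^ (N + 1))⁻¹)) q

/-- The family of kernels that defines the area function. -/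
def lusKer (x : Fin N → ℝ) (θ : LPar N) (z : Fin N → ℝ) : ℝ :=
  lusW x θ.1 * tpd θ.2 (pker N) (θ.1.1 - z, θ.1.2)

lemma lusW_nonneg (x : Fin N → ℝ) (q : (Fin N → ℝ) × ℝ) : 0 ≤ lusW x q :=
  Set.indicator_nonneg (fun _ _ => Real.sqrt_nonneg _) _

lemma lusW_sq (x : Fin N → ℝ) (q : (Fin N → ℝ) × ℝ) :
    lusW x q ^ 2 = (lcone x).indicator (fun q => (q.2 ^ (N + 1))⁻¹) q := by
  unfold lusW
  by_cases h : q ∈ lcone x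
  · have := pos_of_mem_lcone h
    rw [Set.indicator_of_mem h, Set.indicator_of_mem h, Real.sq_sqrt (by positivity)]
  · rw [Set.indicator_of_notMem h, Set.indicator_of_notMem h, sq, zero_mul]

lemma measurable_lusW : Measurable fun p : (Fin N → ℝ) × ((Fin N → ℝ) × ℝ) => lusW p.1 p.2 := by
  have h : Measurable fun p : (Fin N → ℝ) × ((Fin N → ℝ) × ℝ) =>
      Real.sqrt ((p.2.2 ^ (N + 1))⁻¹) := by fun_prop
  exact h.indicator measurableSet_lcone_prod

lemma measurable_fin_prod {α : Type*} [MeasurableSpace α] {M : ℕ} {g : Fin M → α → ℝ}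
    (hg : ∀ i, Measurable (g i)) : Measurable fun p : Fin M × α => g p.1 p.2 :=
  measurable_from_prod_countable_right hg

lemma measurable_enorm_kerApply_left {Θ : Type*} [MeasurableSpace Θ]
    {K : (Fin N → ℝ) → Θ → (Fin N → ℝ) → ℝ}
    (hK : Measurable fun p : ((Fin N → ℝ) × Θ) × (Fin N → ℝ) => K p.1.1 p.1.2 p.2)
    {φ : (Fin N → ℝ) → H} (hφ : StronglyMeasurable φ) (x : Fin N → ℝ) :
    Measurable fun θ => ‖kerApply K φ x θ‖ₑ ^ 2 :=
  (measurable_enorm_kerApply hK hφ).comp measurable_prodMk_left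

lemma measurable_lusKer : Measurable fun p : ((Fin N → ℝ) × LPar N) × (Fin N → ℝ) =>
    lusKer p.1.1 p.1.2 p.2 := by
  have h0 : Measurable fun p : ((Fin N → ℝ) × LPar N) × (Fin N → ℝ) => (p.1.1, p.1.2.1) := by
    fun_prop
  have h1 := measurable_lusW.comp h0
  have h2 : Measurable fun p : Fin (N + 1) × ((Fin N → ℝ) × ℝ) => tpd p.1 (pker N) p.2 :=
    measurable_fin_prod fun i => (pKer_pker.tpd i).measurable
  have h3 : Measurable fun p : ((Fin N → ℝ) × LPar N) × (Fin N → ℝ) =>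
      ((p.1.2.2, (p.1.2.1.1 - p.2, p.1.2.1.2)) : Fin (N + 1) × ((Fin N → ℝ) × ℝ)) := by
    fun_prop
  have h4 := h1.mul (h2.comp h3)
  exact h4

lemma kerApply_lusKer (F : (Fin N → ℝ) → H) (x : Fin N → ℝ) (q : (Fin N → ℝ) × ℝ)
    (i : Fin (N + 1)) :
    kerApply lusKer F x (q, i) = lusW x q • pconv (tpd i (pker N)) F q := by
  simp only [kerApply, lusKer, pconv, mul_smul, integral_smul]

lemma enorm_smul_sq_eq (w : ℝ) (v : H) : ‖w • v‖ₑ ^ 2 = ENNReal.ofReal (w ^ 2 * ‖v‖ ^ 2) := by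
  rw [← ofReal_norm, norm_smul, ← ENNReal.ofReal_pow (by positivity), mul_pow,
    Real.norm_eq_abs, sq_abs]

lemma lintegral_kerApply_lusKer {F : (Fin N → ℝ) → H} (hF : StronglyMeasurable F)
    (x : Fin N → ℝ) :
    ∫⁻ θ, ‖kerApply lusKer F x θ‖ₑ ^ 2 ∂lparMeasure N =
      ∫⁻ q, ENNReal.ofReal (lusW x q ^ 2 * gradSq F q) := by
  rw [lintegral_lparMeasure]
  · refine lintegral_congr fun q => ?_
    simp only [kerApply_lusKer, enorm_smul_sq_eq]
    rw [← ENNReal.ofReal_sum_of_nonneg fun _ _ => by positivity, ← Finset.mul_sum, gradSq]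
  · exact measurable_enorm_kerApply_left measurable_lusKer hF x

lemma lintegral_lusW_sq_le (q : (Fin N → ℝ) × ℝ) :
    ∫⁻ x, ENNReal.ofReal (lusW x q ^ 2) ≤
      (Set.univ ×ˢ Set.Ioi 0).indicator (fun q => ENNReal.ofReal (2 ^ N * q.2⁻¹)) q := by
  by_cases hq : 0 < q.2
  · have hmem : q ∈ (Set.univ : Set (Fin N → ℝ)) ×ˢ Set.Ioi (0 : ℝ) := ⟨trivial, hq⟩
    rw [Set.indicator_of_mem hmem]
    calc _ ≤ ∫⁻ x, (Metric.closedBall q.1 q.2).indicator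
          (fun _ => ENNReal.ofReal ((q.2 ^ (N + 1))⁻¹)) x := by
          refine lintegral_mono fun x => ?_
          rw [lusW_sq]
          by_cases h : q ∈ lcone x
          · have h' : x ∈ Metric.closedBall q.1 q.2 := by
              rw [mem_closedBall_iff_norm, norm_sub_rev]
              exact (norm_sub_lt_of_mem_lcone h).le
            rw [Set.indicator_of_mem h, Set.indicator_of_mem h']
          · rw [Set.indicator_of_notMem h, ENNReal.ofReal_zero]
            exact zero_le
      _ = _ := by
          rw [lintegral_indicator Metric.isClosed_closedBall.measurableSet, setLIntegral_const,
            Real.volume_pi_closedBall _ hq.le, ← ENNReal.ofReal_mul (by positivity),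
            Fintype.card_fin]
          congr 1
          rw [mul_pow, pow_succ]
          field_simp
  · have h0 : ∀ x, lusW x q = 0 := fun x =>
      Set.indicator_of_notMem (fun h => hq (pos_of_mem_lcone h)) _
    simp [h0]

lemma l2Bound_lusKer :
    L2Bound H (lusKer (N := N)) (lparMeasure N) (2 ^ N * (etaNorm N).toNNReal) := by
  rintro φ hφ - hφi
  have hm : Measurable fun p : (Fin N → ℝ) × ((Fin N → ℝ) × ℝ) =>
      ENNReal.ofReal (lusW p.1 p.2 ^ 2 * gradSq φ p.2) :=
    ENNReal.measurable_ofReal.comp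
      ((measurable_lusW.pow_const 2).mul ((measurable_gradSq hφ).comp measurable_snd))
  simp only [lintegral_kerApply_lusKer hφ]
  rw [lintegral_lintegral_swap hm.aemeasurable]
  have hm2 : Measurable fun q : (Fin N → ℝ) × ℝ => ENNReal.ofReal (q.2⁻¹ * gradSq φ q) :=
    ENNReal.measurable_ofReal.comp (measurable_snd.inv.mul (measurable_gradSq hφ))
  calc _ ≤ ∫⁻ q : (Fin N → ℝ) × ℝ, (Set.univ ×ˢ Set.Ioi 0).indicator
        (fun q => 2 ^ N * ENNReal.ofReal (q.2⁻¹ * gradSq φ q)) q := by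
        refine lintegral_mono fun q => ?_
        have hm' : Measurable fun x => ENNReal.ofReal (lusW x q ^ 2) :=
          ENNReal.measurable_ofReal.comp
            ((measurable_lusW.comp (measurable_id.prodMk measurable_const)).pow_const 2)
        simp only [ENNReal.ofReal_mul (sq_nonneg _)]
        rw [lintegral_mul_const _ hm']
        refine (mul_le_mul_left (lintegral_lusW_sq_le q) _).trans ?_
        by_cases hq : q ∈ (Set.univ : Set (Fin N → ℝ)) ×ˢ Set.Ioi (0 : ℝ)
        · rw [Set.indicator_of_mem hq, Set.indicator_of_mem hq, ENNReal.ofReal_mul (by positivity),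
            ENNReal.ofReal_mul (inv_nonneg.2 (le_of_lt hq.2)), ENNReal.ofReal_pow (by norm_num),
            ENNReal.ofReal_ofNat, mul_assoc]
        · rw [Set.indicator_of_notMem hq, Set.indicator_of_notMem hq, zero_mul]
    _ = 2 ^ N * ∫⁻ q, ENNReal.ofReal (q.2⁻¹ * gradSq φ q)
        ∂((volume : Measure (Fin N → ℝ)).prod (volume.restrict (Set.Ioi 0))) := by
        rw [lintegral_indicator (MeasurableSet.univ.prod measurableSet_Ioi),
          lintegral_const_mul _ hm2, Measure.volume_eq_prod,
          ← Measure.prod_restrict, Measure.restrict_univ]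
    _ ≤ _ := by
        refine (mul_le_mul_right (lintegral_gradSq_le hφ hφi) _).trans (le_of_eq ?_)
        push_cast
        rw [ENNReal.ofReal, mul_assoc]

lemma HomSmooth.norm_sub_le {E F : Type*} [NormedAddCommGroup E] [NormedSpace ℝ E]
    [FiniteDimensional ℝ E] [NormedAddCommGroup F] [NormedSpace ℝ F] {a : ℕ} {g : E → F}
    (hg : HomSmooth a g) : ∃ C, 0 ≤ C ∧ ∀ p q : E, ∀ r, 0 < r →
      (∀ ζ ∈ segment ℝ p q, r ≤ ‖ζ‖) → ‖g q - g p‖ ≤ C / r ^ (a + 1) * ‖q - p‖ := by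
  obtain ⟨C, hC, h⟩ := hg.fderiv.exists_bound
  refine ⟨C, hC, fun p q r hr hζ => ?_⟩
  have h0 : ∀ ζ ∈ segment ℝ p q, ζ ≠ 0 := fun ζ hz h0 => by
    have := hζ ζ hz
    rw [h0, norm_zero] at this
    linarith
  refine (convex_segment p q).norm_image_sub_le_of_norm_fderiv_le (𝕜 := ℝ)
    (fun ζ hz => hg.differentiableAt (h0 ζ hz)) (fun ζ hz => ?_) (left_mem_segment ℝ p q)
    (right_mem_segment ℝ p q)
  refine (h ζ (h0 ζ hz)).trans ?_
  have := hζ ζ hz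
  gcongr

lemma exists_tpd_sub_le (N : ℕ) : ∃ C, 0 ≤ C ∧ ∀ (i : Fin (N + 1)) (y z z' : Fin N → ℝ) (t r : ℝ),
    0 < t → 0 < r → (∀ ζ ∈ segment ℝ z' z, r ≤ ‖((y - ζ, t) : (Fin N → ℝ) × ℝ)‖) →
    |tpd i (pker N) (y - z, t) - tpd i (pker N) (y - z', t)| ≤
      t * (C / r ^ (N + 2) * ‖z - z'‖) := by
  choose C hC h using fun i : Fin (N + 1) => ((homSmooth_pker N).pd i).norm_sub_le
  refine ⟨∑ i, C i, Finset.sum_nonneg fun i _ => hC i, fun i y z z' t r ht hr hζ => ?_⟩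
  simp only [tpd]
  rw [← mul_sub, abs_mul, abs_of_pos ht]
  refine mul_le_mul_of_nonneg_left ?_ ht.le
  have hle : C i ≤ ∑ i, C i := Finset.single_le_sum (fun i _ => hC i) (Finset.mem_univ i)
  have hn : ‖((y - z, t) : (Fin N → ℝ) × ℝ) - (y - z', t)‖ = ‖z - z'‖ := by
    rw [Prod.mk_sub_mk, sub_self, sub_sub_sub_cancel_left, Prod.norm_mk, norm_zero,
      norm_sub_rev, max_eq_left (norm_nonneg _)]
  have hs : ∀ ζ ∈ segment ℝ ((y - z', t) : (Fin N → ℝ) × ℝ) (y - z, t), r ≤ ‖ζ‖ := by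
    rintro ζ ⟨a, b, ha, hb, hab, rfl⟩
    have := hζ (a • z' + b • z) ⟨a, b, ha, hb, hab, rfl⟩
    convert this using 2
    rw [Prod.smul_mk, Prod.smul_mk, Prod.mk_add_mk, ← add_smul, hab, one_smul]
    have : y = (a + b) • y := by rw [hab, one_smul]
    congr 1
    conv_rhs => rw [this]
    module
  refine (h i _ _ r hr hs).trans ?_
  rw [hn]
  gcongr

end LusinKer

section LusinBounds

variable {N : ℕ}

lemma lusW_comm (x y : Fin N → ℝ) (t : ℝ) : lusW x (y, t) = lusW y (x, t) := by
  have h : (y, t) ∈ lcone x ↔ (x, t) ∈ lcone y := by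
    have : ∀ i, (y i - x i) ^ 2 = (x i - y i) ^ 2 := fun i => by ring
    simp only [lcone, Set.mem_ofPred_eq, this]
  unfold lusW
  by_cases h' : (y, t) ∈ lcone x
  · rw [Set.indicator_of_mem h', Set.indicator_of_mem (h.1 h')]
  · rw [Set.indicator_of_notMem h', Set.indicator_of_notMem fun h'' => h' (h.2 h'')]

lemma lusW_le {s : ℝ} (hs : 0 < s) (x : Fin N → ℝ) {q : (Fin N → ℝ) × ℝ} (hq : s ≤ q.2) :
    lusW x q ≤ Real.sqrt ((s ^ (N + 1))⁻¹) := by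
  unfold lusW
  by_cases h : q ∈ lcone x
  · rw [Set.indicator_of_mem h]
    gcongr
  · rw [Set.indicator_of_notMem h]
    exact Real.sqrt_nonneg _

/-- The truncation of the parameter space of `lusKer`. -/
def lparTrunc (N : ℕ) (m : ℕ) : Set (LPar N) :=
  (Metric.closedBall 0 m ×ˢ (Set.Icc (-(m : ℝ)) 0 ∪ Set.Icc (1 / ((m : ℝ) + 1)) m)) ×ˢ Set.univ

lemma measurableSet_lparTrunc (m : ℕ) : MeasurableSet (lparTrunc N m) :=
  (Metric.isClosed_closedBall.measurableSet.prod
    (measurableSet_Icc.union measurableSet_Icc)).prod MeasurableSet.univ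

lemma monotone_lparTrunc : Monotone (lparTrunc N) := fun a b hab => by
  have h : (a : ℝ) ≤ b := by exact_mod_cast hab
  refine Set.prod_mono (Set.prod_mono (Metric.closedBall_subset_closedBall h)
    (Set.union_subset_union (Set.Icc_subset_Icc (neg_le_neg h) le_rfl)
      (Set.Icc_subset_Icc ?_ h))) le_rfl
  gcongr

lemma iUnion_lparTrunc : ⋃ m, lparTrunc N m = Set.univ := by
  refine Set.eq_univ_of_forall fun θ => ?_
  obtain ⟨a, ha⟩ := exists_nat_ge ‖θ.1.1‖
  obtain ⟨b, hb⟩ := exists_nat_ge |θ.1.2|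
  rcases le_or_gt θ.1.2 0 with h | h
  · have h1 : (a : ℝ) ≤ (max a b : ℕ) := by exact_mod_cast le_max_left a b
    have h2 : (b : ℝ) ≤ (max a b : ℕ) := by exact_mod_cast le_max_right a b
    exact Set.mem_iUnion.2 ⟨max a b, ⟨mem_closedBall_zero_iff.2 (ha.trans h1),
      Or.inl ⟨(abs_le.1 (hb.trans h2)).1, h⟩⟩, trivial⟩
  · obtain ⟨c, hc⟩ := exists_nat_one_div_lt h
    have h1 : (a : ℝ) ≤ (max (max a b) c : ℕ) := by
      exact_mod_cast (le_max_left a b).trans (le_max_left _ c)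
    have h2 : (b : ℝ) ≤ (max (max a b) c : ℕ) := by
      exact_mod_cast (le_max_right a b).trans (le_max_left _ c)
    have h3 : (c : ℝ) ≤ (max (max a b) c : ℕ) := by exact_mod_cast le_max_right _ c
    refine Set.mem_iUnion.2 ⟨max (max a b) c, ⟨mem_closedBall_zero_iff.2 (ha.trans h1),
      Or.inr ⟨le_trans ?_ hc.le, (abs_le.1 (hb.trans h2)).2⟩⟩, trivial⟩
    gcongr

lemma lparMeasure_lparTrunc_lt_top (m : ℕ) : lparMeasure N (lparTrunc N m) < ⊤ := by
  rw [lparMeasure, lparTrunc, Measure.prod_prod, Measure.prod_prod]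
  refine ENNReal.mul_lt_top (ENNReal.mul_lt_top measure_closedBall_lt_top
    (measure_union_lt_top ?_ ?_)) (Measure.count_apply_lt_top.2 Set.finite_univ)
  all_goals rw [Real.volume_Icc]; exact ENNReal.ofReal_lt_top

lemma lusKer_of_nonpos {θ : LPar N} (h : θ.1.2 ≤ 0) (x z : Fin N → ℝ) : lusKer x θ z = 0 := by
  have h0 : lusW x θ.1 = 0 :=
    Set.indicator_of_notMem (fun h' => absurd (pos_of_mem_lcone h') (not_lt.2 h)) _
  rw [lusKer, h0, zero_mul]

lemma abs_lusKer_sub_le {W T : ℝ} (hW0 : 0 ≤ W) {x : Fin N → ℝ} {θ : LPar N} {z z' : Fin N → ℝ}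
    (hW : lusW x θ.1 ≤ W)
    (h : |tpd θ.2 (pker N) (θ.1.1 - z, θ.1.2) - tpd θ.2 (pker N) (θ.1.1 - z', θ.1.2)| ≤ T) :
    |lusKer x θ z - lusKer x θ z'| ≤ W * T := by
  rw [lusKer, lusKer, ← mul_sub, abs_mul, abs_of_nonneg (lusW_nonneg _ _)]
  have := lusW_nonneg x θ.1
  gcongr

lemma exists_truncBound_lusKer (m : ℕ) :
    ∃ B, 0 ≤ B ∧ TruncBound (lusKer (N := N)) (lparMeasure N) m (lparTrunc N m) B := by
  have hs : 0 < 1 / ((m : ℝ) + 1) := by positivity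
  set s := 1 / ((m : ℝ) + 1) with hsdef
  set W := Real.sqrt ((s ^ (N + 1))⁻¹) with hWdef
  have hW0 : 0 ≤ W := Real.sqrt_nonneg _
  choose D' hD' hd using fun i : Fin (N + 1) =>
    (pKer_pker.tpd i).exists_decay (r := (m : ℝ)) hs
  set D := ∑ i, D' i with hDdef
  have hD : 0 ≤ D := Finset.sum_nonneg fun i _ => hD' i
  have hDi : ∀ i, D' i ≤ D := fun i => Finset.single_le_sum (fun i _ => hD' i) (Finset.mem_univ i)
  obtain ⟨C, hC, hL⟩ := exists_tpd_sub_le N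
  have hb : ∀ x, ∀ θ ∈ lparTrunc N m, ∀ z,
      |lusKer x θ z| ≤ W * (D * (1 + ‖θ.1.1 - z‖) ^ (-((N : ℝ) + 1))) := by
    intro x θ hθ z
    rcases hθ.1.2 with hθ0 | hθ2
    · rw [lusKer_of_nonpos hθ0.2, abs_zero]
      positivity
    rw [lusKer, abs_mul, abs_of_nonneg (lusW_nonneg _ _)]
    have h1 := lusW_le hs x hθ2.1
    have h2 := hd θ.2 θ.1.2 hθ2 (θ.1.1 - z)
    have h3 := lusW_nonneg x θ.1
    have h4 := hDi θ.2
    calc _ ≤ W * (D' θ.2 * (1 + ‖θ.1.1 - z‖) ^ (-((N : ℝ) + 1))) :=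
          mul_le_mul h1 h2 (abs_nonneg _) hW0
      _ ≤ _ := by gcongr
  have hb1 : ∀ x, ∀ θ ∈ lparTrunc N m, ∀ z, |lusKer x θ z| ≤ W * D := by
    intro x θ hθ z
    refine (hb x θ hθ z).trans ?_
    have : (1 + ‖θ.1.1 - z‖) ^ (-((N : ℝ) + 1)) ≤ 1 :=
      Real.rpow_le_one_of_one_le_of_nonpos (by linarith [norm_nonneg (θ.1.1 - z)])
        (by have := N.cast_nonneg (α := ℝ); linarith)
    gcongr
    exact mul_le_of_le_one_right hD this
  refine TruncBound.of_separate (B₁ := W * D) (B₂ := W * D * (1 + (m : ℝ)) ^ ((N : ℝ) + 1))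
    (B₃ := (2 * (W * D)) * (W * (m * (C / s ^ (N + 2)))) *
      (lparMeasure N (lparTrunc N m)).toReal) (measurableSet_lparTrunc m)
    (lparMeasure_lparTrunc_lt_top m) hb1 ?_ ?_
  · intro x _ θ hθ z
    refine (hb x θ hθ z).trans ?_
    rw [← mul_assoc, mul_assoc (W * D)]
    refine mul_le_mul_of_nonneg_left ?_ (by positivity)
    have hy : ‖θ.1.1‖ ≤ m := by simpa using hθ.1.1
    have h1 : 1 + ‖z‖ ≤ (1 + m) * (1 + ‖θ.1.1 - z‖) := by
      have h2 := norm_sub_le θ.1.1 (θ.1.1 - z)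
      rw [sub_sub_cancel] at h2
      nlinarith [norm_nonneg (θ.1.1 - z), m.cast_nonneg (α := ℝ)]
    rw [Real.rpow_neg (by positivity), Real.rpow_neg (by positivity), ← div_eq_mul_inv,
      inv_eq_one_div, div_le_div_iff₀ (by positivity) (by positivity), one_mul,
      ← Real.mul_rpow (by positivity) (by positivity)]
    gcongr
  · intro x z z'
    calc _ ≤ ∫⁻ θ in lparTrunc N m, ENNReal.ofReal
          ((2 * (W * D)) * (W * (m * (C / s ^ (N + 2)))) * ‖z - z'‖) ∂lparMeasure N := by
          refine setLIntegral_mono measurable_const fun θ hθ => ?_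
          rcases hθ.1.2 with hθ0 | hθ2
          · rw [lusKer_of_nonpos hθ0.2, lusKer_of_nonpos hθ0.2, sub_self, enorm_zero]
            simp
          have ht : 0 < θ.1.2 := hs.trans_le hθ2.1
          have h1 : |lusKer x θ z - lusKer x θ z'| ≤ 2 * (W * D) := by
            have := abs_sub (lusKer x θ z) (lusKer x θ z')
            linarith [hb1 x θ hθ z, hb1 x θ hθ z']
          have h2 : |lusKer x θ z - lusKer x θ z'| ≤ W * (m * (C / s ^ (N + 2) * ‖z - z'‖)) := by
            refine abs_lusKer_sub_le hW0 (lusW_le hs x hθ2.1) ?_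
            refine (hL θ.2 θ.1.1 z z' θ.1.2 s ht hs fun ζ _ =>
              hθ2.1.trans (snd_le_norm (θ.1.1 - ζ, θ.1.2))).trans ?_
            have := hθ2.2
            gcongr
          rw [Real.enorm_eq_ofReal_abs, ← ENNReal.ofReal_pow (abs_nonneg _)]
          refine ENNReal.ofReal_le_ofReal ?_
          rw [sq]
          calc _ ≤ (2 * (W * D)) * (W * (m * (C / s ^ (N + 2) * ‖z - z'‖))) :=
                mul_le_mul h1 h2 (abs_nonneg _) (by positivity)
            _ = _ := by ring
      _ = _ := by
          rw [setLIntegral_const]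
          nth_rw 1 [← ENNReal.ofReal_toReal (lparMeasure_lparTrunc_lt_top (N := N) m).ne]
          rw [← ENNReal.ofReal_mul (by positivity)]
          congr 1
          ring

lemma lintegral_Ioi_inv_pow_le {s : ℝ} (hs : 0 < s) (k : ℕ) :
    ∫⁻ t in Set.Ioi (0 : ℝ), ENNReal.ofReal (((t + s) ^ (k + 2))⁻¹) ≤
      ENNReal.ofReal ((s ^ (k + 1))⁻¹) := by
  have hk : (-((k : ℝ) + 2)) < -1 := by have := k.cast_nonneg (α := ℝ); linarith
  have hi := integrableOn_Ioi_rpow_of_lt hk hs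
  have he := integral_Ioi_rpow_of_lt hk hs
  calc _ = ∫⁻ t,
        (Set.Ioi s).indicator (fun t => ENNReal.ofReal (t ^ (-((k : ℝ) + 2)))) (t + s) := by
        rw [← lintegral_indicator measurableSet_Ioi]
        refine lintegral_congr fun t => ?_
        by_cases ht : 0 < t
        · rw [Set.indicator_of_mem (show t ∈ Set.Ioi 0 from ht),
            Set.indicator_of_mem (show t + s ∈ Set.Ioi s by simpa using ht),
            Real.rpow_neg (by positivity)]
          norm_cast
        · rw [Set.indicator_of_notMem (show t ∉ Set.Ioi 0 from ht),
            Set.indicator_of_notMem (show t + s ∉ Set.Ioi s by simpa using ht)]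
    _ = ∫⁻ t in Set.Ioi s, ENNReal.ofReal (t ^ (-((k : ℝ) + 2))) := by
        rw [lintegral_add_right_eq_self, lintegral_indicator measurableSet_Ioi]
    _ = ENNReal.ofReal (∫ t in Set.Ioi s, t ^ (-((k : ℝ) + 2))) := by
        rw [ofReal_integral_eq_lintegral_ofReal hi]
        filter_upwards [ae_restrict_mem measurableSet_Ioi] with t ht
        exact Real.rpow_nonneg (hs.trans ht).le _
    _ ≤ _ := by
        rw [he]
        refine ENNReal.ofReal_le_ofReal ?_
        rw [show -((k : ℝ) + 2) + 1 = -((k + 1 : ℕ) : ℝ) by push_cast; ring, neg_div_neg_eq,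
          Real.rpow_neg hs.le, Real.rpow_natCast]
        exact div_le_self (by positivity) (by push_cast; linarith [k.cast_nonneg (α := ℝ)])

lemma lusKer_sub_enorm_sq (x z z' : Fin N → ℝ) (θ : LPar N) :
    ‖lusKer x θ z - lusKer x θ z'‖ₑ ^ 2 = ENNReal.ofReal (lusW x θ.1 ^ 2 *
      (tpd θ.2 (pker N) (θ.1.1 - z, θ.1.2) - tpd θ.2 (pker N) (θ.1.1 - z', θ.1.2)) ^ 2) := by
  rw [lusKer, lusKer, ← mul_sub, Real.enorm_eq_ofReal_abs, ← ENNReal.ofReal_pow (abs_nonneg _),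
    sq_abs, mul_pow]

lemma measurable_lusKer_sub (x z z' : Fin N → ℝ) :
    Measurable fun θ => ‖lusKer x θ z - lusKer x θ z'‖ₑ ^ 2 :=
  (((measurable_ker_middle measurable_lusKer x z).sub
    (measurable_ker_middle measurable_lusKer x z')).enorm.pow_const 2)

lemma exists_horBound_lusKer :
    ∃ C : NNReal, HorBound (lusKer (N := N)) (lparMeasure N) C := by
  obtain ⟨C, hC, hL⟩ := exists_tpd_sub_le N
  set A : ℝ := 2 ^ N * (N + 1) * (C * 2 ^ (N + 2)) ^ 2 with hA
  refine exists_horBound (p := 2) two_pos (D := A * 4 ^ (2 * N + 2))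
    (by positivity) fun z₀ z x l hl hz hx => ?_
  set d := ‖x - z₀‖ with hd
  set s := (l + d) / 4 with hs
  have hs0 : 0 < s := by positivity
  rw [lintegral_lparMeasure (measurable_lusKer_sub x z z₀)]
  have key : ∀ q : (Fin N → ℝ) × ℝ, ∑ i, ‖lusKer x (q, i) z - lusKer x (q, i) z₀‖ₑ ^ 2 ≤
      ENNReal.ofReal (lusW x q ^ 2) *
        ENNReal.ofReal ((N + 1) * (q.2 * (C * 2 ^ (N + 2) / (q.2 + s) ^ (N + 2) * l)) ^ 2) := by
    intro q
    by_cases hq : q ∈ lcone x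
    · have ht := pos_of_mem_lcone hq
      have hr : 0 < (q.2 + s) / 2 := by positivity
      have hyx := norm_sub_lt_of_mem_lcone hq
      rw [← ENNReal.ofReal_mul (sq_nonneg _)]
      simp only [lusKer_sub_enorm_sq]
      rw [← ENNReal.ofReal_sum_of_nonneg fun _ _ => by positivity, ← Finset.mul_sum]
      refine ENNReal.ofReal_le_ofReal (mul_le_mul_of_nonneg_left ?_ (sq_nonneg _))
      calc _ ≤ ∑ _i : Fin (N + 1), (q.2 * (C * 2 ^ (N + 2) / (q.2 + s) ^ (N + 2) * l)) ^ 2 := by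
            refine Finset.sum_le_sum fun i _ => ?_
            rw [← sq_abs]
            refine pow_le_pow_left₀ (abs_nonneg _) ?_ 2
            refine (hL i q.1 z z₀ q.2 ((q.2 + s) / 2) ht hr fun ζ hζ => ?_).trans ?_
            · have h1 : ‖ζ - z₀‖ ≤ l := by
                have hb : segment ℝ z₀ z ⊆ Metric.closedBall z₀ l :=
                  (convex_closedBall z₀ l).segment_subset (by simp [hl.le])
                    (by simpa [dist_eq_norm] using hz)
                simpa [dist_eq_norm] using hb hζ
              have h2 : q.2 ≤ ‖((q.1 - ζ, q.2) : (Fin N → ℝ) × ℝ)‖ := snd_le_norm (q.1 - ζ, q.2)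
              have h3 : ‖q.1 - ζ‖ ≤ ‖((q.1 - ζ, q.2) : (Fin N → ℝ) × ℝ)‖ :=
                norm_fst_le (q.1 - ζ, q.2)
              have h4 : d ≤ ‖q.1 - ζ‖ + ‖q.1 - x‖ + ‖ζ - z₀‖ := by
                have e : x - z₀ = (q.1 - ζ) - (q.1 - x) + (ζ - z₀) := by abel
                rw [hd, e]
                exact (norm_add_le _ _).trans (by gcongr; exact norm_sub_le _ _)
              linarith
            · rw [div_pow, div_div_eq_mul_div]
              gcongr
        _ = _ := by simp
    · have h0 : lusW x q = 0 := Set.indicator_of_notMem hq _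
      simp [lusKer, h0]
  have hmW : Measurable fun q => ENNReal.ofReal (lusW x q ^ 2) :=
    ENNReal.measurable_ofReal.comp ((measurable_lusW.comp measurable_prodMk_left).pow_const 2)
  have hmG : Measurable fun q : (Fin N → ℝ) × ℝ =>
      ENNReal.ofReal ((N + 1) * (q.2 * (C * 2 ^ (N + 2) / (q.2 + s) ^ (N + 2) * l)) ^ 2) := by
    fun_prop
  have hmWG : Measurable fun q : (Fin N → ℝ) × ℝ => ENNReal.ofReal (lusW x q ^ 2) *
      ENNReal.ofReal ((N + 1) * (q.2 * (C * 2 ^ (N + 2) / (q.2 + s) ^ (N + 2) * l)) ^ 2) :=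
    hmW.mul hmG
  refine (lintegral_mono key).trans ?_
  rw [Measure.volume_eq_prod, lintegral_prod_symm' _ hmWG]
  calc _ ≤ ∫⁻ t : ℝ, (Set.Ioi 0).indicator (fun t => ENNReal.ofReal (A * l ^ 2) *
          ENNReal.ofReal (((t + s) ^ (2 * N + 1 + 2))⁻¹)) t := by
        refine lintegral_mono fun t => ?_
        have hmWt : Measurable fun y => ENNReal.ofReal (lusW x (y, t) ^ 2) :=
          hmW.comp measurable_prodMk_right
        dsimp only
        rw [lintegral_mul_const _ hmWt]
        simp only [lusW_comm x]
        refine (mul_le_mul_left (lintegral_lusW_sq_le (x, t)) _).trans ?_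
        by_cases ht : 0 < t
        · rw [Set.indicator_of_mem (show (x, t) ∈ Set.univ ×ˢ Set.Ioi 0 from ⟨trivial, ht⟩),
            Set.indicator_of_mem (show t ∈ Set.Ioi 0 from ht), ← ENNReal.ofReal_mul (by positivity),
            ← ENNReal.ofReal_mul (by positivity)]
          refine ENNReal.ofReal_le_ofReal ?_
          have hts : t / (t + s) ≤ 1 := (div_le_one (by positivity)).2 (by linarith)
          have e : 2 ^ N * t⁻¹ * (((N : ℝ) + 1) *
              (t * (C * 2 ^ (N + 2) / (t + s) ^ (N + 2) * l)) ^ 2) =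
              A * l ^ 2 * ((t + s) ^ (2 * N + 1 + 2))⁻¹ * (t / (t + s)) := by
            rw [hA]
            field_simp
            ring
          rw [e]
          exact mul_le_of_le_one_right (by positivity) hts
        · rw [Set.indicator_of_notMem (fun h => ht h.2), zero_mul]
          exact zero_le
    _ = ENNReal.ofReal (A * l ^ 2) *
          ∫⁻ t in Set.Ioi 0, ENNReal.ofReal (((t + s) ^ (2 * N + 1 + 2))⁻¹) := by
        rw [lintegral_indicator measurableSet_Ioi, lintegral_const_mul _ (by fun_prop)]
    _ ≤ ENNReal.ofReal (A * l ^ 2) * ENNReal.ofReal ((s ^ (2 * N + 1 + 1))⁻¹) :=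
        mul_le_mul_right (lintegral_Ioi_inv_pow_le hs0 _) _
    _ = _ := by
        rw [← ENNReal.ofReal_mul (by positivity)]
        congr 1
        rw [hs, div_pow, inv_div]
        ring

end LusinBounds

section LusinLeDyadic

variable {N : ℕ} {H : Type*} [NormedAddCommGroup H] [InnerProductSpace ℝ H] [CompleteSpace H]

lemma le_lintegral_sqrt_of_forall {α Ω : Type*} [MeasurableSpace α] [MeasurableSpace Ω]
    {μ : Measure α} [SFinite μ] {P : Measure Ω} [IsProbabilityMeasure P] {g : α → Ω → ℝ≥0∞}
    (hg : Measurable fun p : α × Ω => g p.1 p.2) {a c : ℝ≥0∞}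
    (h : ∀ ω, a ≤ c * ∫⁻ x, g x ω ^ (1 / 2 : ℝ) ∂μ) :
    a ≤ c * ∫⁻ x, (∫⁻ ω, g x ω ∂P) ^ (1 / 2 : ℝ) ∂μ := by
  have hgs : Measurable fun p : α × Ω => g p.1 p.2 ^ (1 / 2 : ℝ) := hg.pow_const _
  calc a = ∫⁻ _ω, a ∂P := by simp
    _ ≤ ∫⁻ ω, c * ∫⁻ x, g x ω ^ (1 / 2 : ℝ) ∂μ ∂P := lintegral_mono h
    _ = c * ∫⁻ x, ∫⁻ ω, g x ω ^ (1 / 2 : ℝ) ∂P ∂μ := by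
        rw [lintegral_const_mul _ hgs.lintegral_prod_left',
          lintegral_lintegral_swap (f := fun x ω => g x ω ^ (1 / 2 : ℝ)) hgs.aemeasurable]
    _ ≤ _ := by
        refine mul_le_mul_right (lintegral_mono fun x => ?_) _
        have hgx : Measurable (g x) := hg.comp measurable_prodMk_left
        have h1 := lintegral_mul_le_sqrt (μ := P)
          (hgx.pow_const (1 / 2 : ℝ)).aemeasurable (aemeasurable_const (b := 1))
        simp only [mul_one, one_pow, lintegral_const, measure_univ, ENNReal.one_rpow] at h1
        refine h1.trans (le_of_eq ?_)
        congr 1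
        refine lintegral_congr fun ω => ?_
        rw [← ENNReal.rpow_natCast, ← ENNReal.rpow_mul]
        norm_num

lemma lintegral_dparMeasure_eq_tsum {g : DPar N → ℝ≥0∞} (hg : Measurable g) :
    ∫⁻ θ, g θ ∂dparMeasure N = ∫⁻ ω, ∑' k : ℤ, g (k, ω) ∂randMeasure N := by
  have h : ∀ k : ℤ, Measurable fun ω => g (k, ω) := fun k => hg.comp measurable_prodMk_left
  rw [lintegral_dparMeasure hg, lintegral_tsum fun k => (h k).aemeasurable]

lemma le_lintegral_sqrt_dparMeasure {g : (Fin N → ℝ) → DPar N → ℝ≥0∞}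
    (hg : Measurable fun p : (Fin N → ℝ) × DPar N => g p.1 p.2) {a c : ℝ≥0∞}
    (h : ∀ ω, a ≤ c * ∫⁻ x, (∑' k : ℤ, g x (k, ω)) ^ (1 / 2 : ℝ)) :
    a ≤ c * ∫⁻ x, (∫⁻ θ, g x θ ∂dparMeasure N) ^ (1 / 2 : ℝ) := by
  have hgm : Measurable fun p : (Fin N → ℝ) × RSpace N => ∑' k : ℤ, g p.1 (k, p.2) :=
    Measurable.tsum fun k =>
      hg.comp (measurable_fst.prodMk (measurable_const.prodMk measurable_snd))
  refine (le_lintegral_sqrt_of_forall (P := randMeasure N)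
    (g := fun x ω => ∑' k : ℤ, g x (k, ω)) hgm h).trans (le_of_eq ?_)
  congr 1
  refine lintegral_congr fun x => ?_
  have hx : Measurable (g x) := hg.comp measurable_prodMk_left
  rw [lintegral_dparMeasure_eq_tsum hx]

lemma ofReal_integral_inner_le_dyadic (hN : 0 < N) {F b : (Fin N → ℝ) → H} (hF : Integrable F)
    (hFm : StronglyMeasurable F) (hb : StronglyMeasurable b) (hbc : Continuous b)
    (hB : ∃ B, ∀ x, ‖b x‖ ≤ B) (hbi : Integrable b) {M : NNReal} (hM : BMOBound b M) :
    ENNReal.ofReal (∫ x, inner ℝ (F x) (b x)) ≤ (1 + 2 ^ N * M) *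
      ∫⁻ x, (∫⁻ θ, ‖kerApply diffKer F x θ‖ₑ ^ 2 ∂dparMeasure N) ^ (1 / 2 : ℝ) := by
  obtain ⟨B, hB⟩ := hB
  refine le_lintegral_sqrt_dparMeasure (g := fun x θ => ‖kerApply diffKer F x θ‖ₑ ^ 2)
    (measurable_enorm_kerApply measurable_diffKer hFm) fun ω => ?_
  simp only [kerApply_diffKer hF]
  exact ofReal_integral_inner_le_of_bmo hN (nested_randOffset ω) hF hFm hb hbc hB hbi hM

lemma lusin_le_dyadic (hN : 0 < N) {C : NNReal}
    (hC : HorBound (lusKer (N := N)) (lparMeasure N) C)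
    {F : (Fin N → ℝ) → H} (hF : Integrable F) (hFm : StronglyMeasurable F) :
    ∫⁻ x, (∫⁻ θ, ‖kerApply lusKer F x θ‖ₑ ^ 2 ∂lparMeasure N) ^ (1 / 2 : ℝ) ≤
      ((1 + 2 ^ N * (2 * (2 ^ N * (etaNorm N).toNNReal * 8 ^ N + C ^ 2 * 2 ^ N)) : NNReal) : ℝ≥0∞) *
      ∫⁻ x, (∫⁻ θ, ‖kerApply diffKer F x θ‖ₑ ^ 2 ∂dparMeasure N) ^ (1 / 2 : ℝ) := by
  choose B hB hT using fun m : ℕ => exists_truncBound_lusKer (N := N) m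
  refine lintegral_kerApply_le_of_bmo hB hT monotone_lparTrunc iUnion_lparTrunc measurable_lusKer
    l2Bound_lusKer hC hF hFm fun b hb hbc hbB hbi hM => ?_
  refine (ofReal_integral_inner_le_dyadic hN hF hFm hb hbc hbB hbi hM).trans (le_of_eq ?_)
  push_cast
  rfl

end LusinLeDyadic

section BMOTail

variable {N : ℕ} {H : Type*} [NormedAddCommGroup H] [InnerProductSpace ℝ H] [CompleteSpace H]

lemma volume_closedBall_fin (z : Fin N → ℝ) {l : ℝ} (hl : 0 ≤ l) :
    volume (Metric.closedBall z l) = ENNReal.ofReal (2 ^ N * l ^ N) := by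
  rw [Real.volume_pi_closedBall z hl, Fintype.card_fin, mul_pow]

lemma lintegral_closedBall_enorm_sub_le {b : (Fin N → ℝ) → H}
    {M : NNReal} {z₀ : Fin N → ℝ} {l : ℝ} (hl : 0 < l) {a : H}
    (h : ∫⁻ z in Metric.closedBall z₀ l, ‖b z - a‖ₑ ^ 2 ≤ M * ENNReal.ofReal (l ^ N)) :
    ∫⁻ z in Metric.closedBall z₀ l, ‖b z - a‖ₑ ≤ (2 ^ N + M) * ENNReal.ofReal (l ^ N) := by
  have h1 : ∀ t : ℝ≥0∞, t ≤ 1 + t ^ 2 := fun t => by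
    rcases le_total t 1 with h | h
    · exact h.trans le_self_add
    · rw [sq]
      exact (le_mul_of_one_le_left' h).trans le_add_self
  calc ∫⁻ z in Metric.closedBall z₀ l, ‖b z - a‖ₑ
      ≤ ∫⁻ z in Metric.closedBall z₀ l, (1 + ‖b z - a‖ₑ ^ 2) := lintegral_mono fun z => h1 _
    _ = volume (Metric.closedBall z₀ l) + ∫⁻ z in Metric.closedBall z₀ l, ‖b z - a‖ₑ ^ 2 := by
        rw [lintegral_add_left measurable_const]; simp
    _ ≤ _ := by
        rw [volume_closedBall_fin z₀ hl.le, add_mul, ENNReal.ofReal_mul (by positivity),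
          ENNReal.ofReal_pow (by positivity), ENNReal.ofReal_ofNat]
        gcongr

lemma enorm_sub_le_of_closedBall {b : (Fin N → ℝ) → H} (hb : StronglyMeasurable b)
    {M : NNReal} {z₀ : Fin N → ℝ} {l : ℝ} (hl : 0 < l) {a c : H}
    (ha : ∫⁻ z in Metric.closedBall z₀ l, ‖b z - a‖ₑ ^ 2 ≤ M * ENNReal.ofReal (l ^ N))
    (hc : ∫⁻ z in Metric.closedBall z₀ (2 * l), ‖b z - c‖ₑ ^ 2 ≤
      M * ENNReal.ofReal ((2 * l) ^ N)) :
    ‖a - c‖ₑ ≤ 2 * (2 ^ N + M) := by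
  have h1 := lintegral_closedBall_enorm_sub_le hl ha
  have h2 := lintegral_closedBall_enorm_sub_le (by positivity) hc
  have h3 : ‖a - c‖ₑ * volume (Metric.closedBall z₀ l) ≤
      (2 ^ N + M) * ENNReal.ofReal (l ^ N) + (2 ^ N + M) * ENNReal.ofReal ((2 * l) ^ N) := by
    calc ‖a - c‖ₑ * volume (Metric.closedBall z₀ l)
        = ∫⁻ _z in Metric.closedBall z₀ l, ‖a - c‖ₑ := by simp
      _ ≤ ∫⁻ z in Metric.closedBall z₀ l, (‖b z - a‖ₑ + ‖b z - c‖ₑ) := by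
          refine lintegral_mono fun z => ?_
          have : a - c = (b z - c) - (b z - a) := by abel
          rw [this, add_comm]
          exact enorm_sub_le
      _ = (∫⁻ z in Metric.closedBall z₀ l, ‖b z - a‖ₑ) +
          ∫⁻ z in Metric.closedBall z₀ l, ‖b z - c‖ₑ := by
          rw [lintegral_add_left]
          exact (hb.sub stronglyMeasurable_const).enorm
      _ ≤ _ := by
          refine add_le_add h1 (le_trans ?_ h2)
          exact lintegral_mono_set (Metric.closedBall_subset_closedBall (by linarith))
  have h4 : (2 ^ N + (M : ℝ≥0∞)) * ENNReal.ofReal (l ^ N) +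
      (2 ^ N + M) * ENNReal.ofReal ((2 * l) ^ N) ≤
        2 * (2 ^ N + M) * volume (Metric.closedBall z₀ l) := by
    rw [volume_closedBall_fin z₀ hl.le, ← mul_pow, ← mul_add, mul_comm 2 (2 ^ N + (M : ℝ≥0∞)),
      mul_assoc]
    refine mul_le_mul_right ?_ _
    rw [two_mul (ENNReal.ofReal _)]
    refine add_le_add (ENNReal.ofReal_le_ofReal ?_) le_rfl
    gcongr
    linarith
  have hv : volume (Metric.closedBall z₀ l) ≠ 0 := by
    rw [volume_closedBall_fin z₀ hl.le]
    simp only [ne_eq, ENNReal.ofReal_eq_zero, not_le]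
    positivity
  have hv' : volume (Metric.closedBall z₀ l) ≠ ⊤ := by
    rw [volume_closedBall_fin z₀ hl.le]; exact ENNReal.ofReal_ne_top
  exact (ENNReal.mul_le_mul_iff_left hv hv').1 (h3.trans h4)

/-- The mean oscillation with respect to a fixed value grows at most linearly in the number of
doublings of the ball. -/
lemma BMOBound.lintegral_closedBall_two_pow {b : (Fin N → ℝ) → H} (hb : StronglyMeasurable b)
    {M : NNReal} (hM : BMOBound b M) {z₀ : Fin N → ℝ} {l : ℝ} (hl : 0 < l) {a : H}
    (ha : ∫⁻ z in Metric.closedBall z₀ l, ‖b z - a‖ₑ ^ 2 ≤ M * ENNReal.ofReal (l ^ N)) (j : ℕ) :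
    ∫⁻ z in Metric.closedBall z₀ (2 ^ j * l), ‖b z - a‖ₑ ≤
      (2 ^ N + M) * (2 * j + 1) * ENNReal.ofReal (2 ^ N * (2 ^ j * l) ^ N) := by
  have key : ∀ j : ℕ, ∃ c, ∫⁻ z in Metric.closedBall z₀ (2 ^ j * l), ‖b z - c‖ₑ ^ 2 ≤
      M * ENNReal.ofReal ((2 ^ j * l) ^ N) ∧ ‖c - a‖ₑ ≤ 2 * j * (2 ^ N + M) := by
    intro j
    induction j with
    | zero => exact ⟨a, by simpa using ha, by simp⟩
    | succ j ih =>
      obtain ⟨c, hc, hca⟩ := ih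
      obtain ⟨d, hd⟩ := hM z₀ (2 ^ (j + 1) * l) (by positivity)
      refine ⟨d, hd, ?_⟩
      rw [pow_succ', mul_assoc] at hd
      have h := enorm_sub_le_of_closedBall hb (by positivity) hc hd
      have h1 : d - a = (c - a) - (c - d) := by abel
      rw [h1]
      refine enorm_sub_le.trans ((add_le_add hca h).trans (le_of_eq ?_))
      push_cast
      ring
  obtain ⟨c, hc, hca⟩ := key j
  have h1 := lintegral_closedBall_enorm_sub_le (by positivity) hc
  calc ∫⁻ z in Metric.closedBall z₀ (2 ^ j * l), ‖b z - a‖ₑ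
      ≤ ∫⁻ z in Metric.closedBall z₀ (2 ^ j * l), (‖b z - c‖ₑ + ‖c - a‖ₑ) := by
        refine lintegral_mono fun z => ?_
        have : b z - a = (b z - c) + (c - a) := by abel
        rw [this]
        exact enorm_add_le _ _
    _ = (∫⁻ z in Metric.closedBall z₀ (2 ^ j * l), ‖b z - c‖ₑ) +
        ‖c - a‖ₑ * volume (Metric.closedBall z₀ (2 ^ j * l)) := by
        rw [lintegral_add_right _ measurable_const]; simp
    _ ≤ (2 ^ N + M) * ENNReal.ofReal (2 ^ N * (2 ^ j * l) ^ N) +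
        2 * j * (2 ^ N + M) * ENNReal.ofReal (2 ^ N * (2 ^ j * l) ^ N) := by
        rw [volume_closedBall_fin z₀ (by positivity)]
        refine add_le_add (h1.trans ?_) (mul_le_mul_left hca _)
        refine mul_le_mul_right (ENNReal.ofReal_le_ofReal ?_) _
        exact le_mul_of_one_le_left (by positivity) (one_le_pow₀ (by norm_num))
    _ = _ := by ring

lemma tsum_two_mul_add_three_le :
    ∑' j : ℕ, ENNReal.ofReal ((2 * j + 3) * (1 / 2) ^ j) ≤ 16 := by
  have h : ∀ j : ℕ, (2 * (j : ℝ) + 3) * (1 / 2) ^ j ≤ 4 * (3 / 4) ^ j := by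
    have h1 : ∀ j : ℕ, (2 * (j : ℝ) + 3) ≤ 4 * (3 / 2) ^ j := by
      intro j
      induction j with
      | zero => norm_num
      | succ j ih =>
        rcases Nat.eq_zero_or_pos j with rfl | hj
        · norm_num
        · have : (1 : ℝ) ≤ j := by exact_mod_cast hj
          push_cast
          rw [pow_succ]
          linarith
    intro j
    calc (2 * (j : ℝ) + 3) * (1 / 2) ^ j ≤ 4 * (3 / 2) ^ j * (1 / 2) ^ j := by
          gcongr
          exact h1 j
      _ = _ := by rw [mul_assoc, ← mul_pow]; norm_num
  refine (ENNReal.tsum_le_tsum fun j => ENNReal.ofReal_le_ofReal (h j)).trans ?_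
  have hs : Summable fun j : ℕ => (4 : ℝ) * (3 / 4) ^ j :=
    (summable_geometric_of_lt_one (by norm_num) (by norm_num)).mul_left 4
  rw [← ENNReal.ofReal_tsum_of_nonneg (fun j => by positivity) hs, tsum_mul_left,
    tsum_geometric_of_lt_one (by norm_num) (by norm_num)]
  norm_num

lemma BMOBound.lintegral_compl_closedBall_le {b : (Fin N → ℝ) → H} (hb : StronglyMeasurable b)
    {M : NNReal} (hM : BMOBound b M) {z₀ : Fin N → ℝ} {l : ℝ} (hl : 0 < l) {a : H}
    (ha : ∫⁻ z in Metric.closedBall z₀ l, ‖b z - a‖ₑ ^ 2 ≤ M * ENNReal.ofReal (l ^ N)) :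
    ∫⁻ z in (Metric.closedBall z₀ l)ᶜ, ENNReal.ofReal ((‖z - z₀‖ ^ (N + 1))⁻¹) * ‖b z - a‖ₑ ≤
      16 * 4 ^ N * (2 ^ N + M) * ENNReal.ofReal l⁻¹ := by
  set B : ℕ → Set (Fin N → ℝ) := fun j => Metric.closedBall z₀ (2 ^ j * l) with hB
  have hcov : (Metric.closedBall z₀ l)ᶜ ⊆ ⋃ j, B (j + 1) \ B j := by
    intro z hz
    have hex : ∃ j : ℕ, z ∈ B j := by
      obtain ⟨j, hj⟩ := pow_unbounded_of_one_lt (dist z z₀ / l) (one_lt_two (α := ℝ))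
      refine ⟨j, ?_⟩
      rw [div_lt_iff₀ hl] at hj
      exact Metric.mem_closedBall.2 hj.le
    classical
    have hpos : Nat.find hex ≠ 0 := by
      intro h0
      have := Nat.find_spec hex
      rw [h0] at this
      exact hz (by simpa [hB] using this)
    obtain ⟨j, hj⟩ := Nat.exists_eq_succ_of_ne_zero hpos
    refine Set.mem_iUnion.2 ⟨j, ?_, ?_⟩
    · have := Nat.find_spec hex
      rwa [hj] at this
    · exact Nat.find_min hex (by omega)
  calc ∫⁻ z in (Metric.closedBall z₀ l)ᶜ, ENNReal.ofReal ((‖z - z₀‖ ^ (N + 1))⁻¹) * ‖b z - a‖ₑ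
      ≤ ∫⁻ z in ⋃ j, B (j + 1) \ B j, ENNReal.ofReal ((‖z - z₀‖ ^ (N + 1))⁻¹) * ‖b z - a‖ₑ :=
        lintegral_mono_set hcov
    _ ≤ ∑' j, ∫⁻ z in B (j + 1) \ B j,
          ENNReal.ofReal ((‖z - z₀‖ ^ (N + 1))⁻¹) * ‖b z - a‖ₑ := lintegral_iUnion_le _ _
    _ ≤ ∑' j : ℕ, 4 ^ N * (2 ^ N + M) * ENNReal.ofReal l⁻¹ *
          ENNReal.ofReal ((2 * j + 3) * (1 / 2) ^ j) := by
        refine ENNReal.tsum_le_tsum fun j => ?_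
        calc ∫⁻ z in B (j + 1) \ B j, ENNReal.ofReal ((‖z - z₀‖ ^ (N + 1))⁻¹) * ‖b z - a‖ₑ
            ≤ ∫⁻ z in B (j + 1) \ B j,
                ENNReal.ofReal (((2 ^ j * l) ^ (N + 1))⁻¹) * ‖b z - a‖ₑ := by
              refine setLIntegral_mono' (measurableSet_closedBall.diff measurableSet_closedBall)
                fun z hz => ?_
              have h1 : 2 ^ j * l ≤ ‖z - z₀‖ := by
                have := hz.2
                rw [hB, Metric.mem_closedBall, not_le, dist_eq_norm] at this
                exact this.le
              gcongr
          _ ≤ ENNReal.ofReal (((2 ^ j * l) ^ (N + 1))⁻¹) *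
                ∫⁻ z in B (j + 1), ‖b z - a‖ₑ := by
              have hm : Measurable fun z => ‖b z - a‖ₑ := (hb.sub stronglyMeasurable_const).enorm
              rw [lintegral_const_mul _ hm]
              exact mul_le_mul_right (lintegral_mono_set Set.sdiff_subset) _
          _ ≤ ENNReal.ofReal (((2 ^ j * l) ^ (N + 1))⁻¹) * ((2 ^ N + M) *
                (2 * (j + 1 : ℕ) + 1) * ENNReal.ofReal (2 ^ N * (2 ^ (j + 1) * l) ^ N)) :=
              mul_le_mul_right (hM.lintegral_closedBall_two_pow hb hl ha (j + 1)) _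
          _ = _ := by
              have h2 : (2 * ((j + 1 : ℕ) : ℝ≥0∞) + 1) = ENNReal.ofReal (2 * j + 3) := by
                rw [show (2 * (j : ℝ) + 3) = ((2 * (j + 1) + 1 : ℕ) : ℝ) by push_cast; ring,
                  ENNReal.ofReal_natCast]
                push_cast
                rfl
              have h4 : (4 : ℝ≥0∞) ^ N = ENNReal.ofReal (4 ^ N) := by
                rw [ENNReal.ofReal_pow (by norm_num)]; simp
              rw [h2, h4]
              calc _ = (2 ^ N + (M : ℝ≥0∞)) * (ENNReal.ofReal (((2 ^ j * l) ^ (N + 1))⁻¹) *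
                    ENNReal.ofReal (2 * j + 3) *
                    ENNReal.ofReal (2 ^ N * (2 ^ (j + 1) * l) ^ N)) := by ring
                _ = (2 ^ N + (M : ℝ≥0∞)) * (ENNReal.ofReal (4 ^ N) * ENNReal.ofReal l⁻¹ *
                    ENNReal.ofReal ((2 * j + 3) * (1 / 2) ^ j)) := by
                  rw [← ENNReal.ofReal_mul (by positivity), ← ENNReal.ofReal_mul (by positivity),
                    ← ENNReal.ofReal_mul (by positivity), ← ENNReal.ofReal_mul (by positivity)]
                  congr 2
                  have h5 : (4 : ℝ) ^ N = 2 ^ N * 2 ^ N := by rw [← mul_pow]; norm_num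
                  rw [h5, one_div, inv_pow]
                  field_simp
                  ring
                _ = _ := by ring
    _ ≤ 4 ^ N * (2 ^ N + M) * ENNReal.ofReal l⁻¹ * 16 := by
        rw [ENNReal.tsum_mul_left]
        exact mul_le_mul_right tsum_two_mul_add_three_le _
    _ = _ := by ring

end BMOTail

section Carleson

variable {N : ℕ} {H : Type*} [NormedAddCommGroup H] [InnerProductSpace ℝ H] [CompleteSpace H]

lemma exists_tpd_le (N : ℕ) : ∃ C : NNReal, ∀ (i : Fin (N + 1)) (p : (Fin N → ℝ) × ℝ), 0 < p.2 →
    |tpd i (pker N) p| ≤ C * (p.2 / ‖p‖ ^ (N + 1)) := by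
  choose C hC h using fun i : Fin (N + 1) => (pKer_pker (N := N).tpd i).bound
  refine ⟨⟨∑ i, C i, Finset.sum_nonneg fun i _ => hC i⟩, fun i p hp => (h i p hp).trans ?_⟩
  refine mul_le_mul_of_nonneg_right ?_ (by positivity)
  exact Finset.single_le_sum (fun i _ => hC i) (Finset.mem_univ i)

lemma pconv_tpd_eq_add {b : (Fin N → ℝ) → H} (hbi : Integrable b) {B : Set (Fin N → ℝ)}
    (hB : MeasurableSet B) (a : H) (i : Fin (N + 1)) (y : Fin N → ℝ) {t : ℝ} (ht : 0 < t) :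
    pconv (tpd i (pker N)) b (y, t) =
      pconv (tpd i (pker N)) (B.indicator fun z => b z - a) (y, t) +
        ∫ z in Bᶜ, tpd i (pker N) (y - z, t) • (b z - a) := by
  have hk : Integrable fun z => tpd i (pker N) (y - z, t) :=
    ((pKer_pker.tpd i).integrable_slice ht).comp_sub_left y
  have hk0 : ∫ z, tpd i (pker N) (y - z, t) = 0 := by
    rw [← integral_tpd pKer_pker i ht]
    exact integral_sub_left_eq_self (fun z => tpd i (pker N) (z, t)) volume y
  have h1 : Integrable fun z => tpd i (pker N) (y - z, t) • b z :=
    (pKer_pker.tpd i).integrable_smul hbi y ht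
  have h2 : Integrable fun z => tpd i (pker N) (y - z, t) • a := hk.smul_const a
  have h3 : Integrable fun z => tpd i (pker N) (y - z, t) • (b z - a) := by
    simp only [smul_sub]
    exact h1.sub h2
  calc pconv (tpd i (pker N)) b (y, t) = ∫ z, tpd i (pker N) (y - z, t) • (b z - a) := by
        simp only [smul_sub]
        rw [integral_sub h1 h2, integral_smul_const, hk0, zero_smul, sub_zero]
        rfl
    _ = (∫ z in B, tpd i (pker N) (y - z, t) • (b z - a)) +
        ∫ z in Bᶜ, tpd i (pker N) (y - z, t) • (b z - a) := (integral_add_compl hB h3).symm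
    _ = _ := by
        congr 1
        rw [← integral_indicator hB]
        refine integral_congr_ae (ae_of_all _ fun z => ?_)
        by_cases hz : z ∈ B <;> simp [hz]

/-- The constant in the bound for the part of the extension coming from far away. -/
def farConst (N : ℕ) (C M : NNReal) : NNReal := C * 2 ^ (N + 1) * (16 * 4 ^ N * (2 ^ N + M))

lemma norm_integral_far_le {C : NNReal} (hC : ∀ (i : Fin (N + 1)) (p : (Fin N → ℝ) × ℝ), 0 < p.2 →
    |tpd i (pker N) p| ≤ C * (p.2 / ‖p‖ ^ (N + 1))) {b : (Fin N → ℝ) → H}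
    (hb : StronglyMeasurable b) {M : NNReal} (hM : BMOBound b M) {x : Fin N → ℝ} {r : ℝ}
    (hr : 0 < r) {a : H} (ha : ∫⁻ z in Metric.closedBall x (2 * r), ‖b z - a‖ₑ ^ 2 ≤
      M * ENNReal.ofReal ((2 * r) ^ N)) (i : Fin (N + 1)) {y : Fin N → ℝ}
    (hy : y ∈ Metric.closedBall x r) {t : ℝ} (ht : 0 < t) :
    ‖∫ z in (Metric.closedBall x (2 * r))ᶜ, tpd i (pker N) (y - z, t) • (b z - a)‖ ≤
      farConst N C M * (t / r) := by
  have h1 : ∀ z ∈ (Metric.closedBall x (2 * r))ᶜ,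
      |tpd i (pker N) (y - z, t)| ≤ C * t * 2 ^ (N + 1) * (‖z - x‖ ^ (N + 1))⁻¹ := by
    intro z hz
    rw [Set.mem_compl_iff, Metric.mem_closedBall, not_le, dist_eq_norm] at hz
    rw [Metric.mem_closedBall, dist_eq_norm] at hy
    have h2 : ‖z - x‖ / 2 ≤ ‖((y - z, t) : (Fin N → ℝ) × ℝ)‖ := by
      have h3 : ‖y - z‖ ≤ ‖((y - z, t) : (Fin N → ℝ) × ℝ)‖ := norm_fst_le (y - z, t)
      have h4 : ‖z - x‖ ≤ ‖y - x‖ + ‖y - z‖ := by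
        have : z - x = (y - x) - (y - z) := by abel
        rw [this]
        exact norm_sub_le _ _
      linarith
    have h5 : 0 < ‖z - x‖ := by linarith
    calc |tpd i (pker N) (y - z, t)|
        ≤ C * (t / ‖((y - z, t) : (Fin N → ℝ) × ℝ)‖ ^ (N + 1)) := hC i (y - z, t) ht
      _ ≤ C * (t / (‖z - x‖ / 2) ^ (N + 1)) := by gcongr
      _ = _ := by rw [div_pow]; field_simp
  have h2 : ‖∫ z in (Metric.closedBall x (2 * r))ᶜ, tpd i (pker N) (y - z, t) • (b z - a)‖ₑ ≤
      ENNReal.ofReal (farConst N C M * (t / r)) := by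
    refine (enorm_integral_le_lintegral_enorm _).trans ?_
    have hm : Measurable fun z => ENNReal.ofReal ((‖z - x‖ ^ (N + 1))⁻¹) * ‖b z - a‖ₑ := by
      have := (hb.sub (stronglyMeasurable_const (b := a))).enorm
      exact (by fun_prop : Measurable fun z : Fin N → ℝ =>
        ENNReal.ofReal ((‖z - x‖ ^ (N + 1))⁻¹)).mul this
    calc ∫⁻ z in (Metric.closedBall x (2 * r))ᶜ, ‖tpd i (pker N) (y - z, t) • (b z - a)‖ₑ
        ≤ ∫⁻ z in (Metric.closedBall x (2 * r))ᶜ, ENNReal.ofReal (C * t * 2 ^ (N + 1)) *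
            (ENNReal.ofReal ((‖z - x‖ ^ (N + 1))⁻¹) * ‖b z - a‖ₑ) := by
          refine setLIntegral_mono' measurableSet_closedBall.compl fun z hz => ?_
          rw [enorm_smul, ← mul_assoc, ← ENNReal.ofReal_mul (by positivity)]
          refine mul_le_mul_left ?_ _
          rw [Real.enorm_eq_ofReal_abs]
          exact ENNReal.ofReal_le_ofReal (h1 z hz)
      _ ≤ ENNReal.ofReal (C * t * 2 ^ (N + 1)) *
            (16 * 4 ^ N * (2 ^ N + M) * ENNReal.ofReal (2 * r)⁻¹) := by
          rw [lintegral_const_mul _ hm]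
          exact mul_le_mul_right (hM.lintegral_compl_closedBall_le hb (by positivity) ha) _
      _ = ENNReal.ofReal (C * t * 2 ^ (N + 1)) *
            (ENNReal.ofReal (16 * 4 ^ N * (2 ^ N + M)) * ENNReal.ofReal (2 * r)⁻¹) := by
          congr 2
          rw [show (16 * 4 ^ N * (2 ^ N + (M : ℝ))) =
            ((16 * 4 ^ N * (2 ^ N + M) : NNReal) : ℝ) by push_cast; rfl, ENNReal.ofReal_coe_nnreal]
          push_cast
          rfl
      _ ≤ _ := by
          rw [← ENNReal.ofReal_mul (by positivity), ← ENNReal.ofReal_mul (by positivity)]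
          refine ENNReal.ofReal_le_ofReal ?_
          rw [farConst]
          push_cast
          calc _ = C * 2 ^ (N + 1) * (16 * 4 ^ N * (2 ^ N + M)) * (t * (2 * r)⁻¹) := by ring
            _ ≤ C * 2 ^ (N + 1) * (16 * 4 ^ N * (2 ^ N + M)) * (t * r⁻¹) := by
              gcongr
              linarith
            _ = _ := by ring
  rw [← ofReal_norm] at h2
  exact (ENNReal.ofReal_le_ofReal_iff (by positivity)).1 h2

/-- The constant in the Carleson measure estimate. -/
def carlesonConst (N : ℕ) (C M : NNReal) : NNReal :=
  2 ^ N * (2 * (etaNorm N).toNNReal * M + 2 * (N + 1) * farConst N C M ^ 2)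

/-- The gradient of the extension of a function of bounded mean oscillation gives rise to a
Carleson measure. -/
lemma lintegral_carleson_le {C : NNReal} (hC : ∀ (i : Fin (N + 1)) (p : (Fin N → ℝ) × ℝ), 0 < p.2 →
    |tpd i (pker N) p| ≤ C * (p.2 / ‖p‖ ^ (N + 1))) {b : (Fin N → ℝ) → H}
    (hb : StronglyMeasurable b) (hbi : Integrable b) {M : NNReal} (hM : BMOBound b M)
    (x : Fin N → ℝ) {r : ℝ} (hr : 0 < r) :
    ∫⁻ q in Metric.closedBall x r ×ˢ Set.Ioc 0 r, ENNReal.ofReal (q.2⁻¹ * gradSq b q)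
      ∂(volume.prod volume) ≤ carlesonConst N C M * ENNReal.ofReal (r ^ N) := by
  obtain ⟨a, ha⟩ := hM x (2 * r) (by positivity)
  set B := Metric.closedBall x (2 * r) with hB
  have hBm : MeasurableSet B := measurableSet_closedBall
  have hS : MeasurableSet (Metric.closedBall x r ×ˢ Set.Ioc (0 : ℝ) r) :=
    measurableSet_closedBall.prod measurableSet_Ioc
  set φ : (Fin N → ℝ) → H := B.indicator fun z => b z - a with hφ
  have hφm : StronglyMeasurable φ := (hb.sub stronglyMeasurable_const).indicator hBm
  have hφi : Integrable φ := by
    refine (integrable_indicator_iff hBm).2 (hbi.integrableOn.sub ?_)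
    exact integrableOn_const measure_closedBall_lt_top.ne
  have hφ2 : ∫⁻ z, ‖φ z‖ₑ ^ 2 ≤ M * ENNReal.ofReal ((2 * r) ^ N) := by
    refine le_trans (le_of_eq ?_) ha
    rw [← lintegral_indicator hBm]
    refine lintegral_congr fun z => ?_
    by_cases hz : z ∈ B <;> simp [hφ, hz]
  have hpt : ∀ q ∈ Metric.closedBall x r ×ˢ Set.Ioc (0 : ℝ) r,
      ENNReal.ofReal (q.2⁻¹ * gradSq b q) ≤ 2 * ENNReal.ofReal (q.2⁻¹ * gradSq φ q) +
        ENNReal.ofReal (2 * (N + 1) * farConst N C M ^ 2 * r⁻¹) := by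
    rintro ⟨y, t⟩ ⟨hy, ht⟩
    dsimp only at hy ht ⊢
    have hA : gradSq b (y, t) ≤
        2 * gradSq φ (y, t) + 2 * (N + 1) * (farConst N C M * (t / r)) ^ 2 := by
      have h1 : ∀ i : Fin (N + 1), ‖pconv (tpd i (pker N)) b (y, t)‖ ^ 2 ≤
          2 * ‖pconv (tpd i (pker N)) φ (y, t)‖ ^ 2 + 2 * (farConst N C M * (t / r)) ^ 2 := by
        intro i
        have h2 := norm_integral_far_le hC hb hM hr ha i hy ht.1
        rw [pconv_tpd_eq_add hbi hBm a i y ht.1]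
        set u := pconv (tpd i (pker N)) φ (y, t)
        set v := ∫ z in Bᶜ, tpd i (pker N) (y - z, t) • (b z - a)
        have h3 := norm_add_le u v
        have h4 := norm_nonneg u
        have h5 := norm_nonneg v
        have h6 := norm_nonneg (u + v)
        have h7 : ‖v‖ ^ 2 ≤ (farConst N C M * (t / r)) ^ 2 := by gcongr
        nlinarith [sq_nonneg (‖u‖ - ‖v‖)]
      refine (Finset.sum_le_sum fun i _ => h1 i).trans (le_of_eq ?_)
      rw [Finset.sum_add_distrib, ← Finset.mul_sum, Finset.sum_const, Finset.card_univ,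
        Fintype.card_fin, nsmul_eq_mul]
      push_cast
      rw [gradSq]
      ring
    have h8 : t⁻¹ * gradSq b (y, t) ≤ 2 * (t⁻¹ * gradSq φ (y, t)) +
        2 * (N + 1) * farConst N C M ^ 2 * r⁻¹ := by
      have ht0 := ht.1
      calc t⁻¹ * gradSq b (y, t) ≤
          t⁻¹ * (2 * gradSq φ (y, t) + 2 * (N + 1) * (farConst N C M * (t / r)) ^ 2) := by gcongr
        _ = 2 * (t⁻¹ * gradSq φ (y, t)) + 2 * (N + 1) * farConst N C M ^ 2 * (t / r) * r⁻¹ := by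
          field_simp
        _ ≤ 2 * (t⁻¹ * gradSq φ (y, t)) + 2 * (N + 1) * farConst N C M ^ 2 * 1 * r⁻¹ := by
          have : t / r ≤ 1 := (div_le_one hr).2 ht.2
          gcongr
        _ = _ := by ring
    have ht0 := ht.1
    have hnn := gradSq_nonneg φ (y, t)
    refine (ENNReal.ofReal_le_ofReal h8).trans (le_of_eq ?_)
    rw [ENNReal.ofReal_add (by positivity) (by positivity), ENNReal.ofReal_mul (p := 2)
      (by norm_num), ENNReal.ofReal_ofNat]
  have hm : Measurable fun q : (Fin N → ℝ) × ℝ => 2 * ENNReal.ofReal (q.2⁻¹ * gradSq φ q) :=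
    (ENNReal.measurable_ofReal.comp (measurable_snd.inv.mul (measurable_gradSq hφm))).const_mul 2
  have hm' : Measurable fun q : (Fin N → ℝ) × ℝ => ENNReal.ofReal (q.2⁻¹ * gradSq φ q) :=
    ENNReal.measurable_ofReal.comp (measurable_snd.inv.mul (measurable_gradSq hφm))
  have hvol : (volume.prod volume) (Metric.closedBall x r ×ˢ Set.Ioc (0 : ℝ) r) =
      ENNReal.ofReal (2 ^ N * r ^ N * r) := by
    rw [Measure.prod_prod, volume_closedBall_fin x hr.le, Real.volume_Ioc, sub_zero,
      ← ENNReal.ofReal_mul (by positivity)]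
  calc ∫⁻ q in Metric.closedBall x r ×ˢ Set.Ioc 0 r, ENNReal.ofReal (q.2⁻¹ * gradSq b q)
        ∂(volume.prod volume)
      ≤ ∫⁻ q in Metric.closedBall x r ×ˢ Set.Ioc 0 r, (2 * ENNReal.ofReal (q.2⁻¹ * gradSq φ q) +
        ENNReal.ofReal (2 * (N + 1) * farConst N C M ^ 2 * r⁻¹)) ∂(volume.prod volume) :=
        setLIntegral_mono' hS hpt
    _ = 2 * (∫⁻ q in Metric.closedBall x r ×ˢ Set.Ioc 0 r, ENNReal.ofReal (q.2⁻¹ * gradSq φ q)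
          ∂(volume.prod volume)) + ENNReal.ofReal (2 * (N + 1) * farConst N C M ^ 2 * r⁻¹) *
            ENNReal.ofReal (2 ^ N * r ^ N * r) := by
        rw [lintegral_add_left hm, lintegral_const_mul _ hm', lintegral_const,
          Measure.restrict_apply_univ, hvol]
    _ ≤ 2 * (ENNReal.ofReal (etaNorm N) * (M * ENNReal.ofReal ((2 * r) ^ N))) +
          ENNReal.ofReal (2 * (N + 1) * farConst N C M ^ 2 * r⁻¹) *
            ENNReal.ofReal (2 ^ N * r ^ N * r) := by
        refine add_le_add (mul_le_mul_right ?_ _) le_rfl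
        refine le_trans ?_ ((lintegral_gradSq_le hφm hφi).trans (mul_le_mul_right hφ2 _))
        rw [← Measure.prod_restrict]
        refine lintegral_mono' (Measure.prod_mono Measure.restrict_le_self
          (Measure.restrict_mono (fun t ht => ht.1) le_rfl)) le_rfl
    _ = _ := by
        have h1 : (carlesonConst N C M : ℝ≥0∞) = ENNReal.ofReal (2 ^ N * (2 * etaNorm N * M +
            2 * (N + 1) * farConst N C M ^ 2)) := by
          rw [← ENNReal.ofReal_coe_nnreal, carlesonConst]
          push_cast
          rw [Real.coe_toNNReal _ (etaNorm_nonneg)]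
        have h0 := etaNorm_nonneg (N := N)
        rw [h1, ← ENNReal.ofReal_mul (by positivity), ← ENNReal.ofReal_mul (by positivity),
          ← ENNReal.ofReal_coe_nnreal, ← ENNReal.ofReal_mul (by positivity),
          ← ENNReal.ofReal_mul (by positivity), ← ENNReal.ofReal_ofNat,
          ← ENNReal.ofReal_mul (by positivity), ← ENNReal.ofReal_add (by positivity)
          (by positivity)]
        congr 1
        field_simp
        ring

end Carleson

section Whitney

variable {N : ℕ} {H : Type*} [NormedAddCommGroup H] [InnerProductSpace ℝ H] [CompleteSpace H]

/-- The range of heights of the Whitney boxes above dyadic cubes of sidelength `2^k`. -/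
def whit (N : ℕ) (k : ℤ) : Set ℝ := Set.Ioc ((N + 1) * 2 ^ k) ((N + 1) * 2 ^ (k + 1))

lemma measurableSet_whit (k : ℤ) : MeasurableSet (whit N k) := measurableSet_Ioc

lemma disjoint_whit {j k : ℤ} (h : j ≠ k) : Disjoint (whit N j) (whit N k) := by
  wlog hjk : j < k generalizing j k
  · exact (this h.symm (lt_of_le_of_ne (not_lt.1 hjk) h.symm)).symm
  refine Set.disjoint_left.2 fun t ht ht' => ?_
  have h1 : ((N : ℝ) + 1) * 2 ^ (j + 1) ≤ (N + 1) * 2 ^ k := by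
    gcongr
    · norm_num
    · omega
  exact absurd (ht'.1.trans_le ht.2) (not_lt.2 h1)

/-- The integral over the Whitney box above the standard dyadic cube of sidelength `2^k`
containing `x`. -/
def cellInt (g : (Fin N → ℝ) × ℝ → ℝ≥0∞) (k : ℤ) (x : Fin N → ℝ) : ℝ≥0∞ :=
  ∫⁻ q in dcube 0 k x ×ˢ whit N k, g q ∂(volume.prod volume)

lemma measurableSet_cell (k : ℤ) (x : Fin N → ℝ) : MeasurableSet (dcube 0 k x ×ˢ whit N k) :=
  (measurableSet_dcube 0 k x).prod (measurableSet_whit k)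

lemma measurableSet_mem_cell (k : ℤ) : MeasurableSet
    {p : (Fin N → ℝ) × ((Fin N → ℝ) × ℝ) | p.2 ∈ dcube 0 k p.1 ×ˢ whit N k} := by
  have h1 : MeasurableSet {p : (Fin N → ℝ) × ((Fin N → ℝ) × ℝ) | p.2.1 ∈ dcube 0 k p.1} :=
    measurableSet_mem_dcube k measurable_const measurable_fst (by fun_prop)
  have h2 : MeasurableSet {p : (Fin N → ℝ) × ((Fin N → ℝ) × ℝ) | p.2.2 ∈ whit N k} :=
    (by fun_prop : Measurable fun p : (Fin N → ℝ) × ((Fin N → ℝ) × ℝ) => p.2.2)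
      (measurableSet_whit k)
  exact h1.inter h2

lemma cellInt_eq_indicator (g : (Fin N → ℝ) × ℝ → ℝ≥0∞) (k : ℤ) (x : Fin N → ℝ) :
    cellInt g k x = ∫⁻ q, {p : (Fin N → ℝ) × ((Fin N → ℝ) × ℝ) |
      p.2 ∈ dcube 0 k p.1 ×ˢ whit N k}.indicator (fun p => g p.2) (x, q)
        ∂(volume.prod volume) := by
  rw [cellInt, ← lintegral_indicator (measurableSet_cell k x)]
  rfl

lemma measurable_cellInt {g : (Fin N → ℝ) × ℝ → ℝ≥0∞} (hg : Measurable g) (k : ℤ) :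
    Measurable (cellInt g k) := by
  have h : Measurable ({p : (Fin N → ℝ) × ((Fin N → ℝ) × ℝ) |
      p.2 ∈ dcube 0 k p.1 ×ˢ whit N k}.indicator fun p => g p.2) :=
    (hg.comp measurable_snd).indicator (measurableSet_mem_cell k)
  have h2 := h.lintegral_prod_right' (ν := (volume.prod volume : Measure ((Fin N → ℝ) × ℝ)))
  simpa only [← cellInt_eq_indicator] using h2

lemma cellInt_eq_of_mem {g : (Fin N → ℝ) × ℝ → ℝ≥0∞} {k : ℤ} {x y : Fin N → ℝ}
    (h : y ∈ dcube 0 k x) : cellInt g k y = cellInt g k x := by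
  rw [cellInt, cellInt, dcube_eq_of_mem h]

lemma setLIntegral_cellInt {g : (Fin N → ℝ) × ℝ → ℝ≥0∞} (hg : Measurable g) (k : ℤ)
    {A : Set (Fin N → ℝ)} (hA : MeasurableSet A) (hAk : ∀ x y, y ∈ dcube 0 k x → x ∈ A → y ∈ A) :
    ∫⁻ x in A, cellInt g k x = ENNReal.ofReal (((2 : ℝ) ^ k) ^ N) *
      ∫⁻ q in A ×ˢ whit N k, g q ∂(volume.prod volume) := by
  have hm : Measurable fun p : (Fin N → ℝ) × ((Fin N → ℝ) × ℝ) => A.indicator (fun _ => (1 : ℝ≥0∞))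
      p.1 * {p : (Fin N → ℝ) × ((Fin N → ℝ) × ℝ) |
      p.2 ∈ dcube 0 k p.1 ×ˢ whit N k}.indicator (fun p => g p.2) p := by
    refine Measurable.mul ?_ ((hg.comp measurable_snd).indicator (measurableSet_mem_cell k))
    exact (measurable_const.indicator hA).comp measurable_fst
  have hS : MeasurableSet (A ×ˢ whit N k) := hA.prod (measurableSet_whit k)
  calc ∫⁻ x in A, cellInt g k x
      = ∫⁻ x, ∫⁻ q, A.indicator (fun _ => (1 : ℝ≥0∞)) x *
          {p : (Fin N → ℝ) × ((Fin N → ℝ) × ℝ) |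
          p.2 ∈ dcube 0 k p.1 ×ˢ whit N k}.indicator (fun p => g p.2) (x, q)
          ∂(volume.prod volume) ∂volume := by
        rw [← lintegral_indicator hA]
        refine lintegral_congr fun x => ?_
        by_cases hx : x ∈ A
        · simp only [Set.indicator_of_mem hx, one_mul, cellInt_eq_indicator]
        · simp [Set.indicator_of_notMem hx]
    _ = ∫⁻ q, ∫⁻ x, A.indicator (fun _ => (1 : ℝ≥0∞)) x *
          {p : (Fin N → ℝ) × ((Fin N → ℝ) × ℝ) |
          p.2 ∈ dcube 0 k p.1 ×ˢ whit N k}.indicator (fun p => g p.2) (x, q)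
          ∂volume ∂(volume.prod volume) := lintegral_lintegral_swap hm.aemeasurable
    _ = ∫⁻ q, (A ×ˢ whit N k).indicator g q * ENNReal.ofReal (((2 : ℝ) ^ k) ^ N)
          ∂(volume.prod volume) := by
        refine lintegral_congr fun q => ?_
        rw [← volume_dcube 0 k q.1, ← setLIntegral_const,
          ← lintegral_indicator (measurableSet_dcube 0 k q.1)]
        refine lintegral_congr fun x => ?_
        by_cases hx : x ∈ dcube 0 k q.1
        · have hx' := mem_dcube_symm hx
          by_cases hA' : x ∈ A
          · have := hAk _ _ hx' hA'
            by_cases ht : q.2 ∈ whit N k <;> simp [Set.indicator, hA', hx, hx', this, ht]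
          · have : q.1 ∉ A := fun h => hA' (hAk _ _ hx h)
            simp [Set.indicator, hA', this]
        · have hx' : q.1 ∉ dcube 0 k x := fun h => hx (mem_dcube_symm h)
          simp [Set.indicator, hx, hx']
    _ = _ := by
        rw [lintegral_mul_const _ (hg.indicator hS), lintegral_indicator hS, mul_comm]

lemma sum_setLIntegral_le {α ι : Type*} [MeasurableSpace α] {μ : Measure α} (s : Finset ι)
    {E : ι → Set α} (hE : ∀ i, MeasurableSet (E i))
    (hd : ∀ i ∈ s, ∀ j ∈ s, i ≠ j → Disjoint (E i) (E j)) {g : ι → α → ℝ≥0∞} {h : α → ℝ≥0∞}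
    {T : Set α} (hT : ∀ i ∈ s, E i ⊆ T) (hg : ∀ i ∈ s, ∀ x ∈ E i, g i x ≤ h x) :
    ∑ i ∈ s, ∫⁻ x in E i, g i x ∂μ ≤ ∫⁻ x in T, h x ∂μ := by
  calc ∑ i ∈ s, ∫⁻ x in E i, g i x ∂μ ≤ ∑ i ∈ s, ∫⁻ x in E i, h x ∂μ :=
        Finset.sum_le_sum fun i hi => setLIntegral_mono' (hE i) (hg i hi)
    _ = ∫⁻ x in ⋃ i ∈ s, E i, h x ∂μ :=
        (lintegral_biUnion_finset (fun i hi j hj hij => hd i hi j hj hij) (fun i _ => hE i) _).symm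
    _ ≤ _ := lintegral_mono_set (Set.iUnion₂_subset hT)

/-- The energy density of the extension. -/
def energy (F : (Fin N → ℝ) → H) (q : (Fin N → ℝ) × ℝ) : ℝ≥0∞ := ENNReal.ofReal (q.2⁻¹ * gradSq F q)

lemma measurable_energy {F : (Fin N → ℝ) → H} (hF : StronglyMeasurable F) :
    Measurable (energy F) :=
  ENNReal.measurable_ofReal.comp (measurable_snd.inv.mul (measurable_gradSq hF))

lemma pow_pos_ne_zero (k : ℤ) : ENNReal.ofReal (((2 : ℝ) ^ k) ^ N) ≠ 0 := by
  simp only [ne_eq, ENNReal.ofReal_eq_zero, not_le]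
  positivity

lemma nested_zero : Nested (fun _ : ℤ => (0 : Fin N → ℝ)) :=
  nested_of_sub_eq _ fun _ _ => ⟨0, by simp⟩

lemma slab_eq_restrict (k : ℤ) : slab N ((N + 1) * 2 ^ k) ((N + 1) * 2 ^ (k + 1)) =
    (volume.prod volume).restrict (Set.univ ×ˢ whit N k) := by
  rw [slab, ← Measure.prod_restrict, Measure.restrict_univ]
  rfl

lemma lintegral_slab_energy_le {F b : (Fin N → ℝ) → H} (hF : StronglyMeasurable F)
    (hb : StronglyMeasurable b) (k : ℤ) :
    ∫⁻ q, energy F q ^ (1 / 2 : ℝ) * energy b q ^ (1 / 2 : ℝ)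
      ∂slab N ((N + 1) * 2 ^ k) ((N + 1) * 2 ^ (k + 1)) ≤
    ∫⁻ x, ((ENNReal.ofReal (((2 : ℝ) ^ k) ^ N))⁻¹ * cellInt (energy F) k x) ^ (1 / 2 : ℝ) *
      ((ENNReal.ofReal (((2 : ℝ) ^ k) ^ N))⁻¹ * cellInt (energy b) k x) ^ (1 / 2 : ℝ) := by
  set v := ENNReal.ofReal (((2 : ℝ) ^ k) ^ N) with hv
  have hv0 : v ≠ 0 := pow_pos_ne_zero k
  have hvt : v ≠ ⊤ := ENNReal.ofReal_ne_top
  have hFm := (measurable_energy hF).pow_const (1 / 2 : ℝ)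
  have hbm := (measurable_energy hb).pow_const (1 / 2 : ℝ)
  have hm : Measurable fun q => energy F q ^ (1 / 2 : ℝ) * energy b q ^ (1 / 2 : ℝ) := hFm.mul hbm
  have h1 := setLIntegral_cellInt hm k (A := Set.univ) MeasurableSet.univ (fun _ _ _ _ => trivial)
  rw [Measure.restrict_univ, ← hv] at h1
  rw [slab_eq_restrict]
  refine (ENNReal.mul_le_mul_iff_right hv0 hvt).1 ?_
  rw [← h1]
  have hr : Measurable fun x => ((v⁻¹ * cellInt (energy F) k x) ^ (1 / 2 : ℝ) *
      (v⁻¹ * cellInt (energy b) k x) ^ (1 / 2 : ℝ)) :=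
    (((measurable_cellInt (measurable_energy hF) k).const_mul _).pow_const _).mul
      (((measurable_cellInt (measurable_energy hb) k).const_mul _).pow_const _)
  rw [← lintegral_const_mul _ hr]
  refine lintegral_mono fun x => ?_
  have h2 := lintegral_mul_le_sqrt (μ := (volume.prod volume).restrict (dcube 0 k x ×ˢ whit N k))
    hFm.aemeasurable hbm.aemeasurable
  have h3 : ∀ t : ℝ≥0∞, (t ^ (1 / 2 : ℝ)) ^ 2 = t := fun t => by
    rw [← ENNReal.rpow_natCast, ← ENNReal.rpow_mul]; norm_num
  simp only [h3] at h2
  refine h2.trans (le_of_eq ?_)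
  rw [ENNReal.mul_rpow_of_nonneg _ _ (by norm_num), ENNReal.mul_rpow_of_nonneg _ _ (by norm_num)]
  have h4 : v * (v⁻¹ ^ (1 / 2 : ℝ) * v⁻¹ ^ (1 / 2 : ℝ)) = 1 := by
    rw [← sq, h3, ENNReal.mul_inv_cancel hv0 hvt]
  calc _ = 1 * (cellInt (energy F) k x ^ (1 / 2 : ℝ) * cellInt (energy b) k x ^ (1 / 2 : ℝ)) := by
        rw [one_mul]; rfl
    _ = _ := by rw [← h4]; ring

end Whitney

section WhitneySum

variable {N : ℕ} {H : Type*} [NormedAddCommGroup H] [InnerProductSpace ℝ H] [CompleteSpace H]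

lemma mem_lcone_of_mem_cell {k : ℤ} {x : Fin N → ℝ} {q : (Fin N → ℝ) × ℝ}
    (hq : q ∈ dcube 0 k x ×ˢ whit N k) : q ∈ lcone x := by
  obtain ⟨h1, h2⟩ := hq
  have h3 : ∀ i, (q.1 i - x i) ^ 2 ≤ ((2 : ℝ) ^ k) ^ 2 := fun i =>
    sq_le_sq' (by linarith [neg_le_abs (q.1 i - x i), (abs_sub_lt_of_mem_dcube h1 i)])
      ((le_abs_self _).trans (abs_sub_lt_of_mem_dcube h1 i).le)
  have h4 : ∑ i, (q.1 i - x i) ^ 2 ≤ ((N + 1) * 2 ^ k) ^ 2 := by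
    refine (Finset.sum_le_sum fun i _ => h3 i).trans ?_
    rw [Finset.sum_const, Finset.card_univ, Fintype.card_fin, nsmul_eq_mul, mul_pow]
    refine mul_le_mul_of_nonneg_right ?_ (by positivity)
    have : (0 : ℝ) ≤ N := Nat.cast_nonneg N
    nlinarith
  refine lt_of_le_of_lt ?_ h2.1
  rw [← Real.sqrt_sq (by positivity : (0 : ℝ) ≤ (N + 1) * 2 ^ k)]
  exact Real.sqrt_le_sqrt h4

/-- The loss in passing from cones to Whitney boxes. -/
def whitConst (N : ℕ) : NNReal := (2 * (N + 1)) ^ N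

lemma one_le_whitConst : 1 ≤ whitConst N := by
  refine one_le_pow₀ ?_
  have : (0 : NNReal) ≤ N := bot_le
  calc (1 : NNReal) ≤ 2 * (0 + 1) := by norm_num
    _ ≤ _ := by gcongr

lemma measurable_lusW_right (x : Fin N → ℝ) : Measurable fun q : (Fin N → ℝ) × ℝ => lusW x q :=
  Measurable.of_uncurry_left (f := lusW) measurable_lusW

lemma inv_mul_energy_le_of_mem_cell {F : (Fin N → ℝ) → H} {k : ℤ} {x : Fin N → ℝ}
    {q : (Fin N → ℝ) × ℝ} (hq : q ∈ dcube 0 k x ×ˢ whit N k) :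
    (ENNReal.ofReal (((2 : ℝ) ^ k) ^ N))⁻¹ * energy F q ≤
      whitConst N * ENNReal.ofReal (lusW x q ^ 2 * gradSq F q) := by
  have hc := mem_lcone_of_mem_cell hq
  have ht : 0 < q.2 := pos_of_mem_lcone hc
  have hG := gradSq_nonneg F q
  have hk : (0 : ℝ) < (2 ^ k) ^ N := by positivity
  have h2 : q.2 ^ N ≤ whitConst N * (2 ^ k) ^ N := by
    have h3 := hq.2.2
    rw [zpow_add_one₀ (by norm_num)] at h3
    calc q.2 ^ N ≤ ((2 * (N + 1)) * 2 ^ k) ^ N :=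
          pow_le_pow_left₀ ht.le (h3.trans (le_of_eq (by ring))) N
      _ = _ := by rw [mul_pow, whitConst]; push_cast; rfl
  rw [lusW_sq, Set.indicator_of_mem hc, ← ENNReal.ofReal_coe_nnreal,
    ← ENNReal.ofReal_mul (NNReal.coe_nonneg _), ← ENNReal.ofReal_inv_of_pos hk]
  rw [energy, ← ENNReal.ofReal_mul (inv_nonneg.2 hk.le)]
  refine ENNReal.ofReal_le_ofReal ?_
  rw [← mul_assoc, ← mul_assoc]
  refine mul_le_mul_of_nonneg_right ?_ hG
  rw [pow_succ, ← mul_inv, ← div_eq_mul_inv, inv_eq_one_div, div_le_div_iff₀ (by positivity)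
    (by positivity), one_mul]
  calc q.2 ^ N * q.2 ≤ whitConst N * (2 ^ k) ^ N * q.2 := by gcongr
    _ = _ := by ring

lemma sum_inv_mul_cellInt_le {F : (Fin N → ℝ) → H} (hF : StronglyMeasurable F) (K : ℤ) (n : ℕ)
    (x : Fin N → ℝ) :
    ∑ i ∈ Finset.range n, (ENNReal.ofReal (((2 : ℝ) ^ (K - i)) ^ N))⁻¹ *
      cellInt (energy F) (K - i) x ≤
    whitConst N * ∫⁻ q, ENNReal.ofReal (lusW x q ^ 2 * gradSq F q) ∂(volume.prod volume) := by
  have hm : Measurable fun q => ENNReal.ofReal (lusW x q ^ 2 * gradSq F q) :=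
    (((measurable_lusW_right x).pow_const 2).mul (measurable_gradSq hF)).ennreal_ofReal
  have h1 : ∀ k : ℤ, (ENNReal.ofReal (((2 : ℝ) ^ k) ^ N))⁻¹ * cellInt (energy F) k x =
      ∫⁻ q in dcube 0 k x ×ˢ whit N k, (ENNReal.ofReal (((2 : ℝ) ^ k) ^ N))⁻¹ * energy F q
        ∂(volume.prod volume) := fun k => by
    rw [lintegral_const_mul _ (measurable_energy hF)]; rfl
  simp only [h1]
  rw [← lintegral_const_mul _ hm, ← setLIntegral_univ]
  refine sum_setLIntegral_le _ (fun i => measurableSet_cell _ _) (fun i _ j _ hij => ?_)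
    (fun i _ => Set.subset_univ _) (fun i _ q hq => inv_mul_energy_le_of_mem_cell hq)
  exact Set.disjoint_prod.2 (Or.inr (disjoint_whit (by omega)))

lemma lintegral_sum_cellInt_le {C : NNReal}
    (hC : ∀ (i : Fin (N + 1)) (p : (Fin N → ℝ) × ℝ), 0 < p.2 →
    |tpd i (pker N) p| ≤ C * (p.2 / ‖p‖ ^ (N + 1))) {b : (Fin N → ℝ) → H}
    (hb : StronglyMeasurable b) (hbi : Integrable b) {M : NNReal} (hM : BMOBound b M)
    (K : ℤ) (i n : ℕ) (x : Fin N → ℝ) :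
    ∫⁻ y in dcube 0 (K - i) x, ∑ j ∈ Finset.Ico i n,
      (ENNReal.ofReal (((2 : ℝ) ^ (K - j)) ^ N))⁻¹ * cellInt (energy b) (K - j) y ≤
    (carlesonConst N C M * whitConst N : NNReal) *
      ENNReal.ofReal (((2 : ℝ) ^ (K - i)) ^ N) := by
  have hbm := measurable_energy hb
  have h1 : ∀ j ∈ Finset.Ico i n, ∫⁻ y in dcube 0 (K - i) x,
      (ENNReal.ofReal (((2 : ℝ) ^ (K - j)) ^ N))⁻¹ * cellInt (energy b) (K - j) y =
      ∫⁻ q in dcube 0 (K - i) x ×ˢ whit N (K - j), energy b q ∂(volume.prod volume) := by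
    intro j hj
    rw [lintegral_const_mul _ (measurable_cellInt hbm _), setLIntegral_cellInt hbm _
      (measurableSet_dcube _ _ _), ← mul_assoc, ENNReal.inv_mul_cancel (pow_pos_ne_zero _)
      ENNReal.ofReal_ne_top, one_mul]
    intro y z hz hy
    have h2 : K - (j : ℤ) ≤ K - i := by have := (Finset.mem_Ico.1 hj).1; omega
    have h3 := (nested_zero (N := N)).mem_of_le h2 hz
    rw [← dcube_eq_of_mem hy]
    exact h3
  rw [lintegral_finsetSum _ fun j _ => (measurable_cellInt hbm _).const_mul _,
    Finset.sum_congr rfl h1]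
  set r : ℝ := (N + 1) * 2 ^ (K - (i : ℤ) + 1) with hr
  have hr0 : 0 < r := by positivity
  refine (sum_setLIntegral_le (T := Metric.closedBall x r ×ˢ Set.Ioc 0 r) (h := energy b) _
    (fun j => (measurableSet_dcube _ _ _).prod (measurableSet_whit _)) (fun j _ l _ hjl =>
      Set.disjoint_prod.2 (Or.inr (disjoint_whit (by omega)))) (fun j hj => ?_)
      (fun j _ q _ => le_rfl)).trans ?_
  · have h2 : K - (j : ℤ) ≤ K - i := by have := (Finset.mem_Ico.1 hj).1; omega
    refine Set.prod_mono ((dcube_subset_closedBall _ _ _).trans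
      (Metric.closedBall_subset_closedBall ?_)) fun t ht => ⟨lt_trans (by positivity) ht.1,
        ht.2.trans ?_⟩
    · rw [hr, zpow_add_one₀ (by norm_num)]
      have h3 : (0 : ℝ) < 2 ^ (K - (i : ℤ)) := by positivity
      have : (0 : ℝ) ≤ N := Nat.cast_nonneg N
      nlinarith [mul_nonneg this h3.le]
    · rw [hr]
      gcongr
      norm_num
  · refine (lintegral_carleson_le hC hb hbi hM x hr0).trans (le_of_eq ?_)
    rw [ENNReal.coe_mul, mul_assoc]
    congr 1
    rw [← ENNReal.ofReal_coe_nnreal, ← ENNReal.ofReal_mul (by positivity), hr,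
      zpow_add_one₀ (by norm_num), whitConst]
    congr 1
    push_cast
    rw [← mul_pow]
    ring

lemma PKer.norm_pconv_le {g : (Fin N → ℝ) × ℝ → ℝ} (hg : PKer g) : ∃ C : ℝ, 0 ≤ C ∧
    ∀ (F : (Fin N → ℝ) → H), Integrable F → ∀ y t, 0 < t →
      ‖pconv g F (y, t)‖ ≤ C / t ^ N * ∫ z, ‖F z‖ := by
  obtain ⟨C, hC, h⟩ := hg.exists_bound
  refine ⟨C, hC, fun F hF y t ht => ?_⟩
  rw [← integral_const_mul]
  refine norm_integral_le_of_norm_le (hF.norm.const_mul _) (ae_of_all _ fun z => ?_)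
  rw [norm_smul]
  exact mul_le_mul_of_nonneg_right (h _ t ht) (norm_nonneg _)

lemma cellInt_energy_lt_top {F : (Fin N → ℝ) → H} (hF : Integrable F) (k : ℤ) (x : Fin N → ℝ) :
    cellInt (energy F) k x < ⊤ := by
  choose C hC h using fun i : Fin (N + 1) => (pKer_pker (N := N).tpd i).norm_pconv_le (H := H)
  set s : ℝ := (N + 1) * 2 ^ k with hs
  have hs0 : 0 < s := by positivity
  set J : ℝ := s⁻¹ * ∑ i, (C i / s ^ N * ∫ z, ‖F z‖) ^ 2 with hJ
  have h1 : ∀ q ∈ dcube 0 k x ×ˢ whit N k, energy F q ≤ ENNReal.ofReal J := by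
    rintro ⟨y, t⟩ ⟨_, ht⟩
    have hst : s ≤ t := ht.1.le
    have ht0 : 0 < t := hs0.trans_le hst
    refine ENNReal.ofReal_le_ofReal ?_
    refine mul_le_mul (by dsimp only; gcongr) ?_ (gradSq_nonneg _ _) (by positivity)
    refine Finset.sum_le_sum fun i _ => ?_
    have h2 : ‖pconv (tpd i (pker N)) F (y, t)‖ ≤ C i / s ^ N * ∫ z, ‖F z‖ := by
      refine (h i F hF y t ht0).trans ?_
      refine mul_le_mul_of_nonneg_right ?_ (integral_nonneg fun _ => norm_nonneg _)
      have := hC i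
      gcongr
    exact pow_le_pow_left₀ (norm_nonneg _) h2 2
  refine (setLIntegral_mono' (measurableSet_cell k x) h1).trans_lt ?_
  rw [setLIntegral_const, Measure.prod_prod, volume_dcube, whit, Real.volume_Ioc]
  exact ENNReal.mul_lt_top ENNReal.ofReal_lt_top
    (ENNReal.mul_lt_top ENNReal.ofReal_lt_top ENNReal.ofReal_lt_top)

lemma lintegral_slab_le_sum (g : (Fin N → ℝ) × ℝ → ℝ≥0∞) (K : ℤ) (n : ℕ) :
    ∫⁻ q, g q ∂slab N ((N + 1) * 2 ^ (K + 1 - n)) ((N + 1) * 2 ^ (K + 1)) ≤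
      ∑ i ∈ Finset.range n,
        ∫⁻ q, g q ∂slab N ((N + 1) * 2 ^ (K - i)) ((N + 1) * 2 ^ (K - i + 1)) := by
  induction n with
  | zero => simp [slab]
  | succ n ih =>
    rw [Finset.sum_range_succ]
    refine le_trans ?_ (add_le_add ih le_rfl)
    rw [← lintegral_add_measure]
    refine lintegral_mono' ?_ le_rfl
    have h : (K + 1 - (n + 1 : ℕ) : ℤ) = K - n := by push_cast; ring
    rw [h, show (K - n + 1 : ℤ) = K + 1 - n by ring, slab, slab, slab, ← Measure.prod_add]
    refine Measure.prod_mono le_rfl ?_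
    have h1 : Set.Ioc (((N : ℝ) + 1) * 2 ^ (K - (n : ℤ))) ((N + 1) * 2 ^ (K + 1)) ⊆
        Set.Ioc (((N : ℝ) + 1) * 2 ^ (K + 1 - (n : ℤ))) ((N + 1) * 2 ^ (K + 1)) ∪
        Set.Ioc (((N : ℝ) + 1) * 2 ^ (K - (n : ℤ))) ((N + 1) * 2 ^ (K + 1 - (n : ℤ))) := by
      intro t ht
      rcases le_or_gt t ((N + 1) * 2 ^ (K + 1 - (n : ℤ))) with h2 | h2
      · exact Or.inr ⟨ht.1, h2⟩
      · exact Or.inl ⟨h2, ht.2⟩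
    exact (Measure.restrict_mono h1 le_rfl).trans (Measure.restrict_union_le _ _)

lemma lintegral_slab_energy_le_lusin {C : NNReal}
    (hC : ∀ (i : Fin (N + 1)) (p : (Fin N → ℝ) × ℝ), 0 < p.2 →
    |tpd i (pker N) p| ≤ C * (p.2 / ‖p‖ ^ (N + 1))) {F b : (Fin N → ℝ) → H}
    (hF : StronglyMeasurable F) (hFi : Integrable F)
    (hb : StronglyMeasurable b) (hbi : Integrable b) {M : NNReal} (hM : BMOBound b M)
    (K : ℤ) (n : ℕ) :
    ∫⁻ q, energy F q ^ (1 / 2 : ℝ) * energy b q ^ (1 / 2 : ℝ)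
      ∂slab N ((N + 1) * 2 ^ (K + 1 - n)) ((N + 1) * 2 ^ (K + 1)) ≤
    ((1 + carlesonConst N C M * whitConst N) * whitConst N : NNReal) *
      ∫⁻ x, (∫⁻ q, ENNReal.ofReal (lusW x q ^ 2 * gradSq F q) ∂(volume.prod volume)) ^
        (1 / 2 : ℝ) := by
  have hsq : ∀ t : ℝ≥0∞, (t ^ (1 / 2 : ℝ)) ^ 2 = t := fun t => by
    rw [← ENNReal.rpow_natCast, ← ENNReal.rpow_mul]; norm_num
  set α : ℕ → (Fin N → ℝ) → ℝ≥0∞ := fun i x => ((ENNReal.ofReal (((2 : ℝ) ^ (K - i)) ^ N))⁻¹ *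
    cellInt (energy F) (K - i) x) ^ (1 / 2 : ℝ) with hα
  set β : ℕ → (Fin N → ℝ) → ℝ≥0∞ := fun i x => ((ENNReal.ofReal (((2 : ℝ) ^ (K - i)) ^ N))⁻¹ *
    cellInt (energy b) (K - i) x) ^ (1 / 2 : ℝ) with hβ
  have hαm : ∀ i, Measurable (α i) := fun i =>
    ((measurable_cellInt (measurable_energy hF) _).const_mul _).pow_const _
  have hβm : ∀ i, Measurable (β i) := fun i =>
    ((measurable_cellInt (measurable_energy hb) _).const_mul _).pow_const _
  have hαt : ∀ i x, α i x ≠ ⊤ := fun i x => ENNReal.rpow_ne_top_of_nonneg (by norm_num)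
    (ENNReal.mul_ne_top (ENNReal.inv_ne_top.2 (pow_pos_ne_zero _))
      (cellInt_energy_lt_top hFi _ _).ne)
  have hg := garsia_dcube (fun _ => (0 : Fin N → ℝ)) (fun i : ℕ => K - i) n
    (a := fun i x => (α i x).toNNReal) (fun i => (hαm i).ennreal_toNNReal)
    (fun i j x y hij hy => by
      have h2 : K - (i : ℤ) ≤ K - j := by omega
      simp only [hα, cellInt_eq_of_mem ((nested_zero (N := N)).mem_of_le h2 hy)])
    hβm (M := (carlesonConst N C M * whitConst N : NNReal)) (fun i _ x => by
      simp only [hβ, hsq]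
      exact lintegral_sum_cellInt_le hC hb hbi hM K i n x)
  simp only [ENNReal.coe_toNNReal (hαt _ _)] at hg
  refine ((lintegral_slab_le_sum _ K n).trans ((Finset.sum_le_sum fun (i : ℕ) _ =>
    lintegral_slab_energy_le hF hb (K - (i : ℤ))).trans hg)).trans ?_
  rw [ENNReal.coe_mul (1 + _) (whitConst N), mul_assoc, ENNReal.coe_add, ENNReal.coe_one]
  refine mul_le_mul_right ?_ _
  rw [← lintegral_const_mul']
  swap
  · exact ENNReal.coe_ne_top
  refine lintegral_mono fun x => ?_
  have h1 : (NNReal.sqrt (∑ i ∈ Finset.range n, (α i x).toNNReal ^ 2) : ℝ≥0∞) =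
      (∑ i ∈ Finset.range n, α i x ^ 2) ^ (1 / 2 : ℝ) := by
    rw [NNReal.sqrt_eq_rpow, ENNReal.coe_rpow_of_nonneg _ (by norm_num)]
    congr 1
    push_cast
    exact Finset.sum_congr rfl fun i _ => by rw [ENNReal.coe_toNNReal (hαt _ _)]
  rw [h1]
  simp only [hα, hsq]
  calc _ ≤ ((whitConst N : ℝ≥0∞) * ∫⁻ q, ENNReal.ofReal (lusW x q ^ 2 * gradSq F q)
        ∂(volume.prod volume)) ^ (1 / 2 : ℝ) := by
        gcongr
        exact sum_inv_mul_cellInt_le hF K n x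
    _ ≤ _ := by
        rw [ENNReal.mul_rpow_of_nonneg _ _ (by norm_num)]
        gcongr
        calc (whitConst N : ℝ≥0∞) ^ (1 / 2 : ℝ) ≤ (whitConst N : ℝ≥0∞) ^ (1 : ℝ) :=
              ENNReal.rpow_le_rpow_of_exponent_le (by exact_mod_cast one_le_whitConst)
                (by norm_num)
          _ = _ := ENNReal.rpow_one _

end WhitneySum

section PairingLimit

variable {N : ℕ} {H : Type*} [NormedAddCommGroup H] [InnerProductSpace ℝ H] [CompleteSpace H]

/-- The pairing of `F` with the smooth average at scale `s` of `b`. -/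
def etaPair (F b : (Fin N → ℝ) → H) (s : ℝ) : ℝ :=
  ∫ z : (Fin N → ℝ) × (Fin N → ℝ), inner ℝ (F z.1) (b z.2) * eta (z.2 - z.1) s
    ∂(volume.prod volume)

variable {F b : (Fin N → ℝ) → H}

lemma exists_etaPair_bound (hF : Integrable F) (hb : Integrable b)
    (hFm : StronglyMeasurable F) (hbm : StronglyMeasurable b) :
    ∃ C, ∀ s, 0 < s → Integrable (fun z : (Fin N → ℝ) × (Fin N → ℝ) =>
      inner ℝ (F z.1) (b z.2) * eta (z.2 - z.1) s) (volume.prod volume) ∧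
      |etaPair F b s| ≤ C / s ^ N := by
  obtain ⟨C, hC, h⟩ := exists_bound_eta (N := N)
  have hFb := hF.norm.mul_prod hb.norm
  refine ⟨∫ z : (Fin N → ℝ) × (Fin N → ℝ), (‖F z.1‖ * ‖b z.2‖) * C ∂(volume.prod volume),
    fun s hs => ?_⟩
  have hbd : ∀ z : (Fin N → ℝ) × (Fin N → ℝ), ‖inner ℝ (F z.1) (b z.2) * eta (z.2 - z.1) s‖ ≤
      (‖F z.1‖ * ‖b z.2‖) * C * (s ^ N)⁻¹ := fun z => by
    rw [norm_mul, mul_assoc]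
    exact mul_le_mul (norm_inner_le_norm _ _) (h _ _ hs) (norm_nonneg _) (by positivity)
  have hi := (hFb.mul_const C).mul_const (s ^ N)⁻¹
  have hm : Measurable fun z : (Fin N → ℝ) × (Fin N → ℝ) => eta (z.2 - z.1) s :=
    measurable_eta.comp ((measurable_snd.sub measurable_fst).prodMk measurable_const)
  refine ⟨hi.mono' (((hFm.comp_measurable measurable_fst).inner
    (hbm.comp_measurable measurable_snd)).mul hm.stronglyMeasurable).aestronglyMeasurable
    (ae_of_all _ hbd), ?_⟩
  rw [div_eq_mul_inv, ← integral_mul_const]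
  exact norm_integral_le_of_norm_le hi (ae_of_all _ hbd)

lemma integral_inner_mul_eta {s : ℝ} (hs : 0 < s) (x : Fin N → ℝ) :
    ∫ y, inner ℝ (F x) (b y) * eta (y - x) s =
      ∫ w, inner ℝ (F x) (b (x + s • w)) * eta w 1 := by
  rw [← integral_add_left_eq_self _ x]
  have h := Measure.integral_comp_inv_smul_of_nonneg volume
    (fun w : Fin N → ℝ => inner ℝ (F x) (b (x + s • w)) * eta w 1) hs.le
  rw [Module.finrank_fin_fun, smul_eq_mul] at h
  have h2 : ∀ y, inner ℝ (F x) (b (x + y)) * eta (x + y - x) s = (s ^ N)⁻¹ *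
      (inner ℝ (F x) (b (x + s • s⁻¹ • y)) * eta (s⁻¹ • y) 1) := fun y => by
    rw [add_sub_cancel_left, eta_scale _ hs, smul_inv_smul₀ hs.ne']; ring
  simp only [h2]
  rw [integral_const_mul, h, inv_mul_cancel_left₀ (by positivity)]

lemma tendsto_etaPair (hF : Integrable F) (hb : Integrable b)
    (hFm : StronglyMeasurable F) (hbm : StronglyMeasurable b) (hbc : Continuous b) {B : ℝ}
    (hB : ∀ x, ‖b x‖ ≤ B) {s : ℕ → ℝ} (hs : ∀ n, 0 < s n) (hs0 : Tendsto s atTop (𝓝 0)) :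
    Tendsto (fun n => etaPair F b (s n)) atTop (𝓝 (kappa N * ∫ x, inner ℝ (F x) (b x))) := by
  have he := integrable_eta (N := N) one_pos
  have hdom : Integrable (fun z : (Fin N → ℝ) × (Fin N → ℝ) => ‖F z.1‖ * (B * |eta z.2 1|))
      (volume.prod volume) := hF.norm.mul_prod (he.abs.const_mul B)
  have hbd : ∀ (u : ℝ) (z : (Fin N → ℝ) × (Fin N → ℝ)),
      ‖inner ℝ (F z.1) (b (z.1 + u • z.2)) * eta z.2 1‖ ≤ ‖F z.1‖ * (B * |eta z.2 1|) :=
    fun u z => by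
      rw [norm_mul, ← mul_assoc]
      refine mul_le_mul_of_nonneg_right ((norm_inner_le_norm _ _).trans ?_) (norm_nonneg _)
      exact mul_le_mul_of_nonneg_left (hB _) (norm_nonneg _)
  have hm : ∀ u : ℝ, AEStronglyMeasurable (fun z : (Fin N → ℝ) × (Fin N → ℝ) =>
      inner ℝ (F z.1) (b (z.1 + u • z.2)) * eta z.2 1) (volume.prod volume) := fun u => by
    have h1 : Measurable fun z : (Fin N → ℝ) × (Fin N → ℝ) => z.1 + u • z.2 :=
      measurable_fst.add (measurable_snd.const_smul u)
    have h2 : Measurable fun z : (Fin N → ℝ) × (Fin N → ℝ) => eta z.2 1 :=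
      measurable_eta.comp (measurable_snd.prodMk measurable_const)
    exact (((hFm.comp_measurable measurable_fst).inner (hbm.comp_measurable h1)).mul
      h2.stronglyMeasurable).aestronglyMeasurable
  have heq : ∀ n, etaPair F b (s n) = ∫ z : (Fin N → ℝ) × (Fin N → ℝ),
      inner ℝ (F z.1) (b (z.1 + s n • z.2)) * eta z.2 1 ∂(volume.prod volume) := fun n => by
    obtain ⟨C, hC⟩ := exists_etaPair_bound hF hb hFm hbm
    rw [etaPair, integral_prod _ (hC _ (hs n)).1, integral_prod _ (hdom.mono' (hm _)
      (ae_of_all _ (hbd _)))]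
    exact integral_congr_ae (ae_of_all _ fun x => integral_inner_mul_eta (hs n) x)
  have hlim : kappa N * ∫ x, inner ℝ (F x) (b x) = ∫ z : (Fin N → ℝ) × (Fin N → ℝ),
      inner ℝ (F z.1) (b z.1) * eta z.2 1 ∂(volume.prod volume) := by
    rw [integral_prod_mul (fun x => inner ℝ (F x) (b x)) (fun w => eta w 1),
      integral_eta one_pos, mul_comm]
  rw [hlim]
  simp only [heq]
  refine tendsto_integral_of_dominated_convergence _ (fun n => hm _) hdom
    (fun n => ae_of_all _ (hbd _)) (ae_of_all _ fun z => ?_)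
  have h1 : Tendsto (fun n => z.1 + s n • z.2) atTop (𝓝 (z.1 + (0 : ℝ) • z.2)) :=
    tendsto_const_nhds.add (hs0.smul tendsto_const_nhds)
  rw [zero_smul, add_zero] at h1
  exact (tendsto_const_nhds.inner ((hbc.tendsto _).comp h1)).mul tendsto_const_nhds

lemma tendsto_etaPair_zero (hN : 0 < N) (hF : Integrable F) (hb : Integrable b)
    (hFm : StronglyMeasurable F) (hbm : StronglyMeasurable b) {r : ℕ → ℝ} (hr : ∀ n, 0 < r n)
    (hr0 : Tendsto r atTop atTop) : Tendsto (fun n => etaPair F b (r n)) atTop (𝓝 0) := by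
  obtain ⟨C, hC⟩ := exists_etaPair_bound hF hb hFm hbm
  refine squeeze_zero_norm (fun n => (hC _ (hr n)).2) ?_
  exact ((tendsto_pow_atTop hN.ne').comp hr0).const_div_atTop C

lemma ofReal_etaPair_sub_le (hF : Integrable F) (hb : Integrable b)
    (hFm : StronglyMeasurable F) (hbm : StronglyMeasurable b) {s r : ℝ} (hs : 0 < s)
    (hsr : s ≤ r) :
    ENNReal.ofReal (etaPair F b s - etaPair F b r) ≤
      2 * ∫⁻ q, energy F q ^ (1 / 2 : ℝ) * energy b q ^ (1 / 2 : ℝ) ∂slab N s r := by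
  obtain ⟨C, hC⟩ := exists_etaPair_bound hF hb hFm hbm
  obtain ⟨hi, he⟩ := integral_inner_pconv hF hb hFm hbm hs hsr
  have h1 : etaPair F b s - etaPair F b r = ∫ z : (Fin N → ℝ) × (Fin N → ℝ),
      inner ℝ (F z.1) (b z.2) * (eta (z.2 - z.1) s - eta (z.2 - z.1) r) ∂(volume.prod volume) := by
    rw [etaPair, etaPair, ← integral_sub (hC s hs).1 (hC r (hs.trans_le hsr)).1]
    exact integral_congr_ae (ae_of_all _ fun z => (mul_sub _ _ _).symm)
  have hm : Measurable fun q => energy F q ^ (1 / 2 : ℝ) * energy b q ^ (1 / 2 : ℝ) :=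
    ((measurable_energy hFm).pow_const _).mul ((measurable_energy hbm).pow_const _)
  rw [h1, ← he, ← lintegral_const_mul _ hm]
  refine (ENNReal.ofReal_le_ofReal (le_abs_self _)).trans ?_
  rw [← Real.norm_eq_abs, ofReal_norm]
  refine (enorm_integral_le_lintegral_enorm _).trans (lintegral_mono_ae ?_)
  filter_upwards [ae_slab (N := N) s r] with q hq
  have ht : 0 < q.2 := hs.trans hq.1
  rw [← ofReal_norm, energy, energy, ENNReal.ofReal_rpow_of_nonneg
    (mul_nonneg (inv_nonneg.2 ht.le) (gradSq_nonneg _ _)) (by norm_num),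
    ENNReal.ofReal_rpow_of_nonneg
    (mul_nonneg (inv_nonneg.2 ht.le) (gradSq_nonneg _ _)) (by norm_num),
    ← Real.sqrt_eq_rpow, ← Real.sqrt_eq_rpow, ← ENNReal.ofReal_mul (Real.sqrt_nonneg _),
    ← ENNReal.ofReal_ofNat 2, ← ENNReal.ofReal_mul (by norm_num)]
  refine ENNReal.ofReal_le_ofReal ?_
  calc _ ≤ ∑ i, 2 * q.2⁻¹ * (‖pconv (tpd i (pker N)) F q‖ * ‖pconv (tpd i (pker N)) b q‖) := by
        refine (norm_sum_le _ _).trans (Finset.sum_le_sum fun i _ => ?_)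
        rw [norm_mul, Real.norm_of_nonneg (by positivity)]
        exact mul_le_mul_of_nonneg_left (norm_inner_le_norm _ _) (by positivity)
    _ = 2 * q.2⁻¹ * ∑ i, ‖pconv (tpd i (pker N)) F q‖ * ‖pconv (tpd i (pker N)) b q‖ := by
        rw [Finset.mul_sum]
    _ ≤ 2 * q.2⁻¹ * (Real.sqrt (gradSq F q) * Real.sqrt (gradSq b q)) :=
        mul_le_mul_of_nonneg_left (Real.sum_mul_le_sqrt_mul_sqrt _ _ _) (by positivity)
    _ = _ := by
        rw [Real.sqrt_mul (inv_nonneg.2 ht.le), Real.sqrt_mul (inv_nonneg.2 ht.le)]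
        nth_rewrite 1 [← Real.mul_self_sqrt (inv_nonneg.2 ht.le)]
        ring

lemma ofReal_kappa_mul_integral_le (hN : 0 < N) {C : NNReal}
    (hC : ∀ (i : Fin (N + 1)) (p : (Fin N → ℝ) × ℝ), 0 < p.2 →
    |tpd i (pker N) p| ≤ C * (p.2 / ‖p‖ ^ (N + 1))) (hF : Integrable F) (hb : Integrable b)
    (hFm : StronglyMeasurable F) (hbm : StronglyMeasurable b) (hbc : Continuous b)
    (hB : ∃ B, ∀ x, ‖b x‖ ≤ B) {M : NNReal} (hM : BMOBound b M) :
    ENNReal.ofReal (kappa N * ∫ x, inner ℝ (F x) (b x)) ≤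
      2 * (((1 + carlesonConst N C M * whitConst N) * whitConst N : NNReal) *
      ∫⁻ x, (∫⁻ q, ENNReal.ofReal (lusW x q ^ 2 * gradSq F q) ∂(volume.prod volume)) ^
        (1 / 2 : ℝ)) := by
  obtain ⟨B, hB⟩ := hB
  set s : ℕ → ℝ := fun n => (N + 1) * 2 ^ ((n : ℤ) + 1 - ((2 * n : ℕ) : ℤ)) with hs
  set r : ℕ → ℝ := fun n => (N + 1) * 2 ^ ((n : ℤ) + 1) with hr
  have hs0 : ∀ n, 0 < s n := fun n => by positivity
  have hr0 : ∀ n, 0 < r n := fun n => by positivity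
  have h1 : Tendsto s atTop (𝓝 0) := by
    have h : ∀ n, s n = (N + 1) * 2 * (1 / 2) ^ n := fun n => by
      have : (n : ℤ) + 1 - ((2 * n : ℕ) : ℤ) = 1 + -(n : ℤ) := by push_cast; ring
      simp only [hs]
      rw [this, zpow_add₀ (by norm_num), zpow_one, zpow_neg, zpow_natCast]
      simp [mul_assoc]
    simp only [funext h]
    simpa using (tendsto_pow_atTop_nhds_zero_of_lt_one (by norm_num : (0 : ℝ) ≤ 1 / 2)
      (by norm_num)).const_mul ((N + 1 : ℝ) * 2)
  have h2 : Tendsto r atTop atTop := by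
    have h : ∀ n, r n = (N + 1) * 2 * 2 ^ n := fun n => by
      simp only [hr]
      rw [zpow_add₀ (by norm_num), zpow_one, zpow_natCast]; ring
    simp only [funext h]
    exact (tendsto_pow_atTop_atTop_of_one_lt (by norm_num : (1 : ℝ) < 2)).const_mul_atTop
      (by positivity)
  have h3 := (tendsto_etaPair hF hb hFm hbm hbc hB hs0 h1).sub
    (tendsto_etaPair_zero hN hF hb hFm hbm hr0 h2)
  rw [sub_zero] at h3
  refine le_of_tendsto (ENNReal.tendsto_ofReal h3) (Eventually.of_forall fun n => ?_)
  refine (ofReal_etaPair_sub_le hF hb hFm hbm (hs0 n) ?_).trans ?_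
  · refine mul_le_mul_of_nonneg_left (zpow_le_zpow_right₀ (by norm_num) (by omega)) (by positivity)
  · gcongr
    exact lintegral_slab_energy_le_lusin hC hFm hF hbm hb hM n (2 * n)

/-- The constant in the bound of the random dyadic square function by the Lusin one. -/
def dyadicConst (N : ℕ) (C C' : NNReal) : NNReal :=
  (kappa N).toNNReal⁻¹ * (2 * ((1 + carlesonConst N C (2 * (1 * 8 ^ N + C' ^ 2 * 2 ^ N)) *
    whitConst N) * whitConst N))

lemma dyadic_le_lusin (hN : 0 < N) {C C' : NNReal}
    (hC : ∀ (i : Fin (N + 1)) (p : (Fin N → ℝ) × ℝ), 0 < p.2 →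
    |tpd i (pker N) p| ≤ C * (p.2 / ‖p‖ ^ (N + 1)))
    (hC' : HorBound (diffKer (N := N)) (dparMeasure N) C')
    (hF : Integrable F) (hFm : StronglyMeasurable F) :
    ∫⁻ x, (∫⁻ θ, ‖kerApply diffKer F x θ‖ₑ ^ 2 ∂dparMeasure N) ^ (1 / 2 : ℝ) ≤
      (dyadicConst N C C' : ℝ≥0∞) *
      ∫⁻ x, (∫⁻ θ, ‖kerApply lusKer F x θ‖ₑ ^ 2 ∂lparMeasure N) ^ (1 / 2 : ℝ) := by
  choose B hB hT using fun m : ℕ => exists_truncBound_diffKer (N := N) m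
  simp only [lintegral_kerApply_lusKer hFm]
  refine lintegral_kerApply_le_of_bmo hB hT monotone_dparTrunc iUnion_dparTrunc measurable_diffKer
    l2Bound_diffKer hC' hF hFm fun b hb hbc hbB hbi hM => ?_
  have h := ofReal_kappa_mul_integral_le hN hC hF hbi hFm hb hbc hbB hM
  have hk : 0 < (kappa N).toNNReal := Real.toNNReal_pos.2 kappa_pos
  rw [ENNReal.ofReal_mul kappa_pos.le] at h
  have h2 : (((kappa N).toNNReal⁻¹ : NNReal) : ℝ≥0∞) * ENNReal.ofReal (kappa N) = 1 := by
    rw [ENNReal.ofReal, ← ENNReal.coe_mul, inv_mul_cancel₀ hk.ne', ENNReal.coe_one]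
  calc ENNReal.ofReal (∫ x, inner ℝ (F x) (b x)) = (((kappa N).toNNReal⁻¹ : NNReal) : ℝ≥0∞) *
      (ENNReal.ofReal (kappa N) * ENNReal.ofReal (∫ x, inner ℝ (F x) (b x))) := by
        rw [← mul_assoc, h2, one_mul]
    _ ≤ _ := mul_le_mul_right h _
    _ = _ := by
        rw [dyadicConst, ENNReal.coe_mul _ (2 * _), ENNReal.coe_mul 2, mul_assoc, mul_assoc]
        rfl

end PairingLimit

section LpBridge

/-- A map into a separable metric space is measurable if the distances to points are. -/
lemma measurable_of_measurable_edist {α E : Type*} [MeasurableSpace α] [PseudoEMetricSpace E]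
    [SecondCountableTopology E] [MeasurableSpace E] [BorelSpace E] {f : α → E}
    (h : ∀ c, Measurable fun a => edist (f a) c) : Measurable f := by
  have hb : TopologicalSpace.IsTopologicalBasis
      {s : Set E | ∃ (c : E) (r : ℝ≥0∞), s = Metric.eball c r} := by
    refine TopologicalSpace.isTopologicalBasis_of_isOpen_of_nhds ?_ fun a u hau hu => ?_
    · rintro _ ⟨c, r, rfl⟩
      exact Metric.isOpen_eball
    · obtain ⟨r, hr, hru⟩ := EMetric.isOpen_iff.1 hu a hau
      exact ⟨_, ⟨a, r, rfl⟩, Metric.mem_eball_self hr, hru⟩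
  rw [BorelSpace.measurable_eq (α := E), hb.borel_eq_generateFrom]
  refine measurable_generateFrom ?_
  rintro _ ⟨c, r, rfl⟩
  exact h c measurableSet_Iio

variable {V Λ : Type} [MeasurableSpace V] [MeasurableSpace Λ] {τ : Measure V} [SFinite τ]
  {ρ : Measure Λ} [IsFiniteMeasure ρ]

lemma enorm_toLp_sq {f : Λ → ℝ} (hf : MemLp f 2 ρ) :
    ‖hf.toLp f‖ₑ ^ 2 = ∫⁻ l, ‖f l‖ₑ ^ 2 ∂ρ := by
  rw [Lp.enorm_toLp, eLpNorm_eq_lintegral_rpow_enorm_toReal (by norm_num) (by norm_num),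
    ← ENNReal.rpow_natCast, ← ENNReal.rpow_mul]
  simp

variable {F : V × Λ → ℝ} {g : V → ℝ}

lemma memLp_slice (hF : Measurable F) (hFg : ∀ p, |F p| ≤ g p.1) (z : V) :
    MemLp (fun l => F (z, l)) 2 ρ :=
  MemLp.of_bound (hF.comp measurable_prodMk_left).aestronglyMeasurable (g z)
    (ae_of_all _ fun l => hFg (z, l))

/-- The `L²(ρ)`-valued map `z ↦ F (z, ·)`. -/
def sliceLp (ρ : Measure Λ) [IsFiniteMeasure ρ] (hF : Measurable F)
    (hFg : ∀ p, |F p| ≤ g p.1) (z : V) : Lp ℝ 2 ρ :=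
  (memLp_slice (ρ := ρ) hF hFg z).toLp fun l => F (z, l)

lemma stronglyMeasurable_sliceLp [StandardBorelSpace Λ] (hF : Measurable F)
    (hFg : ∀ p, |F p| ≤ g p.1) : StronglyMeasurable (sliceLp ρ hF hFg) := by
  borelize ↥(Lp ℝ 2 ρ)
  have : Fact ((2 : ℝ≥0∞) ≠ ⊤) := ⟨by norm_num⟩
  have : Fact ((1 : ℝ≥0∞) ≤ 2) := ⟨by norm_num⟩
  have : SecondCountableTopology (Lp ℝ 2 ρ) := inferInstance
  refine Measurable.stronglyMeasurable (measurable_of_measurable_edist fun c => ?_)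
  have h1 : ∀ z, edist (sliceLp ρ hF hFg z) c =
      (∫⁻ l, ‖F (z, l) - c l‖ₑ ^ (2 : ℝ≥0∞).toReal ∂ρ) ^ (1 / (2 : ℝ≥0∞).toReal) := fun z => by
    rw [← eLpNorm_eq_lintegral_rpow_enorm_toReal (by norm_num) (by norm_num)]
    nth_rewrite 1 [← Lp.toLp_coeFn c (Lp.memLp c)]
    exact Lp.edist_toLp_toLp _ _ _ _
  simp only [h1]
  have h2 : Measurable fun p : V × Λ => ‖F p - c p.2‖ₑ ^ (2 : ℝ≥0∞).toReal :=
    ((hF.sub ((Lp.stronglyMeasurable c).measurable.comp measurable_snd)).enorm).pow_const _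
  exact (Measurable.lintegral_prod_right' h2).pow_const _

lemma integrable_sliceLp [StandardBorelSpace Λ] (hF : Measurable F) (hFg : ∀ p, |F p| ≤ g p.1)
    (hg : Integrable g τ) (hg0 : ∀ z, 0 ≤ g z) : Integrable (sliceLp ρ hF hFg) τ := by
  have : Fact ((1 : ℝ≥0∞) ≤ 2) := ⟨by norm_num⟩
  refine (hg.const_mul (((measureUnivNNReal ρ : ℝ) ^ (2 : ℝ≥0∞).toReal⁻¹))).mono'
    (stronglyMeasurable_sliceLp hF hFg).aestronglyMeasurable (ae_of_all _ fun z => ?_)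
  refine Lp.norm_le_of_ae_bound (hg0 z) ?_
  filter_upwards [(memLp_slice (ρ := ρ) hF hFg z).coeFn_toLp] with l hl
  rw [sliceLp, hl]
  exact hFg (z, l)

lemma enorm_integral_smul_sliceLp [StandardBorelSpace Λ] (hF : Measurable F)
    (hFg : ∀ p, |F p| ≤ g p.1) (hg : Integrable g τ) (hg0 : ∀ z, 0 ≤ g z) {k : V → ℝ}
    (hk : Measurable k) {B : ℝ} (hB : ∀ z, |k z| ≤ B) :
    ‖∫ z, k z • sliceLp ρ hF hFg z ∂τ‖ₑ ^ 2 = ∫⁻ l, ‖∫ z, k z * F (z, l) ∂τ‖ₑ ^ 2 ∂ρ := by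
  have : Fact ((1 : ℝ≥0∞) ≤ 2) := ⟨by norm_num⟩
  have hkF : Measurable fun p : V × Λ => k p.1 * F p := (hk.comp measurable_fst).mul hF
  have hbd : ∀ p : V × Λ, |k p.1 * F p| ≤ B * g p.1 := fun p => by
    rw [abs_mul]
    exact mul_le_mul (hB _) (hFg _) (abs_nonneg _) ((abs_nonneg _).trans (hB p.1))
  have hψm : StronglyMeasurable fun l => ∫ z, k z * F (z, l) ∂τ :=
    StronglyMeasurable.integral_prod_left' (f := fun p : V × Λ => k p.1 * F p)
      hkF.stronglyMeasurable
  have hψ : MemLp (fun l => ∫ z, k z * F (z, l) ∂τ) 2 ρ :=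
    MemLp.of_bound hψm.aestronglyMeasurable (∫ z, B * g z ∂τ) (ae_of_all _ fun l =>
      norm_integral_le_of_norm_le (hg.const_mul B) (ae_of_all _ fun z => hbd (z, l)))
  rw [← enorm_toLp_sq hψ]
  congr 2
  have hki : Integrable (fun z => k z • sliceLp ρ hF hFg z) τ :=
    (integrable_sliceLp hF hFg hg hg0).bdd_smul B hk.aestronglyMeasurable (ae_of_all _ hB)
  refine ext_inner_left ℝ fun c => ?_
  rw [← integral_inner hki, L2.inner_def]
  have h1 : ∀ z, inner ℝ c (k z • sliceLp ρ hF hFg z) =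
      ∫ l, c l * (k z * F (z, l)) ∂ρ := fun z => by
    rw [inner_smul_right, L2.inner_def, ← integral_const_mul]
    refine integral_congr_ae ?_
    filter_upwards [(memLp_slice (ρ := ρ) hF hFg z).coeFn_toLp] with l hl
    rw [sliceLp, hl]
    change k z * (F (z, l) * c l) = _
    ring
  have h2 : ∫ l, inner ℝ (c l) (hψ.toLp _ l) ∂ρ = ∫ l, ∫ z, c l * (k z * F (z, l)) ∂τ ∂ρ := by
    refine integral_congr_ae ?_
    filter_upwards [hψ.coeFn_toLp] with l hl
    rw [hl, integral_const_mul]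
    change (∫ z, k z * F (z, l) ∂τ) * c l = _
    ring
  rw [h2]
  simp only [h1]
  refine integral_integral_swap (f := fun z l => c l * (k z * F (z, l))) ?_
  have hc : Integrable c ρ := (Lp.memLp c).integrable (by norm_num)
  have hd := (hg.const_mul B).mul_prod hc.norm
  refine hd.mono' ((((Lp.stronglyMeasurable c).measurable.comp measurable_snd).mul
    hkF).aestronglyMeasurable) (ae_of_all _ fun p => ?_)
  change ‖c p.2 * (k p.1 * F p)‖ ≤ _
  rw [norm_mul, mul_comm]
  exact mul_le_mul_of_nonneg_right (hbd p) (norm_nonneg _)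

end LpBridge

/-- A measurable family of kernels on `ℝ^N`, indexed by a `σ`-finite measure space that is
exhausted by sets of finite measure on which the kernels are uniformly bounded. -/
structure KerSys (N : ℕ) where
  Θ : Type
  [instMeasurableSpace : MeasurableSpace Θ]
  [instStandardBorelSpace : StandardBorelSpace Θ]
  ν : Measure Θ
  [instSigmaFinite : SigmaFinite ν]
  K : (Fin N → ℝ) → Θ → (Fin N → ℝ) → ℝ
  A : ℕ → Set Θ
  B : ℕ → ℝ
  measurable_K : Measurable fun p : ((Fin N → ℝ) × Θ) × (Fin N → ℝ) => K p.1.1 p.1.2 p.2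
  measurableSet_A : ∀ m, MeasurableSet (A m)
  measure_A_lt_top : ∀ m, ν (A m) < ⊤
  monotone_A : Monotone A
  iUnion_A : ⋃ m, A m = Set.univ
  abs_K_le : ∀ m x, ∀ θ ∈ A m, ∀ z, |K x θ z| ≤ B m

attribute [instance] KerSys.instMeasurableSpace
attribute [instance] KerSys.instStandardBorelSpace
attribute [instance] KerSys.instSigmaFinite

/-- The Lusin kernels as a kernel system. -/
def lusSys (N : ℕ) : KerSys N where
  Θ := LPar N
  instStandardBorelSpace := by unfold LPar; infer_instance
  ν := lparMeasure N
  instSigmaFinite := by unfold lparMeasure; infer_instance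
  K := lusKer
  A := lparTrunc N
  B m := (exists_truncBound_lusKer (N := N) m).choose
  measurable_K := measurable_lusKer
  measurableSet_A m := (exists_truncBound_lusKer m).choose_spec.2.measurableSet
  measure_A_lt_top m := (exists_truncBound_lusKer m).choose_spec.2.measure_lt_top
  monotone_A := monotone_lparTrunc
  iUnion_A := iUnion_lparTrunc
  abs_K_le m := (exists_truncBound_lusKer m).choose_spec.2.bound

/-- The random martingale difference kernels as a kernel system. -/
def diffSys (N : ℕ) : KerSys N where
  Θ := DPar N
  instStandardBorelSpace := by unfold DPar; infer_instance
  ν := dparMeasure N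
  instSigmaFinite := by unfold dparMeasure; infer_instance
  K := diffKer
  A := dparTrunc N
  B m := (exists_truncBound_diffKer (N := N) m).choose
  measurable_K := measurable_diffKer
  measurableSet_A m := (exists_truncBound_diffKer m).choose_spec.2.measurableSet
  measure_A_lt_top m := (exists_truncBound_diffKer m).choose_spec.2.measure_lt_top
  monotone_A := monotone_dparTrunc
  iUnion_A := iUnion_dparTrunc
  abs_K_le m := (exists_truncBound_diffKer m).choose_spec.2.bound

/-- The square function of `S` is dominated in `L¹`, for Hilbert space valued functions, by the
square function of `S'`. -/
def Dom {N : ℕ} (S S' : KerSys N) (C : ℝ≥0∞) : Prop :=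
  ∀ (H : Type) [NormedAddCommGroup H] [InnerProductSpace ℝ H] [CompleteSpace H]
    (F : (Fin N → ℝ) → H), Integrable F → StronglyMeasurable F →
      ∫⁻ x, (∫⁻ θ, ‖kerApply S.K F x θ‖ₑ ^ 2 ∂S.ν) ^ (1 / 2 : ℝ) ≤
        C * ∫⁻ x, (∫⁻ θ, ‖kerApply S'.K F x θ‖ₑ ^ 2 ∂S'.ν) ^ (1 / 2 : ℝ)

lemma exists_dom_lusSys_diffSys {N : ℕ} (hN : 0 < N) :
    ∃ C : NNReal, Dom (lusSys N) (diffSys N) C := by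
  obtain ⟨C, hC⟩ := exists_horBound_lusKer (N := N)
  exact ⟨_, fun H _ _ _ F hF hFm => lusin_le_dyadic hN hC hF hFm⟩

lemma exists_dom_diffSys_lusSys {N : ℕ} (hN : 0 < N) :
    ∃ C : NNReal, Dom (diffSys N) (lusSys N) C := by
  obtain ⟨C, hC⟩ := exists_tpd_le N
  obtain ⟨C', hC'⟩ := exists_horBound_diffKer (N := N)
  exact ⟨_, fun H _ _ _ F hF hFm => dyadic_le_lusin hN hC hC' hF hFm⟩

variable {N : ℕ} {S S' : KerSys N} {C : ℝ≥0∞}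

lemma KerSys.measurable_K_right (S : KerSys N) (x : Fin N → ℝ) (θ : S.Θ) :
    Measurable (S.K x θ) := by
  have h : Measurable fun z : Fin N → ℝ => (((x, θ), z) : ((Fin N → ℝ) × S.Θ) × (Fin N → ℝ)) :=
    by fun_prop
  exact S.measurable_K.comp h

lemma KerSys.exists_bound (S : KerSys N) (θ : S.Θ) : ∃ B : ℝ, ∀ x z, |S.K x θ z| ≤ B := by
  obtain ⟨m, hm⟩ := Set.mem_iUnion.1 (S.iUnion_A ▸ Set.mem_univ θ : θ ∈ ⋃ m, S.A m)
  exact ⟨S.B m, fun x z => S.abs_K_le m x θ hm z⟩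

lemma Dom.family (h : Dom S S' C) {Λ : Type} [MeasurableSpace Λ] [StandardBorelSpace Λ]
    {ρ : Measure Λ} [IsFiniteMeasure ρ] {F : (Fin N → ℝ) × Λ → ℝ} (hF : Measurable F)
    {g : (Fin N → ℝ) → ℝ} (hgm : Measurable g) (hg : Integrable g) (hg0 : ∀ z, 0 ≤ g z)
    (hFg : ∀ᵐ z, ∀ᵐ l ∂ρ, |F (z, l)| ≤ g z) :
    ∫⁻ x, (∫⁻ θ, ∫⁻ l, ‖∫ z, S.K x θ z * F (z, l)‖ₑ ^ 2 ∂ρ ∂S.ν) ^ (1 / 2 : ℝ) ≤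
      C * ∫⁻ x, (∫⁻ θ, ∫⁻ l, ‖∫ z, S'.K x θ z * F (z, l)‖ₑ ^ 2 ∂ρ ∂S'.ν) ^ (1 / 2 : ℝ) := by
  set T : Set ((Fin N → ℝ) × Λ) := {p | |F p| ≤ g p.1} with hT
  have hTm : MeasurableSet T := measurableSet_le hF.abs (hgm.comp measurable_fst)
  have hF' : Measurable (T.indicator F) := hF.indicator hTm
  have hFg' : ∀ p, |T.indicator F p| ≤ g p.1 := fun p => by
    by_cases hp : p ∈ T
    · rw [Set.indicator_of_mem hp]; exact hp
    · rw [Set.indicator_of_notMem hp, abs_zero]; exact hg0 _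
  have hcomm : ∀ᵐ l ∂ρ, ∀ᵐ z, (z, l) ∈ T := (Measure.ae_ae_comm hTm).1 hFg
  have key : ∀ (S : KerSys N) x θ,
      ∫⁻ l, ‖∫ z, S.K x θ z * F (z, l)‖ₑ ^ 2 ∂ρ =
        ‖kerApply S.K (sliceLp ρ hF' hFg') x θ‖ₑ ^ 2 := fun S x θ => by
    obtain ⟨B, hB⟩ := S.exists_bound θ
    unfold kerApply
    rw [enorm_integral_smul_sliceLp hF' hFg' hg hg0 (S.measurable_K_right x θ) (hB x)]
    refine lintegral_congr_ae (hcomm.mono fun l hl => ?_)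
    have : ∫ z, S.K x θ z * F (z, l) = ∫ z, S.K x θ z * T.indicator F (z, l) :=
      integral_congr_ae (hl.mono fun z hz => by simp only [Set.indicator_of_mem hz])
    simp only [this]
  simp_rw [key]
  exact h _ _ (integrable_sliceLp hF' hFg' hg hg0) (stronglyMeasurable_sliceLp hF' hFg')

section Product

variable {V' Θ' : Type} [MeasurableSpace V'] [MeasurableSpace Θ'] {τ' : Measure V'} [SFinite τ']
  {lam : Measure Θ'} [SFinite lam] {k : Θ' → V' → ℝ} {A' : ℕ → Set Θ'} {B' : ℕ → ℝ}
  {f : (Fin N → ℝ) × V' → ℝ}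

lemma KerSys.measurable_enorm_integral_prod (S : KerSys N)
    (hk : Measurable fun p : Θ' × V' => k p.1 p.2) (hf : Measurable f) :
    Measurable fun p : (Fin N → ℝ) × (S.Θ × Θ') =>
      ‖∫ z, f z * (S.K p.1 p.2.1 z.1 * k p.2.2 z.2) ∂(volume.prod τ')‖ₑ ^ 2 := by
  have h1 : Measurable fun q : ((Fin N → ℝ) × (S.Θ × Θ')) × ((Fin N → ℝ) × V') =>
      S.K q.1.1 q.1.2.1 q.2.1 := by
    have h : Measurable fun q : ((Fin N → ℝ) × (S.Θ × Θ')) × ((Fin N → ℝ) × V') =>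
      (((q.1.1, q.1.2.1), q.2.1) : ((Fin N → ℝ) × S.Θ) × (Fin N → ℝ)) := by fun_prop
    exact S.measurable_K.comp h
  have h2 : Measurable fun q : ((Fin N → ℝ) × (S.Θ × Θ')) × ((Fin N → ℝ) × V') =>
      k q.1.2.2 q.2.2 := by
    have h : Measurable fun q : ((Fin N → ℝ) × (S.Θ × Θ')) × ((Fin N → ℝ) × V') =>
      ((q.1.2.2, q.2.2) : Θ' × V') := by fun_prop
    exact hk.comp h
  have h3 : Measurable fun q : ((Fin N → ℝ) × (S.Θ × Θ')) × ((Fin N → ℝ) × V') =>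
      f q.2 * (S.K q.1.1 q.1.2.1 q.2.1 * k q.1.2.2 q.2.2) :=
    (hf.comp measurable_snd).mul (h1.mul h2)
  have h4 := StronglyMeasurable.integral_prod_right (ν := volume.prod τ')
    (f := fun (p : (Fin N → ℝ) × (S.Θ × Θ')) (z : (Fin N → ℝ) × V') =>
      f z * (S.K p.1 p.2.1 z.1 * k p.2.2 z.2)) h3.stronglyMeasurable
  exact h4.measurable.enorm.pow_const 2

lemma KerSys.measurable_enorm_integral_prod_right (S : KerSys N)
    (hk : Measurable fun p : Θ' × V' => k p.1 p.2) (hf : Measurable f) (x : Fin N → ℝ) :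
    Measurable fun q : S.Θ × Θ' =>
      ‖∫ z, f z * (S.K x q.1 z.1 * k q.2 z.2) ∂(volume.prod τ')‖ₑ ^ 2 := by
  have h1 := S.measurable_enorm_integral_prod (τ' := τ') hk hf
  exact Measurable.of_uncurry_left (f := fun (x : Fin N → ℝ) (q : S.Θ × Θ') =>
    ‖∫ z, f z * (S.K x q.1 z.1 * k q.2 z.2) ∂(volume.prod τ')‖ₑ ^ 2) h1

lemma KerSys.integral_prod_mul (S : KerSys N) (hk : Measurable fun p : Θ' × V' => k p.1 p.2)
    (hfi : Integrable f (volume.prod τ')) (x : Fin N → ℝ) (θ : S.Θ) {l : Θ'} {b : ℝ}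
    (hb : ∀ z, |k l z| ≤ b) :
    ∫ p, f p * (S.K x θ p.1 * k l p.2) ∂(volume.prod τ') =
      ∫ z, S.K x θ z * ∫ z', f (z, z') * k l z' ∂τ' := by
  obtain ⟨B, hB⟩ := S.exists_bound θ
  have hkl : Measurable (k l) := by
    have h : Measurable fun z : V' => ((l, z) : Θ' × V') := by fun_prop
    exact hk.comp h
  have hm : Measurable fun p : (Fin N → ℝ) × V' => S.K x θ p.1 * k l p.2 :=
    ((S.measurable_K_right x θ).comp measurable_fst).mul (hkl.comp measurable_snd)
  have hi : Integrable (fun p => f p * (S.K x θ p.1 * k l p.2)) (volume.prod τ') := by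
    refine hfi.mul_bdd (c := B * b) hm.aestronglyMeasurable (ae_of_all _ fun p => ?_)
    rw [Real.norm_eq_abs, abs_mul]
    exact mul_le_mul (hB x p.1) (hb p.2) (abs_nonneg _) ((abs_nonneg _).trans (hB x p.1))
  rw [integral_prod _ hi]
  refine integral_congr_ae (ae_of_all _ fun z => ?_)
  dsimp only
  rw [← integral_const_mul]
  congr 1 with z'
  ring

lemma Dom.prod [StandardBorelSpace Θ'] (h : Dom S S' C)
    (hk : Measurable fun p : Θ' × V' => k p.1 p.2)
    (hA : ∀ m, MeasurableSet (A' m)) (hAf : ∀ m, lam (A' m) < ⊤) (hAm : Monotone A')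
    (hAu : ⋃ m, A' m = Set.univ) (hB : ∀ m, ∀ l ∈ A' m, ∀ z, |k l z| ≤ B' m)
    (hf : Measurable f) (hfi : Integrable f (volume.prod τ')) :
    ∫⁻ x, (∫⁻ q, ‖∫ p, f p * (S.K x q.1 p.1 * k q.2 p.2) ∂(volume.prod τ')‖ₑ ^ 2
        ∂(S.ν.prod lam)) ^ (1 / 2 : ℝ) ≤
      C * ∫⁻ x, (∫⁻ q, ‖∫ p, f p * (S'.K x q.1 p.1 * k q.2 p.2) ∂(volume.prod τ')‖ₑ ^ 2
        ∂(S'.ν.prod lam)) ^ (1 / 2 : ℝ) := by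
  refine lintegral_sqrt_le_of_exhaustion (S := fun _ => Set.univ)
    (A := fun m => Set.univ ×ˢ A' m) (S.measurable_enorm_integral_prod hk hf)
    (fun _ => MeasurableSet.univ) monotone_const (Set.iUnion_const _)
    (fun m => MeasurableSet.univ.prod (hA m)) (fun a b hab => Set.prod_mono le_rfl (hAm hab))
    (by rw [← Set.prod_iUnion, hAu, Set.univ_prod_univ]) fun m => ?_
  rw [Measure.restrict_univ]
  set G : (Fin N → ℝ) × Θ' → ℝ := fun p => ∫ z', f (p.1, z') * k p.2 z' ∂τ' with hG
  have hGm : Measurable G := by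
    have h1 : Measurable fun q : ((Fin N → ℝ) × Θ') × V' => f (q.1.1, q.2) := by
      have h : Measurable fun q : ((Fin N → ℝ) × Θ') × V' => (q.1.1, q.2) := by fun_prop
      exact hf.comp h
    have h2 : Measurable fun q : ((Fin N → ℝ) × Θ') × V' => k q.1.2 q.2 := by
      have h : Measurable fun q : ((Fin N → ℝ) × Θ') × V' => (q.1.2, q.2) := by fun_prop
      exact hk.comp h
    have h3 : Measurable fun q : ((Fin N → ℝ) × Θ') × V' => f (q.1.1, q.2) * k q.1.2 q.2 :=
      h1.mul h2
    exact (StronglyMeasurable.integral_prod_right (ν := τ')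
      (f := fun (p : (Fin N → ℝ) × Θ') z' => f (p.1, z') * k p.2 z')
      h3.stronglyMeasurable).measurable
  have key : ∀ (S : KerSys N) x,
      ∫⁻ q in Set.univ ×ˢ A' m, ‖∫ p, f p * (S.K x q.1 p.1 * k q.2 p.2) ∂(volume.prod τ')‖ₑ ^ 2
        ∂(S.ν.prod lam) =
      ∫⁻ θ, ∫⁻ l, ‖∫ z, S.K x θ z * G (z, l)‖ₑ ^ 2 ∂(lam.restrict (A' m)) ∂S.ν := fun S x => by
    have hm := S.measurable_enorm_integral_prod_right (τ' := τ') hk hf x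
    rw [← Measure.prod_restrict, Measure.restrict_univ, lintegral_prod _ hm.aemeasurable]
    refine lintegral_congr fun θ => ?_
    refine setLIntegral_congr_fun (hA m) fun l hl => ?_
    dsimp only
    rw [S.integral_prod_mul hk hfi x θ (hB m l hl)]
  have hfin : IsFiniteMeasure (lam.restrict (A' m)) :=
    ⟨by rw [Measure.restrict_apply_univ]; exact hAf m⟩
  have hgi : Integrable fun z => |B' m| * ∫ z', ‖f (z, z')‖ ∂τ' :=
    hfi.norm.integral_prod_left.const_mul _
  have hgm : Measurable fun z => |B' m| * ∫ z', ‖f (z, z')‖ ∂τ' := by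
    have h1 : Measurable fun q : (Fin N → ℝ) × V' => ‖f (q.1, q.2)‖ := hf.norm
    exact (StronglyMeasurable.integral_prod_right (ν := τ')
      (f := fun (z : Fin N → ℝ) z' => ‖f (z, z')‖) h1.stronglyMeasurable).measurable.const_mul _
  have hbd : ∀ᵐ z, ∀ᵐ l ∂(lam.restrict (A' m)),
      |G (z, l)| ≤ |B' m| * ∫ z', ‖f (z, z')‖ ∂τ' := by
    filter_upwards [hfi.prod_right_ae] with z hz
    refine (ae_restrict_iff' (hA m)).2 (ae_of_all _ fun l hl => ?_)
    rw [← integral_const_mul, ← Real.norm_eq_abs]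
    refine norm_integral_le_of_norm_le (hz.norm.const_mul _) (ae_of_all _ fun z' => ?_)
    rw [norm_mul, mul_comm]
    exact mul_le_mul_of_nonneg_right ((hB m l hl z').trans (le_abs_self _)) (norm_nonneg _)
  simp_rw [key S]
  refine (h.family hGm hgm hgi (fun z => by positivity) hbd).trans ?_
  simp_rw [← key S']
  exact mul_le_mul_right (lintegral_mono fun x =>
    ENNReal.rpow_le_rpow (setLIntegral_le_lintegral _ _) (by norm_num)) _

end Product

section ProductSystems

variable {m : ℕ} {M : Fin m → ℕ}

/-- The kernels of a product of kernel systems. -/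
def prodKer (S : Π j, KerSys (M j)) (x : Π j, Fin (M j) → ℝ) (θ : Π j, (S j).Θ)
    (z : Π j, Fin (M j) → ℝ) : ℝ := ∏ j, (S j).K (x j) (θ j) (z j)

/-- The square of the multi-parameter square function of a product of kernel systems. -/
def prodSq (S : Π j, KerSys (M j)) (f : (Π j, Fin (M j) → ℝ) → ℝ) (x : Π j, Fin (M j) → ℝ) :
    ℝ≥0∞ :=
  ∫⁻ θ, ‖∫ z, f z * prodKer S x θ z‖ₑ ^ 2 ∂Measure.pi fun j => (S j).ν

lemma measurable_prodKer (S : Π j, KerSys (M j)) :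
    Measurable fun p : ((Π j, Fin (M j) → ℝ) × (Π j, (S j).Θ)) × (Π j, Fin (M j) → ℝ) =>
      prodKer S p.1.1 p.1.2 p.2 := by
  unfold prodKer
  refine Finset.measurable_fun_prod _ fun j _ => ?_
  have h : Measurable fun p : ((Π j, Fin (M j) → ℝ) × (Π j, (S j).Θ)) × (Π j, Fin (M j) → ℝ) =>
    (((p.1.1 j, p.1.2 j), p.2 j) : ((Fin (M j) → ℝ) × (S j).Θ) × (Fin (M j) → ℝ)) := by fun_prop
  exact (S j).measurable_K.comp h

lemma measurable_prodSq (S : Π j, KerSys (M j)) {f : (Π j, Fin (M j) → ℝ) → ℝ}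
    (hf : Measurable f) : Measurable (prodSq S f) := by
  have h1 : Measurable fun p :
      ((Π j, Fin (M j) → ℝ) × (Π j, (S j).Θ)) × (Π j, Fin (M j) → ℝ) =>
      f p.2 * prodKer S p.1.1 p.1.2 p.2 := (hf.comp measurable_snd).mul (measurable_prodKer S)
  have h2 := (StronglyMeasurable.integral_prod_right (ν := volume)
    (f := fun (p : (Π j, Fin (M j) → ℝ) × (Π j, (S j).Θ)) z => f z * prodKer S p.1 p.2 z)
    h1.stronglyMeasurable).measurable.enorm.pow_const 2
  exact Measurable.lintegral_prod_right' (ν := Measure.pi fun j => (S j).ν) h2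

end ProductSystems

section Split

variable {m : ℕ} {M : Fin (m + 1) → ℕ}

lemma piFinSuccAbove_symm_same {α : Fin (m + 1) → Type*} [∀ i, MeasurableSpace (α i)]
    (j : Fin (m + 1)) (p : α j × (Π i, α (j.succAbove i))) :
    (MeasurableEquiv.piFinSuccAbove α j).symm p j = p.1 :=
  Fin.insertNth_apply_same j p.1 p.2

lemma piFinSuccAbove_symm_succAbove {α : Fin (m + 1) → Type*} [∀ i, MeasurableSpace (α i)]
    (j : Fin (m + 1)) (p : α j × (Π i, α (j.succAbove i))) (i : Fin m) :
    (MeasurableEquiv.piFinSuccAbove α j).symm p (j.succAbove i) = p.2 i :=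
  Fin.insertNth_apply_succAbove j p.1 p.2 i

/-- The `L¹` norm of the multi-parameter square function, with the `j`-th factor split off. -/
def splitNorm (j : Fin (m + 1)) (s : KerSys (M j)) (r : Π i, KerSys (M (j.succAbove i)))
    (f : (Π j, Fin (M j) → ℝ) → ℝ) : ℝ≥0∞ :=
  ∫⁻ x' : Π i, Fin (M (j.succAbove i)) → ℝ, ∫⁻ x : Fin (M j) → ℝ,
    (∫⁻ q, ‖∫ p, f ((MeasurableEquiv.piFinSuccAbove (fun j => Fin (M j) → ℝ) j).symm p) *
      (s.K x q.1 p.1 * prodKer r x' q.2 p.2) ∂(volume.prod volume)‖ₑ ^ 2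
      ∂(s.ν.prod (Measure.pi fun i => (r i).ν))) ^ (1 / 2 : ℝ)

lemma prodSq_symm_eq (S : Π j, KerSys (M j)) (j : Fin (m + 1))
    (f : (Π j, Fin (M j) → ℝ) → ℝ) (x : Fin (M j) → ℝ)
    (x' : Π i, Fin (M (j.succAbove i)) → ℝ) :
    prodSq S f ((MeasurableEquiv.piFinSuccAbove (fun j => Fin (M j) → ℝ) j).symm (x, x')) =
      ∫⁻ q, ‖∫ p, f ((MeasurableEquiv.piFinSuccAbove (fun j => Fin (M j) → ℝ) j).symm p) *
        ((S j).K x q.1 p.1 * prodKer (fun i => S (j.succAbove i)) x' q.2 p.2)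
          ∂(volume.prod volume)‖ₑ ^ 2
        ∂((S j).ν.prod (Measure.pi fun i => (S (j.succAbove i)).ν)) := by
  unfold prodSq
  have h1 := (measurePreserving_piFinSuccAbove (fun j => (S j).ν) j).symm
  rw [← h1.lintegral_comp_emb (MeasurableEquiv.measurableEmbedding _)]
  refine lintegral_congr fun q => ?_
  have h2 := (volume_preserving_piFinSuccAbove (fun j => Fin (M j) → ℝ) j).symm
  rw [← h2.integral_comp (MeasurableEquiv.measurableEmbedding _)]
  congr 2
  refine integral_congr_ae (ae_of_all _ fun p => ?_)
  simp only [prodKer, Fin.prod_univ_succAbove _ j, piFinSuccAbove_symm_same,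
    piFinSuccAbove_symm_succAbove]

lemma lintegral_prodSq_eq_splitNorm (S : Π j, KerSys (M j)) (j : Fin (m + 1))
    {f : (Π j, Fin (M j) → ℝ) → ℝ} (hf : Measurable f) :
    ∫⁻ x, prodSq S f x ^ (1 / 2 : ℝ) = splitNorm j (S j) (fun i => S (j.succAbove i)) f := by
  have h2 := (volume_preserving_piFinSuccAbove (fun j => Fin (M j) → ℝ) j).symm
  rw [← h2.lintegral_comp_emb (MeasurableEquiv.measurableEmbedding _)]
  have hm : Measurable fun p : (Fin (M j) → ℝ) × (Π i, Fin (M (j.succAbove i)) → ℝ) =>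
      prodSq S f ((MeasurableEquiv.piFinSuccAbove (fun j => Fin (M j) → ℝ) j).symm p) ^
        (1 / 2 : ℝ) :=
    ((measurable_prodSq S hf).comp (MeasurableEquiv.measurable _)).pow_const _
  refine (lintegral_prod_symm' _ hm).trans ?_
  unfold splitNorm
  simp_rw [prodSq_symm_eq]

lemma splitNorm_le (j : Fin (m + 1)) {s s' : KerSys (M j)} {C : ℝ≥0∞} (h : Dom s s' C)
    (r : Π i, KerSys (M (j.succAbove i))) {f : (Π j, Fin (M j) → ℝ) → ℝ} (hf : Measurable f)
    (hfi : Integrable f) (hC : C ≠ ⊤) : splitNorm j s r f ≤ C * splitNorm j s' r f := by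
  unfold splitNorm
  rw [← lintegral_const_mul' _ _ hC]
  refine lintegral_mono fun x' => ?_
  have hk : Measurable fun p : (Π i, (r i).Θ) × (Π i, Fin (M (j.succAbove i)) → ℝ) =>
      prodKer r x' p.1 p.2 := by
    have h : Measurable fun p : (Π i, (r i).Θ) × (Π i, Fin (M (j.succAbove i)) → ℝ) =>
      ((x', p.1), p.2) := by fun_prop
    exact (measurable_prodKer r).comp h
  have h2 := (volume_preserving_piFinSuccAbove (fun j => Fin (M j) → ℝ) j).symm
  refine h.prod (A' := fun m => Set.univ.pi fun i => (r i).A m)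
    (B' := fun m => ∏ i, (r i).B m) hk
    (fun m => MeasurableSet.univ_pi fun i => (r i).measurableSet_A m) (fun m => ?_)
    (fun a b hab => Set.pi_mono fun i _ => (r i).monotone_A hab) ?_ (fun m l hl z => ?_)
    (hf.comp (MeasurableEquiv.measurable _))
    ((h2.integrable_comp_emb (MeasurableEquiv.measurableEmbedding _)).2 hfi)
  · rw [Measure.pi_pi]
    exact ENNReal.prod_lt_top fun i _ => (r i).measure_A_lt_top m
  · refine Set.eq_univ_of_forall fun l => ?_
    have h3 : ∀ i, ∃ m, l i ∈ (r i).A m := fun i =>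
      Set.mem_iUnion.1 ((r i).iUnion_A ▸ Set.mem_univ (l i) : l i ∈ ⋃ m, (r i).A m)
    choose a ha using h3
    refine Set.mem_iUnion.2 ⟨Finset.univ.sup a, fun i _ => ?_⟩
    exact (r i).monotone_A (Finset.le_sup (Finset.mem_univ i)) (ha i)
  · unfold prodKer
    rw [Finset.abs_prod]
    exact Finset.prod_le_prod (fun _ _ => abs_nonneg _)
      fun i _ => (r i).abs_K_le m _ _ (hl i (Set.mem_univ i)) _

lemma lintegral_prodSq_le_of_eq (j : Fin (m + 1)) {S S' : Π j, KerSys (M j)} {C : ℝ≥0∞}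
    (h : Dom (S j) (S' j) C) (hr : ∀ i, i ≠ j → S i = S' i)
    {f : (Π j, Fin (M j) → ℝ) → ℝ} (hf : Measurable f) (hfi : Integrable f) (hC : C ≠ ⊤) :
    ∫⁻ x, prodSq S f x ^ (1 / 2 : ℝ) ≤ C * ∫⁻ x, prodSq S' f x ^ (1 / 2 : ℝ) := by
  rw [lintegral_prodSq_eq_splitNorm S j hf, lintegral_prodSq_eq_splitNorm S' j hf]
  have h1 : (fun i => S (j.succAbove i)) = fun i => S' (j.succAbove i) :=
    funext fun i => hr _ (Fin.succAbove_ne j i)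
  rw [h1]
  exact splitNorm_le j h _ hf hfi hC

end Split

lemma lintegral_prodSq_le_of_measurable {m : ℕ} {M : Fin m → ℕ} {S S' : Π j, KerSys (M j)}
    {C : Fin m → NNReal} (h : ∀ j, Dom (S j) (S' j) (C j))
    {f : (Π j, Fin (M j) → ℝ) → ℝ} (hf : Measurable f) (hfi : Integrable f) :
    ∫⁻ x, prodSq S f x ^ (1 / 2 : ℝ) ≤
      ((∏ j, C j : NNReal) : ℝ≥0∞) * ∫⁻ x, prodSq S' f x ^ (1 / 2 : ℝ) := by
  cases m with
  | zero =>
    have : S = S' := funext fun j => j.elim0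
    simp [this]
  | succ m =>
    have key : ∀ s : Finset (Fin (m + 1)), ∫⁻ x, prodSq S f x ^ (1 / 2 : ℝ) ≤
        ((∏ j ∈ s, C j : NNReal) : ℝ≥0∞) *
          ∫⁻ x, prodSq (fun j => if j ∈ s then S' j else S j) f x ^ (1 / 2 : ℝ) := by
      intro s
      induction s using Finset.induction_on with
      | empty => simp
      | insert a s ha ih =>
        refine ih.trans ?_
        rw [Finset.prod_insert ha, mul_comm (C a), ENNReal.coe_mul, mul_assoc]
        refine mul_le_mul_right (lintegral_prodSq_le_of_eq a ?_ ?_ hf hfi ENNReal.coe_ne_top) _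
        · simpa [ha] using h a
        · intro i hi
          simp [hi]
    simpa using key Finset.univ

lemma prodSq_congr {m : ℕ} {M : Fin m → ℕ} (S : Π j, KerSys (M j))
    {f g : (Π j, Fin (M j) → ℝ) → ℝ} (h : f =ᵐ[volume] g) : prodSq S f = prodSq S g := by
  ext x
  unfold prodSq
  refine lintegral_congr fun θ => ?_
  congr 2
  exact integral_congr_ae (h.mono fun z hz => by simp only [hz])

lemma lintegral_prodSq_le {m : ℕ} {M : Fin m → ℕ} {S S' : Π j, KerSys (M j)}
    {C : Fin m → NNReal} (h : ∀ j, Dom (S j) (S' j) (C j))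
    {f : (Π j, Fin (M j) → ℝ) → ℝ} (hfi : Integrable f) :
    ∫⁻ x, prodSq S f x ^ (1 / 2 : ℝ) ≤
      ((∏ j, C j : NNReal) : ℝ≥0∞) * ∫⁻ x, prodSq S' f x ^ (1 / 2 : ℝ) := by
  have h1 := hfi.1.ae_eq_mk
  rw [prodSq_congr S h1, prodSq_congr S' h1]
  exact lintegral_prodSq_le_of_measurable h hfi.1.stronglyMeasurable_mk.measurable
    (hfi.congr h1)

section PiProd

variable {ι : Type*} [Fintype ι] {α β : ι → Type*} [∀ i, MeasurableSpace (α i)]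
  [∀ i, MeasurableSpace (β i)]

lemma map_prod_pi (μ : ∀ i, Measure (α i)) (ν : ∀ i, Measure (β i)) [∀ i, SigmaFinite (μ i)]
    [∀ i, SigmaFinite (ν i)] :
    ((Measure.pi μ).prod (Measure.pi ν)).map (fun p i => (p.1 i, p.2 i)) =
      Measure.pi fun i => (μ i).prod (ν i) := by
  symm
  refine Measure.pi_eq_generateFrom
    (C := fun i => Set.image2 (· ×ˢ ·) {s : Set (α i) | MeasurableSet s}
      {t : Set (β i) | MeasurableSet t})
    (fun i => generateFrom_prod) (fun i => isPiSystem_prod)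
    (fun i => (μ i).toFiniteSpanningSetsIn.prod (ν i).toFiniteSpanningSetsIn) fun s hs => ?_
  choose a ha b hb hab using hs
  have hm : Measurable fun (p : (∀ i, α i) × (∀ i, β i)) i => (p.1 i, p.2 i) := by fun_prop
  have hpre : (fun (p : (∀ i, α i) × (∀ i, β i)) i => (p.1 i, p.2 i)) ⁻¹' Set.univ.pi s =
      (Set.univ.pi a) ×ˢ (Set.univ.pi b) := by
    ext p
    simp only [← hab, Set.mem_preimage, Set.mem_pi, Set.mem_univ, true_imp_iff, Set.mem_prod,
      forall_and]
  rw [Measure.map_apply hm, hpre, Measure.prod_prod, Measure.pi_pi, Measure.pi_pi,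
    ← Finset.prod_mul_distrib]
  · refine Finset.prod_congr rfl fun i _ => ?_
    rw [← hab i, Measure.prod_prod]
  · refine MeasurableSet.univ_pi fun i => ?_
    rw [← hab i]
    exact MeasurableSet.prod (ha i) (hb i)

lemma lintegral_pi_prod (μ : ∀ i, Measure (α i)) (ν : ∀ i, Measure (β i))
    [∀ i, SigmaFinite (μ i)] [∀ i, SigmaFinite (ν i)] {g : (∀ i, α i × β i) → ℝ≥0∞}
    (hg : Measurable g) :
    ∫⁻ θ, g θ ∂(Measure.pi fun i => (μ i).prod (ν i)) =
      ∫⁻ p, g (fun i => (p.1 i, p.2 i)) ∂((Measure.pi μ).prod (Measure.pi ν)) := by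
  rw [← map_prod_pi, lintegral_map hg (by fun_prop)]

lemma pi_count_eq_count [∀ i, Countable (α i)] [∀ i, MeasurableSingletonClass (α i)] :
    (Measure.pi fun i => (Measure.count : Measure (α i))) = Measure.count := by
  refine Measure.ext_of_singleton fun a => ?_
  rw [Measure.count_singleton, ← Set.univ_pi_singleton, Measure.pi_pi]
  simp

end PiProd

section DyadicKernel

variable {m : ℕ} {M : Fin m → ℕ}

lemma ravg_eq_integral (c : Π j : Fin m, ℤ → Fin (M j) → ℝ) (k : Fin m → ℤ) (f : X m M → ℝ)
    (x : X m M) :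
    ravg m M c k f x = ∫ z, f z * ∏ j, dker (c j (k j)) (k j) (x j) (z j) := by
  have hs : MeasurableSet (Set.univ.pi fun j => dcube (c j (k j)) (k j) (x j)) :=
    MeasurableSet.univ_pi fun j => measurableSet_dcube _ _ _
  unfold ravg
  rw [← integral_indicator hs, ← integral_div]
  refine integral_congr_ae (ae_of_all _ fun z => ?_)
  dsimp only
  by_cases hz : z ∈ Set.univ.pi fun j => dcube (c j (k j)) (k j) (x j)
  · rw [Set.indicator_of_mem hz, div_eq_mul_inv, ← Finset.prod_inv_distrib]
    congr 1
    refine Finset.prod_congr rfl fun j _ => ?_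
    unfold dker
    rw [Set.indicator_of_mem (hz j (Set.mem_univ j))]
  · rw [Set.indicator_of_notMem hz, zero_div]
    simp only [Set.mem_pi, Set.mem_univ, true_imp_iff, not_forall] at hz
    obtain ⟨j, hj⟩ := hz
    rw [Finset.prod_eq_zero (Finset.mem_univ j), mul_zero]
    unfold dker
    rw [Set.indicator_of_notMem hj]

lemma integrable_mul_prod_dker {f : X m M → ℝ} (hf : Integrable f)
    (t : Π j : Fin m, Fin (M j) → ℝ) (k : Fin m → ℤ) (x : X m M) :
    Integrable fun z => f z * ∏ j, dker (t j) (k j) (x j) (z j) := by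
  have hm : Measurable fun z : X m M => ∏ j, dker (t j) (k j) (x j) (z j) :=
    Finset.measurable_fun_prod _ fun j _ =>
      measurable_dker _ measurable_const measurable_const (measurable_pi_apply j)
  refine hf.mul_bdd (c := ∏ j, (((2 : ℝ) ^ k j) ^ M j)⁻¹) hm.aestronglyMeasurable
    (ae_of_all _ fun z => ?_)
  rw [Real.norm_of_nonneg (Finset.prod_nonneg fun j _ => dker_nonneg _ _ _ _)]
  exact Finset.prod_le_prod (fun j _ => dker_nonneg _ _ _ _) fun j _ => dker_le _ _ _ _

lemma rmdiff_eq_integral {f : X m M → ℝ} (hf : Integrable f) (ω : PSpace m M) (k : Fin m → ℤ)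
    (x : X m M) :
    rmdiff m M (fun j => randOffset (ω j)) k f x =
      ∫ z, f z * ∏ j, diffKer (x j) (k j, ω j) (z j) := by
  have h1 : ∀ z : X m M, ∏ j, diffKer (x j) (k j, ω j) (z j) =
      ∑ ε : Fin m → Bool, (-1 : ℝ) ^ (Finset.univ.filter fun j => ε j = false).card *
        ∏ j, dker (randOffset (ω j) (k j - if ε j then 1 else 0)) (k j - if ε j then 1 else 0)
          (x j) (z j) := fun z => by
    have h2 : ∀ j, diffKer (x j) (k j, ω j) (z j) =
        ∑ b : Bool, (if b = false then (-1 : ℝ) else 1) *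
          dker (randOffset (ω j) (k j - if b then 1 else 0)) (k j - if b then 1 else 0)
          (x j) (z j) := fun j => by
      rw [Fintype.sum_bool]
      simp [diffKer, sub_eq_add_neg]
    simp_rw [h2]
    rw [Finset.prod_univ_sum, Fintype.piFinset_univ]
    refine Finset.sum_congr rfl fun ε _ => ?_
    rw [Finset.prod_mul_distrib, Finset.prod_ite]
    simp
  simp_rw [h1, Finset.mul_sum, mul_left_comm _ ((-1 : ℝ) ^ _)]
  rw [integral_finsetSum _ fun ε _ => (integrable_mul_prod_dker hf _ _ x).const_mul _]
  unfold rmdiff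
  refine Finset.sum_congr rfl fun ε _ => ?_
  rw [ravg_eq_integral, integral_const_mul]

lemma enorm_sq_eq_ofReal (a : ℝ) : ‖a‖ₑ ^ 2 = ENNReal.ofReal (a ^ 2) := by
  rw [← ofReal_norm, ← ENNReal.ofReal_pow (norm_nonneg _), Real.norm_eq_abs, sq_abs]

lemma measurable_enorm_integral_prodKer (S : Π j, KerSys (M j)) {f : X m M → ℝ}
    (hf : Measurable f) (x : X m M) :
    Measurable fun θ : Π j, (S j).Θ => ‖∫ z, f z * prodKer S x θ z‖ₑ ^ 2 := by
  have h1 : Measurable fun p : (Π j, (S j).Θ) × X m M => f p.2 * prodKer S x p.1 p.2 := by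
    have h2 : Measurable fun p : (Π j, (S j).Θ) × X m M => ((x, p.1), p.2) := by fun_prop
    exact (hf.comp measurable_snd).mul ((measurable_prodKer S).comp h2)
  exact (StronglyMeasurable.integral_prod_right (ν := volume)
    (f := fun (θ : Π j, (S j).Θ) z => f z * prodKer S x θ z)
    h1.stronglyMeasurable).measurable.enorm.pow_const 2

lemma prodSq_diffSys_of_measurable {f : X m M → ℝ} (hf : Measurable f) (hfi : Integrable f)
    (x : X m M) :
    prodSq (fun j => diffSys (M j)) f x =
      ∫⁻ ω, rSsq m M (fun j => randOffset (ω j)) f x ∂prodRandMeasure m M := by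
  have hm : Measurable fun θ : Π j, ℤ × RSpace (M j) =>
      ‖∫ z, f z * prodKer (fun j => diffSys (M j)) x θ z‖ₑ ^ 2 :=
    measurable_enorm_integral_prodKer (fun j => diffSys (M j)) hf x
  have h1 : prodSq (fun j => diffSys (M j)) f x =
      ∫⁻ θ, ‖∫ z, f z * prodKer (fun j => diffSys (M j)) x θ z‖ₑ ^ 2
        ∂(Measure.pi fun j => (Measure.count : Measure ℤ).prod (randMeasure (M j))) := rfl
  have h2 : Measurable fun p : (Fin m → ℤ) × PSpace m M => fun j => (p.1 j, p.2 j) := by fun_prop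
  have h3 : Measurable fun p : (Fin m → ℤ) × PSpace m M =>
      ‖∫ z, f z * prodKer (fun j => diffSys (M j)) x (fun j => (p.1 j, p.2 j)) z‖ₑ ^ 2 :=
    hm.comp h2
  rw [h1, lintegral_pi_prod _ _ hm, pi_count_eq_count, lintegral_prod_symm' _ h3]
  unfold prodRandMeasure
  refine lintegral_congr fun ω => ?_
  rw [lintegral_count]
  unfold rSsq
  refine tsum_congr fun k => ?_
  rw [rmdiff_eq_integral hfi, ← enorm_sq_eq_ofReal]
  rfl

lemma rSsq_congr {f g : X m M → ℝ} (h : f =ᵐ[volume] g) (c : Π j : Fin m, ℤ → Fin (M j) → ℝ) :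
    rSsq m M c f = rSsq m M c g := by
  have h1 : ∀ k x, ravg m M c k f x = ravg m M c k g x := fun k x => by
    unfold ravg
    rw [integral_congr_ae (ae_restrict_of_ae h)]
  ext x
  simp only [rSsq, rmdiff, h1]

lemma randProdSNorm_eq {f : X m M → ℝ} (hf : Integrable f) :
    randProdSNorm m M f = ∫⁻ x, prodSq (fun j => diffSys (M j)) f x ^ (1 / 2 : ℝ) := by
  have h1 := hf.1.ae_eq_mk
  unfold randProdSNorm
  rw [prodSq_congr _ h1]
  refine lintegral_congr fun x => ?_
  simp_rw [rSsq_congr h1]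
  rw [prodSq_diffSys_of_measurable hf.1.stronglyMeasurable_mk.measurable (hf.congr h1)]

end DyadicKernel

section BddSmooth

variable {E F Z : Type} [NormedAddCommGroup E] [NormedSpace ℝ E] [NormedAddCommGroup F]
  [NormedSpace ℝ F]

/-- Functions that are smooth on `U` with all derivatives bounded on `U`. -/
structure BddSmooth (U : Set E) (Φ : E → F) : Prop where
  contDiffOn : ContDiffOn ℝ (⊤ : ℕ∞) Φ U
  bound : ∀ k : ℕ, ∃ C : ℝ, ∀ p ∈ U, ‖iteratedFDeriv ℝ k Φ p‖ ≤ C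

lemma BddSmooth.fderiv {U : Set E} {Φ : E → F} (h : BddSmooth U Φ) (hU : IsOpen U) :
    BddSmooth U (fderiv ℝ Φ) := by
  refine ⟨h.contDiffOn.fderiv_of_isOpen hU (by simp), fun k => ?_⟩
  obtain ⟨C, hC⟩ := h.bound (k + 1)
  exact ⟨C, fun p hp => by rw [norm_iteratedFDeriv_fderiv]; exact hC p hp⟩

lemma BddSmooth.exists_norm_le {U : Set E} {Φ : E → F} (h : BddSmooth U Φ) :
    ∃ C : ℝ, ∀ p ∈ U, ‖Φ p‖ ≤ C := by
  obtain ⟨C, hC⟩ := h.bound 0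
  exact ⟨C, fun p hp => by simpa using hC p hp⟩

variable [TopologicalSpace Z] [SecondCountableTopology Z] [MeasurableSpace Z]
  [OpensMeasurableSpace Z] {μ : Measure Z}

lemma BddSmooth.integrable {U : Set E} {Φ : E → F} (h : BddSmooth U Φ) {ι : Z → E}
    (hι : Continuous ι) (hUι : ∀ p ∈ U, ∀ z, p - ι z ∈ U) {f : Z → ℝ} (hf : Integrable f μ)
    {p : E} (hp : p ∈ U) : Integrable (fun z => f z • Φ (p - ι z)) μ := by
  obtain ⟨C, hC⟩ := h.exists_norm_le
  have hc : Continuous fun z => Φ (p - ι z) :=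
    h.contDiffOn.continuousOn.comp_continuous (continuous_const.sub hι) (hUι p hp)
  exact hf.smul_bdd C hc.aestronglyMeasurable (ae_of_all _ fun z => hC _ (hUι p hp z))

lemma BddSmooth.hasFDerivAt_integral {U : Set E} {Φ : E → F} (h : BddSmooth U Φ)
    (hU : IsOpen U) {ι : Z → E} (hι : Continuous ι) (hUι : ∀ p ∈ U, ∀ z, p - ι z ∈ U)
    {f : Z → ℝ} (hf : Integrable f μ) {p : E} (hp : p ∈ U) :
    HasFDerivAt (fun p => ∫ z, f z • Φ (p - ι z) ∂μ)
      (∫ z, f z • _root_.fderiv ℝ Φ (p - ι z) ∂μ) p := by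
  have h' := h.fderiv hU
  obtain ⟨C, hC⟩ := h'.exists_norm_le
  refine hasFDerivAt_integral_of_dominated_of_fderiv_le (bound := fun z => ‖f z‖ * C)
    (F' := fun p z => f z • _root_.fderiv ℝ Φ (p - ι z)) (hU.mem_nhds hp) ?_
    (h.integrable hι hUι hf hp) (h'.integrable hι hUι hf hp).aestronglyMeasurable
    (ae_of_all _ fun z q hq => ?_) (hf.norm.mul_const C) (ae_of_all _ fun z q hq => ?_)
  · filter_upwards [hU.mem_nhds hp] with q hq
    exact (h.integrable hι hUι hf hq).aestronglyMeasurable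
  · rw [norm_smul]
    exact mul_le_mul_of_nonneg_left (hC _ (hUι q hq z)) (norm_nonneg _)
  · have h1 : HasFDerivAt Φ (_root_.fderiv ℝ Φ (q - ι z)) (q - ι z) :=
      ((h.contDiffOn.contDiffAt (hU.mem_nhds (hUι q hq z))).differentiableAt
        (by simp)).hasFDerivAt
    have h2 : HasFDerivAt (fun q => q - ι z) (ContinuousLinearMap.id ℝ E) q :=
      (hasFDerivAt_id q).sub_const _
    exact (h1.comp q h2).const_smul (f z)

end BddSmooth

lemma BddSmooth.iteratedFDeriv_integral {E Z : Type} [NormedAddCommGroup E] [NormedSpace ℝ E]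
    [TopologicalSpace Z] [SecondCountableTopology Z] [MeasurableSpace Z]
    [OpensMeasurableSpace Z] {μ : Measure Z} {U : Set E} (hU : IsOpen U) {ι : Z → E}
    (hι : Continuous ι) (hUι : ∀ p ∈ U, ∀ z, p - ι z ∈ U) {f : Z → ℝ} (hf : Integrable f μ)
    (k : ℕ) : ∀ {F : Type} [NormedAddCommGroup F] [NormedSpace ℝ F] [CompleteSpace F]
    {Φ : E → F}, BddSmooth U Φ → ∀ {p : E}, p ∈ U → ∀ v : Fin k → E,
    iteratedFDeriv ℝ k (fun p => ∫ z, f z • Φ (p - ι z) ∂μ) p v =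
      ∫ z, f z • iteratedFDeriv ℝ k Φ (p - ι z) v ∂μ := by
  induction k with
  | zero =>
    intro F _ _ _ Φ h p hp v
    simp
  | succ k ih =>
    intro F _ _ _ Φ h p hp v
    have h1 : (fun q => _root_.fderiv ℝ (fun p => ∫ z, f z • Φ (p - ι z) ∂μ) q) =ᶠ[𝓝 p]
        fun q => ∫ z, f z • _root_.fderiv ℝ Φ (q - ι z) ∂μ := by
      filter_upwards [hU.mem_nhds hp] with q hq
      exact (h.hasFDerivAt_integral hU hι hUι hf hq).fderiv
    have h2 := (h1.iteratedFDeriv ℝ k).eq_of_nhds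
    rw [iteratedFDeriv_succ_apply_right, h2, ih (h.fderiv hU) hp]
    have h3 : Integrable (fun z => f z • iteratedFDeriv ℝ k (_root_.fderiv ℝ Φ) (p - ι z)
        (Fin.init v)) μ := by
      have h4 : ContinuousOn (iteratedFDeriv ℝ k (_root_.fderiv ℝ Φ)) U := fun q hq =>
        (((h.fderiv hU).contDiffOn.contDiffAt (hU.mem_nhds hq)).differentiableAt_iteratedFDeriv
          (m := k) (by exact_mod_cast WithTop.coe_lt_top k)).continuousAt.continuousWithinAt
      have h5 : Continuous fun z => iteratedFDeriv ℝ k (_root_.fderiv ℝ Φ) (p - ι z)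
          (Fin.init v) :=
        (ContinuousMultilinearMap.apply ℝ _ _ (Fin.init v)).continuous.comp
          (h4.comp_continuous (continuous_const.sub hι) (hUι p hp))
      obtain ⟨C, hC⟩ := (h.fderiv hU).bound k
      refine hf.smul_bdd (C * ∏ i, ‖Fin.init v i‖) h5.aestronglyMeasurable
        (ae_of_all _ fun z => ?_)
      exact (ContinuousMultilinearMap.le_opNorm _ _).trans (mul_le_mul_of_nonneg_right
        (hC _ (hUι p hp z)) (Finset.prod_nonneg fun _ _ => norm_nonneg _))
    rw [ContinuousLinearMap.integral_apply h3]
    refine integral_congr_ae (ae_of_all _ fun z => ?_)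
    dsimp only
    rw [iteratedFDeriv_succ_apply_right]
    rfl

lemma HomSmooth.iteratedFDeriv_bound {E : Type} [NormedAddCommGroup E] [NormedSpace ℝ E]
    [FiniteDimensional ℝ E] (k : ℕ) : ∀ {F : Type} [NormedAddCommGroup F] [NormedSpace ℝ F]
    {a : ℕ} {g : E → F}, HomSmooth a g →
    ∃ C : ℝ, 0 ≤ C ∧ ∀ p, p ≠ 0 → ‖iteratedFDeriv ℝ k g p‖ ≤ C / ‖p‖ ^ (a + k) := by
  induction k with
  | zero =>
    intro F _ _ a g h
    simpa using h.exists_bound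
  | succ k ih =>
    intro F _ _ a g h
    obtain ⟨C, h0, hC⟩ := ih h.fderiv
    refine ⟨C, h0, fun p hp => ?_⟩
    rw [← norm_iteratedFDeriv_fderiv, show a + (k + 1) = a + 1 + k by ring]
    exact hC p hp

/-- The half-space `{t > ε}`. -/
def hspace (N : ℕ) (ε : ℝ) : Set ((Fin N → ℝ) × ℝ) := {q | ε < q.2}

lemma isOpen_hspace (N : ℕ) (ε : ℝ) : IsOpen (hspace N ε) :=
  isOpen_lt continuous_const continuous_snd

lemma bddSmooth_pker (N : ℕ) {ε : ℝ} (hε : 0 < ε) : BddSmooth (hspace N ε) (pker N) := by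
  have h0 : ∀ p ∈ hspace N ε, ε < ‖p‖ := fun p hp =>
    lt_of_lt_of_le (lt_of_lt_of_le hp (le_abs_self _)) (norm_snd_le p)
  have h1 : ∀ p ∈ hspace N ε, p ≠ 0 := fun p hp => norm_pos_iff.1 (hε.trans (h0 p hp))
  refine ⟨fun p hp => ((homSmooth_pker N).contDiffAt p (h1 p hp)).contDiffWithinAt, fun k => ?_⟩
  obtain ⟨C, hC0, hC⟩ := (homSmooth_pker N).iteratedFDeriv_bound k
  refine ⟨C / ε ^ (N + k), fun p hp => (hC p (h1 p hp)).trans ?_⟩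
  have := (h0 p hp).le
  gcongr

lemma BddSmooth.comp_proj {m : ℕ} {E : Fin m → Type} [∀ j, NormedAddCommGroup (E j)]
    [∀ j, NormedSpace ℝ (E j)] {j : Fin m} {U : Set (E j)} (hU : IsOpen U) {g : E j → ℝ}
    (hg : BddSmooth U g) : BddSmooth {q : Π j, E j | q j ∈ U} fun q => g (q j) := by
  let L : (Π j, E j) →L[ℝ] E j := ContinuousLinearMap.proj j
  have hV : IsOpen (L ⁻¹' U) := hU.preimage L.continuous
  refine ⟨hg.contDiffOn.comp L.contDiff.contDiffOn fun q hq => hq, fun k => ?_⟩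
  obtain ⟨C, hC⟩ := hg.bound k
  refine ⟨C * ∏ _i : Fin k, ‖L‖, fun q hq => ?_⟩
  have h1 := L.iteratedFDerivWithin_comp_right hg.contDiffOn hU.uniqueDiffOn hV.uniqueDiffOn
    (x := q) hq (i := k) (by exact_mod_cast le_top)
  rw [iteratedFDerivWithin_of_isOpen k hV hq,
    iteratedFDerivWithin_of_isOpen k hU (x := L q) hq] at h1
  change ‖iteratedFDeriv ℝ k (g ∘ L) q‖ ≤ _
  rw [h1]
  exact (ContinuousMultilinearMap.norm_compContinuousLinearMap_le _ _).trans
    (mul_le_mul_of_nonneg_right (hC _ hq) (Finset.prod_nonneg fun _ _ => norm_nonneg _))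

lemma BddSmooth.prod {m : ℕ} {E : Fin m → Type} [∀ j, NormedAddCommGroup (E j)]
    [∀ j, NormedSpace ℝ (E j)] {U : Π j, Set (E j)} (hU : ∀ j, IsOpen (U j))
    {g : Π j, E j → ℝ} (hg : ∀ j, BddSmooth (U j) (g j)) :
    BddSmooth (Set.univ.pi U) fun q : Π j, E j => ∏ j, g j (q j) := by
  have hV : IsOpen (Set.univ.pi U) := isOpen_set_pi Set.finite_univ fun j _ => hU j
  have h1 : ∀ j, ContDiffOn ℝ (⊤ : ℕ∞) (fun q : Π j, E j => g j (q j)) (Set.univ.pi U) :=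
    fun j => ((hg j).comp_proj (hU j)).contDiffOn.mono fun q hq => hq j (Set.mem_univ j)
  refine ⟨contDiffOn_prod fun j _ => h1 j, fun k => ?_⟩
  choose C hC using fun j => ((hg j).comp_proj (hU j)).bound
  refine ⟨∑ p ∈ (Finset.univ : Finset (Fin m)).sym k, ((p : Multiset (Fin m)).countPerms : ℝ) *
    ∏ j, C j (Multiset.count j (p : Multiset (Fin m))), fun q hq => ?_⟩
  have h2 := norm_iteratedFDerivWithin_prod_le (u := Finset.univ) (fun j _ => h1 j)
    hV.uniqueDiffOn hq (n := k) (by exact_mod_cast le_top)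
  rw [iteratedFDerivWithin_of_isOpen k hV hq] at h2
  refine h2.trans (Finset.sum_le_sum fun p _ => ?_)
  refine mul_le_mul_of_nonneg_left (Finset.prod_le_prod (fun _ _ => norm_nonneg _)
    fun j _ => ?_) (Nat.cast_nonneg _)
  rw [iteratedFDerivWithin_of_isOpen _ hV hq]
  exact hC j _ q (hq j (Set.mem_univ j))

section MixedDeriv

variable {m : ℕ} {E : Fin m → Type} [∀ j, NormedAddCommGroup (E j)] [∀ j, NormedSpace ℝ (E j)]

lemma fderiv_prod_single {h : Π j, E j → ℝ} {q : Π j, E j}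
    (hd : ∀ j, DifferentiableAt ℝ (h j) (q j)) (i : Fin m) (w : E i) :
    fderiv ℝ (fun y : Π j, E j => ∏ j, h j (y j)) q (Pi.single i w) =
      (∏ j ∈ Finset.univ.erase i, h j (q j)) * fderiv ℝ (h i) (q i) w := by
  have h1 : ∀ j, HasFDerivAt (fun y : Π j, E j => h j (y j))
      ((fderiv ℝ (h j) (q j)).comp (ContinuousLinearMap.proj j)) q := fun j =>
    (hd j).hasFDerivAt.comp q (hasFDerivAt_apply j q)
  rw [(HasFDerivAt.finsetProd fun j _ => h1 j).fderiv, sum_apply,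
    Finset.sum_eq_single i]
  · simp
  · intro j _ hj
    simp [hj]
  · simp

open Classical in
lemma iteratedFDeriv_prod_single {U : Π j, Set (E j)} (hU : ∀ j, IsOpen (U j))
    {g : Π j, E j → ℝ} (hg : ∀ j, ContDiffOn ℝ (⊤ : ℕ∞) (g j) (U j))
    (hΦ : ContDiffOn ℝ (⊤ : ℕ∞) (fun q : Π j, E j => ∏ j, g j (q j)) (Set.univ.pi U))
    (w : Π j, E j) (k : ℕ) : ∀ (e : Fin k → Fin m), Function.Injective e →
    ∀ q ∈ Set.univ.pi U,
      iteratedFDeriv ℝ k (fun q : Π j, E j => ∏ j, g j (q j)) q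
          (fun i => Pi.single (e i) (w (e i))) =
        ∏ j, if j ∈ Set.range e then fderiv ℝ (g j) (q j) (w j) else g j (q j) := by
  have hV : IsOpen (Set.univ.pi U) := isOpen_set_pi Set.finite_univ fun j _ => hU j
  induction k with
  | zero =>
    intro e _ q _
    simp
  | succ k ih =>
    intro e he q hq
    have h1 : DifferentiableAt ℝ (iteratedFDeriv ℝ k fun q : Π j, E j => ∏ j, g j (q j)) q :=
      (hΦ.contDiffAt (hV.mem_nhds hq)).differentiableAt_iteratedFDeriv
        (by exact_mod_cast WithTop.coe_lt_top k)
    have hs : Function.Injective (Fin.tail e) := fun a b hab =>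
      Fin.succ_injective _ (he hab)
    have h0 : e 0 ∉ Set.range (Fin.tail e) := fun ⟨i, hi⟩ =>
      Fin.succ_ne_zero i (he hi)
    let h : Π j, E j → ℝ := fun j y =>
      if j ∈ Set.range (Fin.tail e) then fderiv ℝ (g j) y (w j) else g j y
    have h2 : (fun y => iteratedFDeriv ℝ k (fun q : Π j, E j => ∏ j, g j (q j)) y
        (Fin.tail fun i => Pi.single (e i) (w (e i)))) =ᶠ[𝓝 q] fun y => ∏ j, h j (y j) := by
      filter_upwards [hV.mem_nhds hq] with y hy
      exact ih (Fin.tail e) hs y hy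
    have hd : ∀ j, DifferentiableAt ℝ (h j) (q j) := fun j => by
      have hgj := (hg j).contDiffAt ((hU j).mem_nhds (hq j (Set.mem_univ j)))
      by_cases hj : j ∈ Set.range (Fin.tail e)
      · simp only [h, if_pos hj]
        exact ((hgj.fderiv_right (m := (⊤ : ℕ∞)) (by simp)).differentiableAt
          (by simp)).clm_apply (differentiableAt_const _)
      · simp only [h, if_neg hj]
        exact hgj.differentiableAt (by simp)
    have hr : ∀ j, j ∈ Set.range e ↔ j = e 0 ∨ j ∈ Set.range (Fin.tail e) := fun j => by
      simp only [Set.mem_range, Fin.exists_fin_succ, eq_comm]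
      rfl
    rw [h1.iteratedFDeriv_succ_apply_left', h2.fderiv_eq, fderiv_prod_single hd,
      ← Finset.prod_erase_mul _ _ (Finset.mem_univ (e 0))]
    congr 1
    · refine Finset.prod_congr rfl fun j hj => ?_
      simp [h, hr, Finset.ne_of_mem_erase hj]
    · have : h (e 0) = g (e 0) := by
        ext y
        simp only [h, if_neg h0]
      simp [this]

open Classical in
lemma iteratedFDeriv_prod_single_all {U : Π j, Set (E j)} (hU : ∀ j, IsOpen (U j))
    {g : Π j, E j → ℝ} (hg : ∀ j, BddSmooth (U j) (g j)) (w : Π j, E j) {q : Π j, E j}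
    (hq : q ∈ Set.univ.pi U) :
    iteratedFDeriv ℝ m (fun q : Π j, E j => ∏ j, g j (q j)) q (fun i => Pi.single i (w i)) =
      ∏ j, fderiv ℝ (g j) (q j) (w j) := by
  have := iteratedFDeriv_prod_single hU (fun j => (hg j).contDiffOn)
    (BddSmooth.prod hU hg).contDiffOn w m id Function.injective_id q hq
  simpa using this

end MixedDeriv

section Lusin

variable {m : ℕ} {M : Fin m → ℕ}

/-- The mixed partial derivatives of the extension are obtained by differentiating the kernel. -/
lemma iteratedFDeriv_prodPoisson {f : X m M → ℝ} (hf : Integrable f) {p : W m M}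
    (hp : ∀ j, 0 < (p j).2) (d : Π j, Fin (M j + 1)) :
    iteratedFDeriv ℝ m (prodPoisson m M f) p (fun j => dirW m M j (d j)) =
      ∫ z, f z * ∏ j, pd (d j) (pker (M j)) ((p j).1 - z j, (p j).2) := by
  have hU : ∀ j, IsOpen (hspace (M j) ((p j).2 / 2)) := fun j => isOpen_hspace _ _
  have hg : ∀ j, BddSmooth (hspace (M j) ((p j).2 / 2)) (pker (M j)) := fun j =>
    bddSmooth_pker _ (half_pos (hp j))
  have hV : IsOpen (Set.univ.pi fun j => hspace (M j) ((p j).2 / 2)) :=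
    isOpen_set_pi Set.finite_univ fun j _ => hU j
  have hpU : p ∈ Set.univ.pi fun j => hspace (M j) ((p j).2 / 2) := fun j _ =>
    half_lt_self (hp j)
  let ι : X m M → W m M := fun z j => (z j, 0)
  have hι : Continuous ι := by fun_prop
  have hUι : ∀ q ∈ Set.univ.pi (fun j => hspace (M j) ((p j).2 / 2)), ∀ z,
      q - ι z ∈ Set.univ.pi fun j => hspace (M j) ((p j).2 / 2) := fun q hq z j hj => by
    have := hq j hj
    simpa [hspace, ι] using this
  have h1 : prodPoisson m M f = fun q => ∫ z, f z • ∏ j, pker (M j) ((q - ι z) j) := by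
    ext q
    simp [prodPoisson, ι, pker]
  rw [h1, BddSmooth.iteratedFDeriv_integral hV hι hUι hf m (BddSmooth.prod hU hg) hpU]
  refine integral_congr_ae (ae_of_all _ fun z => ?_)
  dsimp only
  rw [smul_eq_mul]
  congr 1
  refine (iteratedFDeriv_prod_single_all hU hg (fun j => pdir (M j) (d j))
    (hUι p hpU z)).trans (Finset.prod_congr rfl fun j _ => ?_)
  have h2 : (p - ι z) j = ((p j).1 - z j, (p j).2) := Prod.ext rfl (sub_zero _)
  rw [pd, h2]

end Lusin

section Lusin

variable {m : ℕ} {M : Fin m → ℕ}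

lemma measurableSet_prodCone (x : X m M) : MeasurableSet (prodCone m M x) := by
  have : prodCone m M x = ⋂ j, (fun p : W m M => p j) ⁻¹' lcone (x j) := by
    ext p
    simp [prodCone, lcone]
  rw [this]
  exact MeasurableSet.iInter fun j => measurable_pi_apply j (measurableSet_lcone _)

lemma sum_enorm_sq_prodKer_lusSys {f : X m M → ℝ} (hf : Integrable f) (x : X m M) (p : W m M) :
    ∑ d : Π j, Fin (M j + 1),
        ‖∫ z, f z * prodKer (fun j => lusSys (M j)) x (fun j => (p j, d j)) z‖ₑ ^ 2 =
      (prodCone m M x).indicator (fun p => ENNReal.ofReal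
        (mixedGradSq m M (prodPoisson m M f) p * ∏ j, (p j).2 ^ (1 - (M j : ℝ)))) p := by
  have h1 : ∀ (d : Π j, Fin (M j + 1)) z,
      prodKer (fun j => lusSys (M j)) x (fun j => (p j, d j)) z =
        (∏ j, lusW (x j) (p j) * (p j).2) *
          ∏ j, pd (d j) (pker (M j)) ((p j).1 - z j, (p j).2) := fun d z => by
    rw [← Finset.prod_mul_distrib]
    refine Finset.prod_congr rfl fun j _ => ?_
    exact (mul_assoc _ _ _).symm
  simp_rw [h1, mul_left_comm (f _), integral_const_mul]
  by_cases hp : p ∈ prodCone m M x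
  · have hpos : ∀ j, 0 < (p j).2 := fun j => pos_of_mem_lcone (hp j)
    rw [Set.indicator_of_mem hp]
    simp_rw [← iteratedFDeriv_prodPoisson hf hpos, enorm_sq_eq_ofReal, mul_pow]
    rw [← ENNReal.ofReal_sum_of_nonneg fun d _ => by positivity, ← Finset.mul_sum, mul_comm,
      ← Finset.prod_pow]
    unfold mixedGradSq
    congr 2
    refine Finset.prod_congr rfl fun j _ => ?_
    have hj : p j ∈ lcone (x j) := hp j
    have := hpos j
    rw [mul_pow, lusW_sq, Set.indicator_of_mem hj, Real.rpow_sub this, Real.rpow_one,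
      Real.rpow_natCast, pow_succ]
    field_simp
  · rw [Set.indicator_of_notMem hp]
    have : ∃ j, p j ∉ lcone (x j) := by
      by_contra! h
      exact hp h
    obtain ⟨j, hj⟩ := this
    have h0 : ∏ j, lusW (x j) (p j) * (p j).2 = 0 :=
      Finset.prod_eq_zero (Finset.mem_univ j) (by
        rw [lusW, Set.indicator_of_notMem hj, zero_mul])
    simp [h0]

lemma prodSq_lusSys_of_measurable {f : X m M → ℝ} (hf : Measurable f) (hfi : Integrable f)
    (x : X m M) : prodSq (fun j => lusSys (M j)) f x = lusinSq m M f x := by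
  have hm : Measurable fun θ : Π j, LPar (M j) =>
      ‖∫ z, f z * prodKer (fun j => lusSys (M j)) x θ z‖ₑ ^ 2 :=
    measurable_enorm_integral_prodKer (fun j => lusSys (M j)) hf x
  have h1 : prodSq (fun j => lusSys (M j)) f x =
      ∫⁻ θ, ‖∫ z, f z * prodKer (fun j => lusSys (M j)) x θ z‖ₑ ^ 2
        ∂(Measure.pi fun j => (volume : Measure ((Fin (M j) → ℝ) × ℝ)).prod
          (Measure.count : Measure (Fin (M j + 1)))) := rfl
  have h2 : Measurable fun p : W m M × (Π j, Fin (M j + 1)) => fun j => (p.1 j, p.2 j) := by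
    fun_prop
  have h3 : Measurable fun p : W m M × (Π j, Fin (M j + 1)) =>
      ‖∫ z, f z * prodKer (fun j => lusSys (M j)) x (fun j => (p.1 j, p.2 j)) z‖ₑ ^ 2 :=
    hm.comp h2
  rw [h1, lintegral_pi_prod _ _ hm, pi_count_eq_count, lintegral_prod _ h3.aemeasurable]
  unfold lusinSq
  rw [← lintegral_indicator (measurableSet_prodCone x)]
  refine lintegral_congr fun p => ?_
  rw [lintegral_count, tsum_fintype]
  exact sum_enorm_sq_prodKer_lusSys hfi x p

lemma H1prodNorm_eq {f : X m M → ℝ} (hf : Integrable f) :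
    H1prodNorm m M f = ∫⁻ x, prodSq (fun j => lusSys (M j)) f x ^ (1 / 2 : ℝ) := by
  have h1 := hf.1.ae_eq_mk
  have h2 : prodPoisson m M f = prodPoisson m M (hf.1.mk f) := by
    ext p
    refine integral_congr_ae (h1.mono fun z hz => ?_)
    dsimp only
    rw [hz]
  unfold H1prodNorm
  rw [prodSq_congr _ h1]
  refine lintegral_congr fun x => ?_
  rw [prodSq_lusSys_of_measurable hf.1.stronglyMeasurable_mk.measurable (hf.congr h1)]
  unfold lusinSq
  rw [h2]

end Lusin

section Equivalence

variable {m : ℕ} {M : Fin m → ℕ}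

lemma exists_H1prodNorm_le (hM : ∀ j, 0 < M j) : ∃ C : NNReal, ∀ f : X m M → ℝ, Integrable f →
    H1prodNorm m M f ≤ (C : ℝ≥0∞) * randProdSNorm m M f := by
  choose C hC using fun j => exists_dom_lusSys_diffSys (hM j)
  refine ⟨∏ j, C j, fun f hf => ?_⟩
  rw [H1prodNorm_eq hf, randProdSNorm_eq hf]
  exact lintegral_prodSq_le hC hf

lemma exists_randProdSNorm_le (hM : ∀ j, 0 < M j) : ∃ C : NNReal, ∀ f : X m M → ℝ,
    Integrable f → randProdSNorm m M f ≤ (C : ℝ≥0∞) * H1prodNorm m M f := by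
  choose C hC using fun j => exists_dom_diffSys_lusSys (hM j)
  refine ⟨∏ j, C j, fun f hf => ?_⟩
  rw [H1prodNorm_eq hf, randProdSNorm_eq hf]
  exact lintegral_prodSq_le hC hf

end Equivalence

/-- **Theorem 0.4** (multi-parameter case): a function `f ∈ L¹(X)` belongs to
`H¹(X₁ × ⋯ × Xₙ)` iff `∫_X [𝔼_ω |S_{𝒟(ω)} f(x)|²]^{1/2} dx < ∞`, and this quantity is an
equivalent norm on `H¹(X)`, with constants depending only on `N₁, …, Nₙ`. -/
theorem theorem04_S (n : ℕ) (hn : 0 < n) (Nd : Fin n → ℕ) (hNd : ∀ j, 0 < Nd j) :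
    ∃ c C : ℝ, 0 < c ∧ c ≤ C ∧
      ∀ f : X n Nd → ℝ, Integrable f volume →
        ((H1prodNorm n Nd f < ⊤ ↔ randProdSNorm n Nd f < ⊤) ∧
          (H1prodNorm n Nd f < ⊤ →
            ENNReal.ofReal c * H1prodNorm n Nd f ≤ randProdSNorm n Nd f ∧
              randProdSNorm n Nd f ≤ ENNReal.ofReal C * H1prodNorm n Nd f)) := by
  obtain ⟨C₁, h₁⟩ := exists_H1prodNorm_le hNd
  obtain ⟨C₂, h₂⟩ := exists_randProdSNorm_le hNd
  have hpos : 0 < (C₁ : ℝ) + 1 := by positivity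
  refine ⟨((C₁ : ℝ) + 1)⁻¹, C₂ + 1, by positivity, ?_, fun f hf => ⟨⟨fun h => ?_, fun h => ?_⟩,
    fun _ => ⟨?_, ?_⟩⟩⟩
  · have h1 : ((C₁ : ℝ) + 1)⁻¹ ≤ 1 := inv_le_one_of_one_le₀ (by simp)
    exact h1.trans (by simp)
  · exact (h₂ f hf).trans_lt (ENNReal.mul_lt_top ENNReal.coe_lt_top h)
  · exact (h₁ f hf).trans_lt (ENNReal.mul_lt_top ENNReal.coe_lt_top h)
  · rw [ENNReal.ofReal_inv_of_pos hpos, ← ENNReal.div_eq_inv_mul]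
    refine ENNReal.div_le_of_le_mul ((h₁ f hf).trans ?_)
    rw [mul_comm]
    gcongr
    rw [← ENNReal.ofReal_coe_nnreal]
    exact ENNReal.ofReal_le_ofReal (by linarith)
  · refine (h₂ f hf).trans ?_
    gcongr
    rw [← ENNReal.ofReal_coe_nnreal]
    exact ENNReal.ofReal_le_ofReal (by linarith)

end Treil
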